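/- Let q > 10⁵ be an integer and let a be an integer coprime to q. Then for every real number x with x ≥ exp(0.03·√q·(log q)³), |π(x;q,a) − Li(x)/φ(q)| ≤ (1/160)·x/(log x)². -/

import Mathlib

/-- `π(x;q,a) = #{p ≤ x : p prime, p ≡ a (mod q)}`. -/
noncomputable def primesPi (x : ℝ) (q : ℕ) (a : ℤ) : ℕ :=
  ((Finset.Icc 1 ⌊x⌋₊).filter (fun p : ℕ => p.Prime ∧ (p : ZMod q) = (a : ZMod q))).card

/-- `Li(x) = ∫₂ˣ dt / log t`, the logarithmic integral. -/
noncomputable def Li (x : ℝ) : ℝ := ∫ t in (2 : ℝ)..x, 1 / Real.log t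

set_option linter.unusedSectionVars false

section ZeroFactorization

open Complex Metric Set Filter Topology

theorem finite_zeros_closedBall {f : ℂ → ℂ} (hf : Differentiable ℂ f) (hne : ∃ z, f z ≠ 0)
    (r : ℝ) : ({z | z ∈ closedBall (0 : ℂ) r ∧ f z = 0}).Finite := by
  by_contra hinf
  obtain ⟨w, -, hw⟩ := Set.Infinite.exists_accPt_of_subset_isCompact (s := {z | z ∈ closedBall (0 : ℂ) r ∧ f z = 0})
    hinf (isCompact_closedBall (0 : ℂ) r) (fun z hz => hz.1)
  have hfr : ∃ᶠ z in 𝓝[≠] w, f z = 0 := by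
    rw [accPt_iff_frequently_nhdsNE] at hw
    exact hw.mono fun z hz => hz.2
  have han : AnalyticOnNhd ℂ f univ := fun z _ => hf.analyticAt z
  have := han.eqOn_zero_of_preconnected_of_frequently_eq_zero isPreconnected_univ (mem_univ w) hfr
  obtain ⟨z, hz⟩ := hne
  exact hz (this (mem_univ z))

/-- Divide an entire function by the full power of `z - ρ` dividing it. -/
theorem exists_factor_zero {f : ℂ → ℂ} (hf : Differentiable ℂ f) (hne : ∃ z, f z ≠ 0) (ρ : ℂ)
    (hρ : f ρ = 0) : ∃ (n : ℕ) (g : ℂ → ℂ), 1 ≤ n ∧ Differentiable ℂ g ∧ g ρ ≠ 0 ∧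
      ∀ z, f z = (z - ρ) ^ n * g z := by
  have han : AnalyticOnNhd ℂ f univ := fun z _ => hf.analyticAt z
  have h1 : ¬ ∀ᶠ z in 𝓝 ρ, f z = 0 := by
    intro h
    obtain ⟨z, hz⟩ := hne
    exact hz (han.eqOn_zero_of_preconnected_of_eventuallyEq_zero isPreconnected_univ
      (mem_univ ρ) h (mem_univ z))
  obtain ⟨n, g₁, hg₁, hg₁0, heq⟩ :=
    ((hf.analyticAt ρ).exists_eventuallyEq_pow_smul_nonzero_iff).2 h1
  have hn : 1 ≤ n := by
    rcases Nat.eq_zero_or_pos n with h | h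
    · subst h
      have := heq.self_of_nhds
      simp [hρ] at this
      exact absurd this.symm hg₁0
    · exact h
  let g : ℂ → ℂ := fun z => if z = ρ then g₁ ρ else f z / (z - ρ) ^ n
  have hgeq : g =ᶠ[𝓝 ρ] g₁ := by
    filter_upwards [heq] with z hz
    by_cases h : z = ρ
    · simp [g, h]
    · have : (z - ρ) ^ n ≠ 0 := pow_ne_zero _ (sub_ne_zero.2 h)
      simp only [g, h, if_false, hz, smul_eq_mul]
      field_simp
  refine ⟨n, g, hn, ?_, by simpa [g] using hg₁0, ?_⟩
  · intro z
    by_cases h : z = ρ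
    · subst h
      exact (hg₁.differentiableAt).congr_of_eventuallyEq hgeq
    · have hz : g =ᶠ[𝓝 z] fun z => f z / (z - ρ) ^ n := by
        filter_upwards [isOpen_ne.mem_nhds h] with w hw
        simp only [g, if_neg hw]
      refine DifferentiableAt.congr_of_eventuallyEq ?_ hz
      exact (hf z).div (by fun_prop) (pow_ne_zero _ (sub_ne_zero.2 h))
  · intro z
    by_cases h : z = ρ
    · subst h; simp [hρ]; left; omega
    · have : (z - ρ) ^ n ≠ 0 := pow_ne_zero _ (sub_ne_zero.2 h)
      simp only [g, h, if_false]
      field_simp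

/-- Divide an entire function by all its zeros in a closed disc. -/
theorem exists_factor_zeros (r : ℝ) {f : ℂ → ℂ} (hf : Differentiable ℂ f) (hne : ∃ z, f z ≠ 0) :
    ∃ (S : Finset ℂ) (n : ℂ → ℕ) (g : ℂ → ℂ), Differentiable ℂ g ∧
      (∀ z ∈ closedBall (0 : ℂ) r, g z ≠ 0) ∧
      (∀ ρ ∈ S, ρ ∈ closedBall (0 : ℂ) r ∧ f ρ = 0 ∧ 1 ≤ n ρ) ∧
      ∀ z, f z = (∏ ρ ∈ S, (z - ρ) ^ n ρ) * g z := by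
  induction hk : ({z | z ∈ closedBall (0 : ℂ) r ∧ f z = 0}).ncard generalizing f with
  | zero =>
    have hfin := finite_zeros_closedBall hf hne r
    rw [Set.ncard_eq_zero hfin] at hk
    refine ⟨∅, fun _ => 0, f, hf, ?_, by simp, by simp⟩
    intro z hz h0
    exact (Set.eq_empty_iff_forall_notMem.1 hk) z ⟨hz, h0⟩
  | succ k ih =>
    have hfin := finite_zeros_closedBall hf hne r
    have hpos : 0 < ({z | z ∈ closedBall (0 : ℂ) r ∧ f z = 0}).ncard := by omega
    obtain ⟨ρ, hρr, hρ⟩ := (Set.ncard_pos hfin).1 hpos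
    obtain ⟨n, g, hn, hg, hgρ, hfac⟩ := exists_factor_zero hf hne ρ hρ
    have hset : {z | z ∈ closedBall (0 : ℂ) r ∧ g z = 0} =
        {z | z ∈ closedBall (0 : ℂ) r ∧ f z = 0} \ {ρ} := by
      ext z
      simp only [Set.mem_ofPred_eq, Set.mem_sdiff, Set.mem_singleton_iff, hfac z]
      constructor
      · rintro ⟨h1, h2⟩
        refine ⟨⟨h1, by simp [h2]⟩, ?_⟩
        rintro rfl
        exact hgρ h2
      · rintro ⟨⟨h1, h2⟩, h3⟩
        refine ⟨h1, (mul_eq_zero.1 h2).resolve_left (pow_ne_zero _ (sub_ne_zero.2 h3))⟩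
    have hcard : ({z | z ∈ closedBall (0 : ℂ) r ∧ g z = 0}).ncard = k := by
      have hmem : ρ ∈ {z | z ∈ closedBall (0 : ℂ) r ∧ f z = 0} := ⟨hρr, hρ⟩
      rw [hset, Set.ncard_sdiff_singleton_of_mem hmem, hk]; simp
    obtain ⟨S, m, g', hg', hg'0, hS, hfac'⟩ := ih hg ⟨ρ, hgρ⟩ hcard
    have hρS : ρ ∉ S := fun h => hgρ (hS ρ h).2.1
    refine ⟨insert ρ S, Function.update m ρ n, g', hg', hg'0, ?_, ?_⟩
    · intro w hw
      rcases Finset.mem_insert.1 hw with rfl | hw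
      · exact ⟨hρr, hρ, by simpa using hn⟩
      · have hne' : w ≠ ρ := fun h => hρS (h ▸ hw)
        refine ⟨(hS w hw).1, ?_, ?_⟩
        · rw [hfac w, (hS w hw).2.1, mul_zero]
        · rw [Function.update_of_ne hne']; exact (hS w hw).2.2
    · intro z
      rw [Finset.prod_insert hρS, Function.update_self, hfac z, hfac' z, ← mul_assoc]
      congr 2
      refine Finset.prod_congr rfl fun w hw => ?_
      have hne' : w ≠ ρ := fun h => hρS (h ▸ hw)
      rw [Function.update_of_ne hne']

end ZeroFactorization

section HolomorphicLogarithm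

open Complex Metric Set Filter Topology

theorem deriv_zero_eq_integral_cos {H : ℂ → ℂ} {r R : ℝ} (hr : 0 < r) (hrR : r < R)
    (hH : DifferentiableOn ℂ H (ball 0 R)) :
    ((Real.pi * r : ℝ) : ℂ) * deriv H 0 =
      ∫ θ in (0 : ℝ)..2 * Real.pi, (Real.cos θ : ℂ) * H (circleMap 0 r θ) := by
  have hsub : closedBall (0 : ℂ) r ⊆ ball 0 R := closedBall_subset_ball hrR
  have h1 := Complex.two_pi_I_inv_smul_circleIntegral_sub_sq_inv_smul_of_differentiable
    isOpen_ball hsub hH (mem_ball_self hr)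
  have hcl : DiffContOnCl ℂ H (ball 0 r) :=
    (hH.mono hsub).diffContOnCl_ball subset_rfl
  have h2 := hcl.circleIntegral_eq_zero hr.le
  have hcont : ContinuousOn H (sphere 0 r) :=
    hH.continuousOn.mono (sphere_subset_closedBall.trans hsub)
  have hcm : Continuous fun θ : ℝ => H (circleMap 0 r θ) :=
    hcont.comp_continuous (continuous_circleMap 0 r) (fun θ => circleMap_mem_sphere 0 hr.le θ)
  have hne : ∀ θ : ℝ, circleMap 0 r θ ≠ 0 := fun θ => by
    simpa using circleMap_ne_center (c := 0) (θ := θ) hr.ne'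
  rw [circleIntegral] at h1 h2
  have hrC : (r : ℂ) ≠ 0 := by exact_mod_cast hr.ne'
  have key : ∀ θ : ℝ, (Real.cos θ : ℂ) * H (circleMap 0 r θ) =
      (r / (2 * I)) * (deriv (circleMap 0 r) θ • ((circleMap 0 r θ - 0) ^ 2)⁻¹ • H (circleMap 0 r θ))
      + (1 / (2 * I * r)) * (deriv (circleMap 0 r) θ • H (circleMap 0 r θ)) := by
    intro θ
    have hh := hne θ
    have he : Complex.exp (θ * I) ≠ 0 := Complex.exp_ne_zero _
    simp only [deriv_circleMap, smul_eq_mul]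
    simp only [circleMap, zero_add]
    rw [Complex.ofReal_cos, Complex.cos, neg_mul, Complex.exp_neg]
    field_simp
    ring
  simp_rw [key]
  rw [intervalIntegral.integral_add, intervalIntegral.integral_const_mul,
    intervalIntegral.integral_const_mul, h2, mul_zero, add_zero, ← h1]
  · simp only [smul_eq_mul]
    push_cast
    have : (Real.pi : ℂ) ≠ 0 := by exact_mod_cast Real.pi_ne_zero
    field_simp
  · apply Continuous.intervalIntegrable
    refine continuous_const.mul ?_
    simp only [deriv_circleMap, smul_eq_mul, sub_zero]
    have := continuous_circleMap 0 r
    exact (this.mul continuous_const).mul (((this.pow 2).inv₀ fun θ => pow_ne_zero _ (hne θ)).mul hcm)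
  · apply Continuous.intervalIntegrable
    refine continuous_const.mul ?_
    simp only [deriv_circleMap, smul_eq_mul, sub_zero]
    have := continuous_circleMap 0 r
    exact (this.mul continuous_const).mul hcm

/-- A holomorphic logarithm of a function without zeros on a closed disc. -/
theorem exists_log_of_ne_zero {G : ℂ → ℂ} {r : ℝ} (hr : 0 < r) (hG : Differentiable ℂ G)
    (h0 : ∀ z ∈ closedBall (0 : ℂ) r, G z ≠ 0) :
    ∃ R, r < R ∧ ∃ H : ℂ → ℂ, H 0 = 0 ∧ (∀ z ∈ ball (0 : ℂ) R, HasDerivAt H (deriv G z / G z) z) ∧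
      (∀ z ∈ ball (0 : ℂ) R, G z = G 0 * Complex.exp (H z)) := by
  obtain ⟨δ, hδ, hsub⟩ := (isCompact_closedBall (0 : ℂ) r).exists_thickening_subset_open
    (isOpen_ne_fun hG.continuous continuous_const) h0
  rw [thickening_closedBall hδ hr.le] at hsub
  have hne : ∀ z ∈ ball (0 : ℂ) (δ + r), G z ≠ 0 := fun z hz => hsub hz
  have hd : DifferentiableOn ℂ (fun z => deriv G z / G z) (ball 0 (δ + r)) := by
    refine DifferentiableOn.div ?_ hG.differentiableOn hne
    exact (hG.differentiableOn.deriv isOpen_ball)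
  obtain ⟨H, hH0, hH⟩ := (hd.isExactOn_ball).with_val_at 0 0
  refine ⟨δ + r, by linarith, H, hH0, hH, ?_⟩
  have hc : ∀ z ∈ ball (0 : ℂ) (δ + r), HasDerivAt (fun z => G z * Complex.exp (-H z)) 0 z := by
    intro z hz
    have := ((hG z).hasDerivAt).mul ((hH z hz).neg.cexp)
    refine this.congr_deriv ?_
    have h1 : G z * (deriv G z / G z) = deriv G z := mul_div_cancel₀ _ (hne z hz)
    linear_combination -Complex.exp (-H z) * h1
  intro z hz
  have hconst := (convex_ball (0 : ℂ) (δ + r)).is_const_of_fderivWithin_eq_zero (𝕜 := ℂ)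
    (f := fun z => G z * Complex.exp (-H z))
    (fun w hw => (hc w hw).differentiableAt.differentiableWithinAt)
    (fun w hw => by
      rw [fderivWithin_of_isOpen isOpen_ball hw]
      have := (hc w hw).hasFDerivAt.fderiv
      rw [this]; ext; simp) hz (mem_ball_self (by linarith))
  simp only [hH0, neg_zero, Complex.exp_zero, mul_one] at hconst
  rw [← hconst, mul_assoc, ← Complex.exp_add]; simp

/-- The real part of the logarithmic derivative at the centre of a zero-free disc. -/
theorem re_logDeriv_zero_eq_integral {G : ℂ → ℂ} {r : ℝ} (hr : 0 < r) (hG : Differentiable ℂ G)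
    (h0 : ∀ z ∈ closedBall (0 : ℂ) r, G z ≠ 0) :
    Real.pi * r * (deriv G 0 / G 0).re =
      ∫ θ in (0 : ℝ)..2 * Real.pi, Real.cos θ * Real.log ‖G (circleMap 0 r θ)‖ := by
  obtain ⟨R, hR, H, hH0, hH, hexp⟩ := exists_log_of_ne_zero hr hG h0
  have hd : DifferentiableOn ℂ H (ball 0 R) := fun z hz =>
    (hH z hz).differentiableAt.differentiableWithinAt
  have h1 := deriv_zero_eq_integral_cos hr hR hd
  rw [(hH 0 (mem_ball_self (by linarith))).deriv] at h1
  have hcm : Continuous fun θ : ℝ => H (circleMap 0 r θ) :=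
    hd.continuousOn.comp_continuous (continuous_circleMap 0 r)
      (fun θ => closedBall_subset_ball hR (sphere_subset_closedBall (circleMap_mem_sphere 0 hr.le θ)))
  have hre : ∀ θ : ℝ, (H (circleMap 0 r θ)).re = Real.log ‖G (circleMap 0 r θ)‖ - Real.log ‖G 0‖ := by
    intro θ
    have hm : circleMap 0 r θ ∈ ball (0 : ℂ) R :=
      closedBall_subset_ball hR (sphere_subset_closedBall (circleMap_mem_sphere 0 hr.le θ))
    have hG0 : G 0 ≠ 0 := h0 0 (by simp [hr.le])
    rw [hexp _ hm, norm_mul, Real.log_mul (norm_ne_zero_iff.2 hG0) (by simp), Complex.norm_exp,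
      Real.log_exp]
    ring
  have h2 := congrArg Complex.re h1
  rw [← Complex.reCLM_apply (∫ θ in (0 : ℝ)..2 * Real.pi, (Real.cos θ : ℂ) * H (circleMap 0 r θ)),
    ← ContinuousLinearMap.intervalIntegral_comp_comm] at h2
  · rw [Complex.re_ofReal_mul] at h2
    rw [h2]
    have : ∀ θ : ℝ, Complex.reCLM ((Real.cos θ : ℂ) * H (circleMap 0 r θ)) =
        Real.cos θ * Real.log ‖G (circleMap 0 r θ)‖ - Real.cos θ * Real.log ‖G 0‖ := by
      intro θ
      rw [Complex.reCLM_apply, Complex.re_ofReal_mul, hre]; ring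
    simp_rw [this]
    rw [intervalIntegral.integral_sub, intervalIntegral.integral_mul_const]
    · simp
    · apply Continuous.intervalIntegrable
      refine Real.continuous_cos.mul ?_
      have : (fun θ : ℝ => Real.log ‖G (circleMap 0 r θ)‖) =
          fun θ => (H (circleMap 0 r θ)).re + Real.log ‖G 0‖ := by
        funext θ; rw [hre]; ring
      rw [this]
      exact (Complex.continuous_re.comp hcm).add continuous_const
    · exact (Real.continuous_cos.mul continuous_const).intervalIntegrable _ _
  · apply Continuous.intervalIntegrable
    exact (Complex.continuous_ofReal.comp Real.continuous_cos).mul hcm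

/-- Bound for the logarithmic derivative near the centre of a zero-free disc. -/
theorem norm_logDeriv_le_of_ne_zero {G : ℂ → ℂ} {r M : ℝ} (hr : 0 < r) (hG : Differentiable ℂ G)
    (h0 : ∀ z ∈ closedBall (0 : ℂ) r, G z ≠ 0) (hM : 0 < M)
    (hb : ∀ z ∈ sphere (0 : ℂ) r, Real.log ‖G z‖ ≤ M + Real.log ‖G 0‖) {z : ℂ} (hz : ‖z‖ ≤ r / 4) :
    ‖deriv G z / G z‖ ≤ 8 * M / r := by
  obtain ⟨R, hR, H, hH0, hH, hexp⟩ := exists_log_of_ne_zero hr hG h0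
  have hG0 : G 0 ≠ 0 := h0 0 (by simp [hr.le])
  have hd : DifferentiableOn ℂ H (ball 0 R) := fun z hz =>
    (hH z hz).differentiableAt.differentiableWithinAt
  have hsub : closedBall (0 : ℂ) r ⊆ ball 0 R := closedBall_subset_ball hR
  have hmax : ∀ w ∈ ball (0 : ℂ) r, (H w).re ≤ M := by
    intro w hw
    have hGw : ‖G w‖ ≤ Real.exp (M + Real.log ‖G 0‖) := by
      refine Complex.norm_le_of_forall_mem_frontier_norm_le isBounded_ball
        (hG.diffContOnCl) ?_ (subset_closure hw)
      intro v hv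
      rw [frontier_ball _ hr.ne'] at hv
      rw [← Real.exp_log (norm_pos_iff.2 (h0 v (sphere_subset_closedBall hv)))]
      exact Real.exp_le_exp.2 (hb v hv)
    rw [hexp w (hsub (ball_subset_closedBall hw)), norm_mul, Complex.norm_exp, Real.exp_add,
      Real.exp_log (norm_pos_iff.2 hG0), mul_comm] at hGw
    exact Real.exp_le_exp.1 (le_of_mul_le_mul_right hGw (norm_pos_iff.2 hG0))
  have hbc : ∀ w ∈ closedBall (0 : ℂ) (r / 2), ‖H w‖ ≤ 2 * M := by
    intro w hw
    have hw' : ‖w‖ ≤ r / 2 := by simpa using hw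
    have := Complex.borelCaratheodory_zero hM
      (hd.mono (ball_subset_closedBall.trans hsub)) hmax hr
      (mem_ball_zero_iff.2 (by linarith)) hH0
    refine this.trans ?_
    rw [div_le_iff₀ (by linarith)]
    nlinarith
  have hzR : z ∈ ball (0 : ℂ) R := mem_ball_zero_iff.2 (by linarith)
  rw [← (hH z hzR).deriv]
  have hball : closedBall z (r / 4) ⊆ closedBall (0 : ℂ) (r / 2) := by
    intro w hw
    have h1 : dist w z ≤ r / 4 := hw
    have : ‖w‖ ≤ ‖w - z‖ + ‖z‖ := by simpa using norm_add_le (w - z) z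
    rw [dist_eq_norm] at h1
    simpa using this.trans (by linarith)
  have hcl : DiffContOnCl ℂ H (ball z (r / 4)) := by
    refine (hd.mono ?_).diffContOnCl_ball subset_rfl
    exact hball.trans ((closedBall_subset_closedBall (by linarith)).trans hsub)
  have := Complex.norm_deriv_le_of_forall_mem_sphere_norm_le (by positivity : 0 < r / 4) hcl
    (fun w hw => hbc w (hball (sphere_subset_closedBall hw)))
  refine this.trans (le_of_eq ?_)
  field_simp
  ring

end HolomorphicLogarithm

section BlaschkeFactors

open Complex Metric Set Filter Topology ComplexConjugate

/-- The contribution of a zero `ρ` to the logarithmic derivative in the disc of radius `r`. -/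
noncomputable def zeroPair (r : ℝ) (ρ z : ℂ) : ℂ := 1 / (z - ρ) + conj ρ / (r ^ 2 - conj ρ * z)

theorem sq_sub_conj_mul_ne_zero {r : ℝ} (hr : 0 < r) {ρ z : ℂ} (hρ : ‖ρ‖ < r) (hz : ‖z‖ ≤ r) :
    (r : ℂ) ^ 2 - conj ρ * z ≠ 0 := by
  intro h
  have h1 : ‖(r : ℂ) ^ 2‖ = ‖conj ρ * z‖ := by rw [sub_eq_zero.1 h]
  rw [norm_mul, norm_pow, Complex.norm_real, Real.norm_of_nonneg hr.le, RCLike.norm_conj] at h1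
  nlinarith [norm_nonneg ρ, norm_nonneg z]

theorem norm_sq_sub_conj_mul_div {r : ℝ} (hr : 0 < r) {ρ z : ℂ} (hz : ‖z‖ = r) :
    ‖((r : ℂ) ^ 2 - conj ρ * z) / r‖ = ‖z - ρ‖ := by
  have h1 : (r : ℂ) ^ 2 = conj z * z := by
    rw [mul_comm, Complex.mul_conj, Complex.normSq_eq_norm_sq, hz]; push_cast; rfl
  rw [h1, ← sub_mul, ← map_sub, norm_div, norm_mul, RCLike.norm_conj, hz, Complex.norm_real,
    Real.norm_of_nonneg hr.le, mul_div_assoc, div_self hr.ne', mul_one]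

theorem exists_blaschke_decomposition {f : ℂ → ℂ} {r : ℝ} (hr : 0 < r) (hf : Differentiable ℂ f)
    (hf0 : f 0 ≠ 0) (hfr : ∀ z ∈ sphere (0 : ℂ) r, f z ≠ 0) :
    ∃ (S : Finset ℂ) (n : ℂ → ℕ) (h : ℂ → ℂ),
      (∀ ρ ∈ S, ‖ρ‖ < r ∧ f ρ = 0 ∧ 1 ≤ n ρ) ∧
      (∀ ρ, ‖ρ‖ < r → f ρ = 0 → ρ ∈ S ∧ (deriv f ρ = 0 → 2 ≤ n ρ) ∧
        (deriv f ρ ≠ 0 → n ρ = 1)) ∧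
      (∀ z, ‖z‖ < r → f z ≠ 0 → deriv f z / f z = h z + ∑ ρ ∈ S, (n ρ : ℂ) * zeroPair r ρ z) ∧
      (Real.pi * r * (h 0).re =
        ∫ θ in (0 : ℝ)..2 * Real.pi, Real.cos θ * Real.log ‖f (circleMap 0 r θ)‖) ∧
      (∀ M, 0 < M → (∀ z ∈ sphere (0 : ℂ) r, Real.log ‖f z‖ ≤ M + Real.log ‖f 0‖) →
        ∀ z, ‖z‖ ≤ r / 4 → ‖h z‖ ≤ 8 * M / r) := by
  obtain ⟨S, n, g, hg, hg0, hS, hfac⟩ := exists_factor_zeros r hf ⟨0, hf0⟩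
  have hrC : (r : ℂ) ≠ 0 := by exact_mod_cast hr.ne'
  have hS' : ∀ ρ ∈ S, ‖ρ‖ < r := fun ρ hρ =>
    lt_of_le_of_ne (by simpa using (hS ρ hρ).1) fun h => hfr ρ (by simpa using h) (hS ρ hρ).2.1
  set G : ℂ → ℂ := fun z => (∏ ρ ∈ S, (((r : ℂ) ^ 2 - conj ρ * z) / r) ^ n ρ) * g z with hGdef
  have hG : Differentiable ℂ G := by
    refine Differentiable.mul ?_ hg
    refine Differentiable.fun_finsetProd fun ρ _ => ?_
    fun_prop
  have hfac0 : ∀ z, ‖z‖ ≤ r → ∀ ρ ∈ S, ((r : ℂ) ^ 2 - conj ρ * z) / r ≠ 0 := fun z hz ρ hρ =>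
    div_ne_zero (sq_sub_conj_mul_ne_zero hr (hS' ρ hρ) hz) hrC
  have hG0 : ∀ z ∈ closedBall (0 : ℂ) r, G z ≠ 0 := by
    intro z hz
    refine mul_ne_zero (Finset.prod_ne_zero_iff.2 fun ρ hρ => pow_ne_zero _ ?_) (hg0 z hz)
    exact hfac0 z (by simpa using hz) ρ hρ
  have hGnorm : ∀ z ∈ sphere (0 : ℂ) r, ‖G z‖ = ‖f z‖ := by
    intro z hz
    rw [hfac z, hGdef, norm_mul, norm_mul, norm_prod, norm_prod]
    congr 1
    refine Finset.prod_congr rfl fun ρ _ => ?_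
    rw [norm_pow, norm_pow, norm_sq_sub_conj_mul_div hr (by simpa using hz)]
  refine ⟨S, n, fun z => deriv G z / G z, fun ρ hρ => ⟨hS' ρ hρ, (hS ρ hρ).2⟩, ?_, ?_, ?_, ?_⟩
  · intro ρ hρ hfρ
    have hmem : ρ ∈ S := by
      by_contra hcon
      have := hfac ρ
      rw [hfρ] at this
      refine mul_ne_zero (Finset.prod_ne_zero_iff.2 fun w hw => pow_ne_zero _
        (sub_ne_zero.2 fun h => hcon (by rw [h]; exact hw))) (hg0 ρ (by simpa using hρ.le)) this.symm
    set Q : ℂ → ℂ := fun z => (∏ w ∈ S.erase ρ, (z - w) ^ n w) * g z with hQ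
    have hQd : Differentiable ℂ Q := by
      refine Differentiable.mul ?_ hg
      refine Differentiable.fun_finsetProd fun ρ _ => ?_
      fun_prop
    have hfQ : f = fun z => (z - ρ) ^ n ρ * Q z := by
      funext z
      rw [hfac z, ← Finset.mul_prod_erase S _ hmem, mul_assoc]
    have hQρ : Q ρ ≠ 0 := mul_ne_zero (Finset.prod_ne_zero_iff.2 fun w hw => pow_ne_zero _
        (sub_ne_zero.2 (Finset.ne_of_mem_erase hw).symm)) (hg0 ρ (by simpa using hρ.le))
    have hder : HasDerivAt f ((n ρ : ℂ) * (0 : ℂ) ^ (n ρ - 1) * Q ρ + (0 : ℂ) ^ n ρ * deriv Q ρ) ρ := by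
      rw [hfQ]
      have := (((hasDerivAt_id ρ).sub_const ρ).pow (n ρ)).mul (hQd ρ).hasDerivAt
      exact this.congr_deriv (by simp)
    have hn1 := (hS ρ hmem).2.2
    refine ⟨hmem, fun hd => ?_, fun hd => ?_⟩
    · by_contra hlt
      have hn1 : n ρ = 1 := by omega
      rw [hder.deriv, hn1] at hd
      simp [hQρ] at hd
    · by_contra hlt
      rw [hder.deriv, zero_pow (by omega), zero_pow (by omega)] at hd
      simp at hd
  · intro z hz hfz
    have hgz : g z ≠ 0 := hg0 z (by simpa using hz.le)
    have hzρ : ∀ ρ ∈ S, z - ρ ≠ 0 := fun ρ hρ h => hfz (by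
      rw [sub_eq_zero.1 h]; exact (hS ρ hρ).2.1)
    have e1 : deriv f z / f z = ∑ ρ ∈ S, (n ρ : ℂ) * (1 / (z - ρ)) + deriv g z / g z := by
      have : f = fun z => (∏ ρ ∈ S, (z - ρ) ^ n ρ) * g z := funext hfac
      rw [← logDeriv_apply, this, logDeriv_mul z
        (Finset.prod_ne_zero_iff.2 fun ρ hρ => pow_ne_zero _ (hzρ ρ hρ)) hgz
        (DifferentiableAt.fun_finsetProd fun ρ _ => by fun_prop) (hg z),
        logDeriv_prod (f := fun ρ z => (z - ρ) ^ n ρ) (fun ρ hρ => pow_ne_zero _ (hzρ ρ hρ)) (fun ρ _ => by fun_prop)]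
      congr 1
      refine Finset.sum_congr rfl fun ρ _ => ?_
      rw [logDeriv_fun_pow (by fun_prop)]
      simp [logDeriv_apply]
    have e2 : deriv G z / G z =
        ∑ ρ ∈ S, (n ρ : ℂ) * (-conj ρ / (r ^ 2 - conj ρ * z)) + deriv g z / g z := by
      rw [← logDeriv_apply, hGdef, logDeriv_mul z
        (Finset.prod_ne_zero_iff.2 fun ρ hρ => pow_ne_zero _ (hfac0 z hz.le ρ hρ)) hgz
        (DifferentiableAt.fun_finsetProd fun ρ _ => by fun_prop) (hg z),
        logDeriv_prod (f := fun ρ z => (((r : ℂ) ^ 2 - conj ρ * z) / r) ^ n ρ)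
          (fun ρ hρ => pow_ne_zero _ (hfac0 z hz.le ρ hρ)) (fun ρ _ => by fun_prop)]
      congr 1
      refine Finset.sum_congr rfl fun ρ hρ => ?_
      rw [logDeriv_fun_pow (by fun_prop)]
      have hd : HasDerivAt (fun z => ((r : ℂ) ^ 2 - conj ρ * z) / r) (-conj ρ / r) z := by
        have := (((hasDerivAt_id z).const_mul (conj ρ)).const_sub ((r : ℂ) ^ 2)).div_const (r : ℂ)
        exact this.congr_deriv (by simp)
      rw [logDeriv_apply, hd.deriv]
      have := sq_sub_conj_mul_ne_zero hr (hS' ρ hρ) hz.le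
      field_simp
    simp only
    rw [e1, e2]
    have : ∀ ρ ∈ S, (n ρ : ℂ) * zeroPair r ρ z =
        (n ρ : ℂ) * (1 / (z - ρ)) - (n ρ : ℂ) * (-conj ρ / (r ^ 2 - conj ρ * z)) := by
      intro ρ _; rw [zeroPair]; ring
    rw [Finset.sum_congr rfl this, Finset.sum_sub_distrib]; ring
  · have := re_logDeriv_zero_eq_integral hr hG hG0
    rw [this]
    refine intervalIntegral.integral_congr fun θ _ => ?_
    rw [hGnorm _ (circleMap_mem_sphere 0 hr.le θ)]
  · intro M hM hb z hz
    refine norm_logDeriv_le_of_ne_zero hr hG hG0 hM (fun w hw => ?_) hz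
    rw [hGnorm w hw]
    refine (hb w hw).trans ?_
    have : ‖f 0‖ ≤ ‖G 0‖ := by
      rw [hfac 0, hGdef, norm_mul, norm_mul, norm_prod, norm_prod]
      refine mul_le_mul_of_nonneg_right ?_ (norm_nonneg _)
      refine Finset.prod_le_prod (fun _ _ => norm_nonneg _) fun ρ hρ => ?_
      rw [norm_pow, norm_pow]
      refine pow_le_pow_left₀ (norm_nonneg _) ?_ _
      rw [mul_zero, sub_zero, zero_sub, norm_neg, sq, mul_div_assoc, div_self hrC, mul_one,
        Complex.norm_real, Real.norm_of_nonneg hr.le]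
      exact (hS' ρ hρ).le
    have := Real.log_le_log (norm_pos_iff.2 hf0) this
    linarith

end BlaschkeFactors

section ZeroPairs

open Complex Metric Set Filter Topology ComplexConjugate

theorem zeroPair_zero {r : ℝ} (hr : 0 < r) {ρ : ℂ} (hρ : ρ ≠ 0) :
    zeroPair r ρ 0 = -conj ρ * ((1 / ‖ρ‖ ^ 2 - 1 / r ^ 2 : ℝ) : ℂ) := by
  have hrC : (r : ℂ) ≠ 0 := by exact_mod_cast hr.ne'
  have h1 : ρ * conj ρ = ((‖ρ‖ ^ 2 : ℝ) : ℂ) := by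
    rw [Complex.mul_conj, Complex.normSq_eq_norm_sq]
  have h2 : ((‖ρ‖ : ℝ) : ℂ) ≠ 0 := by exact_mod_cast norm_ne_zero_iff.2 hρ
  push_cast at h1 ⊢
  rw [zeroPair]
  simp only [mul_zero, sub_zero, zero_sub]
  field_simp
  linear_combination ((r:ℂ)^2) * h1

theorem zeroPair_zero_re {r : ℝ} (hr : 0 < r) {ρ : ℂ} (hρ : ρ ≠ 0) :
    (zeroPair r ρ 0).re = -ρ.re * (1 / ‖ρ‖ ^ 2 - 1 / r ^ 2) := by
  rw [zeroPair_zero hr hρ, Complex.re_mul_ofReal]; simp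

theorem inv_norm_sq_sub_nonneg {r : ℝ} {ρ : ℂ} (hρ : ρ ≠ 0) (hρr : ‖ρ‖ < r) :
    0 ≤ 1 / ‖ρ‖ ^ 2 - 1 / r ^ 2 := by
  have h0 := norm_pos_iff.2 hρ
  rw [sub_nonneg]
  exact one_div_le_one_div_of_le (by positivity) (pow_le_pow_left₀ h0.le hρr.le 2)

theorem zeroPair_zero_re_nonneg {r : ℝ} (hr : 0 < r) {ρ : ℂ} (hρr : ‖ρ‖ < r) (hre : ρ.re < 0) :
    0 ≤ (zeroPair r ρ 0).re := by
  have hρ : ρ ≠ 0 := fun h => by simp [h] at hre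
  rw [zeroPair_zero_re hr hρ]
  exact mul_nonneg (by linarith) (inv_norm_sq_sub_nonneg hρ hρr)

theorem norm_zeroPair_sub_le {r : ℝ} (hr : 0 < r) {ρ : ℂ} (hρr : ‖ρ‖ < r) {w : ℝ} (hw0 : 0 ≤ w)
    (hw : w < -ρ.re) (hwr : w ≤ r / 21) :
    ‖zeroPair r ρ (-w : ℝ) - zeroPair r ρ 0‖ ≤
      2.05 * (w / (-ρ.re - w)) * (zeroPair r ρ 0).re := by
  have hre : ρ.re < 0 := by linarith
  have hρ : ρ ≠ 0 := fun h => by simp [h] at hre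
  have hn0 := norm_pos_iff.2 hρ
  set z : ℂ := ((-w : ℝ) : ℂ) with hz
  have hzn : ‖z‖ = w := by rw [hz, Complex.norm_real, norm_neg, Real.norm_of_nonneg hw0]
  have hzρ : z - ρ ≠ 0 := by
    intro h
    have := congrArg Complex.re h
    simp [hz] at this; linarith
  have hd : (r : ℂ) ^ 2 - conj ρ * z ≠ 0 := sq_sub_conj_mul_ne_zero hr hρr (by linarith)
  have hrC : (r : ℂ) ≠ 0 := by exact_mod_cast hr.ne'
  have key : zeroPair r ρ z - zeroPair r ρ 0 = zeroPair r ρ 0 *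
      (-z * (r ^ 2 + ρ * conj ρ - conj ρ * z) / ((z - ρ) * (r ^ 2 - conj ρ * z))) := by
    rw [zeroPair, zeroPair]
    simp only [mul_zero, sub_zero, zero_sub]
    have hr2 : (r : ℂ) ^ 2 ≠ 0 := pow_ne_zero _ hrC
    rw [div_add_div _ _ hzρ hd, div_add_div _ _ (neg_ne_zero.2 hρ) hr2, div_sub_div _ _
      (mul_ne_zero hzρ hd) (mul_ne_zero (neg_ne_zero.2 hρ) hr2), div_mul_div_comm, div_eq_div_iff
      (mul_ne_zero (mul_ne_zero hzρ hd) (mul_ne_zero (neg_ne_zero.2 hρ) hr2))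
      (mul_ne_zero (mul_ne_zero (neg_ne_zero.2 hρ) hr2) (mul_ne_zero hzρ hd))]
    ring
  -- the ratio of the last two factors
  have h1 : ‖(r : ℂ) ^ 2 + ρ * conj ρ - conj ρ * z‖ ≤ 2.05 * ‖(r : ℂ) ^ 2 - conj ρ * z‖ := by
    have e1 : ‖(r : ℂ) ^ 2 + ρ * conj ρ - conj ρ * z‖ ≤ ‖(r : ℂ) ^ 2 - conj ρ * z‖ + ‖ρ‖ * ‖ρ‖ := by
      have : (r : ℂ) ^ 2 + ρ * conj ρ - conj ρ * z = ((r : ℂ) ^ 2 - conj ρ * z) + ρ * conj ρ := by ring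
      rw [this]
      refine (norm_add_le _ _).trans ?_
      rw [norm_mul, RCLike.norm_conj]
    have e2 : r ^ 2 - ‖ρ‖ * w ≤ ‖(r : ℂ) ^ 2 - conj ρ * z‖ := by
      have := norm_sub_norm_le ((r : ℂ) ^ 2) (conj ρ * z)
      rwa [norm_mul, RCLike.norm_conj, hzn, norm_pow, Complex.norm_real,
        Real.norm_of_nonneg hr.le] at this
    nlinarith
  have h2 : ‖zeroPair r ρ 0‖ * (-ρ.re) = (zeroPair r ρ 0).re * ‖ρ‖ := by
    rw [zeroPair_zero_re hr hρ, zeroPair_zero hr hρ, norm_mul, norm_neg, RCLike.norm_conj,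
      Complex.norm_real, Real.norm_of_nonneg (inv_norm_sq_sub_nonneg hρ hρr)]
    ring
  have h3 : ‖ρ‖ * (-ρ.re - w) ≤ ‖z - ρ‖ * (-ρ.re) := by
    have hp : 0 < -ρ.re := by linarith
    refine abs_le_of_sq_le_sq' ?_ (by positivity) |>.2
    rw [mul_pow, mul_pow, ← Complex.normSq_eq_norm_sq, ← Complex.normSq_eq_norm_sq,
      Complex.normSq_apply, Complex.normSq_apply]
    simp only [hz, Complex.sub_re, Complex.sub_im, Complex.ofReal_re, Complex.ofReal_im]
    nlinarith [sq_nonneg (ρ.im), mul_nonneg hw0 (by linarith : 0 ≤ -ρ.re - w),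
      mul_nonneg (mul_nonneg hw0 (by linarith : 0 ≤ -2 * ρ.re - w)) (sq_nonneg ρ.im)]
  rw [key, norm_mul, norm_div, norm_mul, norm_mul, norm_neg, hzn]
  have hA := norm_pos_iff.2 hzρ
  have hB := norm_pos_iff.2 hd
  have hP := zeroPair_zero_re_nonneg hr hρr hre
  have hp : 0 < -ρ.re - w := by linarith
  have hp' : 0 < -ρ.re := by linarith
  have h4 : ‖zeroPair r ρ 0‖ / ‖z - ρ‖ ≤ (zeroPair r ρ 0).re / (-ρ.re - w) := by
    rw [div_le_div_iff₀ hA hp]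
    have : ‖zeroPair r ρ 0‖ = (zeroPair r ρ 0).re * ‖ρ‖ / (-ρ.re) := by
      rw [← h2, mul_div_assoc, div_self hp'.ne', mul_one]
    rw [this, div_mul_eq_mul_div, div_le_iff₀ hp', mul_assoc, mul_assoc]
    exact mul_le_mul_of_nonneg_left h3 hP
  have h5 : ‖(r : ℂ) ^ 2 + ρ * conj ρ - conj ρ * z‖ / ‖(r : ℂ) ^ 2 - conj ρ * z‖ ≤ 2.05 :=
    (div_le_iff₀ hB).2 h1
  calc _ = w * (‖zeroPair r ρ 0‖ / ‖z - ρ‖) *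
        (‖(r : ℂ) ^ 2 + ρ * conj ρ - conj ρ * z‖ / ‖(r : ℂ) ^ 2 - conj ρ * z‖) := by
        field_simp
    _ ≤ w * ((zeroPair r ρ 0).re / (-ρ.re - w)) * 2.05 := by
        gcongr
    _ = _ := by ring

end ZeroPairs

section LocalDecomposition

open Complex Metric Set Filter Topology ComplexConjugate

/-- The mean value that controls the logarithmic derivative at the centre of a circle. -/
noncomputable def circleCosMean (f : ℂ → ℂ) (s : ℂ) (r : ℝ) : ℝ :=
  1 / (Real.pi * r) * ∫ θ in (0 : ℝ)..2 * Real.pi,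
    Real.cos θ * Real.log ‖f (s + circleMap 0 r θ)‖

theorem deriv_comp_const_add' (f : ℂ → ℂ) (s z : ℂ) :
    deriv (fun z => f (s + z)) z = deriv f (s + z) := by
  simpa using deriv_comp_const_add f s z

theorem exists_local_decomposition {f : ℂ → ℂ} {s : ℂ} {r : ℝ} (hr : 0 < r)
    (hf : Differentiable ℂ f) (hf0 : f s ≠ 0) (hfr : ∀ z ∈ sphere s r, f z ≠ 0)
    (hzero : ∀ ρ, ‖ρ - s‖ < r → f ρ = 0 → ρ.re < s.re) :
    ∃ (S : Finset ℂ) (n : ℂ → ℕ) (h : ℂ → ℂ),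
      (∀ ρ ∈ S, ‖ρ‖ < r ∧ f (s + ρ) = 0 ∧ 1 ≤ n ρ ∧ ρ.re < 0) ∧
      (∀ ρ, ‖ρ‖ < r → f (s + ρ) = 0 → ρ ∈ S ∧ (deriv f (s + ρ) = 0 → 2 ≤ n ρ) ∧
        (deriv f (s + ρ) ≠ 0 → n ρ = 1)) ∧
      (∀ z, ‖z‖ < r → f (s + z) ≠ 0 →
        deriv f (s + z) / f (s + z) = h z + ∑ ρ ∈ S, (n ρ : ℂ) * zeroPair r ρ z) ∧
      (h 0).re = circleCosMean f s r ∧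
      (∀ M, 0 < M → (∀ z ∈ sphere s r, Real.log ‖f z‖ ≤ M + Real.log ‖f s‖) →
        ∀ z, ‖z‖ ≤ r / 4 → ‖h z‖ ≤ 8 * M / r) := by
  have hfs : Differentiable ℂ (fun z => f (s + z)) := by fun_prop
  obtain ⟨S, n, h, h1, h2, h3, h4, h5⟩ := exists_blaschke_decomposition (f := fun z => f (s + z)) hr
    hfs (by simpa using hf0) (fun z hz => hfr _ (by simpa using hz))
  simp only [deriv_comp_const_add'] at h2 h3
  refine ⟨S, n, h, fun ρ hρ => ?_, h2, h3, ?_, fun M hM hb => h5 M hM fun z hz => ?_⟩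
  · obtain ⟨a, b, c⟩ := h1 ρ hρ
    refine ⟨a, b, c, ?_⟩
    have := hzero (s + ρ) (by simpa using a) b
    rw [Complex.add_re] at this; linarith
  · rw [circleCosMean, ← h4]
    have := Real.pi_pos
    field_simp
  · simpa using hb (s + z) (by simpa using hz)

theorem neg_re_logDeriv_le {f : ℂ → ℂ} {s : ℂ} {r : ℝ} (hr : 0 < r)
    (hf : Differentiable ℂ f) (hf0 : f s ≠ 0) (hfr : ∀ z ∈ sphere s r, f z ≠ 0)
    (hzero : ∀ ρ, ‖ρ - s‖ < r → f ρ = 0 → ρ.re < s.re) {G : ℝ} (hG : -circleCosMean f s r ≤ G)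
    (Z : Finset ℂ) (m : ℂ → ℕ)
    (hZ : ∀ ρ ∈ Z, ‖ρ - s‖ < r ∧ f ρ = 0 ∧ (m ρ ≤ 1 ∨ (m ρ ≤ 2 ∧ deriv f ρ = 0))) :
    -(deriv f s / f s).re ≤ G - ∑ ρ ∈ Z, (m ρ : ℝ) * (zeroPair r (ρ - s) 0).re := by
  obtain ⟨S, n, h, h1, h2, h3, h4, -⟩ := exists_local_decomposition hr hf hf0 hfr hzero
  have e := congrArg Complex.re (h3 0 (by simpa using hr) (by simpa using hf0))
  rw [add_zero, Complex.add_re, h4, Complex.re_sum] at e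
  simp only [← Complex.ofReal_natCast, Complex.re_ofReal_mul] at e
  have hsum : ∑ ρ ∈ Z, (m ρ : ℝ) * (zeroPair r (ρ - s) 0).re ≤
      ∑ ρ ∈ S, (n ρ : ℝ) * (zeroPair r ρ 0).re := by
    have hinj : Set.InjOn (fun ρ => ρ - s) (Z : Set ℂ) := fun a _ b _ hab => by simpa using hab
    calc ∑ ρ ∈ Z, (m ρ : ℝ) * (zeroPair r (ρ - s) 0).re
        = ∑ ρ ∈ Z.image (fun ρ => ρ - s), (m (s + ρ) : ℝ) * (zeroPair r ρ 0).re := by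
          rw [Finset.sum_image hinj]; simp
      _ ≤ ∑ ρ ∈ Z.image (fun ρ => ρ - s), (n ρ : ℝ) * (zeroPair r ρ 0).re := by
          refine Finset.sum_le_sum fun ρ hρ => ?_
          obtain ⟨w, hw, rfl⟩ := Finset.mem_image.1 hρ
          obtain ⟨a, b, c⟩ := hZ w hw
          have hb := h2 (w - s) a (by simpa using b)
          have hS := h1 (w - s) hb.1
          refine mul_le_mul_of_nonneg_right ?_ (zeroPair_zero_re_nonneg hr a hS.2.2.2)
          simp only [add_sub_cancel] at hb ⊢
          rcases c with c | c
          · exact_mod_cast c.trans hS.2.2.1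
          · exact_mod_cast c.1.trans (hb.2.1 c.2)
      _ ≤ _ := by
          refine Finset.sum_le_sum_of_subset_of_nonneg ?_ fun ρ hρ _ => ?_
          · intro ρ hρ
            obtain ⟨w, hw, rfl⟩ := Finset.mem_image.1 hρ
            obtain ⟨a, b, c⟩ := hZ w hw
            exact (h2 (w - s) a (by simpa using b)).1
          · have := h1 ρ hρ
            exact mul_nonneg (Nat.cast_nonneg _) (zeroPair_zero_re_nonneg hr this.1 this.2.2.2)
  linarith

theorem norm_logDeriv_le {f : ℂ → ℂ} {s : ℂ} {r : ℝ} (hr : 0 < r)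
    (hf : Differentiable ℂ f) (hf0 : f s ≠ 0) (hfr : ∀ z ∈ sphere s r, f z ≠ 0) {G M R : ℝ}
    (hG : -circleCosMean f s r ≤ G) (hM : 0 < M)
    (hb : ∀ z ∈ sphere s r, Real.log ‖f z‖ ≤ M + Real.log ‖f s‖) {w : ℝ} (hw0 : 0 ≤ w)
    (hwr : w ≤ r / 21) (hR : 0 ≤ R)
    (hzero : ∀ ρ, ‖ρ - s‖ < r → f ρ = 0 → w < s.re - ρ.re ∧ w / (s.re - ρ.re - w) ≤ R) :
    ‖deriv f (s - w) / f (s - w)‖ ≤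
      ‖deriv f s / f s‖ + 16 * M / r + 2.05 * R * ((deriv f s / f s).re + G) := by
  obtain ⟨S, n, h, h1, h2, h3, h4, h5⟩ := exists_local_decomposition hr hf hf0 hfr
    (fun ρ a b => by have := (hzero ρ a b).1; linarith)
  set z : ℂ := ((-w : ℝ) : ℂ) with hz
  have hzn : ‖z‖ = w := by rw [hz, Complex.norm_real, norm_neg, Real.norm_of_nonneg hw0]
  have hsz : s - w = s + z := by rw [hz]; push_cast; ring
  have hnz : f (s + z) ≠ 0 := by
    intro h0
    have := (hzero (s + z) (by rw [add_sub_cancel_left, hzn]; linarith) h0).1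
    simp [hz] at this
  have e0 := h3 0 (by simpa using hr) (by simpa using hf0)
  have ez := h3 z (by rw [hzn]; linarith) hnz
  rw [add_zero] at e0
  have e := congrArg Complex.re e0
  rw [Complex.add_re, h4, Complex.re_sum] at e
  simp only [← Complex.ofReal_natCast, Complex.re_ofReal_mul] at e
  have hsum : ‖∑ ρ ∈ S, (n ρ : ℂ) * zeroPair r ρ z - ∑ ρ ∈ S, (n ρ : ℂ) * zeroPair r ρ 0‖ ≤
      2.05 * R * ∑ ρ ∈ S, (n ρ : ℝ) * (zeroPair r ρ 0).re := by
    rw [← Finset.sum_sub_distrib, Finset.mul_sum]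
    refine (norm_sum_le _ _).trans (Finset.sum_le_sum fun ρ hρ => ?_)
    obtain ⟨a, b, c, d⟩ := h1 ρ hρ
    obtain ⟨p1, p2⟩ := hzero (s + ρ) (by simpa using a) b
    rw [Complex.add_re, sub_add_cancel_left] at p1 p2
    rw [← mul_sub, norm_mul, Complex.norm_natCast]
    have := (norm_zeroPair_sub_le hr a hw0 p1 hwr).trans (mul_le_mul_of_nonneg_right
      (mul_le_mul_of_nonneg_left p2 (by norm_num)) (zeroPair_zero_re_nonneg hr a d))
    calc _ ≤ (n ρ : ℝ) * (2.05 * R * (zeroPair r ρ 0).re) :=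
          mul_le_mul_of_nonneg_left this (Nat.cast_nonneg _)
      _ = _ := by ring
  have key : deriv f (s + z) / f (s + z) = deriv f s / f s + (h z - h 0) +
      (∑ ρ ∈ S, (n ρ : ℂ) * zeroPair r ρ z - ∑ ρ ∈ S, (n ρ : ℂ) * zeroPair r ρ 0) := by
    rw [ez, e0]; ring
  have hh : ‖h z - h 0‖ ≤ 16 * M / r := by
    have a := h5 M hM hb z (by rw [hzn]; linarith)
    have b := h5 M hM hb 0 (by simp; positivity)
    have c : 16 * M / r = 8 * M / r + 8 * M / r := by ring
    rw [c]
    exact (norm_sub_le _ _).trans (add_le_add a b)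
  rw [hsz, key]
  refine (norm_add₃_le).trans (add_le_add (add_le_add le_rfl hh) (hsum.trans ?_))
  refine mul_le_mul_of_nonneg_left ?_ (by positivity)
  linarith

theorem norm_logDeriv_sub_le {f : ℂ → ℂ} {s : ℂ} {r : ℝ} (hr : 0 < r)
    (hf : Differentiable ℂ f) (hf0 : f s ≠ 0) (hfr : ∀ z ∈ sphere s r, f z ≠ 0) {G M R : ℝ}
    (hG : -circleCosMean f s r ≤ G) (hM : 0 < M)
    (hb : ∀ z ∈ sphere s r, Real.log ‖f z‖ ≤ M + Real.log ‖f s‖) {w : ℝ} (hw0 : 0 ≤ w)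
    (hwr : w ≤ r / 21) (hR : 0 ≤ R) {β : ℂ} (hβre : β.re < s.re) (hβs : s - w ≠ β)
    (hβ : f β = 0) (hβd : deriv f β ≠ 0)
    (hzero : ∀ ρ, ‖ρ - s‖ < r → f ρ = 0 → ρ ≠ β → w < s.re - ρ.re ∧ w / (s.re - ρ.re - w) ≤ R) :
    ‖deriv f (s - w) / f (s - w) - 1 / (s - w - β)‖ ≤
      ‖deriv f s / f s‖ + 16 * M / r + 2.05 * R * ((deriv f s / f s).re + G) +
        (1 / ‖s - β‖ + 2.1 / r) := by
  obtain ⟨S, n, h, h1, h2, h3, h4, h5⟩ := exists_local_decomposition hr hf hf0 hfr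
    (fun ρ a b => by
      by_cases hρ : ρ = β
      · rw [hρ]; exact hβre
      · have := (hzero ρ a b hρ).1; linarith)
  set z : ℂ := ((-w : ℝ) : ℂ) with hz
  have hzn : ‖z‖ = w := by rw [hz, Complex.norm_real, norm_neg, Real.norm_of_nonneg hw0]
  have hsz : s - w = s + z := by rw [hz]; push_cast; ring
  rw [hsz] at hβs ⊢
  have hnz : f (s + z) ≠ 0 := by
    intro h0
    have := (hzero (s + z) (by rw [add_sub_cancel_left, hzn]; linarith) h0 hβs).1
    simp [hz] at this
  have e0 := h3 0 (by simpa using hr) (by simpa using hf0)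
  have ez := h3 z (by rw [hzn]; linarith) hnz
  rw [add_zero] at e0
  have e := congrArg Complex.re e0
  rw [Complex.add_re, h4, Complex.re_sum] at e
  simp only [← Complex.ofReal_natCast, Complex.re_ofReal_mul] at e
  have hpos : ∀ ρ ∈ S, 0 ≤ (n ρ : ℝ) * (zeroPair r ρ 0).re := fun ρ hρ =>
    mul_nonneg (Nat.cast_nonneg _) (zeroPair_zero_re_nonneg hr (h1 ρ hρ).1 (h1 ρ hρ).2.2.2)
  have hsum : ‖∑ ρ ∈ S.erase (β - s), (n ρ : ℂ) * zeroPair r ρ z -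
      ∑ ρ ∈ S.erase (β - s), (n ρ : ℂ) * zeroPair r ρ 0‖ ≤
      2.05 * R * ∑ ρ ∈ S, (n ρ : ℝ) * (zeroPair r ρ 0).re := by
    refine le_trans ?_ (mul_le_mul_of_nonneg_left (Finset.sum_le_sum_of_subset_of_nonneg
      (Finset.erase_subset (β - s) S) fun ρ hρ _ => hpos ρ hρ) (by positivity))
    rw [← Finset.sum_sub_distrib, Finset.mul_sum]
    refine (norm_sum_le _ _).trans (Finset.sum_le_sum fun ρ hρ' => ?_)
    have hρ := Finset.mem_of_mem_erase hρ'
    obtain ⟨a, b, c, d⟩ := h1 ρ hρ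
    obtain ⟨p1, p2⟩ := hzero (s + ρ) (by simpa using a) b
      (fun h => Finset.ne_of_mem_erase hρ' (by rw [← h]; ring))
    rw [Complex.add_re, sub_add_cancel_left] at p1 p2
    rw [← mul_sub, norm_mul, Complex.norm_natCast]
    have := (norm_zeroPair_sub_le hr a hw0 p1 hwr).trans (mul_le_mul_of_nonneg_right
      (mul_le_mul_of_nonneg_left p2 (by norm_num)) (zeroPair_zero_re_nonneg hr a d))
    calc _ ≤ (n ρ : ℝ) * (2.05 * R * (zeroPair r ρ 0).re) :=
          mul_le_mul_of_nonneg_left this (Nat.cast_nonneg _)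
      _ = _ := by ring
  have hh : ‖h z - h 0‖ ≤ 16 * M / r := by
    have a := h5 M hM hb z (by rw [hzn]; linarith)
    have b := h5 M hM hb 0 (by simp; positivity)
    have c : 16 * M / r = 8 * M / r + 8 * M / r := by ring
    rw [c]
    exact (norm_sub_le _ _).trans (add_le_add a b)
  have hE : ∃ E : ℂ, ‖E‖ ≤ 1 / ‖s - β‖ + 2.1 / r ∧
      (∑ ρ ∈ S, (n ρ : ℂ) * zeroPair r ρ z - ∑ ρ ∈ S, (n ρ : ℂ) * zeroPair r ρ 0) -
        1 / (s + z - β) = (∑ ρ ∈ S.erase (β - s), (n ρ : ℂ) * zeroPair r ρ z -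
      ∑ ρ ∈ S.erase (β - s), (n ρ : ℂ) * zeroPair r ρ 0) + E := by
    have hbound : 1 / (r - w) ≤ 1.05 / r := by
      rw [div_le_div_iff₀ (by linarith) hr]; linarith
    have hsβ : 0 < ‖s - β‖ := norm_pos_iff.2 fun h => by
      rw [sub_eq_zero.1 h] at hf0; exact hf0 hβ
    by_cases hin : ‖β - s‖ < r
    · obtain ⟨hm, -, hn⟩ := h2 (β - s) hin (by simpa using hβ)
      have hn1 := hn (by simpa using hβd)
      refine ⟨conj (β - s) / (r ^ 2 - conj (β - s) * z) - zeroPair r (β - s) 0, ?_, ?_⟩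
      · rw [zeroPair]
        simp only [mul_zero, sub_zero, zero_sub]
        have a1 : ‖conj (β - s) / (r ^ 2 - conj (β - s) * z)‖ ≤ 1 / (r - w) := by
          rw [norm_div, RCLike.norm_conj]
          have e2 : r ^ 2 - ‖β - s‖ * w ≤ ‖(r : ℂ) ^ 2 - conj (β - s) * z‖ := by
            have := norm_sub_norm_le ((r : ℂ) ^ 2) (conj (β - s) * z)
            rwa [norm_mul, RCLike.norm_conj, hzn, norm_pow, Complex.norm_real,
              Real.norm_of_nonneg hr.le] at this
          have e3 : r * (r - w) ≤ r ^ 2 - ‖β - s‖ * w := by nlinarith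
          have e4 : 0 < r * (r - w) := mul_pos hr (by linarith)
          rw [div_le_div_iff₀ (by linarith) (by linarith)]
          nlinarith [norm_nonneg (β - s)]
        have a2 : ‖1 / -(β - s) + conj (β - s) / (r : ℂ) ^ 2‖ ≤ 1 / ‖s - β‖ + 1 / r := by
          refine (norm_add_le _ _).trans (add_le_add (by simp) ?_)
          rw [norm_div, RCLike.norm_conj, norm_pow, Complex.norm_real, Real.norm_of_nonneg hr.le,
            div_le_div_iff₀ (by positivity) hr]
          nlinarith
        have a3 : 2.1 / r = 1.05 / r + 1 / r + 0.05 / r := by ring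
        have a4 : 0 < 0.05 / r := by positivity
        refine (norm_sub_le _ _).trans ?_
        linarith
      · rw [← Finset.add_sum_erase S _ hm, ← Finset.add_sum_erase S _ hm, hn1]
        have : zeroPair r (β - s) z =
            1 / (s + z - β) + conj (β - s) / (r ^ 2 - conj (β - s) * z) := by
          rw [zeroPair]; congr 2; ring
        rw [this]; push_cast; ring
    · have hnm : β - s ∉ S := fun h => hin (h1 _ h).1
      rw [Finset.erase_eq_of_notMem hnm]
      refine ⟨-(1 / (s + z - β)), ?_, by ring⟩
      rw [norm_neg, norm_div, norm_one]
      have a1 : r - w ≤ ‖s + z - β‖ := by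
        have : s + z - β = z - (β - s) := by ring
        rw [this, norm_sub_rev]
        have := norm_sub_norm_le (β - s) z
        rw [hzn] at this; linarith [not_lt.1 hin]
      have a2 : 1 / ‖s + z - β‖ ≤ 1 / (r - w) := one_div_le_one_div_of_le (by linarith) a1
      have a3 : 2.1 / r = 1.05 / r + 1.05 / r := by ring
      have : 0 < 1 / ‖s - β‖ := by positivity
      have : 0 < 1.05 / r := by positivity
      linarith
  obtain ⟨E, hEn, hE⟩ := hE
  have key : deriv f (s + z) / f (s + z) - 1 / (s + z - β) = deriv f s / f s + (h z - h 0) +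
      (∑ ρ ∈ S.erase (β - s), (n ρ : ℂ) * zeroPair r ρ z -
        ∑ ρ ∈ S.erase (β - s), (n ρ : ℂ) * zeroPair r ρ 0) + E := by
    rw [ez, e0]
    linear_combination hE
  rw [key]
  refine (norm_add_le _ _).trans (add_le_add ?_ hEn)
  refine (norm_add₃_le).trans (add_le_add (add_le_add le_rfl hh) (hsum.trans ?_))
  refine mul_le_mul_of_nonneg_left ?_ (by positivity)
  linarith

end LocalDecomposition

section CharSums

open Complex Metric Set Filter Topology

variable {q : ℕ} [NeZero q]

theorem sum_Ico_period_eq {M : Type*} [AddCommGroup M] (f : ℕ → M) (hf : Function.Periodic f q) (a : ℕ) :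
    ∑ n ∈ Finset.Ico a (a + q), f n = ∑ n ∈ Finset.range q, f n := by
  induction a with
  | zero => simp
  | succ a ih =>
    have hq : 0 < q := Nat.pos_of_ne_zero (NeZero.ne q)
    rw [← ih, Finset.sum_eq_sum_Ico_succ_bot (by omega : a < a + q),
      show a + 1 + q = (a + q) + 1 by ring, Finset.sum_Ico_succ_top (by omega), hf a]
    abel

theorem sum_range_dirichletCharacter (χ : DirichletCharacter ℂ q) (hχ : χ ≠ 1) :
    ∑ n ∈ Finset.range q, χ n = 0 := by
  obtain ⟨k, rfl⟩ := Nat.exists_eq_succ_of_ne_zero (NeZero.ne q)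
  rw [Finset.sum_range, ← MulChar.sum_eq_zero_of_ne_one hχ]
  exact Finset.sum_congr rfl fun i _ => by congr 1; exact Fin.cast_val_eq_self i

theorem periodic_dirichletCharacter (χ : DirichletCharacter ℂ q) :
    Function.Periodic (fun n : ℕ => χ n) q := fun n => by simp

theorem norm_sum_Ico_le_card (χ : DirichletCharacter ℂ q) (a b : ℕ) :
    ‖∑ n ∈ Finset.Ico a b, χ n‖ ≤ ((Finset.Ico a b).filter (q.Coprime ·)).card := by
  rw [Finset.card_filter, Nat.cast_sum]
  refine (norm_sum_le _ _).trans (Finset.sum_le_sum fun n _ => ?_)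
  split_ifs with h
  · simpa using χ.norm_le_one n
  · rw [χ.map_nonunit, norm_zero]; simp
    rw [ZMod.isUnit_iff_coprime]; exact fun h' => h h'.symm

theorem norm_sum_Ico_add_mul (χ : DirichletCharacter ℂ q) (hχ : χ ≠ 1) (a k l : ℕ) :
    ∑ n ∈ Finset.Ico a (a + (q * k + l)), χ n = ∑ n ∈ Finset.Ico a (a + l), χ n := by
  induction k with
  | zero => simp
  | succ k ih =>
    rw [← ih, show a + (q * (k + 1) + l) = (a + (q * k + l)) + q by ring,
      ← Finset.sum_Ico_consecutive _ (by omega : a ≤ a + (q * k + l)) (by omega),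
      sum_Ico_period_eq _ (periodic_dirichletCharacter χ), sum_range_dirichletCharacter χ hχ, add_zero]

theorem norm_sum_Ico_le (χ : DirichletCharacter ℂ q) (hχ : χ ≠ 1) (a b : ℕ) :
    ‖∑ n ∈ Finset.Ico a b, χ n‖ ≤ (q.totient : ℝ) / 2 := by
  rcases le_total b a with h | h
  · rw [Finset.Ico_eq_empty_of_le h]; simp; positivity
  have hq : 0 < q := Nat.pos_of_ne_zero (NeZero.ne q)
  obtain ⟨m, rfl⟩ := Nat.exists_eq_add_of_le h
  rw [← Nat.div_add_mod m q, norm_sum_Ico_add_mul χ hχ]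
  set l := m % q
  have hl : l < q := Nat.mod_lt _ hq
  have h1 := norm_sum_Ico_le_card χ a (a + l)
  have h2 := norm_sum_Ico_le_card χ (a + l) (a + q)
  have h3 : ∑ n ∈ Finset.Ico a (a + l), χ n + ∑ n ∈ Finset.Ico (a + l) (a + q), χ n = 0 := by
    rw [Finset.sum_Ico_consecutive _ (by omega) (by omega),
      sum_Ico_period_eq _ (periodic_dirichletCharacter χ), sum_range_dirichletCharacter χ hχ]
  rw [← norm_neg, ← eq_neg_of_add_eq_zero_left h3] at h2
  have h4 : ((Finset.Ico a (a + l)).filter (q.Coprime ·)).card +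
      ((Finset.Ico (a + l) (a + q)).filter (q.Coprime ·)).card = q.totient := by
    rw [← Nat.filter_coprime_Ico_eq_totient q a, ← Finset.card_union_of_disjoint, ← Finset.filter_union,
      Finset.Ico_union_Ico_eq_Ico (by omega) (by omega)]
    exact Finset.disjoint_filter_filter (Finset.Ico_disjoint_Ico_consecutive _ _ _)
  have h5 : (((Finset.Ico a (a + l)).filter (q.Coprime ·)).card : ℝ) +
      ((Finset.Ico (a + l) (a + q)).filter (q.Coprime ·)).card = q.totient := by exact_mod_cast h4
  linarith

theorem abs_sum_Ico_one_sub_le (a b : ℕ) (h : a ≤ b) :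
    ‖∑ n ∈ Finset.Ico a b, (1 : DirichletCharacter ℂ q) n -
      ((q.totient / q * (b - a : ℝ) : ℝ) : ℂ)‖ ≤ q.totient := by
  have hq : 0 < q := Nat.pos_of_ne_zero (NeZero.ne q)
  have hqR : (0 : ℝ) < q := by exact_mod_cast hq
  have e1 : ∑ n ∈ Finset.Ico a b, (1 : DirichletCharacter ℂ q) n =
      (((Finset.Ico a b).filter (q.Coprime ·)).card : ℂ) := by
    rw [Finset.card_filter, Nat.cast_sum]
    refine Finset.sum_congr rfl fun n _ => ?_
    split_ifs with h
    · rw [MulChar.one_apply ((ZMod.isUnit_iff_coprime n q).2 h.symm)]; simp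
    · rw [MulChar.map_nonunit]; simp
      rw [ZMod.isUnit_iff_coprime]; exact fun h' => h h'.symm
  obtain ⟨m, rfl⟩ := Nat.exists_eq_add_of_le h
  have e2 : ∀ k l, ((Finset.Ico a (a + (q * k + l))).filter (q.Coprime ·)).card =
      k * q.totient + ((Finset.Ico a (a + l)).filter (q.Coprime ·)).card := by
    intro k l
    induction k with
    | zero => simp
    | succ k ih =>
      rw [show a + (q * (k + 1) + l) = (a + (q * k + l)) + q by ring,
        ← Finset.Ico_union_Ico_eq_Ico (by omega : a ≤ a + (q * k + l)) (by omega),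
        Finset.filter_union, Finset.card_union_of_disjoint, ih, Nat.filter_coprime_Ico_eq_totient]
      · ring
      · exact Finset.disjoint_filter_filter (Finset.Ico_disjoint_Ico_consecutive _ _ _)
  have e3 := e2 (m / q) (m % q)
  rw [Nat.div_add_mod] at e3
  have hl : m % q < q := Nat.mod_lt _ hq
  have h1 : ((Finset.Ico a (a + m % q)).filter (q.Coprime ·)).card ≤ q.totient := by
    rw [← Nat.filter_coprime_Ico_eq_totient q a]
    exact Finset.card_le_card (Finset.filter_subset_filter _
      (Finset.Ico_subset_Ico_right (by omega)))
  have h2 : (m : ℝ) = q * (m / q : ℕ) + (m % q : ℕ) := by exact_mod_cast (Nat.div_add_mod m q).symm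
  rw [e1, e3, show ((((m / q) * q.totient + ((Finset.Ico a (a + m % q)).filter (q.Coprime ·)).card : ℕ)
    : ℂ)) = ((((m / q) * q.totient + ((Finset.Ico a (a + m % q)).filter (q.Coprime ·)).card : ℕ) : ℝ) : ℂ)
    by push_cast; rfl, ← Complex.ofReal_sub, Complex.norm_real, Real.norm_eq_abs]
  have h3 : (q.totient / q * ((a + m : ℕ) - a : ℝ) : ℝ) =
      (m / q : ℕ) * q.totient + q.totient * ((m % q : ℕ) / q) := by
    push_cast
    rw [add_sub_cancel_left, h2]; field_simp
    
  rw [h3]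
  have h4 : ((m % q : ℕ) : ℝ) / q ≤ 1 := by
    rw [div_le_one hqR]; exact_mod_cast hl.le
  have h5 : (0 : ℝ) ≤ ((m % q : ℕ) : ℝ) / q := by positivity
  have h6 : (0 : ℝ) ≤ q.totient := by positivity
  have h7 : (((Finset.Ico a (a + m % q)).filter (q.Coprime ·)).card : ℝ) ≤ q.totient := by
    exact_mod_cast h1
  have h8 : (0 : ℝ) ≤ (((Finset.Ico a (a + m % q)).filter (q.Coprime ·)).card : ℝ) := by positivity
  rw [abs_le]
  push_cast
  constructor <;> nlinarith [mul_le_of_le_one_right h6 h4, mul_nonneg h6 h5]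

end CharSums

section LBounds

open Complex Metric Set Filter Topology MeasureTheory

variable {q : ℕ} [NeZero q]

/-- Error term of the summatory function of `χ` beyond `N`. -/
noncomputable def charErr (χ : DirichletCharacter ℂ q) (N t : ℝ) : ℂ :=
  open Classical in
  if t ≤ N then 0 else ∑ k ∈ Finset.Ico (⌊N⌋₊ + 1) (⌊t⌋₊ + 1), χ k -
    if χ = 1 then (((q.totient / q * (t - N) : ℝ)) : ℂ) else 0

/-- Bound for the oscillation of the summatory function of `χ`. -/
noncomputable def charV (χ : DirichletCharacter ℂ q) : ℝ :=
  open Classical in if χ = 1 then q.totient + 1 else q.totient / 2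

theorem totient_div_le_one : (q.totient : ℝ) / q ≤ 1 :=
  div_le_one_of_le₀ (by exact_mod_cast Nat.totient_le q) (by positivity)

theorem charV_nonneg (χ : DirichletCharacter ℂ q) : 0 ≤ charV χ := by
  unfold charV; split_ifs <;> positivity

theorem norm_charErr_le (χ : DirichletCharacter ℂ q) {N : ℝ} (hN : 0 ≤ N) (t : ℝ) :
    ‖charErr χ N t‖ ≤ charV χ := by
  unfold charErr
  split_ifs with h1 h2
  · simpa using charV_nonneg χ
  · subst h2
    have hft : ⌊N⌋₊ ≤ ⌊t⌋₊ := Nat.floor_le_floor (not_le.1 h1).le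
    have h3 := abs_sum_Ico_one_sub_le (q := q) (⌊N⌋₊ + 1) (⌊t⌋₊ + 1) (by omega)
    rw [charV, if_pos rfl]
    have e : ∀ S : ℂ, S - (((q.totient / q * (t - N) : ℝ)) : ℂ) =
        (S - ((q.totient / q * (((⌊t⌋₊ + 1 : ℕ) : ℝ) - ((⌊N⌋₊ + 1 : ℕ) : ℝ)) : ℝ) : ℂ)) +
        ((q.totient / q * ((((⌊t⌋₊ + 1 : ℕ) : ℝ) - ((⌊N⌋₊ + 1 : ℕ) : ℝ)) - (t - N)) : ℝ) : ℂ) := by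
      intro S; push_cast; ring
    rw [e]
    refine (norm_add_le _ _).trans (add_le_add h3 ?_)
    rw [Complex.norm_real, Real.norm_eq_abs, abs_mul]
    have h4 := Nat.floor_le hN
    have h5 := Nat.lt_floor_add_one N
    have h6 := Nat.floor_le (hN.trans (not_le.1 h1).le)
    have h7 := Nat.lt_floor_add_one t
    refine mul_le_one₀ ?_ (abs_nonneg _) ?_
    · rw [abs_of_nonneg (by positivity)]; exact totient_div_le_one
    · push_cast
      rw [abs_le]; constructor <;> linarith
  · rw [charV, if_neg h2, sub_zero]
    exact norm_sum_Ico_le χ h2 _ _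

theorem measurable_charErr (χ : DirichletCharacter ℂ q) (N : ℝ) : Measurable (charErr χ N) := by
  unfold charErr
  refine Measurable.ite measurableSet_Iic measurable_const (Measurable.sub ?_ ?_)
  · exact (measurable_from_nat (f := fun n : ℕ => ∑ k ∈ Finset.Ico (⌊N⌋₊ + 1) (n + 1), χ k)).comp
      Nat.measurable_floor
  · split_ifs
    · fun_prop
    · exact measurable_const

theorem locallyIntegrableOn_charErr (χ : DirichletCharacter ℂ q) {N : ℝ} (hN : 0 ≤ N) :
    LocallyIntegrableOn (charErr χ N) (Ioi 0) := by
  apply LocallyIntegrable.locallyIntegrableOn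
  refine (locallyIntegrable_const (charV χ)).mono (measurable_charErr χ N).aestronglyMeasurable ?_
  refine Eventually.of_forall fun t => ?_
  exact (norm_charErr_le χ hN t).trans (Real.le_norm_self _)

theorem mellin_charErr_aux (χ : DirichletCharacter ℂ q) {N : ℝ} (hN : 0 < N) :
    (charErr χ N =O[atTop] fun t => t ^ (-(0 : ℝ))) ∧
      ∀ b : ℝ, charErr χ N =O[𝓝[>] 0] fun t => t ^ (-b) := by
  constructor
  · simp only [neg_zero, Real.rpow_zero]
    exact Asymptotics.isBigO_of_le' (c := charV χ) _ fun t => by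
      simpa using norm_charErr_le χ hN.le t
  · intro b
    have : charErr χ N =ᶠ[𝓝[>] 0] fun _ => 0 := by
      filter_upwards [mem_nhdsWithin_of_mem_nhds (Iio_mem_nhds hN)] with t ht
      rw [charErr, if_pos (le_of_lt ht)]
    exact this.trans_isBigO (Asymptotics.isBigO_zero _ _)

theorem differentiableAt_mellin_charErr (χ : DirichletCharacter ℂ q) {N : ℝ} (hN : 0 < N) {s : ℂ}
    (hs : 0 < s.re) : DifferentiableAt ℂ (fun s => mellin (charErr χ N) (-s)) s := by
  obtain ⟨h1, h2⟩ := mellin_charErr_aux χ hN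
  have := mellin_differentiableAt_of_isBigO_rpow (s := -s) (locallyIntegrableOn_charErr χ hN.le) h1
    (by simpa using hs) (h2 ((-s).re - 1)) (by linarith)
  exact this.comp s differentiableAt_id.neg

theorem mellinConvergent_charErr (χ : DirichletCharacter ℂ q) {N : ℝ} (hN : 0 < N) {s : ℂ}
    (hs : 0 < s.re) : MellinConvergent (charErr χ N) (-s) := by
  obtain ⟨h1, h2⟩ := mellin_charErr_aux χ hN
  exact mellinConvergent_of_isBigO_rpow (locallyIntegrableOn_charErr χ hN.le) h1
    (by simpa using hs) (h2 ((-s).re - 1)) (by linarith)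

theorem norm_mellin_charErr_le_of_norm_le (χ : DirichletCharacter ℂ q) {N B : ℝ} (hN : 0 < N)
    (hB : ∀ t, ‖charErr χ N t‖ ≤ B) {s : ℂ} (hs : 0 < s.re) :
    ‖mellin (charErr χ N) (-s)‖ ≤ B * (N ^ (-s.re) / s.re) := by
  have h1 : mellin (charErr χ N) (-s) = ∫ t in Ioi N, (t : ℂ) ^ (-s - 1) • charErr χ N t := by
    rw [mellin]
    refine setIntegral_eq_of_subset_of_forall_sdiff_eq_zero measurableSet_Ioi
      (Ioi_subset_Ioi hN.le) fun t ht => ?_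
    rw [charErr, if_pos (by simpa using ht.2), smul_zero]
  rw [h1]
  have h2 : ∫ t in Ioi N, B * t ^ (-s.re - 1) = B * (N ^ (-s.re) / s.re) := by
    rw [integral_const_mul, integral_Ioi_rpow_of_lt (by linarith) hN]
    simp
  rw [← h2]
  refine norm_integral_le_of_norm_le ((integrableOn_Ioi_rpow_of_lt (by linarith) hN).const_mul _) ?_
  refine (ae_restrict_iff' measurableSet_Ioi).2 (Eventually.of_forall fun t ht => ?_)
  rw [norm_smul, Complex.norm_cpow_eq_rpow_re_of_pos (hN.trans ht), mul_comm]
  have : 0 ≤ t ^ (-s.re - 1) := Real.rpow_nonneg (hN.trans ht).le _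
  simpa using mul_le_mul_of_nonneg_right (hB t) this

theorem norm_mellin_charErr_le (χ : DirichletCharacter ℂ q) {N : ℝ} (hN : 0 < N) {s : ℂ}
    (hs : 0 < s.re) : ‖mellin (charErr χ N) (-s)‖ ≤ charV χ * (N ^ (-s.re) / s.re) :=
  norm_mellin_charErr_le_of_norm_le χ hN (norm_charErr_le χ hN.le) hs

/-- The Dirichlet polynomial part. -/
noncomputable def charPoly (χ : DirichletCharacter ℂ q) (N : ℝ) (s : ℂ) : ℂ :=
  ∑ n ∈ Finset.Ico 1 (⌊N⌋₊ + 1), χ n * (n : ℂ) ^ (-s)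

theorem integral_sub_mul_cpow {N : ℝ} (hN : 0 < N) {s : ℂ} (hs : 1 < s.re) :
    IntegrableOn (fun t : ℝ => ((t - N : ℝ) : ℂ) * (t : ℂ) ^ (-(s + 1))) (Ioi N) ∧
    s * ∫ t in Ioi N, ((t - N : ℝ) : ℂ) * (t : ℂ) ^ (-(s + 1)) = (N : ℂ) ^ (1 - s) / (s - 1) := by
  have e : ∀ t ∈ Ioi N, ((t - N : ℝ) : ℂ) * (t : ℂ) ^ (-(s + 1)) =
      (t : ℂ) ^ (-s) - N * (t : ℂ) ^ (-s - 1) := by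
    intro t ht
    have ht0 : (t : ℂ) ≠ 0 := by exact_mod_cast (hN.trans ht).ne'
    have : (t : ℂ) ^ (-s) = t * (t : ℂ) ^ (-s - 1) := by
      rw [Complex.cpow_sub _ _ ht0, Complex.cpow_one]; field_simp
    rw [this, show -(s + 1) = -s - 1 by ring]; push_cast; ring
  have i1 : IntegrableOn (fun t : ℝ => (t : ℂ) ^ (-s)) (Ioi N) :=
    integrableOn_Ioi_cpow_of_lt (by simpa using hs) hN
  have i2 : IntegrableOn (fun t : ℝ => (t : ℂ) ^ (-s - 1)) (Ioi N) :=
    integrableOn_Ioi_cpow_of_lt (by simp; linarith) hN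
  refine ⟨(integrableOn_congr_fun e measurableSet_Ioi).2 (i1.sub (i2.const_mul _)), ?_⟩
  rw [setIntegral_congr_fun measurableSet_Ioi e, integral_sub i1 (i2.const_mul _),
    integral_const_mul, integral_Ioi_cpow_of_lt (by simpa using hs) hN,
    integral_Ioi_cpow_of_lt (by simp; linarith) hN]
  have hN0 : (N : ℂ) ≠ 0 := by exact_mod_cast hN.ne'
  have hs0 : s ≠ 0 := by rintro rfl; norm_num at hs
  have hs1 : s - 1 ≠ 0 := by
    intro h; rw [sub_eq_zero] at h; rw [h] at hs; norm_num at hs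
  have hs1' : -s + 1 ≠ 0 := by intro h; apply hs1; linear_combination -h
  have h1 : (N : ℂ) ^ (-s + 1) = N * (N : ℂ) ^ (-s) := by
    rw [Complex.cpow_add _ _ hN0, Complex.cpow_one]; ring
  have h2 : (N : ℂ) ^ (1 - s) = N * (N : ℂ) ^ (-s) := by rw [← h1]; congr 1; ring
  rw [h1, h2, show -s - 1 + 1 = -s by ring]
  field_simp
  ring

theorem LFunction_eq_of_one_lt_re (χ : DirichletCharacter ℂ q) {N : ℝ} (hN : 1 ≤ N) {s : ℂ}
    (hs : 1 < s.re) :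
    DirichletCharacter.LFunction χ s = charPoly χ N s +
      (open Classical in if χ = 1 then ((q.totient / q : ℝ) : ℂ) * (N : ℂ) ^ (1 - s) / (s - 1) else 0) +
      s * mellin (charErr χ N) (-s) := by
  classical
  have hN0 : 0 < N := by linarith
  set M := ⌊N⌋₊ with hM
  let g : ℕ → ℂ := fun n => if n ≤ M then χ n else 0
  let f : ℕ → ℂ := fun n => if n ≤ M then 0 else χ n
  have hfn : ∀ n, ‖f n‖ ≤ 1 := by
    intro n; simp only [f]; split_ifs
    · simp
    · exact DirichletCharacter.norm_le_one _ _
  have hgn : ∀ n, ‖g n‖ ≤ 1 := by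
    intro n; simp only [g]; split_ifs
    · exact DirichletCharacter.norm_le_one _ _
    · simp
  have hfs : LSeriesSummable f s := LSeriesSummable_of_bounded_of_one_lt_re (fun n _ => hfn n) hs
  have hgs : LSeriesSummable g s := LSeriesSummable_of_bounded_of_one_lt_re (fun n _ => hgn n) hs
  have hL : DirichletCharacter.LFunction χ s = LSeries g s + LSeries f s := by
    rw [DirichletCharacter.LFunction_eq_LSeries χ hs, ← LSeries_add hgs hfs]
    congr 1; ext n; simp only [g, f, Pi.add_apply]; split_ifs <;> simp
  have hg : LSeries g s = charPoly χ N s := by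
    rw [LSeries, tsum_eq_sum (s := Finset.Ico 1 (M + 1)), charPoly]
    · refine Finset.sum_congr rfl fun n hn => ?_
      rw [Finset.mem_Ico] at hn
      rw [LSeries.term_of_ne_zero (by omega), Complex.cpow_neg, div_eq_mul_inv]
      simp only [g]; rw [if_pos (by omega)]
    · intro n hn
      rw [Finset.mem_Ico] at hn
      rcases Nat.eq_zero_or_pos n with h | h
      · rw [h, LSeries.term_zero]
      · rw [LSeries.term_of_ne_zero (by omega)]
        simp only [g]; rw [if_neg (by omega), zero_div]
  have hO : (fun n => ∑ k ∈ Finset.Icc 1 n, ‖f k‖) =O[atTop] fun n => (n : ℝ) ^ (1 : ℝ) := by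
    refine Asymptotics.isBigO_of_le _ fun n => ?_
    rw [Real.rpow_one, Real.norm_of_nonneg (by positivity), Real.norm_of_nonneg (by positivity)]
    refine (Finset.sum_le_sum fun k _ => hfn k).trans (by simp)
  have hf := LSeries_eq_mul_integral' f zero_le_one hs hO
  set κ : ℂ := if χ = 1 then ((q.totient / q : ℝ) : ℂ) else 0 with hκ
  have hsum : ∀ t : ℝ, (∑ k ∈ Finset.Icc 1 ⌊t⌋₊, f k) =
      charErr χ N t + (if t ≤ N then 0 else κ * ((t - N : ℝ) : ℂ)) := by
    intro t
    by_cases ht : t ≤ N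
    · rw [charErr, if_pos ht, if_pos ht, add_zero]
      refine Finset.sum_eq_zero fun k hk => ?_
      rw [Finset.mem_Icc] at hk
      exact if_pos (hk.2.trans (Nat.floor_le_floor ht))
    · rw [charErr, if_neg ht, if_neg ht, hκ]
      have : ∑ k ∈ Finset.Icc 1 ⌊t⌋₊, f k =
          ∑ k ∈ Finset.Ico (⌊N⌋₊ + 1) (⌊t⌋₊ + 1), χ k := by
        symm
        refine Finset.sum_subset_zero_on_sdiff ?_ ?_ ?_
        · intro k hk; rw [Finset.mem_Ico] at hk; rw [Finset.mem_Icc]; omega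
        · intro k hk; rw [Finset.mem_sdiff, Finset.mem_Icc, Finset.mem_Ico] at hk
          exact if_pos (by omega)
        · intro k hk; rw [Finset.mem_Ico] at hk
          simp only [f]; rw [if_neg (by omega)]
      rw [this]
      split_ifs <;> push_cast <;> ring
  have hI := (integral_sub_mul_cpow hN0 hs)
  have hmel : mellin (charErr χ N) (-s) = ∫ t in Ioi (1 : ℝ), charErr χ N t * (t : ℂ) ^ (-(s + 1)) := by
    rw [mellin]
    rw [setIntegral_eq_of_subset_of_forall_sdiff_eq_zero measurableSet_Ioi
      (Ioi_subset_Ioi zero_le_one)]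
    · refine setIntegral_congr_fun measurableSet_Ioi fun t _ => ?_
      simp only [smul_eq_mul]; rw [mul_comm, show -s - 1 = -(s + 1) by ring]
    · intro t ht
      have : t ≤ 1 := by simpa using ht.2
      rw [charErr, if_pos (by linarith), smul_zero]
  have hmi : IntegrableOn (fun t : ℝ => charErr χ N t * (t : ℂ) ^ (-(s + 1))) (Ioi 1) := by
    have := (mellinConvergent_charErr χ hN0 (s := s) (by linarith)).mono_set
      (Ioi_subset_Ioi zero_le_one)
    refine this.congr_fun (fun t _ => ?_) measurableSet_Ioi
    simp only [smul_eq_mul]; rw [mul_comm, show -s - 1 = -(s + 1) by ring]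
  have hki : (∫ t in Ioi (1 : ℝ), (if t ≤ N then 0 else κ * ((t - N : ℝ) : ℂ)) * (t : ℂ) ^ (-(s + 1)))
      = κ * ∫ t in Ioi N, ((t - N : ℝ) : ℂ) * (t : ℂ) ^ (-(s + 1)) := by
    rw [setIntegral_eq_of_subset_of_forall_sdiff_eq_zero measurableSet_Ioi
      (Ioi_subset_Ioi hN), ← integral_const_mul]
    · refine setIntegral_congr_fun measurableSet_Ioi fun t ht => ?_
      rw [if_neg (not_le.2 ht), mul_assoc]
    · intro t ht
      rw [if_pos (by simpa using ht.2), zero_mul]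
  have hkii : IntegrableOn (fun t : ℝ => (if t ≤ N then 0 else κ * ((t - N : ℝ) : ℂ)) *
      (t : ℂ) ^ (-(s + 1))) (Ioi 1) := by
    have h1 : IntegrableOn (fun t : ℝ => (if t ≤ N then 0 else κ * ((t - N : ℝ) : ℂ)) *
      (t : ℂ) ^ (-(s + 1))) (Ioi N) := by
      refine IntegrableOn.congr_fun (hI.1.const_mul κ) (fun t ht => ?_) measurableSet_Ioi
      rw [if_neg (not_le.2 ht), mul_assoc]
    have h2 : IntegrableOn (fun t : ℝ => (if t ≤ N then 0 else κ * ((t - N : ℝ) : ℂ)) *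
      (t : ℂ) ^ (-(s + 1))) (Ioc 1 N) := by
      refine IntegrableOn.congr_fun (f := fun _ => (0 : ℂ)) integrableOn_zero (fun t ht => ?_)
        measurableSet_Ioc
      simp only; rw [if_pos ht.2, zero_mul]
    rw [← Ioc_union_Ioi_eq_Ioi hN]
    exact h2.union h1
  rw [hL, hg, hf]
  simp_rw [hsum, add_mul]
  rw [integral_add hmi hkii, ← hmel, hki, mul_add, ← mul_assoc s κ, mul_comm s κ, mul_assoc κ,
    hI.2, hκ]
  split_ifs <;> ring

end LBounds

section EntireLFunction

open Complex Metric Set Filter Topology MeasureTheory DirichletCharacter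

variable {q : ℕ} [NeZero q]

/-- The entire function attached to `χ`: `L(s, χ)`, with its pole removed when `χ` is trivial. -/
noncomputable def charF (χ : DirichletCharacter ℂ q) : ℂ → ℂ :=
  open Classical in if χ = 1 then LFunctionTrivChar₁ q else LFunction χ

theorem differentiable_charF (χ : DirichletCharacter ℂ q) : Differentiable ℂ (charF χ) := by
  unfold charF; split_ifs with h
  · exact differentiable_LFunctionTrivChar₁ q
  · exact differentiable_LFunction h

theorem charF_of_ne (χ : DirichletCharacter ℂ q) (h : χ ≠ 1) : charF χ = LFunction χ := if_neg h

theorem charF_one_apply {s : ℂ} (hs : s ≠ 1) :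
    charF (1 : DirichletCharacter ℂ q) s = (s - 1) * LFunction (1 : DirichletCharacter ℂ q) s := by
  rw [charF, if_pos rfl]; exact Function.update_of_ne hs _ _

theorem charF_ne_zero_of_one_le_re (χ : DirichletCharacter ℂ q) {s : ℂ} (hs : 1 ≤ s.re) :
    charF χ s ≠ 0 := by
  by_cases h : χ = 1
  · subst h
    by_cases h1 : s = 1
    · rw [charF, if_pos rfl, h1]; exact LFunctionTrivChar₁_apply_one_ne_zero q
    · rw [charF_one_apply h1]
      exact mul_ne_zero (sub_ne_zero.2 h1) (LFunction_ne_zero_of_one_le_re 1 (Or.inr h1) hs)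
  · rw [charF_of_ne χ h]
    exact LFunction_ne_zero_of_one_le_re χ (Or.inl h) hs

theorem isPreconnected_zero_lt_re : IsPreconnected {s : ℂ | 0 < s.re} :=
  (convex_halfSpace_re_gt 0).isPreconnected

theorem eqOn_zero_lt_re_of_eqOn_one_lt_re {f g : ℂ → ℂ}
    (hf : DifferentiableOn ℂ f {s | 0 < s.re}) (hg : DifferentiableOn ℂ g {s | 0 < s.re})
    (h : ∀ s : ℂ, 1 < s.re → f s = g s) {s : ℂ} (hs : 0 < s.re) : f s = g s := by
  have ho : IsOpen {s : ℂ | 0 < s.re} := isOpen_lt continuous_const continuous_re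
  have ho1 : IsOpen {s : ℂ | 1 < s.re} := isOpen_lt continuous_const continuous_re
  refine (hf.analyticOnNhd ho).eqOn_of_preconnected_of_eventuallyEq (hg.analyticOnNhd ho)
    isPreconnected_zero_lt_re (z₀ := 2) (by simp) ?_ hs
  filter_upwards [ho1.mem_nhds (show (2 : ℂ) ∈ {s : ℂ | 1 < s.re} by simp)] with s hs using h s hs

theorem differentiable_charPoly (χ : DirichletCharacter ℂ q) (N : ℝ) :
    Differentiable ℂ (charPoly χ N) := by
  unfold charPoly
  refine Differentiable.fun_sum fun n hn => ?_
  have : (n : ℂ) ≠ 0 := by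
    rw [Finset.mem_Ico] at hn; exact_mod_cast (by omega : n ≠ 0)
  intro s
  exact (differentiableAt_const _).mul (DifferentiableAt.const_cpow differentiableAt_id.neg
    (Or.inl this))

theorem charF_eq_of_ne (χ : DirichletCharacter ℂ q) (h : χ ≠ 1) {N : ℝ} (hN : 1 ≤ N) {s : ℂ}
    (hs : 0 < s.re) : charF χ s = charPoly χ N s + s * mellin (charErr χ N) (-s) := by
  refine eqOn_zero_lt_re_of_eqOn_one_lt_re
    (g := fun s => charPoly χ N s + s * mellin (charErr χ N) (-s))
    (differentiable_charF χ).differentiableOn ?_ ?_ hs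
  · intro s hs
    exact ((differentiable_charPoly χ N s).add (differentiableAt_id.mul
      (differentiableAt_mellin_charErr χ (by linarith) hs))).differentiableWithinAt
  · intro s hs
    rw [charF_of_ne χ h, LFunction_eq_of_one_lt_re χ hN hs, if_neg h, add_zero]

theorem charF_one_eq {N : ℝ} (hN : 1 ≤ N) {s : ℂ} (hs : 0 < s.re) :
    charF (1 : DirichletCharacter ℂ q) s =
      (s - 1) * (charPoly (1 : DirichletCharacter ℂ q) N s +
        s * mellin (charErr (1 : DirichletCharacter ℂ q) N) (-s)) +
      ((q.totient / q : ℝ) : ℂ) * (N : ℂ) ^ (1 - s) := by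
  refine eqOn_zero_lt_re_of_eqOn_one_lt_re (g := fun s =>
      (s - 1) * (charPoly (1 : DirichletCharacter ℂ q) N s +
        s * mellin (charErr (1 : DirichletCharacter ℂ q) N) (-s)) +
      ((q.totient / q : ℝ) : ℂ) * (N : ℂ) ^ (1 - s))
    (differentiable_charF 1).differentiableOn ?_ ?_ hs
  · intro s hs
    have hN0 : (N : ℂ) ≠ 0 := by exact_mod_cast (by linarith : N ≠ 0)
    refine DifferentiableAt.differentiableWithinAt (DifferentiableAt.add (DifferentiableAt.mul
      (by fun_prop) ((differentiable_charPoly _ N s).add (differentiableAt_id.mul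
      (differentiableAt_mellin_charErr _ (by linarith) hs)))) ?_)
    exact (differentiableAt_const _).mul (DifferentiableAt.const_cpow (by fun_prop) (Or.inl hN0))
  · intro s hs
    have h1 : s ≠ 1 := by rintro rfl; norm_num at hs
    have h2 : s - 1 ≠ 0 := sub_ne_zero.2 h1
    rw [charF_one_apply h1, LFunction_eq_of_one_lt_re 1 hN hs, if_pos rfl]
    field_simp
    ring

theorem sum_rpow_neg_le {σ : ℝ} (h0 : 0 ≤ σ) (h1 : σ < 1) (M : ℕ) :
    ∑ n ∈ Finset.Ico 1 (M + 1), (n : ℝ) ^ (-σ) ≤ (M : ℝ) ^ (1 - σ) / (1 - σ) := by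
  have hp : 0 < 1 - σ := by linarith
  induction M with
  | zero => simp; positivity
  | succ M ih =>
    rw [Finset.sum_Ico_succ_top (by omega)]
    have hx : (0 : ℝ) < ((M + 1 : ℕ) : ℝ) := by positivity
    have hb := _root_.rpow_one_add_le_one_add_mul_self (s := -1 / ((M + 1 : ℕ) : ℝ)) (p := 1 - σ)
      (by rw [neg_div, neg_le_neg_iff, div_le_one hx]; push_cast; linarith [Nat.cast_nonneg (α := ℝ) M])
      hp.le (by linarith)
    have hm : (M : ℝ) ^ (1 - σ) = ((M + 1 : ℕ) : ℝ) ^ (1 - σ) *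
        (1 + -1 / ((M + 1 : ℕ) : ℝ)) ^ (1 - σ) := by
      rw [← Real.mul_rpow hx.le]
      · congr 1; field_simp; push_cast; ring
      · rw [neg_div, ← sub_eq_add_neg, sub_nonneg, div_le_one hx]
        push_cast; linarith [Nat.cast_nonneg (α := ℝ) M]
    have hs : ((M + 1 : ℕ) : ℝ) ^ (-σ) = ((M + 1 : ℕ) : ℝ) ^ (1 - σ) / ((M + 1 : ℕ) : ℝ) := by
      rw [show -σ = (1 - σ) - 1 by ring, Real.rpow_sub hx, Real.rpow_one]
    have h3 : (M : ℝ) ^ (1 - σ) ≤ ((M + 1 : ℕ) : ℝ) ^ (1 - σ) -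
        (1 - σ) * ((M + 1 : ℕ) : ℝ) ^ (-σ) := by
      rw [hm, hs]
      calc _ ≤ ((M + 1 : ℕ) : ℝ) ^ (1 - σ) * (1 + (1 - σ) * (-1 / ((M + 1 : ℕ) : ℝ))) := by gcongr
        _ = _ := by ring
    rw [le_div_iff₀ hp] at ih ⊢
    rw [add_mul]
    linarith

theorem norm_charPoly_le (χ : DirichletCharacter ℂ q) {N σ : ℝ} (hN : 0 ≤ N) (h0 : 0 ≤ σ)
    (h1 : σ < 1) {s : ℂ} (hs : σ ≤ s.re) : ‖charPoly χ N s‖ ≤ N ^ (1 - σ) / (1 - σ) := by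
  have hp : 0 < 1 - σ := by linarith
  calc ‖charPoly χ N s‖ ≤ ∑ n ∈ Finset.Ico 1 (⌊N⌋₊ + 1), (n : ℝ) ^ (-σ) := by
        refine norm_sum_le_of_le _ fun n hn => ?_
        rw [Finset.mem_Ico] at hn
        rw [norm_mul, Complex.norm_natCast_cpow_of_pos (by omega), neg_re]
        refine (mul_le_of_le_one_left (by positivity) (norm_le_one _ _)).trans ?_
        exact Real.rpow_le_rpow_of_exponent_le (by exact_mod_cast hn.1) (by linarith)
    _ ≤ (⌊N⌋₊ : ℝ) ^ (1 - σ) / (1 - σ) := sum_rpow_neg_le h0 h1 _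
    _ ≤ _ := by gcongr; exact Nat.floor_le hN

theorem norm_charPoly_add_le (χ : DirichletCharacter ℂ q) {N σ S : ℝ} (hN : 1 ≤ N) (h0 : 0 < σ)
    (h1 : σ < 1) (hV : charV χ * S ≤ N) {s : ℂ} (hs : σ ≤ s.re) (hS : ‖s‖ ≤ S) :
    ‖charPoly χ N s + s * mellin (charErr χ N) (-s)‖ ≤ N ^ (1 - σ) / (σ * (1 - σ)) := by
  have hp : 0 < 1 - σ := by linarith
  have hN0 : 0 < N := by linarith
  have h2 : ‖s * mellin (charErr χ N) (-s)‖ ≤ N ^ (1 - σ) / σ := by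
    rw [norm_mul]
    have h3 := norm_mellin_charErr_le χ hN0 (s := s) (by linarith)
    have h4 : N ^ (-s.re) / s.re ≤ N ^ (-σ) / σ := by
      gcongr
    calc _ ≤ S * (charV χ * (N ^ (-σ) / σ)) := by
          have := charV_nonneg χ
          have := (norm_nonneg s).trans hS
          gcongr
          exact h3.trans (by gcongr)
      _ = (charV χ * S) * (N ^ (-σ) / σ) := by ring
      _ ≤ N * (N ^ (-σ) / σ) := by gcongr
      _ = _ := by rw [sub_eq_add_neg, Real.rpow_add hN0, Real.rpow_one]; ring
  refine (norm_add_le _ _).trans ((add_le_add (norm_charPoly_le χ hN0.le h0.le h1 hs) h2).trans ?_)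
  apply le_of_eq; field_simp; ring

theorem norm_charF_le_of_ne (χ : DirichletCharacter ℂ q) (h : χ ≠ 1) {N σ S : ℝ} (hN : 1 ≤ N)
    (h0 : 0 < σ) (h1 : σ < 1) (hV : charV χ * S ≤ N) {s : ℂ} (hs : σ ≤ s.re) (hS : ‖s‖ ≤ S) :
    ‖charF χ s‖ ≤ N ^ (1 - σ) / (σ * (1 - σ)) := by
  rw [charF_eq_of_ne χ h hN (by linarith)]
  exact norm_charPoly_add_le χ hN h0 h1 hV hs hS

theorem norm_charF_one_le {N σ S : ℝ} (hN : 1 ≤ N) (h0 : 0 < σ) (h1 : σ < 1)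
    (hV : charV (1 : DirichletCharacter ℂ q) * S ≤ N) {s : ℂ} (hs : σ ≤ s.re) (hS : ‖s‖ ≤ S) :
    ‖charF (1 : DirichletCharacter ℂ q) s‖ ≤
      ‖s - 1‖ * (N ^ (1 - σ) / (σ * (1 - σ))) + N ^ (1 - σ) := by
  rw [charF_one_eq hN (by linarith)]
  have hN0 : 0 < N := by linarith
  refine (norm_add_le _ _).trans (add_le_add ?_ ?_)
  · rw [norm_mul]
    gcongr
    exact norm_charPoly_add_le 1 hN h0 h1 hV hs hS
  · rw [norm_mul, Complex.norm_cpow_eq_rpow_re_of_pos hN0, Complex.norm_real,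
      Real.norm_of_nonneg (by positivity), sub_re, one_re]
    refine (mul_le_of_le_one_left (by positivity) totient_div_le_one).trans ?_
    exact Real.rpow_le_rpow_of_exponent_le hN (by linarith)

theorem tsum_one_div_rpow_le {σ : ℝ} (h : 1 < σ) :
    ∑' n : ℕ, 1 / (n + 1 : ℝ) ^ σ ≤ σ / (σ - 1) := by
  have h1 := ZetaAsymptotics.zeta_limit_aux1 h
  have h2 : 0 ≤ ZetaAsymptotics.termTSum σ := tsum_nonneg fun n => ZetaAsymptotics.term_nonneg _ _
  have h3 : 0 ≤ σ * ZetaAsymptotics.termTSum σ := by positivity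
  have h4 : σ / (σ - 1) = 1 + 1 / (σ - 1) := by
    have : σ - 1 ≠ 0 := by linarith
    field_simp; ring
  linarith

theorem norm_LSeries_le_of_norm_le_one {f : ℕ → ℂ} (hf : ∀ n, ‖f n‖ ≤ 1) {s : ℂ} (hs : 1 < s.re) :
    ‖LSeries f s‖ ≤ s.re / (s.re - 1) := by
  have hsum : Summable fun n : ℕ => 1 / (n + 1 : ℝ) ^ s.re := by
    have := (summable_nat_add_iff 1).2 (Real.summable_one_div_nat_rpow.2 hs)
    exact_mod_cast this
  rw [LSeries]
  have hS : Summable (LSeries.term f s) :=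
    LSeriesSummable_of_bounded_of_one_lt_re (fun n _ => hf n) hs
  rw [hS.tsum_eq_zero_add, LSeries.term_zero, zero_add]
  refine (tsum_of_norm_bounded hsum.hasSum fun n => ?_).trans (tsum_one_div_rpow_le hs)
  rw [LSeries.term_of_ne_zero (by omega), norm_div, Complex.norm_natCast_cpow_of_pos (by omega)]
  push_cast
  gcongr
  exact hf _

theorem le_norm_LFunction (χ : DirichletCharacter ℂ q) {s : ℂ} (hs : 1 < s.re) :
    (s.re - 1) / s.re ≤ ‖LFunction χ s‖ := by
  have h1 := LSeries.mul_mu_eq_one χ hs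
  rw [← LFunction_eq_LSeries χ hs] at h1
  have h2 := congrArg norm h1
  rw [norm_mul, norm_one] at h2
  have h3 := norm_LSeries_le_of_norm_le_one
    (f := (fun n : ℕ => χ (n : ZMod q)) * fun n : ℕ => ((ArithmeticFunction.moebius n : ℤ) : ℂ)) (fun n => by
      rw [Pi.mul_apply, norm_mul]
      refine mul_le_one₀ (norm_le_one _ _) (norm_nonneg _) ?_
      rw [Complex.norm_intCast]
      exact_mod_cast ArithmeticFunction.abs_moebius_le_one) hs
  have hr : 0 < s.re - 1 := by linarith
  have hr2 : 0 < s.re := by linarith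
  rw [le_div_iff₀ hr] at h3
  rw [div_le_iff₀ hr2]
  have h4 := norm_nonneg (LFunction χ s)
  nlinarith [mul_le_mul_of_nonneg_left h3 h4]

end EntireLFunction

section CosMean

open Complex Metric Set Filter Topology MeasureTheory DirichletCharacter

variable {q : ℕ} [NeZero q]

theorem neg_circleCosMean_eq {f : ℂ → ℂ} {s : ℂ} {r : ℝ} (hr : 0 < r) (hf : Continuous f)
    (hne : ∀ z ∈ sphere s r, f z ≠ 0) :
    IntervalIntegrable (fun θ => Real.cos θ * (Real.log ‖f (s + circleMap 0 r (Real.pi - θ))‖ -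
        Real.log ‖f (s + circleMap 0 r θ)‖)) volume (-(Real.pi / 2)) (Real.pi / 2) ∧
    -circleCosMean f s r = 1 / (Real.pi * r) * ∫ θ in (-(Real.pi / 2))..(Real.pi / 2),
      Real.cos θ * (Real.log ‖f (s + circleMap 0 r (Real.pi - θ))‖ -
        Real.log ‖f (s + circleMap 0 r θ)‖) := by
  have hs : ∀ θ, s + circleMap 0 r θ ∈ sphere s r := fun θ => by
    simp [abs_of_pos hr]
  have hc : Continuous fun θ => Real.log ‖f (s + circleMap 0 r θ)‖ := by
    refine Continuous.log (by fun_prop) fun θ => ?_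
    exact norm_ne_zero_iff.2 (hne _ (hs θ))
  have hc' : Continuous fun θ => Real.log ‖f (s + circleMap 0 r (Real.pi - θ))‖ :=
    hc.comp (continuous_const.sub continuous_id)
  set g : ℝ → ℝ := fun θ => Real.cos θ * Real.log ‖f (s + circleMap 0 r θ)‖ with hg
  have hgc : Continuous g := Real.continuous_cos.mul hc
  have hgc' : Continuous fun θ => g (Real.pi - θ) := hgc.comp (continuous_const.sub continuous_id)
  have hgp : Function.Periodic g (2 * Real.pi) := by
    intro θ
    simp only [hg]
    rw [Real.cos_add_two_pi, periodic_circleMap 0 r θ]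
  refine ⟨(Real.continuous_cos.mul (hc'.sub hc)).intervalIntegrable _ _, ?_⟩
  have h1 : (∫ θ in (0)..(2 * Real.pi), g θ) =
      ∫ θ in (-(Real.pi / 2))..(-(Real.pi / 2) + 2 * Real.pi), g θ := by
    have := hgp.intervalIntegral_add_eq 0 (-(Real.pi / 2))
    rwa [zero_add] at this
  have h2 : (∫ θ in (-(Real.pi / 2))..(Real.pi / 2), g (Real.pi - θ)) =
      ∫ θ in (Real.pi / 2)..(-(Real.pi / 2) + 2 * Real.pi), g θ := by
    rw [intervalIntegral.integral_comp_sub_left]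
    congr 1 <;> ring
  have h3 : circleCosMean f s r = 1 / (Real.pi * r) * ∫ θ in (0)..(2 * Real.pi), g θ := rfl
  rw [h3, h1, ← intervalIntegral.integral_add_adjacent_intervals
    (hgc.intervalIntegrable _ (Real.pi / 2)) (hgc.intervalIntegrable _ _), ← h2,
    ← intervalIntegral.integral_add (hgc.intervalIntegrable _ _)
      (hgc'.intervalIntegrable _ _), ← mul_neg,
    ← intervalIntegral.integral_neg]
  congr 1
  refine intervalIntegral.integral_congr fun θ _ => ?_
  simp only [hg, Real.cos_pi_sub]
  ring

theorem neg_log_one_sub_mul_le {r c : ℝ} (hr1 : r < 1) (hc : 0 ≤ c) (hc1 : c ≤ 1) :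
    -Real.log (1 - r * c) ≤ c * -Real.log (1 - r) := by
  have h := strictConcaveOn_log_Ioi.concaveOn.2 (x := 1) (y := 1 - r) (by simp)
    (by simp [hr1]) (sub_nonneg.2 hc1) hc (by ring)
  simp only [smul_eq_mul, Real.log_one, mul_zero, zero_add, mul_one] at h
  rw [show 1 - c + c * (1 - r) = 1 - r * c by ring] at h
  linarith

theorem log_le_div_add {x k : ℝ} (hx : 0 < x) (hk : 0 < k) :
    Real.log x ≤ x / k + Real.log k - 1 := by
  have := Real.log_le_sub_one_of_pos (div_pos hx hk)
  rw [Real.log_div hx.ne' hk.ne'] at this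
  linarith

theorem re_circleMap_zero (r θ : ℝ) : (circleMap 0 r θ).re = r * Real.cos θ := by
  simp [circleMap, Complex.exp_re]

theorem im_circleMap_zero (r θ : ℝ) : (circleMap 0 r θ).im = r * Real.sin θ := by
  simp [circleMap, Complex.exp_im]

theorem circleMap_pi_sub_re (r θ : ℝ) : (circleMap 0 r (Real.pi - θ)).re = -(r * Real.cos θ) := by
  rw [re_circleMap_zero]; simp

theorem circleMap_pi_sub_im (r θ : ℝ) : (circleMap 0 r (Real.pi - θ)).im = r * Real.sin θ := by
  rw [im_circleMap_zero]; simp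

/-- Ratio bound on mirror points of the circle. -/
theorem log_norm_charF_sub_le (χ : DirichletCharacter ℂ q) {r a t N θ : ℝ} (hr0 : 0 < r) (hr1 : r < 1)
    (ha : 0 < a) (har : a + r ≤ 1) (hN : 1 ≤ N) (hV : charV χ * (|t| + 2) ≤ N)
    (hc : 0 < Real.cos θ)
    (hne : charF χ (1 + a + t * I + circleMap 0 r (Real.pi - θ)) ≠ 0) :
    Real.log ‖charF χ (1 + a + t * I + circleMap 0 r (Real.pi - θ))‖ -
      Real.log ‖charF χ (1 + a + t * I + circleMap 0 r θ)‖ ≤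
    r * Real.cos θ * Real.log N + Real.log (1 / (r * Real.cos θ)) - Real.log (1 - r * Real.cos θ)
      + Real.log (1 + 1 / (r * Real.cos θ)) + (open Classical in if χ = 1 then Real.log 2 else 0) := by
  have hc1 := Real.cos_le_one θ
  set sL : ℂ := 1 + a + t * I + circleMap 0 r (Real.pi - θ) with hsL
  set sR : ℂ := 1 + a + t * I + circleMap 0 r θ with hsR
  have hLre : sL.re = 1 + a - r * Real.cos θ := by
    rw [hsL, add_re, circleMap_pi_sub_re]; simp; ring
  have hLim : sL.im = t + r * Real.sin θ := by
    rw [hsL, add_im, circleMap_pi_sub_im]; simp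
  have hRre : sR.re = 1 + a + r * Real.cos θ := by
    rw [hsR, add_re, re_circleMap_zero]; simp
  have hRim : sR.im = t + r * Real.sin θ := by
    rw [hsR, add_im, im_circleMap_zero]; simp
  set c := r * Real.cos θ with hcdef
  have hc0 : 0 < c := by positivity
  have hcr : c ≤ r := by rw [hcdef]; nlinarith
  have hcl : c < 1 := by linarith
  have hnL : ‖sL‖ ≤ |t| + 2 := by
    calc ‖sL‖ ≤ ‖(1 + a : ℝ) + (t : ℂ) * I‖ + ‖circleMap 0 r (Real.pi - θ)‖ := by
          rw [hsL]; push_cast; exact norm_add_le _ _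
      _ ≤ (‖((1 + a : ℝ) : ℂ)‖ + ‖(t : ℂ) * I‖) + r := by
          gcongr
          · exact norm_add_le _ _
          · simp [abs_of_pos hr0]
      _ ≤ _ := by
          rw [Complex.norm_real, norm_mul, Complex.norm_I, Complex.norm_real, mul_one,
            Real.norm_of_nonneg (by linarith), Real.norm_eq_abs]
          linarith
  have hN0 : 0 < N := by linarith
  have hσ : 1 - c ≤ sL.re := by rw [hLre]; linarith
  have hR1 : 1 < sR.re := by rw [hRre]; linarith
  have hLR := le_norm_LFunction χ hR1
  have hlow : c / (1 + c) ≤ ‖LFunction χ sR‖ := by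
    refine le_trans ?_ hLR
    rw [hRre, div_le_div_iff₀ (by linarith) (by linarith)]
    nlinarith
  have hlowp : 0 < c / (1 + c) := by positivity
  have hNc : 0 < N ^ c := by positivity
  -- the common logarithm computation
  have key : ∀ D : ℝ, 0 < D → ‖charF χ sL‖ / ‖charF χ sR‖ ≤
        D * (N ^ c * (1 / c) / (1 - c) * (1 + 1 / c)) → 0 < ‖charF χ sR‖ →
      Real.log ‖charF χ sL‖ - Real.log ‖charF χ sR‖ ≤ c * Real.log N + Real.log (1 / c) -
        Real.log (1 - c) + Real.log (1 + 1 / c) + Real.log D := by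
    intro D hD h hp
    have h1c : 0 < 1 - c := by linarith
    rw [← Real.log_div (norm_ne_zero_iff.2 hne) hp.ne']
    refine (Real.log_le_log (div_pos (norm_pos_iff.2 hne) hp) h).trans (le_of_eq ?_)
    rw [Real.log_mul hD.ne' (by positivity), Real.log_mul (by positivity) (by positivity),
      Real.log_div (by positivity) h1c.ne', Real.log_mul hNc.ne' (by positivity),
      Real.log_rpow hN0]
    ring
  have hc1' : 0 < 1 - c := by linarith
  by_cases h1 : χ = 1
  · rw [if_pos h1]
    subst h1
    have hR : sR ≠ 1 := by intro h; rw [h] at hR1; norm_num at hR1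
    have hRn : c ≤ ‖sR - 1‖ := by
      refine le_trans ?_ (Complex.re_le_norm _)
      rw [sub_re, hRre, one_re]; linarith
    have hRp : 0 < ‖sR - 1‖ := by linarith
    have hcmp : ‖sL - 1‖ ≤ ‖sR - 1‖ := by
      rw [← sq_le_sq₀ (norm_nonneg _) (norm_nonneg _), ← Complex.normSq_eq_norm_sq,
        ← Complex.normSq_eq_norm_sq, Complex.normSq_apply, Complex.normSq_apply, sub_re, sub_re,
        sub_im, sub_im, hLre, hLim, hRre, hRim, one_re, one_im]
      nlinarith
    have hFL := norm_charF_one_le (q := q) (σ := 1 - c) hN (by linarith) (by linarith) hV hσ hnL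
    have hFR : ‖sR - 1‖ * (c / (1 + c)) ≤ ‖charF (1 : DirichletCharacter ℂ q) sR‖ := by
      rw [charF_one_apply hR, norm_mul]; gcongr
    have hFRp : 0 < ‖charF (1 : DirichletCharacter ℂ q) sR‖ := lt_of_lt_of_le (by positivity) hFR
    refine key 2 two_pos ?_ hFRp
    rw [div_le_iff₀ hFRp]
    rw [sub_sub_cancel] at hFL
    calc _ ≤ _ := hFL
      _ ≤ ‖sR - 1‖ * (N ^ c / ((1 - c) * c)) + ‖sR - 1‖ * (N ^ c / ((1 - c) * c)) := by
          gcongr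
          rw [← mul_div_assoc, le_div_iff₀ (by positivity)]
          have h5 : (1 - c) * c ≤ ‖sR - 1‖ := by nlinarith
          rw [mul_comm ‖sR - 1‖]
          gcongr
      _ = 2 * (N ^ c * (1 / c) / (1 - c) * (1 + 1 / c)) * (‖sR - 1‖ * (c / (1 + c))) := by
          field_simp; ring
      _ ≤ _ := by gcongr
  · rw [if_neg h1, ← Real.log_one]
    rw [← charF_of_ne χ h1] at hlow
    have hFRp := hlowp.trans_le hlow
    refine key 1 one_pos ?_ hFRp
    rw [div_le_iff₀ hFRp, one_mul]
    have hFL := norm_charF_le_of_ne χ h1 (σ := 1 - c) hN (by linarith) (by linarith) hV hσ hnL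
    rw [sub_sub_cancel] at hFL
    calc _ ≤ _ := hFL
      _ = (N ^ c * (1 / c) / (1 - c) * (1 + 1 / c)) * (c / (1 + c)) := by
          field_simp; ring
      _ ≤ _ := by gcongr

theorem integral_cos_sq_half : ∫ θ in (-(Real.pi / 2))..(Real.pi / 2), Real.cos θ ^ 2 =
    Real.pi / 2 := by
  rw [integral_cos_sq]; simp

theorem integral_cos_half : ∫ θ in (-(Real.pi / 2))..(Real.pi / 2), Real.cos θ = 2 := by
  rw [integral_cos]; simp; norm_num

theorem log_const_bounds : Real.log 1.848 ≤ 0.6172 ∧ Real.log 2.848 ≤ 1.0478 ∧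
    -Real.log 0.149 ≤ 1.9065 := by
  have h2 := Real.log_two_lt_d9
  have he := Real.exp_one_gt_d9
  have he' := Real.exp_one_lt_d9
  refine ⟨?_, ?_, ?_⟩
  · rw [show (1.848 : ℝ) = 2 * 0.924 by norm_num, Real.log_mul (by norm_num) (by norm_num)]
    have := Real.log_le_sub_one_of_pos (show (0 : ℝ) < 0.924 by norm_num)
    linarith
  · have := log_le_div_add (show (0 : ℝ) < 2.848 by norm_num) (Real.exp_pos 1)
    rw [Real.log_exp] at this
    have h3 : (2.848 : ℝ) / Real.exp 1 ≤ 1.0478 := by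
      rw [div_le_iff₀ (Real.exp_pos 1)]; linarith
    linarith
  · rw [← Real.log_inv]
    have hle : Real.log (0.149)⁻¹ ≤ Real.log (2.5907 ^ 2) :=
      Real.log_le_log (by norm_num) (by norm_num)
    rw [Real.log_pow] at hle
    have := log_le_div_add (show (0 : ℝ) < 2.5907 by norm_num) (Real.exp_pos 1)
    rw [Real.log_exp] at this
    have h3 : (2.5907 : ℝ) / Real.exp 1 ≤ 0.95325 := by
      rw [div_le_iff₀ (Real.exp_pos 1)]; linarith
    push_cast at hle
    linarith

theorem neg_circleCosMean_charF_le (χ : DirichletCharacter ℂ q) {r a t N : ℝ} (hr : 0.85 ≤ r)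
    (hr' : r ≤ 0.851) (ha : 0 < a) (har : a ≤ 0.149) (hN : 1 ≤ N)
    (hV : charV χ * (|t| + 2) ≤ N)
    (hne : ∀ z ∈ sphere (1 + a + t * I : ℂ) r, charF χ z ≠ 0) :
    -circleCosMean (charF χ) (1 + a + t * I) r ≤
      Real.log N / 2 + 2.37 + (open Classical in if χ = 1 then 0.52 else 0) := by
  have hr0 : 0 < r := by linarith
  have hpi := Real.pi_gt_d6
  have hpi0 := Real.pi_pos
  obtain ⟨hi, he⟩ := neg_circleCosMean_eq hr0 (differentiable_charF χ).continuous hne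
  set D : ℝ := (open Classical in if χ = 1 then Real.log 2 else 0) with hD
  set ℓ := -Real.log (1 - r) with hℓ
  set B : ℝ := Real.log 1.848 + Real.log 2.848 - 2 + 1 / 2.848 + D with hB
  have hpt : ∀ θ ∈ Icc (-(Real.pi / 2)) (Real.pi / 2),
      Real.cos θ * (Real.log ‖charF χ (1 + a + t * I + circleMap 0 r (Real.pi - θ))‖ -
        Real.log ‖charF χ (1 + a + t * I + circleMap 0 r θ)‖) ≤
      (r * Real.log N + ℓ) * Real.cos θ ^ 2 + (B * Real.cos θ +
        (1 / (r * 1.848) + 1 / (r * 2.848))) := by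
    intro θ hθ
    have hc := Real.cos_nonneg_of_neg_pi_div_two_le_of_le hθ.1 hθ.2
    have hc1 := Real.cos_le_one θ
    rcases hc.eq_or_lt with h0 | h0
    · rw [← h0]; simp; positivity
    · have h1 := log_norm_charF_sub_le χ hr0 (by linarith) ha (by linarith) hN hV h0 (hne _ (by
        simp [abs_of_pos hr0]))
      have h2 := neg_log_one_sub_mul_le (r := r) (c := Real.cos θ) (by linarith) hc hc1
      have hrc : 0 < r * Real.cos θ := by positivity
      have h3 := log_le_div_add (x := 1 / (r * Real.cos θ)) (k := 1.848) (by positivity) (by norm_num)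
      have h4 := log_le_div_add (x := 1 + 1 / (r * Real.cos θ)) (k := 2.848) (by positivity)
        (by norm_num)
      calc _ ≤ Real.cos θ * (r * Real.cos θ * Real.log N +
            (1 / (r * Real.cos θ) / 1.848 + Real.log 1.848 - 1) + Real.cos θ * ℓ +
            ((1 + 1 / (r * Real.cos θ)) / 2.848 + Real.log 2.848 - 1) + D) := by
            refine mul_le_mul_of_nonneg_left (h1.trans ?_) hc
            linarith
        _ = _ := by rw [hB]; field_simp; ring
  have hinteg : ∫ θ in (-(Real.pi / 2))..(Real.pi / 2), ((r * Real.log N + ℓ) * Real.cos θ ^ 2 +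
      (B * Real.cos θ + (1 / (r * 1.848) + 1 / (r * 2.848)))) =
      (r * Real.log N + ℓ) * (Real.pi / 2) + (B * 2 + Real.pi * (1 / (r * 1.848) + 1 / (r * 2.848))) := by
    rw [intervalIntegral.integral_add, intervalIntegral.integral_add,
      intervalIntegral.integral_const_mul, intervalIntegral.integral_const_mul,
      integral_cos_sq_half, integral_cos_half, intervalIntegral.integral_const, smul_eq_mul]
    · ring
    all_goals exact Continuous.intervalIntegrable (by fun_prop) _ _
  rw [he]
  have hmono := intervalIntegral.integral_mono_on (by linarith) hi
    (Continuous.intervalIntegrable (by fun_prop) _ _) hpt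
  rw [hinteg] at hmono
  calc _ ≤ 1 / (Real.pi * r) * ((r * Real.log N + ℓ) * (Real.pi / 2) + (B * 2 +
        Real.pi * (1 / (r * 1.848) + 1 / (r * 2.848)))) := by gcongr
    _ = Real.log N / 2 + ℓ / (2 * r) + 2 * B / (Real.pi * r) +
        (1 / 1.848 + 1 / 2.848) / r ^ 2 := by field_simp; ring
    _ ≤ _ := by
        obtain ⟨b1, b2, b3⟩ := log_const_bounds
        have hl2 := Real.log_two_lt_d9
        have hℓ1 : ℓ ≤ 1.9065 := by
          have : Real.log 0.149 ≤ Real.log (1 - r) :=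
            Real.log_le_log (by norm_num) (by linarith)
          linarith
        have t1 : ℓ / (2 * r) ≤ 1.1215 := by
          rw [div_le_iff₀ (by positivity)]; linarith
        have t3 : (1 / 1.848 + 1 / 2.848) / r ^ 2 ≤ 1.236 := by
          rw [div_le_iff₀ (by positivity)]; nlinarith
        have hpr : 2.67 ≤ Real.pi * r := by nlinarith
        by_cases h1 : χ = 1
        · simp only [h1, if_true] at hD ⊢
          have t2 : 2 * B / (Real.pi * r) ≤ 0.5318 := by
            rw [div_le_iff₀ (by positivity)]
            have : B ≤ 0.7094 := by rw [hB, hD]; norm_num at *; linarith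
            linarith
          linarith
        · simp only [h1, if_false] at hD ⊢
          have t2 : 2 * B / (Real.pi * r) ≤ 0.0125 := by
            rw [div_le_iff₀ (by positivity)]
            have : B ≤ 0.0162 := by rw [hB, hD]; norm_num at *; linarith
            linarith
          linarith

end CosMean

section ZeroFree

open Complex Metric Set Filter Topology MeasureTheory DirichletCharacter

variable {q : ℕ} [NeZero q]

theorem exists_radius_sphere_ne_zero {f : ℂ → ℂ} (hf : Differentiable ℂ f) {s : ℂ} (hs : f s ≠ 0)
    {a b : ℝ} (hab : a < b) : ∃ r ∈ Icc a b, ∀ z ∈ sphere s r, f z ≠ 0 := by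
  have hfin := finite_zeros_closedBall hf ⟨s, hs⟩ (b + ‖s‖)
  have h2 : ((fun z => ‖z - s‖) '' {z | z ∈ closedBall 0 (b + ‖s‖) ∧ f z = 0}).Finite :=
    hfin.image _
  obtain ⟨r, hr, hr'⟩ := (Icc_infinite hab).exists_notMem_finite h2
  refine ⟨r, hr, fun z hz hfz => hr' ⟨z, ⟨?_, hfz⟩, ?_⟩⟩
  · rw [mem_closedBall_zero_iff]
    rw [mem_sphere_iff_norm] at hz
    calc ‖z‖ = ‖(z - s) + s‖ := by ring_nf
      _ ≤ ‖z - s‖ + ‖s‖ := norm_add_le _ _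
      _ ≤ _ := by rw [hz]; linarith [hr.2]
  · rwa [mem_sphere_iff_norm] at hz

/-- Contribution of a zero at horizontal distance `x` and square distance `d`. -/
noncomputable def zeroTerm (s ρ : ℂ) : ℝ := (s.re - ρ.re) * (1 / ‖ρ - s‖ ^ 2 - 1 / 0.7225)

theorem neg_re_logDeriv_charF_le (χ : DirichletCharacter ℂ q) {u t N : ℝ} (hu : 0 < u)
    (hu' : u ≤ 0.149) (hN : 1 ≤ N) (hV : charV χ * (|t| + 2) ≤ N) (Z : Finset ℂ) (m : ℂ → ℕ)
    (hZ : ∀ ρ ∈ Z, charF χ ρ = 0 ∧ (m ρ ≤ 1 ∨ (m ρ ≤ 2 ∧ deriv (charF χ) ρ = 0))) :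
    -(deriv (charF χ) (1 + u + t * I) / charF χ (1 + u + t * I)).re ≤
      Real.log N / 2 + 2.37 + (open Classical in if χ = 1 then 0.52 else 0) -
      ∑ ρ ∈ Z, m ρ * zeroTerm (1 + u + t * I) ρ := by
  have hsre : (1 + u + t * I : ℂ).re = 1 + u := by simp
  have hs0 : charF χ (1 + u + t * I) ≠ 0 :=
    charF_ne_zero_of_one_le_re χ (by rw [hsre]; linarith)
  have hlt : ∀ ρ, charF χ ρ = 0 → ρ.re < 1 := fun ρ h => by
    by_contra h1
    exact charF_ne_zero_of_one_le_re χ (not_lt.1 h1) h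
  obtain ⟨r, hr, hne⟩ := exists_radius_sphere_ne_zero (differentiable_charF χ) hs0
    (show (0.85 : ℝ) < 0.851 by norm_num)
  have hr0 : 0 < r := by linarith [hr.1]
  have hG := neg_circleCosMean_charF_le χ hr.1 hr.2 hu hu' hN hV hne
  have h := neg_re_logDeriv_le hr0 (differentiable_charF χ) hs0 hne
    (fun ρ _ hρ => by rw [hsre]; linarith [hlt ρ hρ]) hG
    (Z.filter fun ρ => ‖ρ - (1 + u + t * I)‖ < r) m (fun ρ hρ => by
      rw [Finset.mem_filter] at hρ
      exact ⟨hρ.2, hZ ρ hρ.1⟩)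
  refine h.trans (sub_le_sub_left ?_ _)
  rw [Finset.sum_filter]
  refine Finset.sum_le_sum fun ρ hρ => ?_
  have hx : ρ.re < 1 := hlt ρ (hZ ρ hρ).1
  have hne' : ρ - (1 + u + t * I) ≠ 0 := by
    intro h
    have := congrArg Complex.re h
    rw [sub_re, hsre, zero_re] at this
    linarith
  have hpos : 0 < ‖ρ - (1 + u + t * I)‖ := norm_pos_iff.2 hne'
  have hr2 : 0.7225 ≤ r ^ 2 := by nlinarith [hr.1]
  split_ifs with hc
  · rw [zeroPair_zero_re hr0 hne', zeroTerm, sub_re, hsre]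
    have : 1 / r ^ 2 ≤ 1 / 0.7225 := one_div_le_one_div_of_le (by norm_num) hr2
    have hy : (1 + u - ρ.re) * (1 / ‖ρ - (1 + u + t * I)‖ ^ 2 - 1 / 0.7225) ≤
        -(ρ.re - (1 + u)) * (1 / ‖ρ - (1 + u + t * I)‖ ^ 2 - 1 / r ^ 2) := by
      rw [neg_sub]
      apply mul_le_mul_of_nonneg_left _ (by linarith)
      linarith
    exact mul_le_mul_of_nonneg_left hy (by positivity)
  · apply mul_nonpos_of_nonneg_of_nonpos (by positivity)
    rw [zeroTerm, hsre]
    apply mul_nonpos_of_nonneg_of_nonpos (by linarith)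
    rw [sub_nonpos]
    refine one_div_le_one_div_of_le (by norm_num) ?_
    nlinarith [hr.1, not_lt.1 hc]

end ZeroFree

section VonMangoldtPositivity

open Complex Metric Set Filter Topology MeasureTheory DirichletCharacter

variable {q : ℕ} [NeZero q]

theorem zetaTerm_antitone {n : ℕ} (hn : 0 < n) {s t : ℝ} (hs : 0 < s) (hst : s ≤ t) :
    ZetaAsymptotics.term n t ≤ ZetaAsymptotics.term n s := by
  refine intervalIntegral.integral_mono_on (by linarith)
    (ZetaAsymptotics.term_welldef hn (hs.trans_le hst)) (ZetaAsymptotics.term_welldef hn hs) ?_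
  intro x hx
  have hx1 : (1 : ℝ) ≤ x := le_trans (by exact_mod_cast hn) hx.1
  have : 0 ≤ x - n := by linarith [hx.1]
  gcongr

theorem termTSum_antitone {s t : ℝ} (hs : 1 ≤ s) (hst : s ≤ t) :
    ZetaAsymptotics.termTSum t ≤ ZetaAsymptotics.termTSum s := by
  have hsum : ∀ s : ℝ, 1 ≤ s → Summable fun n : ℕ => ZetaAsymptotics.term (n + 1) s := fun s hs =>
    Summable.of_nonneg_of_le (fun n => ZetaAsymptotics.term_nonneg _ _)
      (fun n => zetaTerm_antitone (by omega) one_pos hs) ZetaAsymptotics.term_tsum_one.summable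
  exact Summable.tsum_le_tsum (fun n => zetaTerm_antitone (by omega) (by linarith) hst)
    (hsum t (hs.trans hst)) (hsum s hs)

theorem termTSum_le_half {s : ℝ} (hs : 1 ≤ s) : ZetaAsymptotics.termTSum s ≤ 1 / 2 := by
  have h1 := termTSum_antitone le_rfl hs
  have h2 : ZetaAsymptotics.termTSum 1 = 1 - Real.eulerMascheroniConstant :=
    ZetaAsymptotics.term_tsum_one.tsum_eq
  linarith [Real.one_half_lt_eulerMascheroniConstant]

theorem riemannZeta_ofReal_eq {σ : ℝ} (h : 1 < σ) : riemannZeta σ =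
    ((1 / (σ - 1) + 1 - σ * ZetaAsymptotics.termTSum σ : ℝ) : ℂ) := by
  have h1 := ZetaAsymptotics.zeta_limit_aux1 h
  rw [zeta_eq_tsum_one_div_nat_add_one_cpow (by simpa using h)]
  have h2 : (∑' n : ℕ, 1 / ((n : ℂ) + 1) ^ (σ : ℂ)) = ((∑' n : ℕ, 1 / (n + 1 : ℝ) ^ σ : ℝ) : ℂ) := by
    rw [Complex.ofReal_tsum]
    congr 1; ext n
    push_cast
    rw [Complex.ofReal_cpow (by positivity)]
    push_cast; rfl
  rw [h2]; congr 1; linarith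

theorem re_LSeries_vonMangoldt_le {σ : ℝ} (h : 1 < σ) (h' : σ < 1.5) :
    (LSeries (fun n => (ArithmeticFunction.vonMangoldt n : ℂ)) σ).re ≤ 1 / (σ - 1) := by
  have hd : HasDerivAt (fun x : ℝ => (riemannZeta x).re) (deriv riemannZeta σ).re σ := by
    have : DifferentiableAt ℂ riemannZeta (σ : ℂ) :=
      differentiableAt_riemannZeta (by exact_mod_cast h.ne')
    exact this.hasDerivAt.real_of_complex
  have hd2 : HasDerivAt (fun x : ℝ => (x - 1) * (riemannZeta x).re)
      (1 * (riemannZeta σ).re + (σ - 1) * (deriv riemannZeta σ).re) σ :=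
    ((hasDerivAt_id σ).sub_const 1).mul hd
  have hval : ∀ x : ℝ, 1 < x → (x - 1) * (riemannZeta x).re =
      1 + (x - 1) * (1 - x * ZetaAsymptotics.termTSum x) := by
    intro x hx
    rw [riemannZeta_ofReal_eq hx, ofReal_re]
    have : x - 1 ≠ 0 := by linarith
    field_simp; ring
  have hmono : MonotoneOn (fun x : ℝ => (x - 1) * (riemannZeta x).re) (Ioo 1 1.5) := by
    intro x hx y hy hxy
    simp only
    rw [hval x hx.1, hval y hy.1]
    have h1 := termTSum_antitone hx.1.le hxy
    have h2 := termTSum_le_half hx.1.le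
    have h3 : (y - 1) * y * ZetaAsymptotics.termTSum y ≤ (y - 1) * y * ZetaAsymptotics.termTSum x :=
      mul_le_mul_of_nonneg_left h1 (by nlinarith [hy.1])
    have h4 : 0 ≤ (y - x) * (1 - ZetaAsymptotics.termTSum x * (x + y - 1)) := by
      refine mul_nonneg (by linarith) ?_
      have := hx.1; have := hx.2; have := hy.1; have := hy.2
      nlinarith
    nlinarith
  have hnn := hd2.hasDerivWithinAt.derivWithin ((isOpen_Ioo.uniqueDiffWithinAt ⟨h, h'⟩)) ▸
    hmono.derivWithin_nonneg (x := σ)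
  have hz : riemannZeta σ = (((riemannZeta σ).re : ℝ) : ℂ) := by
    rw [riemannZeta_ofReal_eq h, ofReal_re]
  have hpos : 0 < (riemannZeta σ).re := by
    rw [riemannZeta_ofReal_eq h, ofReal_re]
    have := termTSum_le_half h.le
    have : 0 < 1 / (σ - 1) := by rw [one_div_pos]; linarith
    nlinarith
  rw [ArithmeticFunction.LSeries_vonMangoldt_eq_deriv_riemannZeta_div (by simpa using h), hz,
    Complex.div_ofReal_re, neg_re, div_le_div_iff₀ hpos (by linarith)]
  linarith

/-- `-L'/L` as a Dirichlet series. -/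
noncomputable def vonMangoldtSeries (χ : DirichletCharacter ℂ q) (s : ℂ) : ℂ :=
  LSeries ((fun n : ℕ => χ n) * fun n => (ArithmeticFunction.vonMangoldt n : ℂ)) s

theorem logDeriv_charF (χ : DirichletCharacter ℂ q) {s : ℂ} (hs : 1 < s.re) :
    deriv (charF χ) s / charF χ s = -vonMangoldtSeries χ s +
      (open Classical in if χ = 1 then 1 / (s - 1) else 0) := by
  have hs1 : s ≠ 1 := by rintro rfl; norm_num at hs
  rw [vonMangoldtSeries, LSeries_twist_vonMangoldt_eq χ hs, ← deriv_LFunction_eq_deriv_LSeries χ hs,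
    ← LFunction_eq_LSeries χ hs]
  by_cases h : χ = 1
  · subst h
    have h1 : charF (1 : DirichletCharacter ℂ q) = LFunctionTrivChar₁ q := if_pos rfl
    have h2 : LFunction (1 : DirichletCharacter ℂ q) s ≠ 0 :=
      LFunction_ne_zero_of_one_le_re 1 (Or.inr hs1) hs.le
    have h3 : s - 1 ≠ 0 := sub_ne_zero.2 hs1
    rw [charF_one_apply hs1, h1, deriv_LFunctionTrivChar₁_apply_of_ne_one q hs1, if_pos rfl]
    simp only [LFunctionTrivChar]
    field_simp
  · rw [charF_of_ne χ h, if_neg h]; ring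

theorem sum_re_vonMangoldtSeries_nonneg {ι : Type*} (S : Finset ι) (c : ι → ℝ)
    (ψ : ι → DirichletCharacter ℂ q) (t : ι → ℝ) (c₀ : ℝ) {σ : ℝ} (hσ : 1 < σ)
    (h : ∀ n : ℕ, n ≠ 0 → 0 ≤ c₀ + ∑ i ∈ S, c i * (ψ i n * (n : ℂ) ^ (-(t i * I))).re) :
    0 ≤ c₀ * (LSeries (fun n => (ArithmeticFunction.vonMangoldt n : ℂ)) σ).re +
      ∑ i ∈ S, c i * (vonMangoldtSeries (ψ i) (σ + t i * I)).re := by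
  have h0 := (ArithmeticFunction.LSeriesSummable_vonMangoldt (s := σ) (by simpa using hσ)).LSeriesHasSum
  have hi : ∀ i, LSeriesHasSum ((fun n : ℕ => ψ i n) *
      fun n => (ArithmeticFunction.vonMangoldt n : ℂ)) (σ + t i * I)
      (vonMangoldtSeries (ψ i) (σ + t i * I)) := fun i =>
    (LSeriesSummable_twist_vonMangoldt (ψ i) (s := σ + t i * I) (by simpa using hσ)).LSeriesHasSum
  have hs := ((Complex.hasSum_re h0).mul_left c₀).add
    (hasSum_sum fun i (_ : i ∈ S) => (Complex.hasSum_re (hi i)).mul_left (c i))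
  refine hs.nonneg fun n => ?_
  rcases eq_or_ne n 0 with rfl | hn
  · simp
  have hn0 : (n : ℂ) ≠ 0 := by exact_mod_cast hn
  have e0 : (LSeries.term (fun n => (ArithmeticFunction.vonMangoldt n : ℂ)) σ n).re =
      ArithmeticFunction.vonMangoldt n * (n : ℝ) ^ (-σ) := by
    rw [LSeries.term_of_ne_zero hn, div_eq_mul_inv, ← Complex.cpow_neg, ← ofReal_neg,
      ← ofReal_natCast, ← Complex.ofReal_cpow (by positivity), ← ofReal_mul, ofReal_re]
  have ei : ∀ i, (LSeries.term ((fun n : ℕ => ψ i n) *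
      fun n => (ArithmeticFunction.vonMangoldt n : ℂ)) (σ + t i * I) n).re =
      ArithmeticFunction.vonMangoldt n * (n : ℝ) ^ (-σ) *
        (ψ i n * (n : ℂ) ^ (-(t i * I))).re := by
    intro i
    rw [← Complex.re_ofReal_mul]
    congr 1
    rw [LSeries.term_of_ne_zero hn, div_eq_mul_inv, ← Complex.cpow_neg, neg_add,
      Complex.cpow_add _ _ hn0, Pi.mul_apply, ofReal_mul, Complex.ofReal_cpow (by positivity)]
    push_cast; ring
  rw [e0]
  simp_rw [ei]
  have hΛ : 0 ≤ (ArithmeticFunction.vonMangoldt n : ℝ) * (n : ℝ) ^ (-σ) :=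
    mul_nonneg ArithmeticFunction.vonMangoldt_nonneg (by positivity)
  calc 0 ≤ _ := mul_nonneg hΛ (h n hn)
    _ = _ := by
        rw [mul_add, Finset.mul_sum]
        congr 1
        · ring
        · exact Finset.sum_congr rfl fun i _ => by ring

theorem trig_poly_nonneg {z : ℂ} (hz : z = 0 ∨ ‖z‖ = 1) :
    0 ≤ 11.5032 + (19.584 * z.re + (11.92 * (z ^ 2).re + (4.8 * (z ^ 3).re + 1 * (z ^ 4).re))) := by
  rcases hz with rfl | hz
  · simp; norm_num
  · have h : z.re ^ 2 + z.im ^ 2 = 1 := by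
      have := Complex.normSq_eq_norm_sq z
      rw [hz, Complex.normSq_apply] at this
      nlinarith
    have h2 : (z ^ 2).re = 2 * z.re ^ 2 - 1 := by
      rw [pow_two, mul_re]; linear_combination -h
    have h2i : (z ^ 2).im = 2 * z.re * z.im := by rw [pow_two, mul_im]; ring
    have h3 : (z ^ 3).re = 4 * z.re ^ 3 - 3 * z.re := by
      rw [pow_succ, mul_re, h2, h2i]; linear_combination -2 * z.re * h
    have h4 : (z ^ 4).re = 8 * z.re ^ 4 - 8 * z.re ^ 2 + 1 := by
      rw [show z ^ 4 = z ^ 2 * z ^ 2 by ring, mul_re, h2, h2i]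
      linear_combination -4 * z.re ^ 2 * h
    rw [h2, h3, h4]
    nlinarith [sq_nonneg ((0.9 + z.re) * (0.3 + z.re))]

theorem quartic_vonMangoldtSeries_nonneg (χ : DirichletCharacter ℂ q) {σ : ℝ} (hσ : 1 < σ) (γ : ℝ) :
    0 ≤ 11.5032 * (LSeries (fun n => (ArithmeticFunction.vonMangoldt n : ℂ)) σ).re +
      (19.584 * (vonMangoldtSeries χ (σ + γ * I)).re +
      (11.92 * (vonMangoldtSeries (χ ^ 2) (σ + (2 * γ : ℝ) * I)).re +
      (4.8 * (vonMangoldtSeries (χ ^ 3) (σ + (3 * γ : ℝ) * I)).re +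
      1 * (vonMangoldtSeries (χ ^ 4) (σ + (4 * γ : ℝ) * I)).re))) := by
  have h := sum_re_vonMangoldtSeries_nonneg (Finset.univ : Finset (Fin 4)) ![19.584, 11.92, 4.8, 1]
    ![χ, χ ^ 2, χ ^ 3, χ ^ 4] ![γ, 2 * γ, 3 * γ, 4 * γ] 11.5032 hσ (by
    intro n hn
    have hn0 : (n : ℂ) ≠ 0 := by exact_mod_cast hn
    have hz : (χ n * (n : ℂ) ^ (-(γ * I)) = 0) ∨ ‖χ n * (n : ℂ) ^ (-(γ * I))‖ = 1 := by
      by_cases hu : IsUnit (n : ZMod q)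
      · right
        rw [norm_mul, ← hu.unit_spec, DirichletCharacter.unit_norm_eq_one,
          Complex.norm_natCast_cpow_of_pos (Nat.pos_of_ne_zero hn)]
        simp
      · left; rw [MulChar.map_nonunit _ hu, zero_mul]
    have hk : ∀ k : ℕ, k ≠ 0 → (χ ^ k) n * (n : ℂ) ^ (-((k * γ : ℝ) * I)) =
        (χ n * (n : ℂ) ^ (-(γ * I))) ^ k := by
      intro k hk
      rw [mul_pow, MulChar.pow_apply' _ hk, ← Complex.cpow_nat_mul]
      congr 2; push_cast; ring
    have := trig_poly_nonneg hz
    rw [← hk 2 (by norm_num), ← hk 3 (by norm_num), ← hk 4 (by norm_num)] at this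
    simp [Fin.sum_univ_four] at this ⊢
    linarith)
  simp [Fin.sum_univ_four] at h ⊢
  linarith

end VonMangoldtPositivity

section PoleContribution

open Complex Metric Set Filter Topology MeasureTheory DirichletCharacter ComplexConjugate

variable {q : ℕ} [NeZero q]

theorem charF_conj (χ : DirichletCharacter ℂ q) {s : ℂ} (hs : 0 < s.re) :
    charF χ⁻¹ (conj s) = conj (charF χ s) := by
  have h : ∀ s : ℂ, 0 < s.re → charF χ⁻¹ s = conj (charF χ (conj s)) := by
    intro s hs
    refine eqOn_zero_lt_re_of_eqOn_one_lt_re (f := charF χ⁻¹)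
      (g := fun s => conj (charF χ (conj s))) (differentiable_charF _).differentiableOn ?_ ?_ hs
    · intro s _
      exact (differentiableAt_conj_conj_iff.2
        (differentiable_charF χ (conj s))).differentiableWithinAt
    · intro s hs
      have hL : LFunction χ⁻¹ s = conj (LFunction χ (conj s)) := by
        rw [LFunction_eq_LSeries _ hs, LFunction_eq_LSeries _ (by simpa using hs), LSeries, LSeries,
          Complex.conj_tsum]
        congr 1; ext n
        rcases eq_or_ne n 0 with rfl | hn
        · simp
        rw [LSeries.term_of_ne_zero hn, LSeries.term_of_ne_zero hn, map_div₀,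
          ← MulChar.star_apply', Complex.cpow_conj _ _ (by
            rw [Complex.natCast_arg]; exact Real.pi_ne_zero.symm), Complex.conj_conj,
          Complex.conj_natCast]
        rfl
      by_cases h1 : χ = 1
      · subst h1
        have hs1 : s ≠ 1 := by rintro rfl; norm_num at hs
        have hs2 : conj s ≠ 1 := by
          intro h; apply hs1; rw [← Complex.conj_conj s, h, map_one]
        rw [inv_one] at hL ⊢
        rw [charF_one_apply hs1, charF_one_apply hs2, hL, map_mul, map_sub, Complex.conj_conj, map_one]
      · rw [charF_of_ne χ h1, charF_of_ne _ (by simpa using h1), hL]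
  rw [h _ (by simpa using hs), Complex.conj_conj]

theorem re_one_div_pole {u t : ℝ} : (1 / ((1 + u + t * I : ℂ) - 1)).re = u / (u ^ 2 + t ^ 2) := by
  rw [one_div, Complex.inv_re, Complex.normSq_apply]
  simp
  ring_nf

/-- The conductor term in the zero-free region. -/
noncomputable def condLog (q : ℕ) (T : ℝ) : ℝ := Real.log (q.totient / 2 * (T + 2)) / 2

theorem re_vonMangoldtSeries_le (χ : DirichletCharacter ℂ q) (hφ : 200 ≤ q.totient) {u γ T : ℝ}
    (hu : 0 < u) (hu' : u ≤ 0.149) {k : ℕ} (hk : 1 ≤ k) (hγ : |γ| ≤ T) (Z : Finset ℂ) (m : ℂ → ℕ)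
    (hZ : ∀ ρ ∈ Z, charF χ ρ = 0 ∧ (m ρ ≤ 1 ∨ (m ρ ≤ 2 ∧ deriv (charF χ) ρ = 0))) :
    (vonMangoldtSeries χ ((1 + u : ℝ) + (k * γ : ℝ) * I)).re ≤ condLog q T + Real.log k / 2 + 2.37 +
      (open Classical in if χ = 1 then 0.87 + u / (u ^ 2 + (k * γ) ^ 2) else 0) -
      ∑ ρ ∈ Z, m ρ * zeroTerm ((1 + u : ℝ) + (k * γ : ℝ) * I) ρ := by
  have hk0 : (1 : ℝ) ≤ k := by exact_mod_cast hk
  have hφ' : (200 : ℝ) ≤ q.totient := by exact_mod_cast hφ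
  have hT : 0 ≤ T := (abs_nonneg _).trans hγ
  have hs : 1 < ((1 + u : ℝ) + (k * γ : ℝ) * I : ℂ).re := by simp; linarith
  have hS : |(k * γ : ℝ)| + 2 ≤ k * (T + 2) := by
    rw [abs_mul, abs_of_nonneg (by linarith : (0 : ℝ) ≤ k)]; nlinarith
  have hD := congrArg Complex.re (logDeriv_charF χ hs)
  rw [add_re, neg_re] at hD
  have hNpos : 0 < (q.totient : ℝ) / 2 * (T + 2) := by positivity
  by_cases h1 : χ = 1
  · have hV : charV χ = q.totient + 1 := by rw [charV, if_pos h1]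
    have hb := neg_re_logDeriv_charF_le χ (t := (k * γ : ℝ)) (N := (q.totient + 1) * (k * (T + 2)))
      hu hu' (by nlinarith) (by rw [hV]; gcongr) Z m hZ
    rw [if_pos h1] at hb hD ⊢
    have hl : Real.log ((q.totient + 1) * (k * (T + 2))) / 2 ≤
        condLog q T + Real.log k / 2 + 0.35 := by
      have e : ((q.totient : ℝ) + 1) * (k * (T + 2)) =
          (q.totient / 2 * (T + 2)) * k * (2 * (1 + 1 / q.totient)) := by
        field_simp
      rw [e, condLog]
      generalize (q.totient : ℝ) / 2 * (T + 2) = A at hNpos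
      rw [Real.log_mul (by positivity) (by positivity), Real.log_mul (by positivity) (by positivity),
        Real.log_mul (by positivity) (by positivity)]
      have h2 := Real.log_two_lt_d9
      have h3 := Real.log_le_sub_one_of_pos (show (0 : ℝ) < 1 + 1 / q.totient by positivity)
      have h4 : 1 / (q.totient : ℝ) ≤ 1 / 200 := one_div_le_one_div_of_le (by norm_num) hφ'
      linarith
    have hp := re_one_div_pole (u := u) (t := (k * γ : ℝ))
    push_cast at hb hD hp ⊢
    rw [hp] at hD
    linarith
  · have hV : charV χ = q.totient / 2 := by rw [charV, if_neg h1]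
    have hb := neg_re_logDeriv_charF_le χ (t := (k * γ : ℝ)) (N := q.totient / 2 * (k * (T + 2)))
      hu hu' (by nlinarith) (by rw [hV]; gcongr) Z m hZ
    rw [if_neg h1] at hb hD ⊢
    have hl : Real.log (q.totient / 2 * (k * (T + 2))) / 2 = condLog q T + Real.log k / 2 := by
      have e : ((q.totient : ℝ) / 2) * (k * (T + 2)) = (q.totient / 2 * (T + 2)) * k := by ring
      rw [e, Real.log_mul (by positivity) (by positivity), condLog]
      ring
    rw [zero_re] at hD
    push_cast at hb hD ⊢
    linarith

theorem zeroTerm_conj {u η γ : ℝ} {ρ : ℂ} (hre : ρ.re = 1 - η) (him : ρ.im = γ) (j : ℝ) :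
    zeroTerm ((1 + u : ℝ) + (j * γ : ℝ) * I) (conj ρ) =
      (u + η) * (1 / ((u + η) ^ 2 + ((j + 1) * γ) ^ 2) - 1 / 0.7225) := by
  rw [zeroTerm, ← Complex.normSq_eq_norm_sq, Complex.normSq_apply]
  simp [hre, him]
  ring_nf
  simp

theorem zeroTerm_self {u η γ : ℝ} (hv : u + η ≠ 0) {ρ : ℂ} (hre : ρ.re = 1 - η) (him : ρ.im = γ) :
    zeroTerm ((1 + u : ℝ) + ((1 : ℕ) * γ : ℝ) * I) ρ = 1 / (u + η) - (u + η) / 0.7225 := by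
  have h : ‖ρ - ((1 + u : ℝ) + ((1 : ℕ) * γ : ℝ) * I)‖ ^ 2 = (u + η) ^ 2 := by
    rw [← Complex.normSq_eq_norm_sq, Complex.normSq_apply]
    simp [hre, him]
    ring
  have h' : ((1 + u : ℝ) + ((1 : ℕ) * γ : ℝ) * I : ℂ).re - ρ.re = u + η := by
    simp [hre]
  rw [zeroTerm, h, h']
  field_simp

theorem pole_le_zeroTerm {u v z c d : ℝ} (hu : 0 < u) (huv : u ≤ v) (hc : 0 ≤ c)
    (hcd : c * v ≤ d * u) :
    c * (u / (u ^ 2 + z ^ 2)) ≤ d * (v * (1 / (v ^ 2 + z ^ 2) - 1 / 0.7225)) + d * v / 0.7225 := by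
  have hv : 0 < v := by linarith
  have h1 : d * (v * (1 / (v ^ 2 + z ^ 2) - 1 / 0.7225)) + d * v / 0.7225 =
      d * v / (v ^ 2 + z ^ 2) := by ring
  rw [h1, ← mul_div_assoc, div_le_div_iff₀ (by positivity) (by positivity)]
  have hdu : 0 ≤ d * u := le_trans (by positivity) hcd
  have hd : 0 ≤ d := nonneg_of_mul_nonneg_left hdu hu
  have h4 : c * u * v ^ 2 ≤ d * v * u ^ 2 := by
    have := mul_le_mul_of_nonneg_right hcd (mul_pos hu hv).le
    linarith
  have h5 : c * u ≤ d * v :=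
    calc c * u ≤ c * v := by gcongr
      _ ≤ d * u := hcd
      _ ≤ d * v := by gcongr
  have h6 := mul_le_mul_of_nonneg_right h5 (sq_nonneg z)
  linarith

end PoleContribution

section ZeroFreeRegion

open DirichletCharacter Complex Filter Topology Set MeasureTheory ComplexConjugate

variable {q : ℕ} [NeZero q]

theorem zero_free_arith {a V1 V2 V3 V4 z1 z2 z3 z4 C η : ℝ} (hη : 0 < η)
    (h0 : 0 ≤ 11.5032 * a + (19.584 * V1 + (11.92 * V2 + (4.8 * V3 + 1 * V4))))
    (ha : a ≤ 1 / (3.28 * η))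
    (h1 : V1 ≤ C + 2.37 + z1 - (1 / (4.28 * η) - 4.28 * η / 0.7225))
    (h2 : V2 ≤ C + Real.log 2 / 2 + 2.37 + z2) (h3 : V3 ≤ C + Real.log 3 / 2 + 2.37 + z3)
    (h4 : V4 ≤ C + Real.log 4 / 2 + 2.37 + z4)
    (hz : 19.584 * z1 + (11.92 * z2 + (4.8 * z3 + z4)) ≤ 33.2)
    (hH : 12 ≤ C + 3.47) (hnear : η * (C + 3.47) < 0.0286) : False := by
  have hη' : η < 0.0024 := by nlinarith
  have l2 := Real.log_two_lt_d9
  have l4 : Real.log 4 = 2 * Real.log 2 := by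
    rw [show (4 : ℝ) = 2 ^ 2 by norm_num, Real.log_pow]; norm_num
  have l3 : Real.log 3 ≤ 1.0987 := by
    rw [Real.log_le_iff_le_exp (by norm_num), show (1.0987 : ℝ) = 1 + 0.0987 by norm_num, Real.exp_add]
    have e1 := Real.exp_one_gt_d9
    have e2 := Real.quadratic_le_exp_of_nonneg (show (0 : ℝ) ≤ 0.0987 by norm_num)
    have e3 := Real.sum_le_exp_of_nonneg (show (0 : ℝ) ≤ 0.0987 by norm_num) 4
    norm_num [Finset.sum_range_succ, Nat.factorial] at e3
    nlinarith
  have e1 : 1 / (3.28 * η) = (1 / 3.28) * (1 / η) := by field_simp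
  have e2 : 1 / (4.28 * η) = (1 / 4.28) * (1 / η) := by field_simp
  rw [e1] at ha
  rw [e2] at h1
  have hinv : C + 3.47 < 0.0286 * (1 / η) := by
    rw [mul_one_div, lt_div_iff₀ hη]; linarith
  generalize 1 / η = w at *
  norm_num at *
  nlinarith

theorem zeroTerm_conj_natCast {η γ : ℝ} {ρ : ℂ} (hre : ρ.re = 1 - η) (him : ρ.im = γ) (k : ℕ) :
    zeroTerm ((1 + 3.28 * η : ℝ) + (k * γ : ℝ) * I) (conj ρ) =
      (4.28 * η) * (1 / ((4.28 * η) ^ 2 + ((k + 1) * γ) ^ 2) - 1 / 0.7225) := by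
  have h := zeroTerm_conj (u := 3.28 * η) hre him (k : ℝ)
  rw [h, show 3.28 * η + η = 4.28 * η by ring]

set_option maxHeartbeats 1000000 in
theorem zero_free (χ : DirichletCharacter ℂ q) (hφ : 200 ≤ q.totient) {T : ℝ} {ρ : ℂ}
    (hT : |ρ.im| ≤ T) (hρ : charF χ ρ = 0) (hH : 12 ≤ condLog q T + 3.47)
    (hnear : (1 - ρ.re) * (condLog q T + 3.47) < 0.0286) :
    (χ ≠ 1 ∧ χ ^ 2 = 1 ∧ ρ.im = 0 ∧ deriv (charF χ) ρ ≠ 0) ∨ (χ = 1 ∧ |ρ.im| < 0.9) := by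
  by_contra hcon
  push Not at hcon
  obtain ⟨hc1, hc2⟩ := hcon
  set γ := ρ.im with hγ
  obtain ⟨η, hη⟩ : ∃ η, η = 1 - ρ.re := ⟨_, rfl⟩
  have hre : ρ.re = 1 - η := by linarith
  rw [← hη] at hnear
  have hη0 : 0 < η := by
    by_contra h
    exact charF_ne_zero_of_one_le_re χ (by linarith) hρ
  have hη' : η < 0.0024 := by nlinarith
  have hu : 0 < 3.28 * η := by positivity
  have hu' : 3.28 * η ≤ 0.149 := by linarith
  have hself : zeroTerm ((1 + 3.28 * η : ℝ) + ((1 : ℕ) * γ : ℝ) * I) ρ =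
      1 / (4.28 * η) - 4.28 * η / 0.7225 := by
    rw [zeroTerm_self (u := 3.28 * η) (by positivity) hre hγ.symm,
      show 3.28 * η + η = 4.28 * η by ring]
  have hconjz : ∀ k, χ ^ (k + 1) = 1 → charF (χ ^ k) (conj ρ) = 0 := by
    intro k hk
    have : χ ^ k = χ⁻¹ := eq_inv_of_mul_eq_one_left (by rw [← pow_succ]; exact hk)
    rw [this, charF_conj χ (by linarith), hρ, map_zero]
  have hq4 := quartic_vonMangoldtSeries_nonneg χ (σ := 1 + 3.28 * η) (by linarith) γ
  have hΛ := re_LSeries_vonMangoldt_le (σ := 1 + 3.28 * η) (by linarith) (by linarith)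
  rw [add_sub_cancel_left] at hΛ
  set S : ℕ → ℝ := fun k =>
    (vonMangoldtSeries (χ ^ k) ((1 + 3.28 * η : ℝ) + (k * γ : ℝ) * I)).re with hS
  set P : ℕ → ℝ := fun k => 0.87 + 3.28 * η / ((3.28 * η) ^ 2 + (k * γ) ^ 2) with hP
  set Q : ℕ → ℝ := fun k =>
    (4.28 * η) * (1 / ((4.28 * η) ^ 2 + ((k + 1 : ℕ) * γ) ^ 2) - 1 / 0.7225) with hQ
  have hQe : ∀ k : ℕ, zeroTerm ((1 + 3.28 * η : ℝ) + (k * γ : ℝ) * I) (conj ρ) = Q k := by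
    intro k
    rw [zeroTerm_conj_natCast hre hγ.symm, hQ]
    push_cast
    rfl
  have hQ0 : ∀ k, -0.0143 ≤ Q k := by
    intro k
    have : 0 ≤ 1 / ((4.28 * η) ^ 2 + ((k + 1 : ℕ) * γ) ^ 2) := by positivity
    simp only [hQ]
    nlinarith [mul_nonneg (show 0 ≤ 4.28 * η by positivity) this]
  have hpole : ∀ (c d : ℝ) (k : ℕ), 0 ≤ c → c * 4.28 ≤ d * 3.28 → d ≤ 20 →
      c * P (k + 1) - d * Q k ≤ 0.87 * c + 0.3 := by
    intro c d k hc hcd hd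
    have h := pole_le_zeroTerm (z := (k + 1 : ℕ) * γ) (c := c) (d := d) (v := 4.28 * η) hu
      (by linarith) hc (by nlinarith)
    have h' : d * (4.28 * η) / 0.7225 ≤ 0.3 := by
      rw [div_le_iff₀ (by norm_num)]; nlinarith
    simp only [hP, hQ]
    nlinarith
  have key : ∀ z1 z2 z3 z4 : ℝ, S 1 ≤ condLog q T + 2.37 + z1 - (1 / (4.28 * η) - 4.28 * η / 0.7225) →
      S 2 ≤ condLog q T + Real.log 2 / 2 + 2.37 + z2 →
      S 3 ≤ condLog q T + Real.log 3 / 2 + 2.37 + z3 →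
      S 4 ≤ condLog q T + Real.log 4 / 2 + 2.37 + z4 →
      19.584 * z1 + (11.92 * z2 + (4.8 * z3 + z4)) ≤ 33.2 → False := by
    intro z1 z2 z3 z4 h1 h2 h3 h4 hz
    refine zero_free_arith hη0 ?_ hΛ h1 h2 h3 h4 hz hH hnear
    simpa [hS] using hq4
  clear hq4 hΛ
  have B : ∀ k : ℕ, 1 ≤ k → ∀ Z : Finset ℂ, ∀ m : ℂ → ℕ, (∀ ρ ∈ Z, charF (χ ^ k) ρ = 0 ∧
      (m ρ ≤ 1 ∨ (m ρ ≤ 2 ∧ deriv (charF (χ ^ k)) ρ = 0))) → S k ≤ condLog q T + Real.log k / 2 + 2.37 +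
      (open Classical in if χ ^ k = 1 then P k else 0) -
      ∑ ρ ∈ Z, m ρ * zeroTerm ((1 + 3.28 * η : ℝ) + (k * γ : ℝ) * I) ρ :=
    fun k hk Z m hZ => re_vonMangoldtSeries_le (χ ^ k) hφ hu hu' hk hT Z m hZ
  have Bempty : ∀ k : ℕ, 1 ≤ k → S k ≤ condLog q T + Real.log k / 2 + 2.37 +
      (open Classical in if χ ^ k = 1 then P k else 0) := by
    intro k hk
    simpa using B k hk ∅ 0 (by simp)
  have Bconj : ∀ k : ℕ, 1 ≤ k → χ ^ (k + 1) = 1 → S k ≤ condLog q T + Real.log k / 2 + 2.37 +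
      (open Classical in if χ ^ k = 1 then P k else 0) - Q k := by
    intro k hk h
    have := B k hk {conj ρ} 1 (by simpa using hconjz k h)
    rwa [Finset.sum_singleton, hQe, Pi.one_apply, Nat.cast_one, one_mul] at this
  have Bself : S 1 ≤ condLog q T + 2.37 +
      (open Classical in if χ = 1 then P 1 else 0) - (1 / (4.28 * η) - 4.28 * η / 0.7225) := by
    have := B 1 le_rfl {ρ} 1 (by simpa using hρ)
    rw [Finset.sum_singleton, hself, Pi.one_apply, Nat.cast_one, one_mul, Real.log_one, pow_one] at this
    linarith
  by_cases h1 : χ = 1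
  · have hg := hc2 h1
    have hk : ∀ k : ℕ, χ ^ k = 1 := by simp [h1]
    have hPk : ∀ k : ℕ, 1 ≤ k → P k ≤ 0.88 := by
      intro k hk
      have hk' : (1 : ℝ) ≤ k := by exact_mod_cast hk
      have hγ2 : 0.81 ≤ (k * γ) ^ 2 := by
        rw [mul_pow, ← sq_abs γ]
        calc (0.81 : ℝ) = 1 ^ 2 * 0.9 ^ 2 := by norm_num
          _ ≤ _ := by gcongr
      have : 3.28 * η / ((3.28 * η) ^ 2 + (k * γ) ^ 2) ≤ 0.01 := by
        rw [div_le_iff₀ (by positivity)]; nlinarith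
      simp only [hP]
      linarith
    have b2 := Bempty 2 (by norm_num)
    have b3 := Bempty 3 (by norm_num)
    have b4 := Bempty 4 (by norm_num)
    rw [if_pos (hk _)] at b2 b3 b4
    rw [if_pos h1] at Bself
    exact key _ _ _ _ Bself b2 b3 b4 (by
      linarith [hPk 1 le_rfl, hPk 2 (by norm_num), hPk 3 (by norm_num), hPk 4 (by norm_num)])
  by_cases h2 : χ ^ 2 = 1
  · have h3 : χ ^ 3 = χ := by rw [pow_succ, h2, one_mul]
    have h4 : χ ^ 4 = 1 := by rw [show 4 = 2 * 2 from rfl, pow_mul, h2, one_pow]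
    have b1 : S 1 ≤ condLog q T + 2.37 - Q 1 - (1 / (4.28 * η) - 4.28 * η / 0.7225) := by
      by_cases hγ0 : γ = 0
      · have hd : deriv (charF χ) ρ = 0 := by
          by_contra h
          exact h (hc1 h1 h2 hγ0)
        have hcρ : conj ρ = ρ := Complex.conj_eq_iff_im.2 hγ0
        have := B 1 le_rfl {ρ} 2 (by simpa using ⟨hρ, hd⟩)
        have hQs := hQe 1
        rw [hcρ] at hQs
        rw [Finset.sum_singleton, Nat.cast_one, Real.log_one, pow_one, if_neg h1] at this
        rw [Nat.cast_one] at hQs hself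
        have e : ((2 : ℂ → ℕ) ρ : ℝ) = 2 := by simp
        rw [e] at this
        linarith
      · have hne : ρ ≠ conj ρ := fun h => hγ0 (Complex.conj_eq_iff_im.1 h.symm)
        have := B 1 le_rfl {ρ, conj ρ} 1 (by simpa using ⟨hρ, by simpa using hconjz 1 h2⟩)
        rw [Finset.sum_pair hne, hself, hQe, pow_one, if_neg h1] at this
        simp only [Pi.one_apply, Nat.cast_one, one_mul, Real.log_one] at this
        linarith
    have b2 := Bempty 2 (by norm_num)
    have b3 := Bconj 3 (by norm_num) h4
    have b4 := Bempty 4 (by norm_num)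
    rw [if_pos h2] at b2
    rw [h3, if_neg h1] at b3
    rw [if_pos h4] at b4
    refine key (-Q 1) _ (-Q 3) _ (by linarith) b2 (by push_cast at b3; linarith) b4 ?_
    have p1 := hpole 11.92 19.584 1 (by norm_num) (by norm_num) (by norm_num)
    have p2 := hpole 1 4.8 3 (by norm_num) (by norm_num) (by norm_num)
    norm_num at p1 p2 ⊢
    linarith
  · rw [if_neg h1, add_zero] at Bself
    have b2 : S 2 ≤ condLog q T + Real.log 2 / 2 + 2.37 -
        (open Classical in if χ ^ 3 = 1 then Q 2 else 0) := by
      split_ifs with h3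
      · have := Bconj 2 (by norm_num) h3
        rw [if_neg h2] at this
        push_cast at this
        linarith
      · have := Bempty 2 (by norm_num)
        rw [if_neg h2] at this
        push_cast at this
        linarith
    have b4 := Bempty 4 (by norm_num)
    by_cases h3 : χ ^ 3 = 1
    · have h4 : χ ^ 4 ≠ 1 := by rw [pow_succ, h3, one_mul]; exact h1
      have b3 := Bempty 3 (by norm_num)
      rw [if_pos h3] at b2 b3
      rw [if_neg h4] at b4
      refine key 0 (-Q 2) (P 3) 0 (by linarith) (by linarith) b3 b4 ?_
      have p1 := hpole 4.8 11.92 2 (by norm_num) (by norm_num) (by norm_num)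
      norm_num at p1 ⊢
      linarith
    · rw [if_neg h3] at b2
      by_cases h4 : χ ^ 4 = 1
      · have b3 := Bconj 3 (by norm_num) h4
        rw [if_neg h3] at b3
        rw [if_pos h4] at b4
        refine key 0 0 (-Q 3) (P 4) (by linarith) (by linarith) (by push_cast at b3; linarith) b4 ?_
        have p1 := hpole 1 4.8 3 (by norm_num) (by norm_num) (by norm_num)
        norm_num at p1 ⊢
        linarith
      · have b3 := Bempty 3 (by norm_num)
        rw [if_neg h3] at b3
        rw [if_neg h4] at b4
        exact key 0 0 0 0 (by linarith) (by linarith) b3 b4 (by norm_num)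

end ZeroFreeRegion

section RealZeros

open DirichletCharacter Complex Filter Topology Set MeasureTheory ComplexConjugate

theorem charF_modOne_ne_zero {s : ℂ} (hs : ‖s - 1‖ < s.re) :
    charF (1 : DirichletCharacter ℂ 1) s ≠ 0 := by
  have h0 : 0 < s.re := (norm_nonneg _).trans_lt hs
  have hB : ∀ t, ‖charErr (1 : DirichletCharacter ℂ 1) 1 t‖ ≤ 1 := by
    intro t
    unfold charErr
    rw [if_pos rfl]
    split_ifs with h1
    · simp
    · have ht : 1 ≤ t := (not_le.1 h1).le
      have hft : 1 ≤ ⌊t⌋₊ := Nat.le_floor (by simpa using ht)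
      have e : (∑ k ∈ Finset.Ico (⌊(1 : ℝ)⌋₊ + 1) (⌊t⌋₊ + 1), (1 : DirichletCharacter ℂ 1) k) =
          ((⌊t⌋₊ - 1 : ℝ) : ℂ) := by
        rw [Finset.sum_congr rfl (g := fun _ => (1 : ℂ)) (fun k _ =>
          MulChar.one_apply (isUnit_of_subsingleton _))]
        simp [Nat.cast_sub hft]
      rw [e, ← ofReal_sub, norm_real, Real.norm_eq_abs, abs_le]
      have := Nat.floor_le (show 0 ≤ t by linarith)
      have := Nat.lt_floor_add_one t
      norm_num
      constructor <;> linarith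
  have hM := norm_mellin_charErr_le_of_norm_le (1 : DirichletCharacter ℂ 1) one_pos hB h0
  rw [Real.one_rpow, one_mul] at hM
  rw [charF_one_eq le_rfl h0]
  have hP : charPoly (1 : DirichletCharacter ℂ 1) 1 s = 1 := by
    simp [charPoly, MulChar.one_apply (isUnit_of_subsingleton (0 : ZMod 1))]
  rw [hP]
  set M := mellin (charErr (1 : DirichletCharacter ℂ 1) 1) (-s)
  intro h
  have h1 : s * (1 + (s - 1) * M) = 0 := by
    rw [← h]; simp; ring
  have hs0 : s ≠ 0 := by rintro rfl; simp at h0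
  have h2 : (s - 1) * M = -1 := by
    have := (mul_eq_zero.1 h1).resolve_left hs0
    linear_combination this
  have h3 := congrArg norm h2
  rw [norm_mul, norm_neg, norm_one] at h3
  have h4 : ‖s - 1‖ * ‖M‖ ≤ ‖s - 1‖ * (1 / s.re) := by gcongr
  have h5 : ‖s - 1‖ * (1 / s.re) < 1 := by
    rw [mul_one_div, div_lt_one h0]; exact hs
  linarith

section ExceptionalZero
variable {q : ℕ} [NeZero q]

theorem charF_one_ne_zero {s : ℂ} (hs : ‖s - 1‖ < s.re) :
    charF (1 : DirichletCharacter ℂ q) s ≠ 0 := by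
  have h0 : 0 < s.re := (norm_nonneg _).trans_lt hs
  rcases eq_or_ne s 1 with rfl | h1
  · exact charF_ne_zero_of_one_le_re 1 (by simp)
  have h := charF_modOne_ne_zero hs
  rw [charF_one_apply h1] at h ⊢
  rw [LFunction_modOne_eq] at h
  have h2 : LFunction (1 : DirichletCharacter ℂ q) s =
    (∏ p ∈ q.primeFactors, (1 - (p : ℂ) ^ (-s))) * riemannZeta s :=
      LFunctionTrivChar_eq_mul_riemannZeta h1
  rw [h2]
  refine mul_ne_zero (left_ne_zero_of_mul h) (mul_ne_zero ?_ (right_ne_zero_of_mul h))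
  refine Finset.prod_ne_zero_iff.2 fun p hp => ?_
  have hp' := Nat.prime_of_mem_primeFactors hp
  intro h
  have h3 : ‖(p : ℂ) ^ (-s)‖ = 1 := by rw [← sub_eq_zero.1 h, norm_one]
  rw [Complex.norm_natCast_cpow_of_pos hp'.pos] at h3
  have h4 : (p : ℝ) ^ (-s).re < 1 :=
    Real.rpow_lt_one_of_one_lt_of_neg (by exact_mod_cast hp'.one_lt) (by simpa using h0)
  linarith

theorem exists_real_of_sq_eq_one {χ : DirichletCharacter ℂ q} (h : χ ^ 2 = 1) (n : ZMod q) :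
    ∃ r : ℝ, χ n = r ∧ |r| ≤ 1 := by
  by_cases hn : IsUnit n
  · have h1 : χ n ^ 2 = 1 := by
      rw [← MulChar.pow_apply' _ (by norm_num), h, MulChar.one_apply hn]
    rcases sq_eq_one_iff.1 h1 with h2 | h2
    · exact ⟨1, by simp [h2]⟩
    · exact ⟨-1, by simp [h2]⟩
  · exact ⟨0, by simp [MulChar.map_nonunit _ hn]⟩

theorem le_zeroTerm_of_real {u η : ℝ} (hu : 0 < u) {β : ℂ} (him : β.im = 0) (h0 : 0 < 1 - β.re)
    (hη : 1 - β.re ≤ η) :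
    1 / (u + η) - (u + η) / 0.7225 ≤ zeroTerm ((1 + u : ℝ) + ((1 : ℕ) * 0 : ℝ) * I) β := by
  have h := zeroTerm_self (u := u) (η := 1 - β.re) (γ := 0) (ρ := β) (by linarith) (by ring) him
  rw [h]
  have h2 : (u + (1 - β.re)) / 0.7225 ≤ (u + η) / 0.7225 := by gcongr
  have h1 : 1 / (u + η) ≤ 1 / (u + (1 - β.re)) := one_div_le_one_div_of_le (by linarith) (by linarith)
  linarith

theorem exceptional_unique {χ₁ χ₂ : DirichletCharacter ℂ q} (hφ : 200 ≤ q.totient) {T : ℝ} (hT : 0 ≤ T)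
    (hH : 12 ≤ condLog q T + 3.47) (h₁ : χ₁ ≠ 1) (h₂ : χ₂ ≠ 1) (hr₁ : χ₁ ^ 2 = 1) (hr₂ : χ₂ ^ 2 = 1)
    {β₁ β₂ : ℂ} (hβ₁ : charF χ₁ β₁ = 0) (hβ₂ : charF χ₂ β₂ = 0) (him₁ : β₁.im = 0) (him₂ : β₂.im = 0)
    (hn₁ : (1 - β₁.re) * (condLog q T + 3.47) < 0.0286)
    (hn₂ : (1 - β₂.re) * (condLog q T + 3.47) < 0.0286) : χ₁ = χ₂ ∧ β₁ = β₂ := by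
  set H := condLog q T + 3.47 with hHdef
  set η := 0.0286 / H with hη
  have hH0 : 0 < H := by linarith
  have hη0 : 0 < η := by positivity
  have hη1 : η ≤ 0.0024 := by rw [hη, div_le_iff₀ hH0]; linarith
  have hle₁ : 1 - β₁.re ≤ η := by rw [hη, le_div_iff₀ hH0]; exact hn₁.le
  have hle₂ : 1 - β₂.re ≤ η := by rw [hη, le_div_iff₀ hH0]; exact hn₂.le
  have hp₁ : 0 < 1 - β₁.re := by
    by_contra h; exact charF_ne_zero_of_one_le_re χ₁ (by linarith) hβ₁
  have hp₂ : 0 < 1 - β₂.re := by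
    by_contra h; exact charF_ne_zero_of_one_le_re χ₂ (by linarith) hβ₂
  have hu : 0 < 3.28 * η := by positivity
  have hu' : 3.28 * η ≤ 0.149 := by linarith
  have z₁ := le_zeroTerm_of_real hu him₁ hp₁ hle₁
  have z₂ := le_zeroTerm_of_real hu him₂ hp₂ hle₂
  have hΛ := re_LSeries_vonMangoldt_le (σ := 1 + 3.28 * η) (by linarith) (by linarith)
  rw [add_sub_cancel_left] at hΛ
  have B := fun χ : DirichletCharacter ℂ q => re_vonMangoldtSeries_le χ hφ hu hu' (k := 1) le_rfl
    (show |(0 : ℝ)| ≤ T by simpa using hT)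
  have hcond : condLog q T = H - 3.47 := by rw [hHdef]; ring
  have hHη : H = 0.0286 * (1 / η) := by rw [hη]; field_simp
  have e1 : 1 / (3.28 * η) = (1 / 3.28) * (1 / η) := by field_simp
  have e2 : 1 / (3.28 * η + η) = (1 / 4.28) * (1 / η) := by
    rw [show 3.28 * η + η = 4.28 * η by ring]; field_simp
  rw [e1] at hΛ
  rw [e2] at z₁ z₂
  by_cases hχ : χ₁ = χ₂
  · refine ⟨hχ, ?_⟩
    subst hχ
    by_contra hne
    have b := B χ₁ {β₁, β₂} 1 (by simpa using ⟨hβ₁, hβ₂⟩)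
    rw [if_neg h₁, Finset.sum_pair hne] at b
    have hs := sum_re_vonMangoldtSeries_nonneg (Finset.univ : Finset (Fin 1)) ![1] ![χ₁] ![0] 1
      (σ := 1 + 3.28 * η) (by linarith) (by
        intro n hn
        obtain ⟨r, hr, hr'⟩ := exists_real_of_sq_eq_one hr₁ n
        simp [hr]
        linarith [(abs_le.1 hr').1])
    rw [hcond] at b
    simp at b hs z₁ z₂ hΛ hHη
    generalize η⁻¹ = w at *
    norm_num at b hs z₁ z₂ hΛ hHη hη1
    linarith
  · exfalso
    have b₁ := B χ₁ {β₁} 1 (by simpa using hβ₁)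
    have b₂ := B χ₂ {β₂} 1 (by simpa using hβ₂)
    have h3 : χ₁ * χ₂ ≠ 1 := by
      intro h
      apply hχ
      have := eq_inv_of_mul_eq_one_left h
      rw [this, inv_eq_of_mul_eq_one_left (a := χ₂) (by rw [← sq]; exact hr₂)]
    have b₃ := B (χ₁ * χ₂) ∅ 1 (by simp)
    rw [if_neg h₁, Finset.sum_singleton] at b₁
    rw [if_neg h₂, Finset.sum_singleton] at b₂
    rw [if_neg h3, Finset.sum_empty] at b₃
    have hs := sum_re_vonMangoldtSeries_nonneg (Finset.univ : Finset (Fin 3)) ![1, 1, 1]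
      ![χ₁, χ₂, χ₁ * χ₂] ![0, 0, 0] 1
      (σ := 1 + 3.28 * η) (by linarith) (by
        intro n hn
        obtain ⟨r, hr, hr'⟩ := exists_real_of_sq_eq_one hr₁ n
        obtain ⟨r₂, hr₂, hr₂'⟩ := exists_real_of_sq_eq_one hr₂ n
        simp [Fin.sum_univ_three, hr, hr₂]
        nlinarith [(abs_le.1 hr').1, (abs_le.1 hr₂').1])
    rw [hcond] at b₁ b₂ b₃
    simp [Fin.sum_univ_three] at b₁ b₂ b₃ hs z₁ z₂ hΛ hHη
    generalize η⁻¹ = w at *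
    norm_num at b₁ b₂ b₃ hs z₁ z₂ hΛ hHη hη1
    linarith

end ExceptionalZero

end RealZeros

section LogDerivBound

open DirichletCharacter Complex Filter Topology Set MeasureTheory ComplexConjugate Metric

variable {q : ℕ} [NeZero q]

theorem norm_vonMangoldtSeries_le (χ : DirichletCharacter ℂ q) {s : ℂ} (hs : 1 < s.re)
    (hs' : s.re < 1.5) : ‖vonMangoldtSeries χ s‖ ≤ 1 / (s.re - 1) := by
  refine le_trans ?_ (re_LSeries_vonMangoldt_le hs hs')
  have hΛ := ArithmeticFunction.LSeriesSummable_vonMangoldt (s := (s.re : ℂ)) (by simpa using hs)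
  have hnn : ∀ n, LSeries.term (fun n => (ArithmeticFunction.vonMangoldt n : ℂ)) s.re n =
      ((‖LSeries.term (fun n => (ArithmeticFunction.vonMangoldt n : ℂ)) s n‖ : ℝ) : ℂ) := by
    intro n
    rcases eq_or_ne n 0 with rfl | hn
    · simp
    rw [LSeries.term_of_ne_zero hn, LSeries.term_of_ne_zero hn, norm_div,
      Complex.norm_natCast_cpow_of_pos (Nat.pos_of_ne_zero hn), norm_real,
      Real.norm_of_nonneg ArithmeticFunction.vonMangoldt_nonneg]
    push_cast
    rw [Complex.ofReal_cpow (by positivity)]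
    simp
  have hle : ∀ n, ‖LSeries.term ((fun n : ℕ => χ n) *
      fun n => (ArithmeticFunction.vonMangoldt n : ℂ)) s n‖ ≤
      ‖LSeries.term (fun n => (ArithmeticFunction.vonMangoldt n : ℂ)) s n‖ := by
    intro n
    refine LSeries.norm_term_le s ?_
    rw [Pi.mul_apply, norm_mul]
    exact mul_le_of_le_one_left (norm_nonneg _) (DirichletCharacter.norm_le_one χ _)
  have hsum : Summable fun n => ‖LSeries.term (fun n => (ArithmeticFunction.vonMangoldt n : ℂ)) s n‖ := by
    have := hΛ.norm
    refine this.congr fun n => ?_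
    rw [hnn, norm_real, norm_norm]
  rw [vonMangoldtSeries, LSeries, LSeries]
  refine (norm_tsum_le_tsum_norm (hsum.of_nonneg_of_le (fun _ => norm_nonneg _) hle)).trans ?_
  simp_rw [hnn]
  rw [← ofReal_tsum, ofReal_re]
  exact Summable.tsum_le_tsum hle (hsum.of_nonneg_of_le (fun _ => norm_nonneg _) hle) hsum

theorem norm_logDeriv_charF_le_of_one_lt_re (χ : DirichletCharacter ℂ q) {s : ℂ} (hs : 1 < s.re)
    (hs' : s.re < 1.5) : ‖deriv (charF χ) s / charF χ s‖ ≤ 2 / (s.re - 1) := by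
  rw [logDeriv_charF χ hs]
  refine (norm_add_le _ _).trans ?_
  have h1 := norm_vonMangoldtSeries_le χ hs hs'
  have h0 : 0 < s.re - 1 := by linarith
  have h2 : ‖(open Classical in if χ = 1 then 1 / (s - 1) else 0)‖ ≤ 1 / (s.re - 1) := by
    split_ifs
    · rw [norm_div, norm_one]
      refine one_div_le_one_div_of_le h0 ?_
      simpa using Complex.re_le_norm (s - 1)
    · rw [norm_zero]; positivity
  rw [norm_neg]
  calc _ ≤ 1 / (s.re - 1) + 1 / (s.re - 1) := add_le_add h1 h2
    _ = _ := by ring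

theorem log_one_add_mul_le {c H : ℝ} (hc : 0 < c) (hc' : c ≤ 22) (hH : 12 ≤ H) :
    Real.log (1 + c * H) ≤ H := by
  have h0 : 0 < 1 + c * H := by positivity
  have h1 := log_le_div_add h0 (show (0 : ℝ) < 2 ^ 9 by norm_num)
  have h2 := Real.log_two_lt_d9
  rw [Real.log_pow] at h1
  push_cast at h1
  have : (1 + c * H) / 2 ^ 9 ≤ (1 + 22 * H) / 2 ^ 9 := by gcongr
  norm_num at *
  linarith

theorem log_inv_const_le : Real.log (1 / (0.149 * (1 - 0.149))) ≤ 2.08 := by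
  have h1 := log_le_div_add (show (0 : ℝ) < 1 / (0.149 * (1 - 0.149)) by norm_num)
    (show (0 : ℝ) < 2 ^ 3 by norm_num)
  have h2 := Real.log_two_lt_d9
  rw [Real.log_pow] at h1
  norm_num at *
  linarith

theorem log_norm_charF_sphere_le (χ : DirichletCharacter ℂ q) (hφ : 200 ≤ q.totient) {T t r κ H : ℝ}
    (hH : 12 ≤ H) (hHT : H = condLog q T + 3.47) (hκ : κ = 3 * (0.0286 / H)) (ht : |t| ≤ T)
    (hr0 : 0 < r) (hr : r ≤ 0.851) {z : ℂ} (hz : z ∈ sphere (1 + κ + t * I : ℂ) r) (hne : charF χ z ≠ 0) :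
    Real.log ‖charF χ z‖ ≤ 4 * H + Real.log ‖charF χ (1 + κ + t * I)‖ := by
  set s : ℂ := 1 + κ + t * I with hs
  have hφ' : (200 : ℝ) ≤ q.totient := by exact_mod_cast hφ
  have hT0 : 0 ≤ T := (abs_nonneg _).trans ht
  have hκ0 : 0 < κ := by rw [hκ]; positivity
  have hκH : 1 / κ = H * (1 / 0.0858) := by rw [hκ]; field_simp; norm_num
  have hκ1 : κ ≤ 0.0072 := by
    rw [hκ]
    have : 0.0286 / H ≤ 0.0024 := by rw [div_le_iff₀ (by linarith)]; linarith
    linarith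
  have hsre : s.re = 1 + κ := by simp [hs]
  have hs1 : 1 < s.re := by linarith
  rw [mem_sphere, dist_eq_norm] at hz
  have hzre : 0.149 ≤ z.re := by
    have := (abs_le.1 ((Complex.abs_re_le_norm (z - s)).trans_eq hz)).1
    rw [sub_re, hsre] at this
    linarith
  have hznorm : ‖z‖ ≤ |t| + 2 := by
    have h1 : ‖s‖ ≤ 1 + κ + |t| := by
      rw [hs]
      refine (norm_add_le _ _).trans ?_
      rw [norm_mul, norm_I, mul_one, norm_real, Real.norm_eq_abs, ← ofReal_one, ← ofReal_add, norm_real,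
        Real.norm_of_nonneg (by positivity)]
    have h2 : ‖z‖ ≤ ‖z - s‖ + ‖s‖ := by simpa using norm_add_le (z - s) s
    linarith
  set N := (q.totient : ℝ) / 2 * (T + 2) with hN
  have hN1 : 200 ≤ N := by rw [hN]; nlinarith
  have hlN : Real.log N = 2 * H - 6.94 := by rw [hHT, condLog]; ring
  have hL := le_norm_LFunction χ hs1
  rw [hsre, add_sub_cancel_left] at hL
  have hc : Real.log ((1 + κ) / κ) ≤ H := by
    have : (1 + κ) / κ = 1 + (1 / 0.0858) * H := by
      rw [add_div, div_self hκ0.ne', hκH]; ring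
    rw [this]
    exact log_one_add_mul_le (by norm_num) (by norm_num) hH
  have hlL : -H ≤ Real.log ‖LFunction χ s‖ := by
    have h1 := Real.log_le_log (by positivity) hL
    rw [← inv_div, Real.log_inv] at h1
    linarith
  have hs_ne : s ≠ 1 := by intro h; rw [h] at hs1; simp at hs1
  have hLne : LFunction χ s ≠ 0 := LFunction_ne_zero_of_one_le_re χ (Or.inr hs_ne) hs1.le
  have hzpos : 0 < ‖charF χ z‖ := norm_pos_iff.2 hne
  have hk := log_inv_const_le
  by_cases h : χ = 1
  · have hV : charV (1 : DirichletCharacter ℂ q) * (|t| + 2) ≤ 3 * N := by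
      rw [charV, if_pos rfl, hN]
      calc ((q.totient : ℝ) + 1) * (|t| + 2) ≤ (3 * q.totient / 2) * (T + 2) := by
            gcongr; linarith
        _ = _ := by ring
    have hb := norm_charF_one_le (N := 3 * N) (σ := 0.149) (by linarith) (by norm_num) (by norm_num)
      hV hzre hznorm
    subst h
    have hA : 0 < (3 * N) ^ (1 - 0.149 : ℝ) := by positivity
    have hs1n : κ ≤ ‖s - 1‖ := by
      have := Complex.re_le_norm (s - 1)
      rw [sub_re, hsre] at this
      simpa using this
    have hz1 : ‖z - 1‖ + 1 ≤ ‖s - 1‖ * (1 + (1.851 / 0.0858) * H) := by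
      have e : 1 + (1.851 / 0.0858) * H = 1 + 1.851 * (1 / κ) := by rw [hκH]; ring
      have h2 : ‖z - 1‖ ≤ ‖z - s‖ + ‖s - 1‖ := by simpa using norm_add_le (z - s) (s - 1)
      have h3 : 1.851 ≤ ‖s - 1‖ * (1.851 * (1 / κ)) := by
        calc (1.851 : ℝ) = κ * (1.851 * (1 / κ)) := by field_simp
          _ ≤ _ := by gcongr
      rw [e]
      linarith
    have hb2 : ‖charF (1 : DirichletCharacter ℂ q) z‖ ≤ (‖s - 1‖ * (1 + (1.851 / 0.0858) * H)) *
        ((3 * N) ^ (1 - 0.149 : ℝ) * (1 / (0.149 * (1 - 0.149)))) := by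
      refine hb.trans ?_
      calc _ ≤ (‖z - 1‖ + 1) * ((3 * N) ^ (1 - 0.149 : ℝ) * (1 / (0.149 * (1 - 0.149)))) := by
            rw [add_mul, mul_one_div, one_mul]
            gcongr
            rw [le_div_iff₀ (by norm_num)]
            nlinarith
        _ ≤ _ := by gcongr
    have hsp : 0 < ‖s - 1‖ := by linarith
    have hl := Real.log_le_log hzpos hb2
    rw [Real.log_mul (by positivity) (by positivity), Real.log_mul (by positivity) (by positivity),
      Real.log_mul (by positivity) (by norm_num), Real.log_rpow (by positivity),
      Real.log_mul (by norm_num) (by positivity), hlN] at hl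
    have hl1 := log_one_add_mul_le (c := 1.851 / 0.0858) (by norm_num) (by norm_num) hH
    rw [charF_one_apply hs_ne, norm_mul, Real.log_mul hsp.ne' (norm_ne_zero_iff.2 hLne)]
    have h3 : Real.log 3 ≤ 3 := by
      have := Real.log_le_sub_one_of_pos (show (0 : ℝ) < 3 by norm_num); linarith
    norm_num at *
    linarith
  · have hV : charV χ * (|t| + 2) ≤ N := by
      rw [charV, if_neg h, hN]; gcongr
    have hb := norm_charF_le_of_ne χ h (N := N) (σ := 0.149) (by linarith) (by norm_num) (by norm_num)
      hV hzre hznorm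
    rw [← mul_one_div] at hb
    have hl := Real.log_le_log hzpos hb
    rw [Real.log_mul (by positivity) (by norm_num), Real.log_rpow (by positivity), hlN] at hl
    rw [charF_of_ne χ h] at *
    norm_num at *
    linarith

end LogDerivBound

section LogDerivLeft

open DirichletCharacter Complex Filter Topology Set MeasureTheory ComplexConjugate Metric

variable {q : ℕ} [NeZero q]

/-- Common input for the bounds of `L'/L` to the left of the line `re s = 1`. -/
theorem exists_radius_charF (χ : DirichletCharacter ℂ q) (hφ : 200 ≤ q.totient) {T t κ H : ℝ}
    (hH : 12 ≤ H) (hHT : H = condLog q T + 3.47) (hκ : κ = 3 * (0.0286 / H)) (ht : |t| ≤ T) :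
    ∃ r, 0.85 ≤ r ∧ r ≤ 0.851 ∧ (∀ z ∈ sphere (1 + κ + t * I : ℂ) r, charF χ z ≠ 0) ∧
      (∀ z ∈ sphere (1 + κ + t * I : ℂ) r,
        Real.log ‖charF χ z‖ ≤ 4 * H + Real.log ‖charF χ (1 + κ + t * I)‖) ∧
      -circleCosMean (charF χ) (1 + κ + t * I) r ≤ H := by
  have hφ' : (200 : ℝ) ≤ q.totient := by exact_mod_cast hφ
  have hT0 : 0 ≤ T := (abs_nonneg _).trans ht
  have hκ0 : 0 < κ := by rw [hκ]; positivity
  have hκ1 : κ ≤ 0.149 := by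
    rw [hκ]
    have : 0.0286 / H ≤ 0.0024 := by rw [div_le_iff₀ (by linarith)]; linarith
    linarith
  have hs0 : charF χ (1 + κ + t * I) ≠ 0 :=
    charF_ne_zero_of_one_le_re χ (by simp; linarith)
  obtain ⟨r, ⟨hr1, hr2⟩, hr⟩ := exists_radius_sphere_ne_zero (differentiable_charF χ) hs0
    (show (0.85 : ℝ) < 0.851 by norm_num)
  refine ⟨r, hr1, hr2, hr, fun z hz => log_norm_charF_sphere_le χ hφ hH hHT hκ ht (by linarith) hr2 hz
    (hr z hz), ?_⟩
  set N := (q.totient : ℝ) / 2 * (T + 2) with hN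
  have hN1 : 200 ≤ N := by rw [hN]; nlinarith
  have hlN : Real.log N = 2 * H - 6.94 := by rw [hHT, condLog]; ring
  by_cases h : χ = 1
  · have hV : charV χ * (|t| + 2) ≤ 3 * N := by
      rw [charV, if_pos h, hN]
      calc ((q.totient : ℝ) + 1) * (|t| + 2) ≤ (3 * q.totient / 2) * (T + 2) := by
            gcongr; linarith
        _ = _ := by ring
    have hb := neg_circleCosMean_charF_le χ hr1 hr2 hκ0 hκ1 (by linarith) hV hr
    rw [if_pos h, Real.log_mul (by norm_num) (by positivity), hlN] at hb
    have h3 : Real.log 3 ≤ 1.14 := by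
      have h1 : Real.log 3 = Real.log 2 + (Real.log 2 + Real.log (3 / 4)) := by
        rw [← Real.log_mul (by norm_num) (by norm_num), ← Real.log_mul (by norm_num) (by norm_num)]
        norm_num
      have h2 := Real.log_two_lt_d9
      have h4 := Real.log_le_sub_one_of_pos (show (0 : ℝ) < 3 / 4 by norm_num)
      norm_num at *
      linarith
    linarith
  · have hV : charV χ * (|t| + 2) ≤ N := by
      rw [charV, if_neg h, hN]; gcongr
    have hb := neg_circleCosMean_charF_le χ hr1 hr2 hκ0 hκ1 (by linarith) hV hr
    rw [if_neg h, hlN] at hb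
    linarith

theorem logDeriv_arith {H κ η r D E w : ℝ} (hH : 12 ≤ H) (hη : η = 0.0286 / H) (hκ : κ = 3 * η)
    (hr : 0.85 ≤ r) (hD : D ≤ 2 / κ) (hE : E ≤ D) (hw : w ≤ κ + 0.95 * η) :
    w ≤ r / 21 ∧ D + 16 * (4 * H) / r + 2.05 * 79 * (E + H) + (1 / κ + 2.1 / r) ≤ 4100 * H := by
  have hη1 : η ≤ 0.0024 := by rw [hη, div_le_iff₀ (by linarith)]; linarith
  have hη0 : 0 < η := by rw [hη]; positivity
  have h1 : 1 / κ = H * (1 / 0.0858) := by rw [hκ, hη]; field_simp; norm_num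
  have h2 : 2 / κ = H * (2 / 0.0858) := by
    rw [show 2 / κ = 2 * (1 / κ) by ring, h1]; ring
  have h3 : 16 * (4 * H) / r ≤ 16 * (4 * H) / 0.85 := by gcongr
  have h4 : 2.1 / r ≤ 2.1 / 0.85 := by gcongr
  constructor
  · linarith
  · rw [h1]; rw [h2] at hD
    norm_num at *
    linarith

theorem zero_ratio_le {H κ η w x : ℝ} (hη0 : 0 < η) (hκ : κ = 3 * η) (hH : 0 < H)
    (hη : η = 0.0286 / H) (hw : w ≤ κ + 0.95 * η) (hx : 0.0286 ≤ x * H) :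
    w < κ + x ∧ w / (κ + x - w) ≤ 79 := by
  have hxη : η ≤ x := by rw [hη, div_le_iff₀ hH]; exact hx
  refine ⟨by linarith, ?_⟩
  rw [div_le_iff₀ (by linarith)]
  linarith

theorem norm_logDeriv_charF_le (χ : DirichletCharacter ℂ q) (hφ : 200 ≤ q.totient) {T H : ℝ}
    (hH : 12 ≤ H) (hHT : H = condLog q T + 3.47)
    (hzero : ∀ ρ, charF χ ρ = 0 → |ρ.im| ≤ T → 0.0286 ≤ (1 - ρ.re) * H) {s : ℂ}
    (ht : |s.im| + 0.851 ≤ T) (hs : 1 - 0.95 * (0.0286 / H) ≤ s.re) (hs' : s.re ≤ 1 + 3 * (0.0286 / H)) :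
    ‖deriv (charF χ) s / charF χ s‖ ≤ 4100 * H := by
  obtain ⟨η, hη⟩ : ∃ η, η = 0.0286 / H := ⟨_, rfl⟩
  obtain ⟨κ, hκ⟩ : ∃ κ, κ = 3 * η := ⟨_, rfl⟩
  rw [← hη] at hs hs'
  have hη0 : 0 < η := by rw [hη]; positivity
  have hη1 : η ≤ 0.0024 := by rw [hη, div_le_iff₀ (by linarith)]; linarith
  obtain ⟨r, hr1, hr2, hr3, hr4, hr5⟩ := exists_radius_charF χ hφ hH hHT (κ := κ) (by rw [hκ, hη])
    (show |s.im| ≤ T by linarith)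
  set s0 : ℂ := 1 + κ + s.im * I with hs0
  have hs0re : s0.re = 1 + κ := by simp [hs0]
  have hs0im : s0.im = s.im := by simp [hs0]
  have hs0ne : charF χ s0 ≠ 0 := charF_ne_zero_of_one_le_re χ (by linarith)
  have hD := norm_logDeriv_charF_le_of_one_lt_re χ (s := s0) (by linarith) (by norm_num at *; linarith)
  rw [hs0re, add_sub_cancel_left] at hD
  obtain ⟨w, hw⟩ : ∃ w, w = 1 + κ - s.re := ⟨_, rfl⟩
  obtain ⟨a1, a2⟩ := logDeriv_arith hH hη hκ hr1 hD (Complex.re_le_norm _) (w := w) (by linarith)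
  have hk := norm_logDeriv_le (by linarith) (differentiable_charF χ) hs0ne hr3 hr5 (M := 4 * H)
    (by linarith) hr4 (w := w) (by linarith) a1 (R := 79) (by norm_num) (by
      intro ρ hρ hρ0
      have him : |ρ.im| ≤ T := by
        have h1 := (Complex.abs_im_le_norm (ρ - s0)).trans hρ.le
        rw [sub_im, hs0im] at h1
        have h2 := abs_sub_abs_le_abs_sub ρ.im s.im
        linarith
      have := zero_ratio_le hη0 hκ (by linarith) hη (w := w) (by linarith)
        (hzero ρ hρ0 him)
      rw [hs0re, show 1 + κ - ρ.re = κ + (1 - ρ.re) by ring]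
      exact this)
  have e : s0 - w = s := by
    rw [hs0, hw]; apply Complex.ext <;> simp
  rw [e] at hk
  refine hk.trans (le_trans ?_ a2)
  have : 0 ≤ 1 / κ + 2.1 / r := by rw [hκ]; positivity
  linarith

theorem norm_logDeriv_charF_sub_le (χ : DirichletCharacter ℂ q) (hφ : 200 ≤ q.totient) {T H : ℝ}
    (hH : 12 ≤ H) (hHT : H = condLog q T + 3.47) {β : ℂ} (hβ : charF χ β = 0)
    (hβd : deriv (charF χ) β ≠ 0)
    (hzero : ∀ ρ, charF χ ρ = 0 → ρ ≠ β → |ρ.im| ≤ T → 0.0286 ≤ (1 - ρ.re) * H) {s : ℂ} (hsβ : s ≠ β)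
    (ht : |s.im| + 0.851 ≤ T) (hs : 1 - 0.95 * (0.0286 / H) ≤ s.re) (hs' : s.re ≤ 1 + 3 * (0.0286 / H)) :
    ‖deriv (charF χ) s / charF χ s - 1 / (s - β)‖ ≤ 4100 * H := by
  obtain ⟨η, hη⟩ : ∃ η, η = 0.0286 / H := ⟨_, rfl⟩
  obtain ⟨κ, hκ⟩ : ∃ κ, κ = 3 * η := ⟨_, rfl⟩
  rw [← hη] at hs hs'
  have hη0 : 0 < η := by rw [hη]; positivity
  have hη1 : η ≤ 0.0024 := by rw [hη, div_le_iff₀ (by linarith)]; linarith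
  obtain ⟨r, hr1, hr2, hr3, hr4, hr5⟩ := exists_radius_charF χ hφ hH hHT (κ := κ) (by rw [hκ, hη])
    (show |s.im| ≤ T by linarith)
  set s0 : ℂ := 1 + κ + s.im * I with hs0
  have hs0re : s0.re = 1 + κ := by simp [hs0]
  have hs0im : s0.im = s.im := by simp [hs0]
  have hs0ne : charF χ s0 ≠ 0 := charF_ne_zero_of_one_le_re χ (by linarith)
  have hD := norm_logDeriv_charF_le_of_one_lt_re χ (s := s0) (by linarith) (by norm_num at *; linarith)
  rw [hs0re, add_sub_cancel_left] at hD
  have hβre : β.re < 1 := by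
    by_contra h; exact charF_ne_zero_of_one_le_re χ (by linarith) hβ
  obtain ⟨w, hw⟩ : ∃ w, w = 1 + κ - s.re := ⟨_, rfl⟩
  have e : s0 - w = s := by
    rw [hs0, hw]; apply Complex.ext <;> simp
  obtain ⟨a1, a2⟩ := logDeriv_arith hH hη hκ hr1 hD (Complex.re_le_norm _) (w := w) (by linarith)
  have hk := norm_logDeriv_sub_le (by linarith) (differentiable_charF χ) hs0ne hr3 hr5 (M := 4 * H)
    (by linarith) hr4 (w := w) (by linarith) a1 (R := 79) (by norm_num) (β := β) (by linarith)
    (by rw [e]; exact hsβ) hβ hβd (by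
      intro ρ hρ hρ0 hρβ
      have him : |ρ.im| ≤ T := by
        have h1 := (Complex.abs_im_le_norm (ρ - s0)).trans hρ.le
        rw [sub_im, hs0im] at h1
        have h2 := abs_sub_abs_le_abs_sub ρ.im s.im
        linarith
      have := zero_ratio_le hη0 hκ (by linarith) hη (w := w) (by linarith)
        (hzero ρ hρ0 hρβ him)
      rw [hs0re, show 1 + κ - ρ.re = κ + (1 - ρ.re) by ring]
      exact this)
  rw [e] at hk
  refine hk.trans (le_trans ?_ a2)
  have : 1 / ‖s0 - β‖ ≤ 1 / κ := by
    refine one_div_le_one_div_of_le (by rw [hκ]; positivity) ?_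
    have := Complex.re_le_norm (s0 - β)
    rw [sub_re, hs0re] at this
    linarith
  linarith

end LogDerivLeft

section Ramp

open DirichletCharacter Complex Filter Topology Set MeasureTheory ComplexConjugate Metric

open scoped FourierTransform

theorem integrableOn_mul_exp_neg {c : ℝ} (hc : 0 < c) :
    IntegrableOn (fun v : ℝ => v * Real.exp (-c * v)) (Ioi 0) := by
  have := integrableOn_rpow_mul_exp_neg_mul_rpow (p := 1) (s := 1) (b := c) (by norm_num)
    (by norm_num) hc
  simpa using this

theorem tendsto_mul_exp_neg {c : ℝ} (hc : 0 < c) :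
    Tendsto (fun v : ℝ => v * Real.exp (-c * v)) atTop (𝓝 0) := by
  have := Real.tendsto_pow_mul_exp_neg_atTop_nhds_zero 1
  have h2 := (this.comp (tendsto_id.const_mul_atTop hc)).const_mul c⁻¹
  simp only [mul_zero] at h2
  refine h2.congr fun v => ?_
  simp only [Function.comp, id, pow_one]
  rw [neg_mul]; field_simp

theorem integrableOn_mul_cexp_neg {r : ℂ} (hr : 0 < r.re) :
    IntegrableOn (fun v : ℝ => (v : ℂ) * cexp (-r * v)) (Ioi 0) := by
  refine (integrable_norm_iff (by fun_prop)).mp ?_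
  refine (integrableOn_mul_exp_neg hr).congr_fun (fun v hv => ?_) measurableSet_Ioi
  simp [norm_exp, abs_of_pos (show 0 < v from hv)]

theorem integral_mul_cexp_neg {r : ℂ} (hr : 0 < r.re) :
    ∫ v : ℝ in Ioi 0, (v : ℂ) * cexp (-r * v) = 1 / r ^ 2 := by
  have hr0 : r ≠ 0 := fun h => by simp [h] at hr
  have hd : ∀ v ∈ Ici (0 : ℝ), HasDerivAt (fun v : ℝ => -((v : ℂ) / r + 1 / r ^ 2) * cexp (-r * v))
      ((v : ℂ) * cexp (-r * v)) v := by
    intro v _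
    have h1 : HasDerivAt (fun v : ℝ => (v : ℂ)) 1 v := hasDerivAt_id v |>.ofReal_comp
    have h2 := ((h1.div_const r).add_const (1 / r ^ 2)).neg.mul ((h1.const_mul (-r)).cexp)
    refine h2.congr_deriv ?_
    rw [Pi.neg_apply]
    field_simp
    ring
  have ht : Tendsto (fun v : ℝ => -((v : ℂ) / r + 1 / r ^ 2) * cexp (-r * v)) atTop (𝓝 0) := by
    have h1 : Tendsto (fun v : ℝ => (v : ℂ) * cexp (-r * v)) atTop (𝓝 0) := by
      rw [tendsto_zero_iff_norm_tendsto_zero]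
      refine (tendsto_mul_exp_neg hr).congr' ?_
      filter_upwards [eventually_gt_atTop 0] with v hv
      simp [norm_exp, abs_of_pos hv]
    have h2 : Tendsto (fun v : ℝ => cexp (-r * v)) atTop (𝓝 0) := by
      rw [tendsto_zero_iff_norm_tendsto_zero]
      have := Real.tendsto_exp_neg_atTop_nhds_zero.comp (tendsto_id.const_mul_atTop hr)
      refine this.congr fun v => ?_
      simp [norm_exp]
    have := (h1.const_mul (-(1 / r))).add (h2.const_mul (-(1 / r ^ 2)))
    simp only [mul_zero, add_zero] at this
    refine this.congr fun v => ?_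
    ring
  have := integral_Ioi_of_hasDerivAt_of_tendsto' hd (integrableOn_mul_cexp_neg hr) ht
  rw [this]; simp

theorem line_ne_zero {c : ℝ} (hc : 0 < c) (t : ℝ) : (c + t * I : ℂ) ≠ 0 := by
  intro h
  have := congrArg Complex.re h
  simp at this; exact hc.ne' this

theorem norm_sq_line (c t : ℝ) : ‖(c + t * I : ℂ)‖ ^ 2 = c ^ 2 + t ^ 2 := by
  rw [← Complex.normSq_eq_norm_sq, Complex.normSq_add_mul_I]

theorem integrable_inv_sq_line {c : ℝ} (hc : 0 < c) :
    Integrable fun t : ℝ => ‖(c + t * I : ℂ)‖⁻¹ ^ 2 := by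
  have h := (integrable_inv_one_add_sq.comp_mul_left' (R := c⁻¹) (by positivity)).const_mul (c ^ 2)⁻¹
  refine h.congr (Eventually.of_forall fun t => ?_)
  simp only [inv_pow, norm_sq_line]
  rw [← mul_inv]
  congr 1
  field_simp

theorem integrable_cexp_div_sq {c : ℝ} (hc : 0 < c) (v : ℝ) :
    Integrable fun t : ℝ => cexp (v * (c + t * I)) / (c + t * I) ^ 2 := by
  have hcont : Continuous fun t : ℝ => cexp (v * (c + t * I)) / (c + t * I) ^ 2 :=
    Continuous.div (by fun_prop) (by fun_prop) fun t => pow_ne_zero _ (line_ne_zero hc t)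
  refine ((integrable_inv_sq_line hc).const_mul (Real.exp (v * c))).mono'
    hcont.aestronglyMeasurable (Eventually.of_forall fun t => le_of_eq ?_)
  rw [norm_div, norm_pow, norm_exp, inv_pow]
  simp [div_eq_mul_inv]

theorem max_zero_eq_integral {c : ℝ} (hc : 0 < c) (v : ℝ) :
    ((max v 0 : ℝ) : ℂ) =
      (2 * Real.pi : ℂ)⁻¹ * ∫ t : ℝ, cexp (v * (c + t * I)) / (c + t * I) ^ 2 := by
  let f : ℝ → ℂ := fun v => (max v 0 : ℝ) * cexp (-c * v)
  have hfc : Continuous f := by fun_prop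
  have hfi : f = indicator (Ioi 0) fun v : ℝ => (v : ℂ) * cexp (-(c : ℂ) * v) := by
    ext v
    by_cases hv : 0 < v
    · simp [f, hv, hv.le]
    · simp [f, hv, not_lt.mp hv]
  have hf : Integrable f := by
    rw [hfi, integrable_indicator_iff measurableSet_Ioi]
    exact integrableOn_mul_cexp_neg (by simpa using hc)
  have hF : 𝓕 f = fun w : ℝ => 1 / (c + (2 * Real.pi * w : ℝ) * I : ℂ) ^ 2 := by
    ext w
    rw [Real.fourier_real_eq_integral_exp_smul, ← integral_mul_cexp_neg (by simpa using hc),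
      ← integral_indicator measurableSet_Ioi]
    congr 1
    ext v
    by_cases hv : 0 < v
    · simp only [indicator, mem_Ioi, hv, if_true, f, max_eq_left hv.le, smul_eq_mul]
      rw [mul_left_comm, ← Complex.exp_add]
      congr 2
      push_cast; ring
    · simp [indicator, hv, f, not_lt.mp hv]
  have hFi : Integrable (𝓕 f) := by
    rw [hF]
    have := (integrable_cexp_div_sq hc 0).comp_mul_left' (R := 2 * Real.pi) (by positivity)
    simpa using this
  have hinv := congrFun (hfc.fourierInv_fourier_eq hf hFi) v
  rw [Real.fourierInv_eq', hF] at hinv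
  have hsub := Measure.integral_comp_mul_left
    (fun t : ℝ => cexp (v * (c + t * I)) / (c + t * I : ℂ) ^ 2) (2 * Real.pi)
  rw [abs_of_pos (by positivity), eq_comm, inv_smul_eq_iff₀ (by positivity)] at hsub
  rw [hsub]
  have h1 : ((max v 0 : ℝ) : ℂ) = cexp (c * v) * f v := by
    simp only [f]
    rw [mul_left_comm, ← Complex.exp_add]; simp
  rw [h1, ← hinv, ← integral_const_mul, real_smul, ← mul_assoc]
  have h2 : (2 * Real.pi : ℂ)⁻¹ * ((2 * Real.pi : ℝ) : ℂ) = 1 := by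
    push_cast; rw [inv_mul_cancel₀]
    norm_cast; positivity
  rw [h2, one_mul]
  congr 1
  ext w
  simp only [smul_eq_mul, RCLike.inner_apply, conj_trivial]
  rw [← mul_assoc, ← Complex.exp_add, mul_one_div]
  congr 2
  push_cast; ring

end Ramp

section Smooth

open DirichletCharacter Complex Filter Topology Set MeasureTheory ComplexConjugate Metric

/-- Iterated averages of a ramp: a smoothed version of the indicator function of `v ≥ 0`. -/
noncomputable def smoothW (h : ℝ) : ℕ → ℝ → ℝ
  | 0, v => (max (v + h) 0 - max v 0) / h
  | j + 1, v => h⁻¹ * ∫ t in (0 : ℝ)..h, smoothW h j (v + t)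

/-- The Mellin transform of `smoothW`. -/
noncomputable def smoothM (h : ℝ) (j : ℕ) (s : ℂ) : ℂ :=
  1 / s * ((cexp (h * s) - 1) / (h * s)) ^ (j + 1)

variable {h : ℝ}

theorem continuous_smoothW (h : ℝ) (j : ℕ) : Continuous (smoothW h j) := by
  induction j with
  | zero =>
    have : smoothW h 0 = fun v => (max (v + h) 0 - max v 0) / h := rfl
    rw [this]; fun_prop
  | succ j ih =>
    have : smoothW h (j + 1) = fun v => h⁻¹ * ∫ t in (0 : ℝ)..h, smoothW h j (v + t) := rfl
    rw [this]
    refine continuous_const.mul ?_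
    apply intervalIntegral.continuous_parametric_intervalIntegral_of_continuous'
    exact ih.comp (by fun_prop)

theorem smoothW_mem (hh : 0 < h) (j : ℕ) (v : ℝ) : smoothW h j v ∈ Icc (0 : ℝ) 1 := by
  induction j generalizing v with
  | zero =>
    simp only [smoothW, mem_Icc]
    rw [le_div_iff₀ hh, div_le_iff₀ hh]
    constructor
    · rw [zero_mul, sub_nonneg]; gcongr; linarith
    · rw [one_mul, sub_le_iff_le_add]
      exact max_le (by linarith [le_max_left v 0]) (by linarith [le_max_right v 0])
  | succ j ih =>
    simp only [smoothW, mem_Icc]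
    have hc : ∀ a b, IntervalIntegrable (fun t => smoothW h j (v + t)) volume a b :=
      fun a b => ((continuous_smoothW h j).comp (by fun_prop)).intervalIntegrable _ _
    constructor
    · exact mul_nonneg (by positivity) (intervalIntegral.integral_nonneg hh.le fun t _ => (ih _).1)
    · have := intervalIntegral.integral_mono_on hh.le (hc 0 h) (by simp)
        (g := fun _ => (1 : ℝ)) fun t _ => (ih _).2
      rw [intervalIntegral.integral_const, sub_zero, smul_eq_mul, mul_one] at this
      rw [inv_mul_le_iff₀ hh]; linarith

theorem smoothW_eq_one (hh : 0 < h) (j : ℕ) {v : ℝ} (hv : 0 ≤ v) : smoothW h j v = 1 := by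
  induction j generalizing v with
  | zero =>
    simp only [smoothW]
    rw [max_eq_left (by linarith), max_eq_left hv]; field_simp; ring
  | succ j ih =>
    simp only [smoothW]
    have : ∫ t in (0 : ℝ)..h, smoothW h j (v + t) = ∫ t in (0 : ℝ)..h, 1 := by
      refine intervalIntegral.integral_congr fun t ht => ?_
      rw [uIcc_of_le hh.le] at ht
      exact ih (by linarith [ht.1])
    rw [this]; simp [hh.ne']

theorem smoothW_eq_zero (hh : 0 < h) (j : ℕ) {v : ℝ} (hv : v ≤ -((j + 1) * h)) :
    smoothW h j v = 0 := by
  induction j generalizing v with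
  | zero =>
    simp only [smoothW]
    simp only [Nat.cast_zero, zero_add, one_mul] at hv
    rw [max_eq_right (by linarith), max_eq_right (by linarith)]; simp
  | succ j ih =>
    simp only [smoothW]
    have : ∫ t in (0 : ℝ)..h, smoothW h j (v + t) = ∫ t in (0 : ℝ)..h, 0 := by
      refine intervalIntegral.integral_congr fun t ht => ?_
      rw [uIcc_of_le hh.le] at ht
      refine ih ?_
      push_cast at hv
      linarith [ht.2]
    rw [this]; simp

theorem norm_exp_sub_one_le_exp_re {w : ℂ} (hw : 0 ≤ w.re) :
    ‖cexp w - 1‖ ≤ Real.exp w.re * ‖w‖ := by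
  have hconv : Convex ℝ {z : ℂ | z.re ≤ w.re} := convex_halfSpace_re_le _
  have := hconv.norm_image_sub_le_of_norm_deriv_le (f := cexp) (C := Real.exp w.re) (x := 0) (y := w)
    (fun z _ => Complex.differentiableAt_exp) (fun z hz => ?_) (by simpa using hw) (by simp)
  · simpa using this
  · rw [Complex.deriv_exp, norm_exp]; exact Real.exp_le_exp.mpr hz

theorem norm_smoothM_le_exp (hh : 0 < h) (j : ℕ) {s : ℂ} (hs : 0 ≤ s.re) (hs0 : s ≠ 0) :
    ‖smoothM h j s‖ ≤ 1 / ‖s‖ * Real.exp ((j + 1) * h * s.re) := by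
  unfold smoothM
  rw [norm_mul, norm_pow, norm_div, norm_one]
  gcongr
  rw [mul_assoc, show ((j : ℝ) + 1) = ((j + 1 : ℕ) : ℝ) by push_cast; rfl, Real.exp_nat_mul]
  gcongr
  have h1 : 0 ≤ ((h : ℂ) * s).re := by simpa using mul_nonneg hh.le hs
  have := norm_exp_sub_one_le_exp_re h1
  have hn : 0 < ‖(h : ℂ) * s‖ := norm_pos_iff.mpr (mul_ne_zero (by exact_mod_cast hh.ne') hs0)
  rw [norm_div, div_le_iff₀ hn]
  simpa using this

theorem norm_smoothM_le_pow (hh : 0 < h) (j : ℕ) (s : ℂ) :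
    ‖smoothM h j s‖ ≤ 1 / ‖s‖ * ((Real.exp (h * s.re) + 1) / (h * ‖s‖)) ^ (j + 1) := by
  unfold smoothM
  rw [norm_mul, norm_pow, norm_div, norm_one, norm_div, norm_mul, norm_real, Real.norm_of_nonneg hh.le]
  gcongr
  refine (norm_sub_le _ _).trans ?_
  rw [norm_exp, norm_one]; simp

theorem continuous_smoothM_line {c : ℝ} (hh : 0 < h) (hc : 0 < c) (j : ℕ) :
    Continuous fun t : ℝ => smoothM h j (c + t * I) := by
  unfold smoothM
  have h1 := fun t => line_ne_zero hc t
  have hh' : (h : ℂ) ≠ 0 := by exact_mod_cast hh.ne'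
  refine (continuous_const.div (by fun_prop) h1).mul (Continuous.pow ?_ _)
  exact Continuous.div (by fun_prop) (by fun_prop) fun t => mul_ne_zero hh' (h1 t)

theorem le_norm_line {c : ℝ} (t : ℝ) : c ≤ ‖(c + t * I : ℂ)‖ := by
  have := (le_abs_self _).trans (abs_re_le_norm (c + t * I : ℂ)); simpa using this

theorem integrable_smoothM_line {c : ℝ} (hh : 0 < h) (hc : 0 < c) (j : ℕ) :
    Integrable fun t : ℝ => smoothM h j (c + t * I) := by
  refine ((integrable_inv_sq_line hc).const_mul (((Real.exp (h * c) + 1) / h) ^ (j + 1) * c⁻¹ ^ j)).mono'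
    (continuous_smoothM_line hh hc j).aestronglyMeasurable (Eventually.of_forall fun t => ?_)
  refine (norm_smoothM_le_pow hh j _).trans ?_
  have hle : c ≤ ‖(c + t * I : ℂ)‖ := le_norm_line t
  have hpos : 0 < ‖(c + t * I : ℂ)‖ := hc.trans_le hle
  have hre : (c + t * I : ℂ).re = c := by simp
  rw [hre]
  calc 1 / ‖(c + t * I : ℂ)‖ * ((Real.exp (h * c) + 1) / (h * ‖(c + t * I : ℂ)‖)) ^ (j + 1)
      = ((Real.exp (h * c) + 1) / h) ^ (j + 1) * ‖(c + t * I : ℂ)‖⁻¹ ^ j * ‖(c + t * I : ℂ)‖⁻¹ ^ 2 := by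
        rw [← div_div, div_pow _ ‖_‖, one_div]; ring
    _ ≤ _ := by gcongr

theorem integrable_smoothM_mul_exp {c : ℝ} (hh : 0 < h) (hc : 0 < c) (j : ℕ) (v : ℝ) :
    Integrable fun t : ℝ => smoothM h j (c + t * I) * cexp (v * (c + t * I)) := by
  refine (integrable_smoothM_line hh hc j).mul_bdd (c := Real.exp (v * c))
    (Continuous.aestronglyMeasurable (by fun_prop)) (Eventually.of_forall fun t => ?_)
  rw [norm_exp]; simp

theorem smoothW_eq_integral {c : ℝ} (hh : 0 < h) (hc : 0 < c) (j : ℕ) (v : ℝ) :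
    (smoothW h j v : ℂ) =
      (2 * Real.pi : ℂ)⁻¹ * ∫ t : ℝ, smoothM h j (c + t * I) * cexp (v * (c + t * I)) := by
  have hh' : (h : ℂ) ≠ 0 := by exact_mod_cast hh.ne'
  induction j generalizing v with
  | zero =>
    simp only [smoothW]
    push_cast
    rw [max_zero_eq_integral hc, max_zero_eq_integral hc, ← mul_sub, ← integral_sub
      (integrable_cexp_div_sq hc _) (integrable_cexp_div_sq hc _), mul_div_assoc, ← integral_div]
    congr 2
    ext t
    have := line_ne_zero hc t
    rw [smoothM]
    push_cast
    rw [add_mul, Complex.exp_add]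
    field_simp
  | succ j ih =>
    have hW : smoothW h (j + 1) v = h⁻¹ * ∫ t in (0 : ℝ)..h, smoothW h j (v + t) := rfl
    rw [hW]
    push_cast
    rw [← intervalIntegral.integral_ofReal]
    simp_rw [ih]
    rw [intervalIntegral.integral_const_mul, mul_left_comm]
    congr 1
    rw [intervalIntegral.integral_of_le hh.le, integral_integral_swap]
    · rw [← integral_const_mul]
      congr 1
      ext t
      have ht := line_ne_zero hc t
      have : ∀ u : ℝ, smoothM h j (c + t * I) * cexp ((v + u : ℝ) * (c + t * I)) =
          smoothM h j (c + t * I) * cexp (v * (c + t * I)) * cexp ((c + t * I) * u) := by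
        intro u; rw [mul_assoc, ← Complex.exp_add]; congr 2; push_cast; ring
      simp_rw [this]
      rw [integral_const_mul, ← intervalIntegral.integral_of_le hh.le, integral_exp_mul_complex ht]
      unfold smoothM
      rw [pow_succ _ (j + 1)]
      simp only [ofReal_zero, mul_zero, Complex.exp_zero]
      rw [mul_comm (c + t * I : ℂ) (h : ℂ)]
      field_simp
    · have hb : Integrable (fun p : ℝ × ℝ => (1 : ℂ) * smoothM h j (c + p.2 * I))
          ((volume.restrict (Ioc 0 h)).prod volume) :=
        Integrable.mul_prod (integrable_const _) (integrable_smoothM_line hh hc j)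
      simp_rw [one_mul] at hb
      refine hb.mul_bdd (c := Real.exp ((|v| + h) * c))
        (Continuous.aestronglyMeasurable (by fun_prop)) ?_
      have hae : ∀ᵐ p : ℝ × ℝ ∂((volume.restrict (Ioc 0 h)).prod volume), p.1 ∈ Ioc 0 h := by
        have := (Measure.quasiMeasurePreserving_fst (μ := volume.restrict (Ioc 0 h))
          (ν := (volume : Measure ℝ))).ae (ae_restrict_mem measurableSet_Ioc)
        exact this
      filter_upwards [hae] with p hp
      rw [norm_exp, Real.exp_le_exp]
      simp only [mul_re, ofReal_re, add_re, ofReal_im, I_re, I_im, mul_zero, mul_one, sub_zero,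
        zero_mul, add_zero]
      gcongr
      · exact le_abs_self v
      · exact hp.2

end Smooth

section SmoothTransform

open DirichletCharacter Complex Filter Topology Set MeasureTheory ComplexConjugate Metric

variable {h c : ℝ}

theorem integral_mul_smoothW_eq {α : Type*} [MeasurableSpace α] (ν : Measure α) [SFinite ν]
    (hh : 0 < h) (hc : 0 < c) (j : ℕ) (y : ℝ) {g : α → ℂ} {l : α → ℝ} (hl : Measurable l)
    (hg : Integrable (fun a => g a * cexp (-(c * l a))) ν) :
    Integrable (fun t : ℝ => smoothM h j (c + t * I) * cexp (y * (c + t * I)) *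
        ∫ a, g a * cexp (-((c + t * I) * l a)) ∂ν) ∧
      ∫ a, g a * smoothW h j (y - l a) ∂ν = (2 * Real.pi : ℂ)⁻¹ *
        ∫ t : ℝ, smoothM h j (c + t * I) * cexp (y * (c + t * I)) *
          ∫ a, g a * cexp (-((c + t * I) * l a)) ∂ν := by
  have hprod : Integrable (fun p : α × ℝ => (smoothM h j (c + p.2 * I) *
      cexp (y * (c + p.2 * I))) * (g p.1 * cexp (-((c + p.2 * I) * l p.1)))) (ν.prod volume) := by
    have h1 := Integrable.mul_prod hg (integrable_smoothM_mul_exp hh hc j y)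
    have h2 := h1.mul_bdd (c := 1) (g := fun p : α × ℝ => cexp (-(p.2 * I * l p.1)))
      (Measurable.aestronglyMeasurable (by fun_prop)) (Eventually.of_forall fun p => by
        rw [norm_exp]; simp)
    refine h2.congr (Eventually.of_forall fun p => ?_)
    simp only
    rw [show -((c + p.2 * I) * l p.1 : ℂ) = -(c * l p.1) + -(p.2 * I * l p.1) by ring,
      Complex.exp_add]
    ring
  refine ⟨?_, ?_⟩
  · have := hprod.integral_prod_right
    simpa only [integral_const_mul] using this
  · have hsw := integral_integral_swap (f := fun a (t : ℝ) => (smoothM h j (c + t * I) *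
      cexp (y * (c + t * I))) * (g a * cexp (-((c + t * I) * l a)))) hprod
    simp_rw [integral_const_mul] at hsw
    rw [← hsw, ← integral_const_mul]
    congr 1
    ext a
    rw [smoothW_eq_integral hh hc j, mul_left_comm, ← integral_const_mul]
    congr 2
    ext t
    rw [show ((y - l a : ℝ) : ℂ) * (c + t * I) = y * (c + t * I) + -((c + t * I) * l a) by
      push_cast; ring, Complex.exp_add]
    ring

theorem vonMangoldt_term_eq {q : ℕ} (χ : DirichletCharacter ℂ q) (s : ℂ) (n : ℕ) :
    LSeries.term ((fun n : ℕ => χ n) * fun n => (ArithmeticFunction.vonMangoldt n : ℂ)) s n =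
      (χ n * ArithmeticFunction.vonMangoldt n) * cexp (-(s * Real.log n)) := by
  rcases Nat.eq_zero_or_pos n with rfl | hn
  · simp
  · have hn' : (n : ℂ) ≠ 0 := by exact_mod_cast hn.ne'
    rw [LSeries.term_of_ne_zero hn.ne', cpow_def_of_ne_zero hn', Pi.mul_apply, div_eq_mul_inv,
      ← Complex.exp_neg, ← natCast_log, mul_comm s]

/-- The smoothed Chebyshev sum twisted by a character. -/
noncomputable def smoothPsi {q : ℕ} (χ : DirichletCharacter ℂ q) (h : ℝ) (j : ℕ) (y : ℝ) : ℂ :=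
  ∑' n : ℕ, χ n * ArithmeticFunction.vonMangoldt n * smoothW h j (y - Real.log n)

theorem smoothPsi_eq {q : ℕ} (χ : DirichletCharacter ℂ q) (hh : 0 < h) (hc : 1 < c)
    (j : ℕ) (y : ℝ) :
    Integrable (fun t : ℝ => smoothM h j (c + t * I) * cexp (y * (c + t * I)) *
        vonMangoldtSeries χ (c + t * I)) ∧
      smoothPsi χ h j y = (2 * Real.pi : ℂ)⁻¹ *
        ∫ t : ℝ, smoothM h j (c + t * I) * cexp (y * (c + t * I)) *
          vonMangoldtSeries χ (c + t * I) := by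
  have hc0 : 0 < c := by linarith
  have hsum : ∀ t : ℝ, LSeriesSummable ((fun n : ℕ => χ n) *
      fun n => (ArithmeticFunction.vonMangoldt n : ℂ)) (c + t * I) := fun t =>
    χ.LSeriesSummable_twist_vonMangoldt (by simpa using hc)
  have hinteg : ∀ t : ℝ, Integrable (fun n : ℕ => (χ n * ArithmeticFunction.vonMangoldt n : ℂ) *
      cexp (-((c + t * I) * Real.log n))) Measure.count := fun t => by
    rw [integrable_count_iff]
    have := (hsum t).norm
    simpa only [vonMangoldt_term_eq] using this
  have hg := hinteg 0
  simp only [ofReal_zero, zero_mul, add_zero] at hg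
  have key := integral_mul_smoothW_eq Measure.count hh hc0 j y (l := fun n : ℕ => Real.log n)
    (measurable_of_countable _) hg
  have hv : ∀ t : ℝ, ∫ n : ℕ, (χ n * ArithmeticFunction.vonMangoldt n : ℂ) *
      cexp (-((c + t * I) * Real.log n)) ∂Measure.count = vonMangoldtSeries χ (c + t * I) := by
    intro t
    rw [integral_countable (hinteg t), vonMangoldtSeries, LSeries]
    simp only [vonMangoldt_term_eq]
    simp
  simp_rw [hv] at key
  refine ⟨key.1, ?_⟩
  rw [← key.2, smoothPsi, integral_countable]
  · simp
  · have h1 : Integrable (fun n : ℕ => (χ n * ArithmeticFunction.vonMangoldt n : ℂ) *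
      cexp (-(c * Real.log n)) * (cexp (c * Real.log n) * smoothW h j (y - Real.log n)))
        Measure.count := by
      refine hg.mul_bdd (c := Real.exp (c * (y + (j + 1) * h)))
        (measurable_of_countable _).aestronglyMeasurable (Eventually.of_forall fun n => ?_)
      have hW := smoothW_mem hh j (y - Real.log n)
      by_cases hn : y - Real.log n ≤ -((j + 1) * h)
      · rw [smoothW_eq_zero hh j hn]; simp; positivity
      · rw [norm_mul, norm_exp, norm_real, Real.norm_of_nonneg hW.1]
        refine (mul_le_of_le_one_right (by positivity) hW.2).trans ?_
        rw [Real.exp_le_exp]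
        simp only [mul_re, ofReal_re, ofReal_im, mul_zero, sub_zero]
        gcongr
        linarith
    refine h1.congr (Eventually.of_forall fun n => ?_)
    simp only
    rw [mul_assoc, ← mul_assoc (cexp _), ← Complex.exp_add]
    simp

theorem integral_rpow_mul_smoothW_eq {b : ℝ} (hb : b ≤ 1) (hh : 0 < h) (hc : 1 < c)
    (j : ℕ) (y : ℝ) :
    Integrable (fun t : ℝ => smoothM h j (c + t * I) * cexp (y * (c + t * I)) *
        (1 / (c + t * I - b))) ∧
      ((∫ u in Ioi (1 : ℝ), u ^ (b - 1) * smoothW h j (y - Real.log u) : ℝ) : ℂ) =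
        (2 * Real.pi : ℂ)⁻¹ *
        ∫ t : ℝ, smoothM h j (c + t * I) * cexp (y * (c + t * I)) * (1 / (c + t * I - b)) := by
  have hc0 : 0 < c := by linarith
  have hterm : ∀ t : ℝ, ∀ u ∈ Ioi (1 : ℝ), ((u ^ (b - 1) : ℝ) : ℂ) *
      cexp (-((c + t * I) * Real.log u)) = (u : ℂ) ^ (b - 1 - (c + t * I) : ℂ) := by
    intro t u hu
    have hu0 : (0 : ℝ) < u := lt_trans zero_lt_one hu
    have hu' : (u : ℂ) ≠ 0 := by exact_mod_cast hu0.ne'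
    rw [cpow_sub _ _ hu', ofReal_cpow hu0.le, div_eq_mul_inv, cpow_def_of_ne_zero hu' (_ + _),
      ← Complex.exp_neg, ← ofReal_log hu0.le, mul_comm (Real.log u : ℂ)]
    push_cast
    rfl
  have hg : Integrable (fun u : ℝ => ((u ^ (b - 1) : ℝ) : ℂ) * cexp (-(c * Real.log u)))
      (volume.restrict (Ioi 1)) := by
    have := integrableOn_Ioi_cpow_of_lt (a := (b - 1 - (c + (0 : ℝ) * I) : ℂ)) (c := 1)
      (by simp; linarith) one_pos
    refine (IntegrableOn.congr_fun this (fun u hu => ?_) measurableSet_Ioi)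
    rw [← hterm 0 u hu]; simp
  have key := integral_mul_smoothW_eq (volume.restrict (Ioi (1 : ℝ))) hh hc0 j y
    (l := fun u => Real.log u) Real.measurable_log hg
  have hv : ∀ t : ℝ, ∫ u in Ioi (1 : ℝ), ((u ^ (b - 1) : ℝ) : ℂ) *
      cexp (-((c + t * I) * Real.log u)) = 1 / (c + t * I - b) := by
    intro t
    rw [setIntegral_congr_fun measurableSet_Ioi (hterm t), integral_Ioi_cpow_of_lt _ one_pos]
    · simp only [ofReal_one, one_cpow]
      rw [show (b - 1 - (c + t * I) + 1 : ℂ) = -(c + t * I - b) by ring, neg_div_neg_eq]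
    · simp; linarith
  simp_rw [hv] at key
  refine ⟨key.1, ?_⟩
  rw [← key.2, ← integral_complex_ofReal]
  push_cast
  rfl

theorem smoothPsi_sub_eq {q : ℕ} (χ : DirichletCharacter ℂ q) {b : ℝ} (hb : b ≤ 1) (e : ℂ)
    (hh : 0 < h) (hc : 1 < c) (j : ℕ) (y : ℝ) :
    Integrable (fun t : ℝ => smoothM h j (c + t * I) * cexp (y * (c + t * I)) *
        (vonMangoldtSeries χ (c + t * I) - e * (1 / (c + t * I - b)))) ∧
    smoothPsi χ h j y - e * (∫ u in Ioi (1 : ℝ), u ^ (b - 1) * smoothW h j (y - Real.log u) : ℝ) =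
      (2 * Real.pi : ℂ)⁻¹ *
        ∫ t : ℝ, smoothM h j (c + t * I) * cexp (y * (c + t * I)) *
          (vonMangoldtSeries χ (c + t * I) - e * (1 / (c + t * I - b))) := by
  have h1 := smoothPsi_eq χ hh hc j y
  have h2 := integral_rpow_mul_smoothW_eq hb hh hc j y
  have h3 := h2.1.const_mul e
  have heq : ∀ t : ℝ, smoothM h j (c + t * I) * cexp (y * (c + t * I)) *
        (vonMangoldtSeries χ (c + t * I) - e * (1 / (c + t * I - b))) =
      smoothM h j (c + t * I) * cexp (y * (c + t * I)) * vonMangoldtSeries χ (c + t * I) -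
        e * (smoothM h j (c + t * I) * cexp (y * (c + t * I)) * (1 / (c + t * I - b))) := by
    intro t; ring
  simp_rw [heq]
  refine ⟨h1.1.sub h3, ?_⟩
  rw [integral_sub h1.1 h3, h1.2, h2.2, integral_const_mul]
  ring

end SmoothTransform

section Contour

open DirichletCharacter Complex Filter Topology Set MeasureTheory ComplexConjugate Metric

variable {h : ℝ}

theorem integral_inv_norm_line_le {σ T : ℝ} (hσ : 0 < σ) (hT : 0 ≤ T) :
    ∫ t in (-T)..T, 1 / ‖(σ + t * I : ℂ)‖ ≤ 2 * Real.log (1 + 2 * T / σ) := by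
  have hd : ∀ t : ℝ, HasDerivAt (fun t : ℝ => Real.arsinh (t / σ)) (1 / ‖(σ + t * I : ℂ)‖) t := by
    intro t
    refine (((hasDerivAt_id t).div_const σ).arsinh).congr_deriv ?_
    have h1 : ‖(σ + t * I : ℂ)‖ = σ * √(1 + (t / σ) ^ 2) := by
      rw [← Real.sqrt_sq (norm_nonneg _), norm_sq_line, ← Real.sqrt_sq hσ.le, ← Real.sqrt_mul
        (by positivity), Real.sqrt_sq hσ.le]
      congr 1; field_simp
    rw [h1]
    simp only [id, smul_eq_mul]
    field_simp
  have hcont : Continuous fun t : ℝ => 1 / ‖(σ + t * I : ℂ)‖ :=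
    continuous_const.div (by fun_prop) fun t => norm_ne_zero_iff.mpr (line_ne_zero hσ t)
  rw [intervalIntegral.integral_eq_sub_of_hasDerivAt (fun t _ => hd t)
    (hcont.intervalIntegrable _ _), neg_div, Real.arsinh_neg, sub_neg_eq_add, ← two_mul]
  gcongr
  rw [Real.arsinh]
  have h0 : 0 ≤ T / σ := by positivity
  have : √(1 + (T / σ) ^ 2) ≤ 1 + T / σ := by
    rw [Real.sqrt_le_left (by positivity)]; nlinarith
  refine Real.log_le_log (by positivity) ?_
  rw [mul_div_assoc]; linarith

theorem norm_contour_le {G : ℂ → ℂ} {σ c T K B v : ℝ} (j : ℕ) (hh : 0 < h) (hσ : 0 < σ)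
    (hσc : σ ≤ c) (hT : 0 < T) (hK : 0 ≤ K) (hB : 0 ≤ B) (hv : 0 ≤ v)
    (hdiff : DifferentiableOn ℂ G (uIcc σ c ×ℂ uIcc (-T) T))
    (hGK : ∀ s ∈ uIcc σ c ×ℂ uIcc (-T) T, ‖G s‖ ≤ K) (hGB : ∀ t : ℝ, ‖G (c + t * I)‖ ≤ B)
    (hinteg : Integrable fun t : ℝ => smoothM h j (c + t * I) * cexp (v * (c + t * I)) *
      G (c + t * I)) :
    ‖(2 * Real.pi : ℂ)⁻¹ * ∫ t : ℝ, smoothM h j (c + t * I) * cexp (v * (c + t * I)) *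
      G (c + t * I)‖ ≤ Real.pi⁻¹ * (K * Real.exp (σ * (v + (j + 1) * h)) * Real.log (1 + 2 * T / σ) +
        (K * (c - σ) / T + B / (j + 1)) * ((Real.exp (h * c) + 1) / (h * T)) ^ (j + 1) *
          Real.exp (v * c)) := by
  have hc : 0 < c := hσ.trans_le hσc
  set F : ℂ → ℂ := fun s => smoothM h j s * cexp (v * s) * G s with hF
  set Q := ((Real.exp (h * c) + 1) / (h * T)) ^ (j + 1) with hQ
  have hQ0 : 0 ≤ Q := by positivity
  -- the tails
  have htail : ∀ ε : ℝ, (ε = 1 ∨ ε = -1) →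
      ‖∫ t in Ioi T, F (c + (ε * t : ℝ) * I)‖ ≤ B / (j + 1) * Q * Real.exp (v * c) := by
    intro ε hε
    have hε1 : |ε| = 1 := by rcases hε with rfl | rfl <;> simp
    have hbd : ∀ t ∈ Ioi T, ‖F (c + (ε * t : ℝ) * I)‖ ≤
        B * Real.exp (v * c) * ((Real.exp (h * c) + 1) / h) ^ (j + 1) * t ^ (-(j + 2 : ℝ)) := by
      intro t ht
      have ht0 : 0 < t := hT.trans ht
      have hts : t ≤ ‖(c + (ε * t : ℝ) * I : ℂ)‖ := by
        have := abs_im_le_norm (c + (ε * t : ℝ) * I : ℂ)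
        simpa [abs_mul, hε1, abs_of_pos ht0] using this
      have hM := norm_smoothM_le_pow hh j (c + (ε * t : ℝ) * I : ℂ)
      have hre : (c + (ε * t : ℝ) * I : ℂ).re = c := by simp
      rw [hre] at hM
      have hM2 : 1 / ‖(c + (ε * t : ℝ) * I : ℂ)‖ * ((Real.exp (h * c) + 1) /
          (h * ‖(c + (ε * t : ℝ) * I : ℂ)‖)) ^ (j + 1) ≤
          1 / t * ((Real.exp (h * c) + 1) / (h * t)) ^ (j + 1) := by gcongr
      have hE : ‖cexp (v * (c + (ε * t : ℝ) * I))‖ = Real.exp (v * c) := by rw [norm_exp]; simp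
      have hpow : t ^ (-(j + 2 : ℝ)) = t⁻¹ ^ (j + 2) := by
        rw [Real.rpow_neg ht0.le, inv_pow]; norm_cast
      simp only [hF]
      rw [norm_mul, norm_mul, hE, hpow]
      calc _ ≤ 1 / t * ((Real.exp (h * c) + 1) / (h * t)) ^ (j + 1) * Real.exp (v * c) * B := by
            gcongr
            · exact hM.trans hM2
            · exact hGB _
        _ = _ := by rw [← div_div, div_pow _ t, one_div]; ring
    have hi : IntegrableOn (fun t : ℝ => B * Real.exp (v * c) *
        ((Real.exp (h * c) + 1) / h) ^ (j + 1) * t ^ (-(j + 2 : ℝ))) (Ioi T) :=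
      (integrableOn_Ioi_rpow_of_lt (by
        have : (0 : ℝ) ≤ j := Nat.cast_nonneg j
        linarith) hT).const_mul _
    refine (norm_integral_le_of_norm_le hi ((ae_restrict_iff' measurableSet_Ioi).mpr
      (Eventually.of_forall hbd))).trans (le_of_eq ?_)
    have hj : (0 : ℝ) ≤ j := Nat.cast_nonneg j
    rw [integral_const_mul, integral_Ioi_rpow_of_lt (by linarith) hT]
    have hpow : T ^ (-(j + 2 : ℝ) + 1) = T⁻¹ ^ (j + 1) := by
      rw [show (-(j + 2 : ℝ) + 1) = -((j + 1 : ℕ) : ℝ) by push_cast; ring, Real.rpow_neg hT.le,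
        inv_pow, Real.rpow_natCast]
    rw [hpow, hQ, ← div_div, div_pow _ T, show (-(j + 2 : ℝ) + 1) = -(j + 1) by ring, inv_pow]
    have : (j + 1 : ℝ) ≠ 0 := by positivity
    field_simp
  -- the left side
  have hleft : ‖∫ t in (-T)..T, F (σ + t * I)‖ ≤
      K * Real.exp (σ * (v + (j + 1) * h)) * (2 * Real.log (1 + 2 * T / σ)) := by
    have hcont : Continuous fun t : ℝ => 1 / ‖(σ + t * I : ℂ)‖ :=
      continuous_const.div (by fun_prop) fun t => norm_ne_zero_iff.mpr (line_ne_zero hσ t)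
    refine (intervalIntegral.norm_integral_le_of_norm_le (g := fun t =>
      K * Real.exp (σ * (v + (j + 1) * h)) * (1 / ‖(σ + t * I : ℂ)‖)) (by linarith) ?_
      ((hcont.const_mul _).intervalIntegrable _ _)).trans ?_
    · refine Eventually.of_forall fun t ht => ?_
      have hmem : (σ + t * I : ℂ) ∈ uIcc σ c ×ℂ uIcc (-T) T := by
        simp only [mem_reProdIm, uIcc_of_le hσc, uIcc_of_le (show -T ≤ T by linarith)]
        simp only [add_re, ofReal_re, mul_re, I_re, mul_zero, ofReal_im, I_im, mul_one, sub_self,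
          add_zero, add_im, mul_im, zero_add, mem_Icc, le_refl, true_and]
        exact ⟨hσc, ht.1.le, ht.2⟩
      have hM := norm_smoothM_le_exp hh j (s := (σ + t * I : ℂ)) (by simpa using hσ.le)
        (line_ne_zero hσ t)
      have hre : (σ + t * I : ℂ).re = σ := by simp
      rw [hre] at hM
      have hE : ‖cexp (v * (σ + t * I))‖ = Real.exp (v * σ) := by rw [norm_exp]; simp
      simp only [hF]
      rw [norm_mul, norm_mul, hE]
      calc _ ≤ (1 / ‖(σ + t * I : ℂ)‖ * Real.exp ((j + 1) * h * σ)) * Real.exp (v * σ) * K := by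
            gcongr
            exact hGK _ hmem
        _ = _ := by
            rw [mul_add, Real.exp_add, mul_comm σ v, mul_comm σ]; ring
    · rw [intervalIntegral.integral_const_mul]
      gcongr
      exact integral_inv_norm_line_le hσ hT.le
  -- the horizontal sides
  have hhor : ∀ τ : ℝ, |τ| = T → ‖∫ x in σ..c, F (x + τ * I)‖ ≤
      K * (c - σ) / T * Q * Real.exp (v * c) := by
    intro τ hτ
    have := intervalIntegral.norm_integral_le_of_norm_le_const (a := σ) (b := c)
      (f := fun x : ℝ => F (x + τ * I)) (C := K / T * Q * Real.exp (v * c)) fun x hx => ?_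
    · refine this.trans (le_of_eq ?_)
      rw [abs_of_nonneg (by linarith)]; ring
    · rw [uIoc_of_le hσc] at hx
      have hx0 : 0 < x := hσ.trans hx.1
      have hmem : (x + τ * I : ℂ) ∈ uIcc σ c ×ℂ uIcc (-T) T := by
        simp only [mem_reProdIm, uIcc_of_le hσc, uIcc_of_le (show -T ≤ T by linarith)]
        simp only [add_re, ofReal_re, mul_re, I_re, mul_zero, ofReal_im, I_im, mul_one, sub_self,
          add_zero, add_im, mul_im, zero_add, mem_Icc]
        exact ⟨⟨hx.1.le, hx.2⟩, abs_le.mp hτ.le⟩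
      have hts : T ≤ ‖(x + τ * I : ℂ)‖ := by
        have := abs_im_le_norm (x + τ * I : ℂ)
        simpa [hτ] using this
      have hM := norm_smoothM_le_pow hh j (x + τ * I : ℂ)
      have hre : (x + τ * I : ℂ).re = x := by simp
      rw [hre] at hM
      have hM2 : 1 / ‖(x + τ * I : ℂ)‖ * ((Real.exp (h * x) + 1) /
          (h * ‖(x + τ * I : ℂ)‖)) ^ (j + 1) ≤ 1 / T * Q := by
        rw [hQ]; gcongr; exact hx.2
      have hE : ‖cexp (v * (x + τ * I))‖ ≤ Real.exp (v * c) := by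
        rw [norm_exp, Real.exp_le_exp]
        simp only [mul_re, ofReal_re, add_re, ofReal_im, I_re, I_im, mul_zero, mul_one, sub_zero,
          zero_mul, add_zero]
        gcongr; exact hx.2
      simp only [hF]
      rw [norm_mul, norm_mul]
      calc _ ≤ (1 / T * Q) * Real.exp (v * c) * K := by
            gcongr
            · exact hM.trans hM2
            · exact hGK _ hmem
        _ = _ := by ring
  -- Cauchy's theorem
  have hFd : DifferentiableOn ℂ F (uIcc σ c ×ℂ uIcc (-T) T) := by
    intro s hs
    have hs0 : s ≠ 0 := by
      rintro rfl
      simp only [mem_reProdIm, uIcc_of_le hσc] at hs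
      exact absurd hs.1.1 (by simpa using hσ)
    have hh' : (h : ℂ) ≠ 0 := by exact_mod_cast hh.ne'
    refine DifferentiableWithinAt.mul (DifferentiableAt.differentiableWithinAt ?_) (hdiff s hs)
    unfold smoothM
    have : (h : ℂ) * s ≠ 0 := mul_ne_zero hh' hs0
    fun_prop (disch := assumption)
  have hC := integral_boundary_rect_eq_zero_of_differentiableOn F (⟨σ, -T⟩ : ℂ) (⟨c, T⟩ : ℂ) hFd
  simp only at hC
  have hsplit : ∫ t : ℝ, F (c + t * I) = (∫ t in Ioi T, F (c + ((-1) * t : ℝ) * I)) +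
      (∫ t in (-T)..T, F (c + t * I)) + ∫ t in Ioi T, F (c + (1 * t : ℝ) * I) := by
    have h1 := integral_comp_neg_Ioi T (fun t : ℝ => F (c + t * I))
    have h2 := intervalIntegral.integral_Iic_add_Ioi (b := -T) hinteg.integrableOn hinteg.integrableOn
    have h3 := intervalIntegral.integral_interval_add_Ioi (a := -T) (b := T)
      hinteg.integrableOn hinteg.integrableOn
    simp only [neg_one_mul, one_mul]
    rw [h1, ← h2, ← h3, add_assoc]
  have hmid : ‖∫ t in (-T)..T, F (c + t * I)‖ ≤ ‖∫ t in (-T)..T, F (σ + t * I)‖ +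
      ‖∫ x in σ..c, F (x + (-T : ℝ) * I)‖ + ‖∫ x in σ..c, F (x + T * I)‖ := by
    have h1 : I * (∫ t in (-T)..T, F (c + t * I)) = I * (∫ t in (-T)..T, F (σ + t * I)) -
        (∫ x in σ..c, F (x + (-T : ℝ) * I)) + ∫ x in σ..c, F (x + T * I) := by
      simp only [smul_eq_mul] at hC
      linear_combination hC
    have h2 : ‖∫ t in (-T)..T, F (c + t * I)‖ = ‖I * (∫ t in (-T)..T, F (c + t * I))‖ := by simp
    rw [h2, h1]
    refine (norm_add_le _ _).trans ?_
    gcongr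
    refine (norm_sub_le _ _).trans ?_
    simp
  have h1 := htail (-1) (Or.inr rfl)
  have h2 := htail 1 (Or.inl rfl)
  have h3 := hhor (-T) (by rw [abs_neg, abs_of_pos hT])
  have h4 := hhor T (abs_of_pos hT)
  have htot : ‖∫ t : ℝ, F (c + t * I)‖ ≤
      2 * (K * Real.exp (σ * (v + (j + 1) * h)) * Real.log (1 + 2 * T / σ) +
        (K * (c - σ) / T + B / (j + 1)) * Q * Real.exp (v * c)) := by
    rw [hsplit]
    refine (norm_add_le _ _).trans ?_
    have := norm_add_le (∫ t in Ioi T, F (c + ((-1) * t : ℝ) * I)) (∫ t in (-T)..T, F (c + t * I))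
    linarith
  rw [norm_mul, norm_inv, norm_mul, norm_real, Real.norm_of_nonneg Real.pi_pos.le,
    Complex.norm_ofNat, mul_inv]
  calc _ ≤ 2⁻¹ * Real.pi⁻¹ * (2 * (K * Real.exp (σ * (v + (j + 1) * h)) * Real.log (1 + 2 * T / σ) +
        (K * (c - σ) / T + B / (j + 1)) * Q * Real.exp (v * c))) := by gcongr
    _ = _ := by ring

end Contour

section SmoothPsiBound

open DirichletCharacter Complex Filter Topology Set MeasureTheory ComplexConjugate Metric

/-- The error bound obtained by moving the contour for the smoothed sum. -/
noncomputable def contourErr (h : ℝ) (j : ℕ) (H T c v : ℝ) : ℝ :=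
  Real.pi⁻¹ * (4100 * H * Real.exp ((1 - 0.95 * (0.0286 / H)) * (v + (j + 1) * h)) *
      Real.log (1 + 2 * T / (1 - 0.95 * (0.0286 / H))) +
    (4100 * H * (c - (1 - 0.95 * (0.0286 / H))) / T + 2 / (c - 1) / (j + 1)) *
      ((Real.exp (h * c) + 1) / (h * T)) ^ (j + 1) * Real.exp (v * c))

variable {q : ℕ} [NeZero q] {h H T T₁ c v : ℝ}

theorem norm_smoothPsi_sub_le_aux (χ : DirichletCharacter ℂ q) {f : ℂ → ℂ} (hf : Differentiable ℂ f)
    {b : ℝ} (hb : b ≤ 1) {e : ℂ} (he : ‖e‖ ≤ 1) (j : ℕ) (hh : 0 < h) (hH : 12 ≤ H) (hT : 0 < T)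
    (hc : 1 < c) (hc' : c < 1.5) (hv : 0 ≤ v)
    (hne : ∀ s : ℂ, 1 - 0.95 * (0.0286 / H) ≤ s.re → s.re ≤ c → |s.im| ≤ T → f s ≠ 0)
    (hK : ∀ s : ℂ, 1 - 0.95 * (0.0286 / H) ≤ s.re → s.re ≤ c → |s.im| ≤ T →
      ‖deriv f s / f s‖ ≤ 4100 * H)
    (heq : ∀ s : ℂ, 1 < s.re → vonMangoldtSeries χ s - e * (1 / (s - b)) = -(deriv f s / f s)) :
    ‖smoothPsi χ h j v - e * (∫ u in Ioi (1 : ℝ), u ^ (b - 1) * smoothW h j (v - Real.log u) : ℝ)‖ ≤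
      contourErr h j H T c v := by
  have hη : 0.0286 / H ≤ 0.0024 := by rw [div_le_iff₀ (by linarith)]; linarith
  have hη0 : 0 < 0.0286 / H := by positivity
  have hσ : 0 < 1 - 0.95 * (0.0286 / H) := by linarith
  have hσc : 1 - 0.95 * (0.0286 / H) ≤ c := by linarith
  have key := smoothPsi_sub_eq χ hb e hh hc j v
  rw [key.2]
  have hline : ∀ t : ℝ, vonMangoldtSeries χ (c + t * I) - e * (1 / (c + t * I - b)) =
      -(deriv f (c + t * I) / f (c + t * I)) := fun t => heq _ (by simpa using hc)
  have hmem : ∀ s ∈ uIcc (1 - 0.95 * (0.0286 / H)) c ×ℂ uIcc (-T) T,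
      1 - 0.95 * (0.0286 / H) ≤ s.re ∧ s.re ≤ c ∧ |s.im| ≤ T := by
    intro s hs
    rw [mem_reProdIm, uIcc_of_le hσc, uIcc_of_le (by linarith)] at hs
    exact ⟨hs.1.1, hs.1.2, abs_le.mpr hs.2⟩
  have hinteg := key.1
  simp_rw [hline] at hinteg ⊢
  refine norm_contour_le (G := fun s => -(deriv f s / f s)) j hh hσ hσc hT (by positivity)
    (B := 2 / (c - 1)) (div_nonneg zero_le_two (by linarith)) hv ?_ ?_ ?_ hinteg
  · intro s hs
    obtain ⟨h1, h2, h3⟩ := hmem s hs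
    exact ((((hf.deriv).differentiableAt).div hf.differentiableAt (hne s h1 h2 h3)).neg
      ).differentiableWithinAt
  · intro s hs
    obtain ⟨h1, h2, h3⟩ := hmem s hs
    rw [norm_neg]; exact hK s h1 h2 h3
  · intro t
    rw [← hline t]
    have h1 := norm_vonMangoldtSeries_le χ (s := c + t * I) (by simpa using hc) (by simpa using hc')
    have hre : (c + t * I : ℂ).re = c := by simp
    rw [hre] at h1
    have h2 : ‖e * (1 / (c + t * I - b))‖ ≤ 1 / (c - 1) := by
      rw [norm_mul, norm_div, norm_one]
      refine (mul_le_of_le_one_left (by positivity) he).trans ?_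
      have : c - 1 ≤ ‖(c + t * I - b : ℂ)‖ := by
        have := (le_abs_self _).trans (abs_re_le_norm (c + t * I - b : ℂ))
        simp at this
        linarith
      gcongr
    refine (norm_sub_le _ _).trans ?_
    rw [show 2 / (c - 1) = 1 / (c - 1) + 1 / (c - 1) by ring]
    linarith

open Classical in
theorem norm_smoothPsi_sub_le (χ : DirichletCharacter ℂ q) (hφ : 200 ≤ q.totient) (j : ℕ)
    (hh : 0 < h) (hH : 12 ≤ H) (hHT : H = condLog q T₁ + 3.47)
    (hzero : ∀ ρ, charF χ ρ = 0 → |ρ.im| ≤ T₁ → 0.0286 ≤ (1 - ρ.re) * H) (hT : 0 < T)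
    (hTT : T + 0.851 ≤ T₁) (hc : 1 < c) (hc' : c ≤ 1 + 3 * (0.0286 / H)) (hv : 0 ≤ v) :
    ‖smoothPsi χ h j v - (if χ = 1 then 1 else 0 : ℂ) *
      (∫ u in Ioi (1 : ℝ), u ^ ((1 : ℝ) - 1) * smoothW h j (v - Real.log u) : ℝ)‖ ≤
      contourErr h j H T c v := by
  have hη : 0.0286 / H ≤ 0.0024 := by rw [div_le_iff₀ (by linarith)]; linarith
  refine norm_smoothPsi_sub_le_aux χ (differentiable_charF χ) le_rfl (by split_ifs <;> simp) j hh hH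
    hT hc (by linarith) hv (fun s h1 h2 h3 h0 => ?_) (fun s h1 h2 h3 => ?_) fun s hs => ?_
  · have h4 := hzero s h0 (by linarith)
    have hHpos : 0 < H := by linarith
    have h5 : (1 - s.re) * H ≤ 0.95 * (0.0286 / H) * H := by gcongr; linarith
    rw [mul_assoc, div_mul_cancel₀ _ hHpos.ne'] at h5
    linarith
  · exact norm_logDeriv_charF_le χ hφ hH hHT hzero (by linarith) h1 (by linarith)
  · rw [logDeriv_charF χ hs]
    split_ifs
    · simp only [ofReal_one]; ring
    · simp

theorem norm_smoothPsi_add_le (χ : DirichletCharacter ℂ q) (hφ : 200 ≤ q.totient) (j : ℕ)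
    (hh : 0 < h) (hH : 12 ≤ H) (hHT : H = condLog q T₁ + 3.47) (hχ : χ ≠ 1) {β : ℝ}
    (hβ : charF χ β = 0) (hβd : deriv (charF χ) β ≠ 0)
    (hzero : ∀ ρ, charF χ ρ = 0 → ρ ≠ β → |ρ.im| ≤ T₁ → 0.0286 ≤ (1 - ρ.re) * H) (hT : 0 < T)
    (hTT : T + 0.851 ≤ T₁) (hc : 1 < c) (hc' : c ≤ 1 + 3 * (0.0286 / H)) (hv : 0 ≤ v) :
    ‖smoothPsi χ h j v +
      (∫ u in Ioi (1 : ℝ), u ^ (β - 1) * smoothW h j (v - Real.log u) : ℝ)‖ ≤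
      contourErr h j H T c v := by
  have hη : 0.0286 / H ≤ 0.0024 := by rw [div_le_iff₀ (by linarith)]; linarith
  have hHpos : 0 < H := by linarith
  have hβ1 : β < 1 := by
    by_contra hcon
    exact charF_ne_zero_of_one_le_re χ (s := β) (by simpa using hcon) hβ
  set g := dslope (charF χ) β with hg
  have hgd : Differentiable ℂ g := by
    rw [← differentiableOn_univ]
    exact (differentiableOn_dslope univ_mem).mpr (differentiable_charF χ).differentiableOn
  have hgs : ∀ s : ℂ, s ≠ β → g s = (s - β)⁻¹ * charF χ s := by
    intro s hs
    rw [hg, dslope_of_ne _ hs, slope_def_module, hβ, sub_zero, smul_eq_mul]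
  have hgβ : g β = deriv (charF χ) β := dslope_same _ _
  have hlog : ∀ s : ℂ, s ≠ β → charF χ s ≠ 0 →
      deriv g s / g s = deriv (charF χ) s / charF χ s - 1 / (s - β) := by
    intro s hs h0
    have hsub : s - β ≠ 0 := sub_ne_zero.mpr hs
    have hev : g =ᶠ[𝓝 s] fun z => (z - β)⁻¹ * charF χ z := by
      filter_upwards [isOpen_ne.mem_nhds hs] with z hz using hgs z hz
    have h1 : HasDerivAt (fun z : ℂ => (z - β)⁻¹) (-1 / (s - β) ^ 2) s :=
      ((hasDerivAt_id s).sub_const _).inv hsub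
    have h2 := h1.mul (differentiable_charF χ s).hasDerivAt
    have h3 : deriv (fun z : ℂ => (z - β)⁻¹ * charF χ z) s = _ := h2.deriv
    rw [hev.deriv_eq, h3, hgs s hs]
    field_simp
    ring
  have hne : ∀ s : ℂ, 1 - 0.95 * (0.0286 / H) ≤ s.re → |s.im| ≤ T₁ → s ≠ β → charF χ s ≠ 0 := by
    intro s h1 h3 hs h0
    have h4 := hzero s h0 hs h3
    have h5 : (1 - s.re) * H ≤ 0.95 * (0.0286 / H) * H := by gcongr; linarith
    rw [mul_assoc, div_mul_cancel₀ _ hHpos.ne'] at h5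
    linarith
  have hgne : ∀ s : ℂ, 1 - 0.95 * (0.0286 / H) ≤ s.re → |s.im| ≤ T₁ → g s ≠ 0 := by
    intro s h1 h3
    by_cases hs : s = β
    · rw [hs, hgβ]; exact hβd
    · rw [hgs s hs]
      exact mul_ne_zero (inv_ne_zero (sub_ne_zero.mpr hs)) (hne s h1 h3 hs)
  have hb : ∀ s : ℂ, s ≠ β → 1 - 0.95 * (0.0286 / H) ≤ s.re → s.re ≤ c → |s.im| ≤ T →
      ‖deriv g s / g s‖ ≤ 4100 * H := by
    intro s hs h1 h2 h3
    rw [hlog s hs (hne s h1 (by linarith) hs)]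
    exact norm_logDeriv_charF_sub_le χ hφ hH hHT hβ hβd hzero hs (by linarith) h1 (by linarith)
  have key := norm_smoothPsi_sub_le_aux χ hgd hβ1.le (e := -1) (by simp) j hh hH hT hc
    (by linarith) hv (fun s h1 h2 h3 => hgne s h1 (by linarith)) (fun s h1 h2 h3 => ?_)
    fun s hs => ?_
  · simpa using key
  · by_cases hs : s = β
    · have hcont : ContinuousAt (fun t : ℝ => ‖deriv g (s + t) / g (s + t)‖) 0 := by
        have hg0 : g (s + (0 : ℝ)) ≠ 0 := by simpa using hgne s h1 (by linarith)
        have hc1 : ContinuousAt (fun z : ℂ => deriv g z / g z) (s + (0 : ℝ)) :=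
          hgd.deriv.continuous.continuousAt.div hgd.continuous.continuousAt hg0
        exact (ContinuousAt.comp (f := fun t : ℝ => (s + t : ℂ)) hc1
          (by fun_prop : Continuous fun t : ℝ => (s + t : ℂ)).continuousAt).norm
      have hlim := hcont.tendsto.mono_left (nhdsWithin_le_nhds (s := Ioi (0 : ℝ)))
      simp only [ofReal_zero, add_zero] at hlim
      refine le_of_tendsto hlim ?_
      have hβre : s.re = β := by rw [hs]; simp
      filter_upwards [Ioo_mem_nhdsGT (show (0 : ℝ) < c - β by linarith)] with t ht
      refine hb _ ?_ ?_ ?_ ?_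
      · rw [hs]; intro h; simp at h; exact ht.1.ne' h
      · simp; linarith [ht.1]
      · simp; linarith [ht.2]
      · simpa using h3
    · exact hb s hs h1 h2 h3
  · have hsβ : s ≠ β := by rintro rfl; simp at hs; linarith
    rw [hlog s hsβ (charF_ne_zero_of_one_le_re χ hs.le), logDeriv_charF χ hs, if_neg hχ]
    ring

end SmoothPsiBound

section ClassSum

open DirichletCharacter Complex Filter Topology Set MeasureTheory ComplexConjugate Metric

variable {h : ℝ}

theorem integral_rpow_mul_smoothW_le {b : ℝ} (hb : 0 < b) (hh : 0 < h) (j : ℕ) (v : ℝ)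
    (hv : 0 ≤ v) :
    ∫ u in Ioi (1 : ℝ), u ^ (b - 1) * smoothW h j (v - Real.log u) ≤
      (Real.exp (b * (v + (j + 1) * h)) - 1) / b := by
  set A := Real.exp (v + (j + 1) * h) with hA
  have hA1 : 1 ≤ A := Real.one_le_exp (by positivity)
  have hz : ∀ u ∈ Ioi (1 : ℝ), u ∉ Ioc 1 A → u ^ (b - 1) * smoothW h j (v - Real.log u) = 0 := by
    intro u hu hu'
    have : A < u := by simpa [show 1 < u from hu] using hu'
    have hl : v + (j + 1) * h < Real.log u := (Real.lt_log_iff_exp_lt (by linarith)).mpr this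
    rw [smoothW_eq_zero hh j (by linarith), mul_zero]
  rw [setIntegral_eq_of_subset_of_forall_sdiff_eq_zero measurableSet_Ioi
    (Ioc_subset_Ioi_self : Ioc 1 A ⊆ Ioi 1) (fun u hu => hz u hu.1 hu.2)]
  have hcont : ContinuousOn (fun u : ℝ => u ^ (b - 1)) (Icc 1 A) := fun u hu =>
    (Real.continuousAt_rpow_const _ _ (Or.inl (by linarith [hu.1]))).continuousWithinAt
  have hi : IntegrableOn (fun u : ℝ => u ^ (b - 1)) (Ioc 1 A) :=
    hcont.integrableOn_Icc.mono_set Ioc_subset_Icc_self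
  have hcont2 : ContinuousOn (fun u : ℝ => u ^ (b - 1) * smoothW h j (v - Real.log u)) (Icc 1 A) :=
    hcont.mul ((continuous_smoothW h j).comp_continuousOn (continuousOn_const.sub
      (Real.continuousOn_log.mono fun u hu => by
        simp only [mem_compl_iff, mem_singleton_iff]; linarith [hu.1])))
  refine (setIntegral_mono_on (hcont2.integrableOn_Icc.mono_set Ioc_subset_Icc_self) hi
    measurableSet_Ioc fun u hu => ?_).trans ?_
  · exact mul_le_of_le_one_right (Real.rpow_nonneg (by linarith [hu.1]) _) (smoothW_mem hh j _).2
  · rw [← intervalIntegral.integral_of_le hA1, integral_rpow (Or.inl (by linarith)), Real.one_rpow,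
      sub_add_cancel, hA, ← Real.exp_mul, mul_comm b]

theorem exp_sub_one_le_integral_smoothW (hh : 0 < h) (j : ℕ) (v : ℝ) (hv : 0 ≤ v) :
    Real.exp v - 1 ≤ ∫ u in Ioi (1 : ℝ), u ^ ((1 : ℝ) - 1) * smoothW h j (v - Real.log u) := by
  simp only [sub_self, Real.rpow_zero, one_mul]
  set A := Real.exp (v + (j + 1) * h) with hA
  have hA1 : Real.exp v ≤ A := Real.exp_le_exp.mpr (by linarith [show 0 ≤ (j + 1) * h by positivity])
  have hv1 : 1 ≤ Real.exp v := Real.one_le_exp hv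
  have hcont : ContinuousOn (fun u : ℝ => smoothW h j (v - Real.log u)) (Icc 1 A) :=
    (continuous_smoothW h j).comp_continuousOn (continuousOn_const.sub
      (Real.continuousOn_log.mono fun u hu => by
        simp only [mem_compl_iff, mem_singleton_iff]; linarith [hu.1]))
  have hz : ∀ u ∈ Ioi (1 : ℝ), u ∉ Ioc 1 A → smoothW h j (v - Real.log u) = 0 := by
    intro u hu hu'
    have : A < u := by simpa [show 1 < u from hu] using hu'
    have hl : v + (j + 1) * h < Real.log u := (Real.lt_log_iff_exp_lt (by linarith)).mpr this
    rw [smoothW_eq_zero hh j (by linarith)]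
  rw [setIntegral_eq_of_subset_of_forall_sdiff_eq_zero measurableSet_Ioi
    (Ioc_subset_Ioi_self : Ioc 1 A ⊆ Ioi 1) (fun u hu => hz u hu.1 hu.2)]
  have h1 : ∫ u in Ioc 1 (Real.exp v), smoothW h j (v - Real.log u) = Real.exp v - 1 := by
    rw [setIntegral_congr_fun measurableSet_Ioc (g := fun _ => (1 : ℝ)) fun u hu => ?_]
    · simp [hv1]
    · refine smoothW_eq_one hh j ?_
      have := Real.log_le_log (by linarith [hu.1]) hu.2
      rw [Real.log_exp] at this
      linarith
  rw [← h1]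
  refine setIntegral_mono_set (hcont.integrableOn_Icc.mono_set Ioc_subset_Icc_self)
    (Eventually.of_forall fun u => (smoothW_mem hh j _).1)
    (Ioc_subset_Ioc_right hA1).eventuallyLE

variable {q : ℕ} [NeZero q]

/-- The Chebyshev function of the residue class `a`. -/
noncomputable def classPsi (a : ZMod q) (x : ℝ) : ℝ :=
  ∑ n ∈ Finset.Ioc 0 ⌊x⌋₊, if a = n then ArithmeticFunction.vonMangoldt n else 0

/-- The smoothed Chebyshev function of the residue class `a`. -/
noncomputable def classSmoothPsi (a : ZMod q) (h : ℝ) (j : ℕ) (v : ℝ) : ℝ :=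
  ∑ n ∈ Finset.Ioc 0 ⌊Real.exp (v + (j + 1) * h)⌋₊,
    if a = n then ArithmeticFunction.vonMangoldt n * smoothW h j (v - Real.log n) else 0

theorem smoothW_eq_zero_of_notMem (hh : 0 < h) (j : ℕ) (v : ℝ) {n : ℕ} (hn0 : n ≠ 0)
    (hn : n ∉ Finset.Ioc 0 ⌊Real.exp (v + (j + 1) * h)⌋₊) : smoothW h j (v - Real.log n) = 0 := by
  have h1 : Real.exp (v + (j + 1) * h) < n := by
    rw [Finset.mem_Ioc, not_and, not_le] at hn
    exact Nat.lt_of_floor_lt (hn (Nat.pos_of_ne_zero hn0))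
  have hl : v + (j + 1) * h < Real.log n :=
    (Real.lt_log_iff_exp_lt (by positivity)).mpr h1
  exact smoothW_eq_zero hh j (by linarith)

theorem smoothPsi_eq_sum (χ : DirichletCharacter ℂ q) (hh : 0 < h) (j : ℕ) (v : ℝ) :
    smoothPsi χ h j v = ∑ n ∈ Finset.Ioc 0 ⌊Real.exp (v + (j + 1) * h)⌋₊,
      χ n * ArithmeticFunction.vonMangoldt n * smoothW h j (v - Real.log n) := by
  refine tsum_eq_sum fun n hn => ?_
  rcases eq_or_ne n 0 with rfl | hn0
  · simp
  · rw [smoothW_eq_zero_of_notMem hh j v hn0 hn]; simp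

theorem totient_mul_classSmoothPsi {a : ZMod q} (ha : IsUnit a) (hh : 0 < h) (j : ℕ) (v : ℝ) :
    (q.totient * classSmoothPsi a h j v : ℂ) =
      ∑ χ : DirichletCharacter ℂ q, χ a⁻¹ * smoothPsi χ h j v := by
  simp_rw [smoothPsi_eq_sum _ hh, Finset.mul_sum]
  rw [Finset.sum_comm, classSmoothPsi]
  push_cast
  rw [Finset.mul_sum]
  refine Finset.sum_congr rfl fun n _ => ?_
  have := sum_char_inv_mul_char_eq ℂ ha (n : ZMod q)
  simp_rw [← mul_assoc]
  rw [← Finset.sum_mul, ← Finset.sum_mul, this]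
  split_ifs <;> simp [mul_assoc]

theorem classPsi_le (a : ZMod q) (hh : 0 < h) (j : ℕ) {x : ℝ} (hx : 1 ≤ x) :
    classPsi a x ≤ classSmoothPsi a h j (Real.log x) := by
  have hx0 : 0 < x := by linarith
  unfold classPsi classSmoothPsi
  have hsub : Finset.Ioc 0 ⌊x⌋₊ ⊆ Finset.Ioc 0 ⌊Real.exp (Real.log x + (j + 1) * h)⌋₊ := by
    refine Finset.Ioc_subset_Ioc_right (Nat.floor_mono ?_)
    calc x = Real.exp (Real.log x) := (Real.exp_log hx0).symm
      _ ≤ _ := Real.exp_le_exp.mpr (by linarith [show 0 ≤ (j + 1) * h by positivity])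
  refine le_trans (le_of_eq ?_) (Finset.sum_le_sum_of_subset_of_nonneg hsub fun n _ _ => ?_)
  · refine Finset.sum_congr rfl fun n hn => ?_
    rw [Finset.mem_Ioc] at hn
    have hn1 : (n : ℝ) ≤ x := (Nat.le_floor_iff hx0.le).mp hn.2
    rw [smoothW_eq_one hh j, mul_one]
    have : (0 : ℝ) < n := by exact_mod_cast hn.1
    linarith [Real.log_le_log this hn1]
  · split_ifs
    · exact mul_nonneg ArithmeticFunction.vonMangoldt_nonneg (smoothW_mem hh j _).1
    · exact le_rfl

theorem le_classPsi (a : ZMod q) (hh : 0 < h) (j : ℕ) {x : ℝ} (hx : 1 ≤ x) :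
    classSmoothPsi a h j (Real.log x - (j + 1) * h) ≤ classPsi a x := by
  have hx0 : 0 < x := by linarith
  unfold classPsi classSmoothPsi
  rw [sub_add_cancel, Real.exp_log hx0]
  refine Finset.sum_le_sum fun n _ => ?_
  split_ifs
  · exact mul_le_of_le_one_right ArithmeticFunction.vonMangoldt_nonneg (smoothW_mem hh j _).2
  · exact le_rfl

theorem totient_mul_classSmoothPsi_sub_le {a : ZMod q} (ha : IsUnit a) (hφ : 200 ≤ q.totient)
    {H T T₁ c v b : ℝ} (j : ℕ) (hh : 0 < h) (hH : 12 ≤ H) (hHT : H = condLog q T₁ + 3.47)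
    (hT : 0 < T) (hTT : T + 0.851 ≤ T₁) (hc : 1 < c) (hc' : c ≤ 1 + 3 * (0.0286 / H)) (hv : 0 ≤ v)
    (hb : 0 < b)
    (hexc : ∀ χ : DirichletCharacter ℂ q, ∀ β : ℝ, χ ≠ 1 → χ ^ 2 = 1 → charF χ β = 0 →
      (1 - β) * H < 0.0286 → β ≤ b) :
    |q.totient * classSmoothPsi a h j v -
      ∫ u in Ioi (1 : ℝ), u ^ ((1 : ℝ) - 1) * smoothW h j (v - Real.log u)| ≤
      q.totient * contourErr h j H T c v + Real.exp (b * (v + (j + 1) * h)) / b := by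
  classical
  set J := ∫ u in Ioi (1 : ℝ), u ^ ((1 : ℝ) - 1) * smoothW h j (v - Real.log u) with hJ
  set R := Real.exp (b * (v + (j + 1) * h)) / b with hR
  have hR0 : 0 ≤ R := by positivity
  have hη : 0.0286 / H ≤ 0.0024 := by rw [div_le_iff₀ (by linarith)]; linarith
  have hH0 : 0 < H := by linarith
  have hnear : ∀ χ : DirichletCharacter ℂ q, ∀ ρ : ℂ, charF χ ρ = 0 → |ρ.im| ≤ T₁ →
      (1 - ρ.re) * H < 0.0286 → χ ≠ 1 ∧ χ ^ 2 = 1 ∧ ρ.im = 0 ∧ deriv (charF χ) ρ ≠ 0 := by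
    intro χ ρ h1 h2 h3
    rcases zero_free χ hφ h2 h1 (hHT ▸ hH) (hHT ▸ h3) with h4 | ⟨rfl, h4⟩
    · exact h4
    · exfalso
      refine charF_one_ne_zero (s := ρ) ?_ h1
      have h5 : 1 - ρ.re < 0.0286 / H := by rwa [lt_div_iff₀ hH0]
      have h6 : ρ.re < 1 := by
        by_contra hcon
        exact charF_ne_zero_of_one_le_re _ (not_lt.mp hcon) h1
      have h7 := Complex.norm_le_abs_re_add_abs_im (ρ - 1)
      simp only [sub_re, one_re, sub_im, one_im, sub_zero] at h7
      rw [abs_sub_comm, abs_of_pos (by linarith)] at h7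
      linarith
  let Exc : DirichletCharacter ℂ q → Prop := fun χ =>
    ∃ ρ : ℂ, charF χ ρ = 0 ∧ |ρ.im| ≤ T₁ ∧ (1 - ρ.re) * H < 0.0286
  have huniq : ∀ χ₁ χ₂ : DirichletCharacter ℂ q, ∀ ρ₁ ρ₂ : ℂ, charF χ₁ ρ₁ = 0 → charF χ₂ ρ₂ = 0 →
      |ρ₁.im| ≤ T₁ → |ρ₂.im| ≤ T₁ → (1 - ρ₁.re) * H < 0.0286 → (1 - ρ₂.re) * H < 0.0286 →
      χ₁ = χ₂ ∧ ρ₁ = ρ₂ := by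
    intro χ₁ χ₂ ρ₁ ρ₂ h1 h2 h3 h4 h5 h6
    have e1 := hnear χ₁ ρ₁ h1 h3 h5
    have e2 := hnear χ₂ ρ₂ h2 h4 h6
    exact exceptional_unique hφ (by linarith : 0 ≤ T₁) (hHT ▸ hH) e1.1 e2.1 e1.2.1 e2.2.1 h1 h2
      e1.2.2.1 e2.2.2.1 (hHT ▸ h5) (hHT ▸ h6)
  have hone : ∀ χ : DirichletCharacter ℂ q, ‖smoothPsi χ h j v - (if χ = 1 then 1 else 0 : ℂ) * J‖ ≤
      contourErr h j H T c v + if Exc χ then R else 0 := by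
    intro χ
    by_cases hE : Exc χ
    · rw [if_pos hE]
      obtain ⟨ρ, h1, h2, h3⟩ := hE
      obtain ⟨e1, e2, e3, e4⟩ := hnear χ ρ h1 h2 h3
      obtain ⟨β, rfl⟩ : ∃ β : ℝ, ρ = β := ⟨ρ.re, by apply Complex.ext <;> simp [e3]⟩
      simp only [ofReal_re] at h3
      have hβb := hexc χ β e1 e2 h1 h3
      have hβ0 : 0 < β := by
        have h5 : 1 - β < 0.0286 / H := by rwa [lt_div_iff₀ hH0]
        linarith
      have key := norm_smoothPsi_add_le χ hφ j hh hH hHT e1 h1 e4 (fun ρ' f1 f2 f3 => by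
        by_contra hcon
        exact f2 (huniq χ χ ρ' β f1 h1 f3 h2 (not_le.mp hcon) (by simpa using h3)).2) hT hTT hc hc' hv
      rw [if_neg e1, zero_mul, sub_zero]
      set Iβ := ∫ u in Ioi (1 : ℝ), u ^ (β - 1) * smoothW h j (v - Real.log u) with hI
      have hI0 : 0 ≤ Iβ := setIntegral_nonneg measurableSet_Ioi fun u hu =>
        mul_nonneg (Real.rpow_nonneg (by linarith [show 1 < u from hu]) _) (smoothW_mem hh j _).1
      have hIR : Iβ ≤ R := by
        refine (integral_rpow_mul_smoothW_le hβ0 hh j v hv).trans ?_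
        set A := v + (j + 1) * h
        have hA : 0 ≤ A := by positivity
        rw [hR, div_le_div_iff₀ hβ0 hb]
        -- `(exp (t A) - 1) / t` is increasing in `t`
        have hs : Real.exp (β * A) ≤ 1 - β / b + β / b * Real.exp (b * A) := by
          have hcv := convexOn_exp.2 (mem_univ (0 : ℝ)) (mem_univ (b * A))
            (show 0 ≤ 1 - β / b by rw [sub_nonneg, div_le_one hb]; exact hβb)
            (show 0 ≤ β / b by positivity) (by ring)
          simp only [smul_eq_mul, mul_zero, zero_add, Real.exp_zero, mul_one] at hcv
          rwa [show β / b * (b * A) = β * A by field_simp] at hcv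
        have hs2 : b * Real.exp (β * A) ≤ b - β + β * Real.exp (b * A) := by
          calc _ ≤ b * (1 - β / b + β / b * Real.exp (b * A)) := by gcongr
            _ = _ := by field_simp
        nlinarith
      calc ‖smoothPsi χ h j v‖ = ‖(smoothPsi χ h j v + Iβ) - Iβ‖ := by ring_nf
        _ ≤ _ := (norm_sub_le _ _).trans (by
          rw [norm_real, Real.norm_of_nonneg hI0]; exact add_le_add key hIR)
    · rw [if_neg hE, add_zero]
      refine norm_smoothPsi_sub_le χ hφ j hh hH hHT (fun ρ h1 h2 => ?_) hT hTT hc hc' hv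
      by_contra hcon
      exact hE ⟨ρ, h1, h2, not_le.mp hcon⟩
  have hsum : ∑ χ : DirichletCharacter ℂ q, (if Exc χ then R else 0) ≤ R := by
    rw [← Finset.sum_filter, Finset.sum_const, nsmul_eq_mul]
    have : (Finset.univ.filter Exc).card ≤ 1 := by
      refine Finset.card_le_one.mpr fun χ₁ h₁ χ₂ h₂ => ?_
      obtain ⟨ρ₁, f1, f2, f3⟩ := (Finset.mem_filter.mp h₁).2
      obtain ⟨ρ₂, g1, g2, g3⟩ := (Finset.mem_filter.mp h₂).2
      exact (huniq χ₁ χ₂ ρ₁ ρ₂ f1 g1 f2 g2 f3 g3).1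
    exact mul_le_of_le_one_left hR0 (by exact_mod_cast this)
  have hcard : ((Finset.univ : Finset (DirichletCharacter ℂ q)).card : ℝ) = q.totient := by
    rw [Finset.card_univ, ← Nat.card_eq_fintype_card, card_eq_totient_of_hasEnoughRootsOfUnity ℂ q]
  have hid : ((q.totient * classSmoothPsi a h j v - J : ℝ) : ℂ) =
      ∑ χ : DirichletCharacter ℂ q,
        χ a⁻¹ * (smoothPsi χ h j v - (if χ = 1 then 1 else 0 : ℂ) * J) := by
    simp_rw [mul_sub]
    rw [Finset.sum_sub_distrib, ← totient_mul_classSmoothPsi ha hh]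
    push_cast
    congr 1
    rw [Finset.sum_eq_single 1]
    · have : IsUnit (a⁻¹ : ZMod q) := by
        rw [← ha.unit_spec, ZMod.inv_coe_unit]; exact Units.isUnit _
      rw [MulChar.one_apply this]; simp
    · intro χ _ hχ; rw [if_neg hχ]; simp
    · simp
  have hfin : |q.totient * classSmoothPsi a h j v - J| ≤
      ∑ χ : DirichletCharacter ℂ q, (contourErr h j H T c v + if Exc χ then R else 0) := by
    rw [← Real.norm_eq_abs, ← norm_real, hid]
    refine norm_sum_le_of_le _ fun χ _ => ?_
    rw [norm_mul]
    exact (mul_le_of_le_one_left (norm_nonneg _) (χ.norm_le_one _)).trans (hone χ)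
  rw [Finset.sum_add_distrib, Finset.sum_const, nsmul_eq_mul, hcard] at hfin
  linarith

end ClassSum

section ContourNumerics

open Set

theorem exp_le_of_pow {a r : ℝ} (n : ℕ) (hr : 0 ≤ r) (h : a ≤ 2.7182818283 ^ n * (1 + r + r ^ 2 / 2)) :
    a ≤ Real.exp (n + r) := by
  rw [Real.exp_add]
  refine h.trans ?_
  have h1 : (2.7182818283 : ℝ) ^ n ≤ Real.exp n := by
    rw [← Real.exp_one_pow]
    exact pow_le_pow_left₀ (by norm_num) Real.exp_one_gt_d9.le n
  exact mul_le_mul h1 (Real.quadratic_le_exp_of_nonneg hr) (by positivity) (by positivity)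

theorem log_numeric_H : Real.log (14325 ^ 3 / 7900) ≤ 19.74 := by
  rw [Real.log_le_iff_le_exp (by norm_num)]
  have h1 : (1.2021 : ℝ) ≤ Real.exp ((0 : ℕ) + 0.185) :=
    exp_le_of_pow 0 (by norm_num) (by norm_num)
  have h2 : (2.7182818283 : ℝ) ^ 19 ≤ Real.exp ((19 : ℕ) + 0) :=
    exp_le_of_pow 19 (by norm_num) (by norm_num)
  have h3 : Real.exp (19.74 : ℝ) =
      Real.exp ((19 : ℕ) + 0) * Real.exp ((0 : ℕ) + 0.185) ^ 4 := by
    rw [← Real.exp_nat_mul, ← Real.exp_add]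
    norm_num
  rw [h3]
  calc _ ≤ (2.7182818283 : ℝ) ^ 19 * 1.2021 ^ 4 := by norm_num
    _ ≤ _ := mul_le_mul h2 (pow_le_pow_left₀ (by norm_num) h1 4) (by norm_num) (by positivity)

theorem log_numeric_T : Real.log 500000 ≤ 13.13 := by
  rw [Real.log_le_iff_le_exp (by norm_num)]
  have h2 := exp_le_of_pow (a := 500000) (r := 0.13) 13 (by norm_num) (by norm_num)
  convert h2 using 2; norm_num

variable {y H : ℝ}

theorem zeroFreeHeight_le {w : ℝ} (hw : 1 ≤ w) (hyw : y = 14325 * w ^ 2)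
    (hH : H = Real.log (y ^ 3 / 7900) / 2 + 3.47) : H ≤ 13.34 + 3 * (w - 1) := by
  have h1 : y ^ 3 / 7900 = 14325 ^ 3 / 7900 * w ^ 6 := by rw [hyw]; ring
  rw [hH, h1, Real.log_mul (by norm_num) (by positivity), Real.log_pow]
  have := Real.log_le_sub_one_of_pos (show 0 < w by linarith)
  have h2 := log_numeric_H
  push_cast
  linarith

theorem le_zeroFreeHeight (hy : 14325 ≤ y) (hH : H = Real.log (y ^ 3 / 7900) / 2 + 3.47) :
    12 ≤ H := by
  have h1 : (18 : ℝ) ≤ Real.log (y ^ 3 / 7900) := by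
    rw [Real.le_log_iff_exp_le (by positivity)]
    have h2 : Real.exp (18 : ℝ) ≤ 2.7182818286 ^ 18 := by
      rw [show (18 : ℝ) = ((18 : ℕ) : ℝ) by norm_num, ← Real.exp_one_pow]
      exact pow_le_pow_left₀ (by positivity) Real.exp_one_lt_d9.le 18
    have h3 : (14325 : ℝ) ^ 3 ≤ y ^ 3 := by gcongr
    refine h2.trans ?_
    rw [le_div_iff₀ (by norm_num)]
    refine le_trans ?_ h3
    norm_num
  rw [hH]
  linarith

theorem contour_main_numeric {w : ℝ} (hw : 1 ≤ w) (hyw : y = 14325 * w ^ 2) (hH0 : 12 ≤ H)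
    (hH : H ≤ 13.34 + 3 * (w - 1)) :
    1.022 * w ^ 2 * (4100 * H * Real.exp (-(0.95 * (0.0286 / H) * y)) * (13.13 + 4 * (w - 1))) * y ≤
      0.0023 := by
  have hE : Real.exp (-(0.95 * (0.0286 / H) * y)) ≤ Real.exp (-29.17) * Real.exp (-(20 * (w - 1))) := by
    rw [← Real.exp_add, Real.exp_le_exp]
    have : 29.17 + 20 * (w - 1) ≤ 0.95 * (0.0286 / H) * y := by
      rw [show 0.95 * (0.0286 / H) * y = 0.95 * 0.0286 * y / H by ring, le_div_iff₀ (by linarith)]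
      calc (29.17 + 20 * (w - 1)) * H ≤ (29.17 + 20 * (w - 1)) * (13.34 + 3 * (w - 1)) := by
            gcongr
        _ ≤ _ := by rw [hyw]; nlinarith
    linarith
  have hE2 : Real.exp (-29.17) ≤ 2.149e-13 := by
    have h2 := exp_le_of_pow (a := 4.655e12) (r := 0.17) 29 (by norm_num) (by norm_num)
    rw [Real.exp_neg, inv_le_comm₀ (Real.exp_pos _) (by norm_num)]
    refine le_trans ?_ (h2.trans (le_of_eq (by norm_num)))
    norm_num
  have hw1 : w ≤ Real.exp (w - 1) := by linarith [Real.add_one_le_exp (w - 1)]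
  have hp : (0 : ℝ) < w := by linarith
  have h6 : w ^ 6 * Real.exp (-(20 * (w - 1))) ≤ 1 := by
    have : Real.exp (-(20 * (w - 1))) ≤ Real.exp (-(6 * (w - 1))) :=
      Real.exp_le_exp.mpr (by linarith)
    have h7 : Real.exp (-(6 * (w - 1))) = (Real.exp (w - 1) ^ 6)⁻¹ := by
      rw [Real.exp_neg, ← Real.exp_nat_mul]; norm_num
    calc _ ≤ Real.exp (w - 1) ^ 6 * (Real.exp (w - 1) ^ 6)⁻¹ := by
          rw [← h7]; gcongr
      _ = 1 := mul_inv_cancel₀ (by positivity)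
  have hb1 : H ≤ 13.34 * w := by linarith
  have hb2 : 13.13 + 4 * (w - 1) ≤ 13.13 * w := by linarith
  have hy0 : 0 < y := by rw [hyw]; positivity
  calc _ ≤ 1.022 * w ^ 2 * (4100 * (13.34 * w) * (2.149e-13 * Real.exp (-(20 * (w - 1)))) *
        (13.13 * w)) * y := by
        gcongr
        exact hE.trans (by gcongr)
    _ = 1.022 * 4100 * 13.34 * 2.149e-13 * 13.13 * 14325 * (w ^ 6 * Real.exp (-(20 * (w - 1)))) := by
        rw [hyw]; ring
    _ ≤ 1.022 * 4100 * 13.34 * 2.149e-13 * 13.13 * 14325 * 1 := by gcongr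
    _ ≤ _ := by norm_num

theorem contour_tail_numeric {w : ℝ} (hw : 1 ≤ w) (hyw : y = 14325 * w ^ 2) :
    1.022 * w ^ 2 * (0.1264 * y * (y / 2900)⁻¹ ^ 16 * 2.7184) * y ≤ 0.00058 := by
  have hp : (0 : ℝ) < w := by linarith
  have h1 : (y / 2900)⁻¹ ^ 16 = (14325 / 2900 : ℝ)⁻¹ ^ 16 * w⁻¹ ^ 32 := by
    rw [hyw, mul_div_right_comm, mul_inv, mul_pow, ← inv_pow w 2, ← pow_mul]
  have h2 : w ^ 6 * w⁻¹ ^ 32 ≤ 1 := by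
    rw [inv_pow, ← div_eq_mul_inv, div_le_one (by positivity)]
    exact pow_le_pow_right₀ hw (by norm_num)
  calc _ = 1.022 * 0.1264 * 14325 ^ 2 * (14325 / 2900 : ℝ)⁻¹ ^ 16 * 2.7184 * (w ^ 6 * w⁻¹ ^ 32) := by
        rw [h1, hyw]; ring
    _ ≤ 1.022 * 0.1264 * 14325 ^ 2 * (14325 / 2900 : ℝ)⁻¹ ^ 16 * 2.7184 * 1 := by gcongr
    _ ≤ _ := by norm_num

set_option maxHeartbeats 800000 in
theorem contourErr_le {φ l T : ℝ} (hy : 14325 ≤ y) (hφ : 2930 ≤ φ) (hφy : 2052 * φ ≤ y ^ 2)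
    (hl : l = Real.log (1 + φ / (320 * y))) (hT : T = 32 * (y / 2900) / l)
    (hH : H = Real.log (y ^ 3 / 7900) / 2 + 3.47) :
    contourErr (l / 16) 15 H T (1 + 1 / y) y ≤ 0.15 / 160 * Real.exp y / y := by
  obtain ⟨w, hw⟩ : ∃ w, w = √(y / 14325) := ⟨_, rfl⟩
  have hyw : y = 14325 * w ^ 2 := by rw [hw, Real.sq_sqrt (by positivity)]; ring
  have hw1 : 1 ≤ w := by rw [hw, Real.one_le_sqrt, le_div_iff₀ (by norm_num)]; linarith
  have hy0 : 0 < y := by linarith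
  have hφ0 : 0 < φ := by linarith
  set δ := φ / (320 * y) with hδ
  have hδ0 : 0 < δ := by positivity
  have hδ1 : δ ≤ y / 656640 := by
    rw [hδ, div_le_div_iff₀ (by positivity) (by norm_num)]; nlinarith
  have hl0 : 0 < l := by rw [hl]; exact Real.log_pos (by linarith)
  have hexpl : Real.exp l = 1 + δ := by rw [hl, Real.exp_log (by positivity)]
  have hlδ : l ≤ δ := by rw [hl]; linarith [Real.log_le_sub_one_of_pos (show 0 < 1 + δ by linarith)]
  have hlinv : 1 / l ≤ 1 / δ + 1 := by
    have h1 : 1 - (1 + δ)⁻¹ ≤ l := by rw [hl]; exact Real.one_sub_inv_le_log_of_pos (by linarith)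
    have h2 : 1 - (1 + δ)⁻¹ = 1 / (1 / δ + 1) := by field_simp; ring
    rw [h2] at h1
    rw [one_div_le hl0 (by positivity)]
    exact h1
  have hH12 := le_zeroFreeHeight hy hH
  have hHle := zeroFreeHeight_le hw1 hyw hH
  have hHpos : 0 < H := by linarith
  have hη : 0.0286 / H ≤ 0.0024 := by rw [div_le_iff₀ (by linarith)]; linarith
  have hη0 : 0 < 0.0286 / H := by positivity
  have hHy : H ≤ y := by rw [hyw]; nlinarith
  have hTlow : 7245 ≤ T := by
    rw [hT, le_div_iff₀ hl0]
    have := hlδ.trans hδ1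
    linarith
  have hTup : T ≤ 247700 * w ^ 4 := by
    have h1 : 1 / δ ≤ 320 * y / 2930 := by
      rw [hδ, one_div_div]; gcongr
    rw [hT, div_eq_mul_one_div]
    calc _ ≤ 32 * (y / 2900) * (320 * y / 2930 + 1) := by gcongr; linarith
      _ ≤ _ := by rw [hyw]; nlinarith [pow_pos (show 0 < w by linarith) 2, sq_nonneg (w ^ 2 - 1)]
  have hlog : Real.log (1 + 2 * T / (1 - 0.95 * (0.0286 / H))) ≤ 13.13 + 4 * (w - 1) := by
    have hw4 : 1 ≤ w ^ 4 := one_le_pow₀ hw1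
    have h1 : 1 + 2 * T / (1 - 0.95 * (0.0286 / H)) ≤ 500000 * w ^ 4 := by
      have : 2 * T / (1 - 0.95 * (0.0286 / H)) ≤ 2 * (247700 * w ^ 4) / 0.9977 := by
        gcongr; linarith
      refine (add_le_add_right this 1).trans ?_
      rw [← le_sub_iff_add_le', div_le_iff₀ (by norm_num)]
      nlinarith
    have hpos : 0 < 1 + 2 * T / (1 - 0.95 * (0.0286 / H)) := by
      have : 0 < 1 - 0.95 * (0.0286 / H) := by linarith
      positivity
    refine (Real.log_le_log hpos h1).trans ?_
    rw [Real.log_mul (by norm_num) (by positivity), Real.log_pow]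
    have := Real.log_le_sub_one_of_pos (show 0 < w by linarith)
    have h2 := log_numeric_T
    push_cast
    linarith
  have hone : 1 + δ ≤ 1.0219 * w ^ 2 := by
    have : 1 ≤ w ^ 2 := one_le_pow₀ hw1
    have h2 : δ ≤ 14325 * w ^ 2 / 656640 := hyw ▸ hδ1
    linarith
  -- the two pieces
  have hmain : Real.exp ((1 - 0.95 * (0.0286 / H)) * (y + ((15 : ℕ) + 1) * (l / 16))) ≤
      1.022 * w ^ 2 * (Real.exp y * Real.exp (-(0.95 * (0.0286 / H) * y))) := by
    calc _ ≤ Real.exp (l + (y + -(0.95 * (0.0286 / H) * y))) := by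
          rw [Real.exp_le_exp]
          push_cast
          have : 0 ≤ 0.95 * (0.0286 / H) * l := by positivity
          linarith
      _ = (1 + δ) * (Real.exp y * Real.exp (-(0.95 * (0.0286 / H) * y))) := by
          rw [Real.exp_add, Real.exp_add, hexpl]
      _ ≤ _ := by gcongr; linarith [sq_nonneg w]
  have hQ : ((Real.exp (l / 16 * (1 + 1 / y)) + 1) / (l / 16 * T)) ^ (15 + 1) ≤
      1.022 * w ^ 2 * (y / 2900)⁻¹ ^ 16 := by
    have h1 : l / 16 * T = 2 * (y / 2900) := by rw [hT]; field_simp; norm_num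
    have h2 : (Real.exp (l / 16 * (1 + 1 / y)) + 1) / (l / 16 * T) ≤
        Real.exp (l / 16 * (1 + 1 / y)) * (y / 2900)⁻¹ := by
      rw [h1, div_le_iff₀ (by positivity)]
      have : 1 ≤ Real.exp (l / 16 * (1 + 1 / y)) := Real.one_le_exp (by positivity)
      have h6 : (y / 2900)⁻¹ * (2 * (y / 2900)) = 2 := by field_simp
      rw [mul_assoc, h6]
      linarith
    refine (pow_le_pow_left₀ (by positivity) h2 _).trans ?_
    rw [mul_pow, ← Real.exp_nat_mul]
    norm_num only
    gcongr
    have h3 : 16 * (l / 16 * (1 + 1 / y)) = l + l / y := by ring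
    rw [h3, Real.exp_add, hexpl]
    have h4 : l / y ≤ 1 / 656640 := by rw [div_le_iff₀ hy0]; linarith
    have h5 : Real.exp (l / y) ≤ 1.00001 := by
      refine (Real.exp_le_exp.mpr h4).trans ?_
      refine (Real.exp_bound_div_one_sub_of_interval (by norm_num) (by norm_num)).trans ?_
      norm_num
    calc (1 + δ) * Real.exp (l / y) ≤ 1.0219 * w ^ 2 * 1.00001 := by gcongr
      _ ≤ _ := by nlinarith [sq_nonneg w]
  have hcoef : 4100 * H * (1 + 1 / y - (1 - 0.95 * (0.0286 / H))) / T + 2 / (1 + 1 / y - 1) / ((15 : ℕ) + 1)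
      ≤ 0.1264 * y := by
    have h1 : 2 / (1 + 1 / y - 1) / (((15 : ℕ) : ℝ) + 1) = y / 8 := by
      rw [add_sub_cancel_left]; push_cast; field_simp; norm_num
    rw [h1]
    have h2 : 1 / y ≤ 0.0001 := by rw [div_le_iff₀ hy0]; linarith
    have h3 : 4100 * H * (1 + 1 / y - (1 - 0.95 * (0.0286 / H))) / T ≤ 4100 * y * 0.00238 / 7245 := by
      have h4 : 0 < 1 / y := by positivity
      gcongr
      · linarith
      · linarith
    refine (add_le_add_left h3 _).trans ?_
    linarith
  have hexpc : Real.exp (y * (1 + 1 / y)) ≤ 2.7184 * Real.exp y := by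
    rw [mul_add, mul_one, mul_one_div_cancel hy0.ne', Real.exp_add, mul_comm]
    gcongr
    linarith [Real.exp_one_lt_d9]
  have hm := contour_main_numeric hw1 hyw hH12 hHle
  have ht := contour_tail_numeric hw1 hyw
  unfold contourErr
  have hcoef0 : 0 ≤ 4100 * H * (1 + 1 / y - (1 - 0.95 * (0.0286 / H))) / T +
      2 / (1 + 1 / y - 1) / ((15 : ℕ) + 1) := by
    have : 0 ≤ 1 + 1 / y - (1 - 0.95 * (0.0286 / H)) := by
      have : 0 < 1 / y := by positivity
      linarith
    have h2 : 0 ≤ 1 + 1 / y - 1 := by rw [add_sub_cancel_left]; positivity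
    have hH0 : 0 ≤ H := by linarith
    positivity
  have hlogT : 0 ≤ Real.log (1 + 2 * T / (1 - 0.95 * (0.0286 / H))) := by
    have h1 : 0 < 1 - 0.95 * (0.0286 / H) := by linarith
    exact Real.log_nonneg (by linarith [show 0 < 2 * T / (1 - 0.95 * (0.0286 / H)) by positivity])
  have hlog0 : 0 ≤ 13.13 + 4 * (w - 1) := by linarith
  have hpi : Real.pi⁻¹ ≤ 0.3184 := by
    rw [inv_le_comm₀ Real.pi_pos (by norm_num)]
    refine le_trans ?_ Real.pi_gt_d6.le
    norm_num
  have hA : 4100 * H * Real.exp ((1 - 0.95 * (0.0286 / H)) * (y + ((15 : ℕ) + 1) * (l / 16))) *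
      Real.log (1 + 2 * T / (1 - 0.95 * (0.0286 / H))) ≤ 0.0023 * (Real.exp y / y) := by
    calc _ ≤ 4100 * H * (1.022 * w ^ 2 * (Real.exp y * Real.exp (-(0.95 * (0.0286 / H) * y)))) *
          (13.13 + 4 * (w - 1)) := by gcongr
      _ = (1.022 * w ^ 2 * (4100 * H * Real.exp (-(0.95 * (0.0286 / H) * y)) *
          (13.13 + 4 * (w - 1))) * y) * (Real.exp y / y) := by field_simp
      _ ≤ _ := by gcongr
  have hQ0 : 0 ≤ ((Real.exp (l / 16 * (1 + 1 / y)) + 1) / (l / 16 * T)) ^ (15 + 1) := by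
    have : 0 < T := by linarith
    positivity
  have hB : (4100 * H * (1 + 1 / y - (1 - 0.95 * (0.0286 / H))) / T +
      2 / (1 + 1 / y - 1) / ((15 : ℕ) + 1)) *
      ((Real.exp (l / 16 * (1 + 1 / y)) + 1) / (l / 16 * T)) ^ (15 + 1) *
      Real.exp (y * (1 + 1 / y)) ≤ 0.00058 * (Real.exp y / y) := by
    calc _ ≤ (0.1264 * y) * (1.022 * w ^ 2 * (y / 2900)⁻¹ ^ 16) * (2.7184 * Real.exp y) :=
          mul_le_mul (mul_le_mul hcoef hQ hQ0 (by positivity)) hexpc (by positivity) (by positivity)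
      _ = (1.022 * w ^ 2 * (0.1264 * y * (y / 2900)⁻¹ ^ 16 * 2.7184) * y) * (Real.exp y / y) := by
          field_simp
      _ ≤ _ := by gcongr
  calc _ ≤ Real.pi⁻¹ * (0.0023 * (Real.exp y / y) + 0.00058 * (Real.exp y / y)) := by
        gcongr
    _ ≤ 0.3184 * (0.0023 * (Real.exp y / y) + 0.00058 * (Real.exp y / y)) := by gcongr
    _ ≤ 0.15 / 160 * (Real.exp y / y) := by
        have : 0 ≤ Real.exp y / y := by positivity
        nlinarith
    _ = _ := by ring

theorem contourErr_mono {h H T c v v' : ℝ} (j : ℕ) (hh : 0 < h) (hH : 12 ≤ H) (hT : 0 < T)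
    (hc : 1 < c) (hv : v ≤ v') : contourErr h j H T c v ≤ contourErr h j H T c v' := by
  have hη : 0.0286 / H ≤ 0.0024 := by rw [div_le_iff₀ (by linarith)]; linarith
  have hη0 : 0 < 0.0286 / H := by positivity
  have h1 : 0 < 1 - 0.95 * (0.0286 / H) := by linarith
  have h2 : 0 < c - (1 - 0.95 * (0.0286 / H)) := by linarith
  have h3 : 0 < c - 1 := by linarith
  have h4 : 0 ≤ Real.log (1 + 2 * T / (1 - 0.95 * (0.0286 / H))) :=
    Real.log_nonneg (by linarith [show 0 < 2 * T / (1 - 0.95 * (0.0286 / H)) by positivity])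
  have hH0 : 0 < H := by linarith
  have hc0 : 0 < c := by linarith
  unfold contourErr
  gcongr

end ContourNumerics

section ClassPsi

open Set

variable {q : ℕ} [NeZero q]

theorem height_le {φ l T y : ℝ} (hy : 14325 ≤ y) (hφ : 2930 ≤ φ) (hφy : 2052 * φ ≤ y ^ 2)
    (hlinv : 1 / l ≤ 320 * y / φ + 1) (hT : T = 32 * (y / 2900) / l) :
    T + 0.851 ≤ y ^ 3 / 7900 * 2 / φ - 2 := by
  have hφ0 : 0 < φ := by linarith
  have h1 : T ≤ 32 * (y / 2900) * (320 * y / φ + 1) := by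
    rw [hT, div_eq_mul_one_div]; gcongr
  have h2 : 32 * (y / 2900) * (320 * y / φ + 1) = (32 * (y / 2900) * (320 * y + φ)) / φ := by
    field_simp
  rw [h2] at h1
  rw [← add_le_add_iff_right 2, sub_add_cancel, le_div_iff₀ hφ0]
  rw [le_div_iff₀ hφ0] at h1
  have h3 : y * (2052 * φ) ≤ y * y ^ 2 := by gcongr
  have h4 : 14325 * y ^ 2 ≤ y * y ^ 2 := by gcongr
  nlinarith

set_option maxHeartbeats 2000000 in
theorem abs_classPsi_sub_le {a : ZMod q} (ha : IsUnit a) {y b : ℝ} (hy : 14325 ≤ y)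
    (hφ : 2930 ≤ (q.totient : ℝ)) (hφy : 2052 * (q.totient : ℝ) ≤ y ^ 2)
    (hb : 0 < b) (hb1 : b ≤ 1)
    (hexc : ∀ (χ : DirichletCharacter ℂ q) (β : ℝ), χ ≠ 1 → χ ^ 2 = 1 → charF χ β = 0 → β ≤ b)
    (hbw : Real.exp (-((1 - b) * y)) * (1 / q.totient + 1 / (320 * y)) / b ≤ 0.25 / 160 / y) :
    |classPsi a (Real.exp y) - Real.exp y / q.totient| ≤ 0.91 / 160 * Real.exp y / y := by
  set φ : ℝ := (q.totient : ℝ) with hφdef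
  have hy0 : 0 < y := by linarith
  have hφ0 : 0 < φ := by linarith
  obtain ⟨δ, hδ⟩ : ∃ δ, δ = φ / (320 * y) := ⟨_, rfl⟩
  obtain ⟨l, hl⟩ : ∃ l, l = Real.log (1 + δ) := ⟨_, rfl⟩
  obtain ⟨T, hT⟩ : ∃ T, T = 32 * (y / 2900) / l := ⟨_, rfl⟩
  obtain ⟨H, hH⟩ : ∃ H, H = Real.log (y ^ 3 / 7900) / 2 + 3.47 := ⟨_, rfl⟩
  have hδ0 : 0 < δ := by rw [hδ]; positivity
  have hδφ : δ / φ = 1 / (320 * y) := by rw [hδ]; field_simp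
  have hl0 : 0 < l := by rw [hl]; exact Real.log_pos (by linarith)
  have hexpl : Real.exp l = 1 + δ := by rw [hl, Real.exp_log (by positivity)]
  have hlδ : l ≤ δ := by rw [hl]; linarith [Real.log_le_sub_one_of_pos (show 0 < 1 + δ by linarith)]
  have hδ1 : δ ≤ y / 656640 := by
    rw [hδ, div_le_div_iff₀ (by positivity) (by norm_num)]; nlinarith
  have hlinv : 1 / l ≤ 320 * y / φ + 1 := by
    have h1 : 1 - (1 + δ)⁻¹ ≤ l := by rw [hl]; exact Real.one_sub_inv_le_log_of_pos (by linarith)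
    have h2 : 1 - (1 + δ)⁻¹ = 1 / (1 / δ + 1) := by field_simp; ring
    have h3 : 1 / δ = 320 * y / φ := by rw [hδ, one_div_div]
    rw [h2, h3] at h1
    rw [one_div_le hl0 (by positivity)]
    exact h1
  have hT0 : 0 < T := by rw [hT]; positivity
  have hH12 := le_zeroFreeHeight hy hH
  have hc1 : 1 < 1 + 1 / y := by linarith [show 0 < 1 / y by positivity]
  have hc2 : 1 + 1 / y ≤ 1 + 3 * (0.0286 / H) := by
    have hw1 : 1 ≤ √(y / 14325) := by rw [Real.one_le_sqrt, le_div_iff₀ (by norm_num)]; linarith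
    have hyw : y = 14325 * √(y / 14325) ^ 2 := by rw [Real.sq_sqrt (by positivity)]; ring
    have h1 := zeroFreeHeight_le hw1 hyw hH
    have h2 : H ≤ 0.0858 * y := by nlinarith
    have h3 : 1 / y ≤ 0.0858 / H := by
      rw [div_le_div_iff₀ hy0 (by linarith)]; linarith
    have h4 : 3 * (0.0286 / H) = 0.0858 / H := by ring
    linarith
  have hHT : H = condLog q (y ^ 3 / 7900 * 2 / φ - 2) + 3.47 := by
    rw [hH, condLog, ← hφdef]
    congr 3
    field_simp
    ring
  have hTT := height_le hy hφ hφy hlinv hT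
  have hexc' : ∀ (χ : DirichletCharacter ℂ q) (β : ℝ), χ ≠ 1 → χ ^ 2 = 1 → charF χ β = 0 →
      (1 - β) * H < 0.0286 → β ≤ b := fun χ β h1 h2 h3 _ => hexc χ β h1 h2 h3
  have hφ200 : 200 ≤ q.totient := by
    have : (200 : ℝ) ≤ q.totient := by linarith
    exact_mod_cast this
  have hh : 0 < l / 16 := by positivity
  have h16 : (((15 : ℕ) : ℝ) + 1) * (l / 16) = l := by push_cast; ring
  have hCE : contourErr (l / 16) 15 H T (1 + 1 / y) y ≤ 0.15 / 160 * Real.exp y / y :=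
    contourErr_le hy hφ hφy (by rw [hl, hδ]) hT hH
  have hEy : 0 < Real.exp y := Real.exp_pos y
  have hex1 : 1 ≤ Real.exp y := Real.one_le_exp hy0.le
  have hbexp : Real.exp (b * y) = Real.exp y * Real.exp (-((1 - b) * y)) := by
    rw [← Real.exp_add]; ring_nf
  have hexc1 : Real.exp (b * (y + l)) / b / φ ≤ 0.25 / 160 * Real.exp y / y := by
    calc _ ≤ Real.exp (b * y) * (1 + δ) / b / φ := by
          rw [mul_add, Real.exp_add, ← hexpl]
          gcongr
          nlinarith
      _ = Real.exp y * (Real.exp (-((1 - b) * y)) * (1 / φ + δ / φ) / b) := by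
          rw [hbexp]; field_simp
      _ ≤ Real.exp y * (0.25 / 160 / y) := by rw [hδφ]; gcongr
      _ = _ := by ring
  have hlog1 : Real.log (Real.exp y) = y := Real.log_exp y
  rw [abs_le]
  constructor
  · have h1 := le_classPsi a hh 15 hex1
    rw [hlog1, h16] at h1
    have hv : 0 ≤ y - l := by linarith
    have h2 := totient_mul_classSmoothPsi_sub_le ha hφ200 15 hh hH12 hHT hT0 hTT hc1 hc2 hv hb hexc'
    rw [h16, sub_add_cancel, ← hφdef] at h2
    have h3 := exp_sub_one_le_integral_smoothW hh 15 (y - l) hv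
    have h4 := (abs_le.mp h2).1
    have h5 : contourErr (l / 16) 15 H T (1 + 1 / y) (y - l) ≤ 0.15 / 160 * Real.exp y / y :=
      (contourErr_mono 15 hh hH12 hT0 hc1 (by linarith)).trans hCE
    have h6 : Real.exp y * (1 - δ) ≤ Real.exp (y - l) := by
      rw [Real.exp_sub, hexpl, le_div_iff₀ (by linarith)]
      nlinarith [sq_nonneg δ]
    have h7 : Real.exp (b * y) / b / φ ≤ 0.25 / 160 * Real.exp y / y := by
      refine le_trans ?_ hexc1
      gcongr
      linarith
    have h8 : 1 ≤ 0.01 / 160 * Real.exp y / y * φ := by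
      have : y ^ 2 / 2 ≤ Real.exp y := by linarith [Real.quadratic_le_exp_of_nonneg hy0.le]
      have h9 : 0.01 / 160 * (y ^ 2 / 2) / y * 2930 ≤ 0.01 / 160 * Real.exp y / y * φ := by
        gcongr
      have h10 : 0.01 / 160 * (y ^ 2 / 2) / y * 2930 = 0.01 / 320 * 2930 * y := by field_simp; norm_num
      linarith
    rw [div_le_iff₀ hφ0] at h7
    have h10 : φ * contourErr (l / 16) 15 H T (1 + 1 / y) (y - l) ≤
        φ * (0.15 / 160 * Real.exp y / y) := by gcongr
    have h11 : Real.exp y * δ = 0.5 / 160 * Real.exp y / y * φ := by rw [hδ]; field_simp; norm_num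
    have h12 : φ * classSmoothPsi a (l / 16) 15 (y - l) ≤ φ * classPsi a (Real.exp y) := by gcongr
    have h13 : -(0.91 / 160 * Real.exp y / y) * φ ≤ φ * classPsi a (Real.exp y) - Real.exp y := by
      have e1 : Real.exp (y - l) - 1 - (φ * contourErr (l / 16) 15 H T (1 + 1 / y) (y - l) +
          Real.exp (b * y) / b) ≤ φ * classSmoothPsi a (l / 16) 15 (y - l) := by linarith
      have e2 : ∀ t : ℝ, t / 160 * Real.exp y / y * φ = t * (Real.exp y / y * φ / 160) :=
        fun t => by ring
      rw [e2] at h7 h8 h11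
      rw [mul_comm φ (0.15 / 160 * Real.exp y / y), e2] at h10
      rw [neg_mul, e2]
      rw [mul_sub, mul_one] at h6
      linarith
    rw [← mul_le_mul_iff_left₀ hφ0]
    refine h13.trans (le_of_eq ?_)
    field_simp
  · have h1 := classPsi_le a hh 15 hex1
    rw [hlog1] at h1
    have h2 := totient_mul_classSmoothPsi_sub_le ha hφ200 15 hh hH12 hHT hT0 hTT hc1 hc2 hy0.le hb hexc'
    rw [h16, ← hφdef] at h2
    have h3 := integral_rpow_mul_smoothW_le one_pos hh 15 y hy0.le
    rw [h16, one_mul, div_one] at h3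
    have h4 := (abs_le.mp h2).2
    have h6 : Real.exp (y + l) = Real.exp y + Real.exp y * δ := by
      rw [Real.exp_add, hexpl]; ring
    have h7 := hexc1
    rw [div_le_iff₀ hφ0] at h7
    have h10 : φ * contourErr (l / 16) 15 H T (1 + 1 / y) y ≤
        φ * (0.15 / 160 * Real.exp y / y) := by gcongr
    have h11 : Real.exp y * δ = 0.5 / 160 * Real.exp y / y * φ := by rw [hδ]; field_simp; norm_num
    have h12 : φ * classPsi a (Real.exp y) ≤ φ * classSmoothPsi a (l / 16) 15 y := by gcongr
    have h14 : 0 ≤ 0.01 / 160 * Real.exp y / y * φ := by positivity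
    have h13 : φ * classPsi a (Real.exp y) - Real.exp y ≤ (0.91 / 160 * Real.exp y / y) * φ := by
      have e1 : φ * classSmoothPsi a (l / 16) 15 y ≤ Real.exp (y + l) - 1 +
          (φ * contourErr (l / 16) 15 H T (1 + 1 / y) y + Real.exp (b * (y + l)) / b) := by linarith
      have e2 : ∀ t : ℝ, t / 160 * Real.exp y / y * φ = t * (Real.exp y / y * φ / 160) :=
        fun t => by ring
      rw [e2] at h7 h14 h11
      rw [mul_comm φ (0.15 / 160 * Real.exp y / y), e2] at h10
      rw [e2]
      linarith
    rw [← mul_le_mul_iff_left₀ hφ0]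
    refine (le_of_eq ?_).trans h13
    field_simp

end ClassPsi

section Trapezoid

open Set Filter Topology

variable {F F' F'' : ℝ → ℂ}

theorem norm_trapezoid_sub_integral_le (h1 : ∀ t, HasDerivAt F (F' t) t)
    (h2 : ∀ t, HasDerivAt F' (F'' t) t) (hc : Continuous F'') (a : ℝ) {v : ℝ} (hv : 0 ≤ v) :
    ‖(v / 2 : ℂ) * (F a + F (a + v)) - ∫ t in a..(a + v), F t‖ ≤
      v ^ 2 / 8 * ∫ t in a..(a + v), ‖F'' t‖ := by
  have hF : Continuous F := continuous_iff_continuousAt.mpr fun t => (h1 t).continuousAt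
  set u : ℝ → ℂ := fun t => ((t : ℂ) - a) * (a + v - t) / 2 with hu
  have hu1 : ∀ t : ℝ, HasDerivAt u (a + v / 2 - t) t := fun t => by
    have h : HasDerivAt (fun t : ℝ => (t : ℂ)) 1 t := Complex.ofRealCLM.hasDerivAt
    refine (((h.sub_const (a : ℂ)).mul (h.const_sub ((a : ℂ) + v))).div_const 2).congr_deriv ?_
    ring
  have hu2 : ∀ t : ℝ, HasDerivAt (fun t : ℝ => (a + v / 2 - t : ℂ)) (-1) t := fun t => by
    have h : HasDerivAt (fun t : ℝ => (t : ℂ)) 1 t := Complex.ofRealCLM.hasDerivAt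
    exact h.const_sub _
  have huc : Continuous u := continuous_iff_continuousAt.mpr fun t => (hu1 t).continuousAt
  have hd : ∀ t, HasDerivAt (fun t => u t * F' t - (a + v / 2 - t : ℂ) * F t)
      (u t * F'' t + F t) t := fun t => by
    refine (((hu1 t).mul (h2 t)).sub ((hu2 t).mul (h1 t))).congr_deriv ?_
    ring
  have hI := intervalIntegral.integral_eq_sub_of_hasDerivAt (a := a) (b := a + v)
    (fun t _ => hd t) (((huc.mul hc).add hF).intervalIntegrable _ _)
  rw [intervalIntegral.integral_add (f := fun t => u t * F'' t) ((huc.mul hc).intervalIntegrable _ _)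
    (hF.intervalIntegrable _ _)] at hI
  have hkey : (v / 2 : ℂ) * (F a + F (a + v)) - ∫ t in a..(a + v), F t =
      ∫ t in a..(a + v), u t * F'' t := by
    rw [eq_sub_of_add_eq hI]
    simp only [hu]
    push_cast
    ring
  rw [hkey, ← intervalIntegral.integral_const_mul]
  refine intervalIntegral.norm_integral_le_of_norm_le (by linarith) ?_
    ((continuous_const.mul hc.norm).intervalIntegrable _ _)
  refine Eventually.of_forall fun t ht => ?_
  rw [norm_mul]
  gcongr
  have : u t = (((t - a) * (a + v - t) / 2 : ℝ) : ℂ) := by simp [hu]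
  rw [this, Complex.norm_real, Real.norm_eq_abs, abs_of_nonneg]
  · nlinarith [sq_nonneg (2 * (t - a) - v)]
  · have := ht.1; have := ht.2
    have h3 : 0 ≤ t - a := by linarith
    have h4 : 0 ≤ a + v - t := by linarith
    positivity

theorem norm_sum_sub_integral_le (h1 : ∀ t, HasDerivAt F (F' t) t)
    (h2 : ∀ t, HasDerivAt F' (F'' t) t) (hc : Continuous F'') (h0 : F 0 = 0) {v : ℝ} (hv : 0 ≤ v)
    (N : ℕ) :
    ‖(v : ℂ) * ∑ k ∈ Finset.range N, F ((k + 1) * v) - v / 2 * F (N * v) -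
      ∫ t in (0 : ℝ)..(N * v), F t‖ ≤ v ^ 2 / 8 * ∫ t in (0 : ℝ)..(N * v), ‖F'' t‖ := by
  have hF : Continuous F := continuous_iff_continuousAt.mpr fun t => (h1 t).continuousAt
  induction N with
  | zero => simp [h0]
  | succ N ih =>
    have h := norm_trapezoid_sub_integral_le h1 h2 hc (N * v) hv
    have e : (N : ℝ) * v + v = ((N + 1 : ℕ) : ℝ) * v := by push_cast; ring
    rw [e] at h
    rw [← intervalIntegral.integral_add_adjacent_intervals
      (hF.intervalIntegrable 0 (N * v)) (hF.intervalIntegrable (N * v) (((N + 1 : ℕ) : ℝ) * v)),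
      ← intervalIntegral.integral_add_adjacent_intervals
      (hc.norm.intervalIntegrable 0 (N * v)) (hc.norm.intervalIntegrable (N * v) (((N + 1 : ℕ) : ℝ) * v)),
      mul_add, Finset.sum_range_succ]
    refine le_trans (le_of_eq ?_) ((norm_add_le _ _).trans (add_le_add ih h))
    congr 1
    push_cast
    ring

theorem norm_tsum_sub_integral_le (h1 : ∀ t, HasDerivAt F (F' t) t)
    (h2 : ∀ t, HasDerivAt F' (F'' t) t) (hc : Continuous F'') (h0 : F 0 = 0) {v B : ℝ} (hv : 0 < v)
    (hB : ∀ X, 0 ≤ X → ∫ t in (0 : ℝ)..X, ‖F'' t‖ ≤ B)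
    (hinteg : MeasureTheory.IntegrableOn F (Ioi 0)) {S : ℂ}
    (hs : HasSum (fun k : ℕ => F ((k + 1) * v)) S) :
    ‖(v : ℂ) * S - ∫ t in Ioi (0 : ℝ), F t‖ ≤ v ^ 2 / 8 * B := by
  have hNv : Tendsto (fun N : ℕ => (N : ℝ) * v) atTop atTop :=
    tendsto_natCast_atTop_atTop.atTop_mul_const hv
  have hI := MeasureTheory.intervalIntegral_tendsto_integral_Ioi 0 hinteg hNv
  have hz : Tendsto (fun N : ℕ => F (N * v)) atTop (𝓝 0) := by
    have := hs.summable.tendsto_atTop_zero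
    rw [← tendsto_add_atTop_iff_nat 1]
    convert this using 3
    push_cast; ring
  have ht := ((hs.tendsto_sum_nat.const_mul (v : ℂ)).sub (hz.const_mul (v / 2 : ℂ))).sub hI
  rw [mul_zero, sub_zero] at ht
  refine le_of_tendsto ht.norm (Eventually.of_forall fun N => ?_)
  refine (norm_sum_sub_integral_le h1 h2 hc h0 hv.le N).trans ?_
  gcongr
  exact hB _ (by positivity)

end Trapezoid

section RootKernel

open Set Filter Topology

/-- The function `t ↦ ∑ n, t n zⁿ e^{-n t}`. -/
noncomputable def rootKernel (z : ℂ) (t : ℝ) : ℂ :=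
  t * (z * Complex.exp (-t) / (1 - z * Complex.exp (-t)) ^ 2)

/-- The second derivative of `rootKernel z`. -/
noncomputable def rootKernelDeriv2 (z : ℂ) (t : ℝ) : ℂ :=
  -(2 * (z * Complex.exp (-t) * (1 + z * Complex.exp (-t)) / (1 - z * Complex.exp (-t)) ^ 3)) +
    t * (z * Complex.exp (-t) * (1 + 4 * (z * Complex.exp (-t)) + (z * Complex.exp (-t)) ^ 2) /
      (1 - z * Complex.exp (-t)) ^ 4)

variable {z : ℂ}

theorem one_sub_mul_exp_ne_zero (hz : ‖z‖ = 1) (hz1 : z ≠ 1) (t : ℝ) :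
    1 - z * Complex.exp (-t) ≠ 0 := by
  intro h
  have h1 : z * Complex.exp (-t) = 1 := (sub_eq_zero.mp h).symm
  have h2 : ‖z * Complex.exp (-t)‖ = 1 := by rw [h1, norm_one]
  rw [norm_mul, hz, one_mul, ← Complex.ofReal_neg, Complex.norm_exp_ofReal, Real.exp_eq_one_iff,
    neg_eq_zero] at h2
  subst h2
  simp at h1
  exact hz1 h1

theorem hasDerivAt_mul_exp_neg (z : ℂ) (t : ℝ) :
    HasDerivAt (fun t : ℝ => z * Complex.exp (-t)) (-(z * Complex.exp (-t))) t := by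
  have h : HasDerivAt (fun t : ℝ => -(t : ℂ)) (-1) t := (Complex.ofRealCLM.hasDerivAt (x := t)).neg
  refine (h.cexp.const_mul z).congr_deriv ?_
  ring

theorem hasDerivAt_rootKernel (hz : ‖z‖ = 1) (hz1 : z ≠ 1) (t : ℝ) :
    HasDerivAt (rootKernel z) (z * Complex.exp (-t) / (1 - z * Complex.exp (-t)) ^ 2 +
      t * -(z * Complex.exp (-t) * (1 + z * Complex.exp (-t)) / (1 - z * Complex.exp (-t)) ^ 3)) t := by
  have h : HasDerivAt (fun t : ℝ => (t : ℂ)) 1 t := Complex.ofRealCLM.hasDerivAt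
  have hr := hasDerivAt_mul_exp_neg z t
  have hD := one_sub_mul_exp_ne_zero hz hz1 t
  refine (h.mul (hr.div ((hr.const_sub 1).pow 2) (pow_ne_zero 2 hD))).congr_deriv ?_
  simp only [Pi.pow_apply, Pi.div_apply]
  field_simp
  push_cast
  ring

theorem hasDerivAt_rootKernel_deriv (hz : ‖z‖ = 1) (hz1 : z ≠ 1) (t : ℝ) :
    HasDerivAt (fun t : ℝ => z * Complex.exp (-t) / (1 - z * Complex.exp (-t)) ^ 2 +
      t * -(z * Complex.exp (-t) * (1 + z * Complex.exp (-t)) / (1 - z * Complex.exp (-t)) ^ 3))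
      (rootKernelDeriv2 z t) t := by
  have h : HasDerivAt (fun t : ℝ => (t : ℂ)) 1 t := Complex.ofRealCLM.hasDerivAt
  have hr := hasDerivAt_mul_exp_neg z t
  have hD := one_sub_mul_exp_ne_zero hz hz1 t
  refine ((hr.div ((hr.const_sub 1).pow 2) (pow_ne_zero 2 hD)).add
    (h.mul ((hr.mul (hr.const_add 1)).div ((hr.const_sub 1).pow 3) (pow_ne_zero 3 hD)).neg)).congr_deriv ?_
  rw [rootKernelDeriv2]
  simp only [Pi.mul_apply, Pi.pow_apply, Pi.div_apply, Pi.neg_apply]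
  field_simp
  push_cast
  ring

theorem continuous_rootKernelDeriv2 (hz : ‖z‖ = 1) (hz1 : z ≠ 1) :
    Continuous (rootKernelDeriv2 z) := by
  have hD := one_sub_mul_exp_ne_zero hz hz1
  unfold rootKernelDeriv2
  have h1 : Continuous fun t : ℝ => z * Complex.exp (-t) := by fun_prop
  refine Continuous.add ?_ ?_
  · exact (continuous_const.mul ((h1.mul (continuous_const.add h1)).div₀
      ((continuous_const.sub h1).pow 3) fun t => pow_ne_zero 3 (hD t))).neg
  · exact Complex.continuous_ofReal.mul ((h1.mul ((continuous_const.add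
      (continuous_const.mul h1)).add (h1.pow 2))).div₀ ((continuous_const.sub h1).pow 4)
      fun t => pow_ne_zero 4 (hD t))

theorem norm_one_sub_mul_sq (hz : ‖z‖ = 1) (r : ℝ) :
    ‖1 - z * r‖ ^ 2 = (1 - r) ^ 2 + r * ‖1 - z‖ ^ 2 := by
  have h : z.re ^ 2 + z.im ^ 2 = 1 := by
    have := Complex.sq_norm z
    rw [hz, Complex.normSq_apply] at this
    linarith
  rw [Complex.sq_norm, Complex.sq_norm, Complex.normSq_apply, Complex.normSq_apply]
  simp
  linear_combination (r ^ 2 - r) * h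

theorem norm_rootKernelDeriv2_le (hz : ‖z‖ = 1) (hz1 : z ≠ 1) {t σ C Q : ℝ} (ht : 0 ≤ t)
    (hσ : σ = 2 * Real.sinh (t / 2)) (hC : C = Real.cosh (t / 2)) (hQ : Q = σ ^ 2 + ‖1 - z‖ ^ 2) :
    ‖rootKernelDeriv2 z t‖ ≤ 4 * C / √Q ^ 3 + 2 * σ * C / √Q ^ 3 + 6 * σ * C / Q ^ 2 := by
  obtain ⟨p, hp⟩ : ∃ p, p = Real.exp (-(t / 2)) := ⟨_, rfl⟩
  have hp0 : 0 < p := by rw [hp]; positivity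
  have hpinv : Real.exp (t / 2) = p⁻¹ := by rw [hp, Real.exp_neg, inv_inv]
  have hσp : σ = p⁻¹ - p := by rw [hσ, Real.sinh_eq, hpinv, ← hp]; ring
  have hCp : 2 * C = p⁻¹ + p := by rw [hC, Real.cosh_eq, hpinv, ← hp]; ring
  have hr : Complex.exp (-t) = ((p ^ 2 : ℝ) : ℂ) := by
    rw [hp, ← Real.exp_nat_mul]; push_cast; congr 1; ring
  have hs : 0 < ‖1 - z‖ := norm_pos_iff.mpr (sub_ne_zero.mpr (Ne.symm hz1))
  have hs2 : ‖1 - z‖ ≤ 2 := by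
    refine (norm_sub_le _ _).trans ?_
    rw [hz, norm_one]; norm_num
  have hQ0 : 0 < Q := by rw [hQ]; positivity
  have hsQ : 0 < √Q := Real.sqrt_pos.mpr hQ0
  have hsQ2 : √Q ^ 2 = Q := Real.sq_sqrt hQ0.le
  have hD : ‖1 - z * Complex.exp (-t)‖ = p * √Q := by
    rw [← sq_eq_sq₀ (norm_nonneg _) (by positivity), hr, norm_one_sub_mul_sq hz, mul_pow, hsQ2, hQ,
      hσp]
    field_simp
  have hρ : ‖z * Complex.exp (-t)‖ = p ^ 2 := by
    rw [hr, norm_mul, hz, one_mul, Complex.norm_real, Real.norm_of_nonneg (by positivity)]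
  have h1 : ‖1 + z * Complex.exp (-t)‖ ≤ p * (2 * C) := by
    refine (norm_add_le _ _).trans (le_of_eq ?_)
    rw [hρ, norm_one, hCp]; field_simp
  have h2 : ‖1 + 4 * (z * Complex.exp (-t)) + (z * Complex.exp (-t)) ^ 2‖ ≤ p ^ 2 * (σ ^ 2 + 6) := by
    refine (norm_add_le _ _).trans ((add_le_add_left (norm_add_le _ _) _).trans (le_of_eq ?_))
    rw [norm_mul, norm_pow, hρ, norm_one, hσp]; norm_num; field_simp; ring
  have htσ : t ≤ σ := by
    rw [hσ]; linarith [Real.self_le_sinh_iff.mpr (show 0 ≤ t / 2 by linarith)]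
  have hC1 : 1 ≤ C := by rw [hC]; exact Real.one_le_cosh _
  have hQC : √Q ≤ 2 * C := by
    rw [Real.sqrt_le_left (by linarith), hQ, hσ, hC]
    nlinarith [Real.cosh_sq (t / 2), norm_nonneg (1 - z)]
  have hσ0 : 0 ≤ σ := ht.trans htσ
  have e1 : ‖-(2 * (z * Complex.exp (-t) * (1 + z * Complex.exp (-t)) /
      (1 - z * Complex.exp (-t)) ^ 3))‖ ≤ 4 * C / √Q ^ 3 := by
    rw [norm_neg, norm_mul, norm_div, norm_mul, norm_pow, hD, hρ]
    calc _ ≤ ‖(2 : ℂ)‖ * (p ^ 2 * (p * (2 * C)) / (p * √Q) ^ 3) := by gcongr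
      _ = _ := by norm_num; field_simp; norm_num
  have e2 : ‖t * (z * Complex.exp (-t) * (1 + 4 * (z * Complex.exp (-t)) +
      (z * Complex.exp (-t)) ^ 2) / (1 - z * Complex.exp (-t)) ^ 4)‖ ≤
      2 * σ * C / √Q ^ 3 + 6 * σ * C / Q ^ 2 := by
    rw [norm_mul, norm_div, norm_mul (z * Complex.exp (-t)), norm_pow, hD, hρ, Complex.norm_real,
      Real.norm_of_nonneg ht]
    calc _ ≤ σ * (p ^ 2 * (p ^ 2 * (Q + 6)) / (p * √Q) ^ 4) := by
          gcongr
          refine h2.trans ?_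
          gcongr
          rw [hQ]; nlinarith [sq_nonneg ‖1 - z‖]
      _ = σ * √Q / √Q ^ 3 + 6 * σ * 1 / Q ^ 2 := by
          rw [mul_pow, show √Q ^ 4 = Q ^ 2 by linear_combination (√Q ^ 2 + Q) * hsQ2]
          have : √Q / √Q ^ 3 = 1 / Q := by
            rw [div_eq_div_iff (by positivity) hQ0.ne']; linear_combination -√Q * hsQ2
          rw [mul_div_assoc σ, this]
          field_simp
      _ ≤ σ * (2 * C) / √Q ^ 3 + 6 * σ * C / Q ^ 2 := by gcongr
      _ = _ := by ring
  rw [rootKernelDeriv2]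
  refine (norm_add_le _ _).trans ?_
  linarith

theorem integral_norm_rootKernelDeriv2_le (hz : ‖z‖ = 1) (hz1 : z ≠ 1) {X : ℝ} (hX : 0 ≤ X) :
    ∫ t in (0 : ℝ)..X, ‖rootKernelDeriv2 z t‖ ≤ 11 / ‖1 - z‖ ^ 2 := by
  set s := ‖1 - z‖ with hs
  have hs0 : 0 < s := norm_pos_iff.mpr (sub_ne_zero.mpr (Ne.symm hz1))
  have hs2 : s ≤ 2 := by
    refine (norm_sub_le _ _).trans ?_
    rw [hz, norm_one]; norm_num
  set σ : ℝ → ℝ := fun t => 2 * Real.sinh (t / 2) with hσ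
  set C : ℝ → ℝ := fun t => Real.cosh (t / 2) with hC
  set Q : ℝ → ℝ := fun t => σ t ^ 2 + s ^ 2 with hQ
  have hQ0 : ∀ t, 0 < Q t := fun t => by simp only [hQ]; positivity
  have hσd : ∀ t, HasDerivAt σ (C t) t := fun t => by
    have h : HasDerivAt (fun t : ℝ => t / 2) (1 / 2) t := (hasDerivAt_id t).div_const 2
    refine (h.sinh.const_mul 2).congr_deriv ?_
    simp only [hC]; ring
  have hQd : ∀ t, HasDerivAt Q (2 * σ t * C t) t := fun t => by
    refine (((hσd t).pow 2).add_const (s ^ 2)).congr_deriv ?_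
    simp
  have hsQd : ∀ t, HasDerivAt (fun t => √(Q t)) (σ t * C t / √(Q t)) t := fun t => by
    refine ((hQd t).sqrt (hQ0 t).ne').congr_deriv ?_
    ring
  have hsq : ∀ t, √(Q t) ^ 2 = Q t := fun t => Real.sq_sqrt (hQ0 t).le
  have hsq0 : ∀ t, 0 < √(Q t) := fun t => Real.sqrt_pos.mpr (hQ0 t)
  have hA : ∀ t, HasDerivAt (fun t => 4 / s ^ 2 * (σ t / √(Q t)) - 2 * (√(Q t))⁻¹ - 3 * (Q t)⁻¹)
      (4 * C t / √(Q t) ^ 3 + 2 * σ t * C t / √(Q t) ^ 3 + 6 * σ t * C t / Q t ^ 2) t := fun t => by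
    refine (((((hσd t).div (hsQd t) (hsq0 t).ne').const_mul (4 / s ^ 2)).sub
      (((hsQd t).inv (hsq0 t).ne').const_mul 2)).sub
      (((hQd t).inv (hQ0 t).ne').const_mul 3)).congr_deriv ?_
    have h1 := (hsq0 t).ne'
    have h2 := (hQ0 t).ne'
    have h3 : s ^ 2 = √(Q t) ^ 2 - σ t ^ 2 := by rw [hsq]; simp only [hQ]; ring
    have h4 : C t * √(Q t) - σ t * (σ t * C t / √(Q t)) = C t * s ^ 2 / √(Q t) := by
      rw [h3]; field_simp
    rw [h4, ← hsq t]
    field_simp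
    ring
  have hσc : Continuous σ := by fun_prop
  have hCc : Continuous C := by fun_prop
  have hQc : Continuous Q := by fun_prop
  have hcont : Continuous fun t => 4 * C t / √(Q t) ^ 3 + 2 * σ t * C t / √(Q t) ^ 3 +
      6 * σ t * C t / Q t ^ 2 := by
    refine ((Continuous.div₀ (by fun_prop) (by fun_prop) ?_).add
      (Continuous.div₀ (by fun_prop) (by fun_prop) ?_)).add
      (Continuous.div₀ (by fun_prop) (by fun_prop) ?_)
    · exact fun t => pow_ne_zero 3 (hsq0 t).ne'
    · exact fun t => pow_ne_zero 3 (hsq0 t).ne'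
    · exact fun t => pow_ne_zero 2 (hQ0 t).ne'
  calc _ ≤ ∫ t in (0 : ℝ)..X, (4 * C t / √(Q t) ^ 3 + 2 * σ t * C t / √(Q t) ^ 3 +
      6 * σ t * C t / Q t ^ 2) :=
        intervalIntegral.integral_mono_on hX
          ((continuous_rootKernelDeriv2 hz hz1).norm.intervalIntegrable _ _)
          (hcont.intervalIntegrable _ _)
          fun t ht => norm_rootKernelDeriv2_le hz hz1 ht.1 rfl rfl rfl
    _ = _ := intervalIntegral.integral_eq_sub_of_hasDerivAt (fun t _ => hA t)
          (hcont.intervalIntegrable _ _)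
    _ ≤ _ := ?_
  have hQz : Q 0 = s ^ 2 := by simp [hQ, hσ]
  have hsz : √(Q 0) = s := by rw [hQz, Real.sqrt_sq hs0.le]
  have hσz : σ 0 = 0 := by simp [hσ]
  rw [hσz, hsz, hQz]
  have h1 : σ X / √(Q X) ≤ 1 := by
    rw [div_le_one (hsq0 X)]
    refine Real.le_sqrt_of_sq_le ?_
    simp only [hQ]; nlinarith
  have h2 : 0 < (√(Q X))⁻¹ := inv_pos.mpr (hsq0 X)
  have h3 : 0 < (Q X)⁻¹ := inv_pos.mpr (hQ0 X)
  have h4 : 4 / s ^ 2 * (σ X / √(Q X)) ≤ 4 / s ^ 2 * 1 := by gcongr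
  have h5 : s⁻¹ ≤ 2 / s ^ 2 := by
    rw [le_div_iff₀ (by positivity), sq, ← mul_assoc, inv_mul_cancel₀ hs0.ne']; linarith
  have h6 : (s ^ 2)⁻¹ = 1 / s ^ 2 := by ring
  rw [h6]
  have h7 : 11 / s ^ 2 = 4 / s ^ 2 * 1 + 2 * (2 / s ^ 2) + 3 * (1 / s ^ 2) := by ring
  rw [h7, zero_div, mul_zero]
  linarith

end RootKernel

section FiniteFourier

open Set Filter Topology

open ZMod

variable {N : ℕ} [NeZero N]

theorem norm_stdAddChar (a : ZMod N) : ‖(stdAddChar a : ℂ)‖ = 1 :=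
  AddChar.norm_apply _ _

theorem stdAddChar_ne_one {a : ZMod N} (ha : a ≠ 0) : (stdAddChar a : ℂ) ≠ 1 := by
  intro h
  exact ha ((injective_stdAddChar (N := N)) (by rw [h, AddChar.map_zero_eq_one]))

theorem stdAddChar_mul_natCast (a : ZMod N) (n : ℕ) :
    stdAddChar (a * (n : ZMod N)) = (stdAddChar a : ℂ) ^ n := by
  rw [← AddChar.map_nsmul_eq_pow, nsmul_eq_mul, mul_comm]

theorem sum_norm_dft_sq (Φ : ZMod N → ℂ) : ∑ k, ‖𝓕 Φ k‖ ^ 2 = N * ∑ j, ‖Φ j‖ ^ 2 := by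
  have h1 : ∀ k, (starRingEnd ℂ) (𝓕 Φ k) = ∑ j, stdAddChar (j * k) * (starRingEnd ℂ) (Φ j) := by
    intro k
    rw [dft_apply, map_sum]
    refine Finset.sum_congr rfl fun j _ => ?_
    rw [smul_eq_mul, map_mul, ← AddChar.map_neg_eq_conj, neg_neg]
  have h2 : ((∑ k, ‖𝓕 Φ k‖ ^ 2 : ℝ) : ℂ) = ((N * ∑ j, ‖Φ j‖ ^ 2 : ℝ) : ℂ) := by
    push_cast
    calc _ = ∑ k, 𝓕 Φ k * (starRingEnd ℂ) (𝓕 Φ k) :=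
          Finset.sum_congr rfl fun k _ => (Complex.mul_conj' _).symm
      _ = ∑ j, (starRingEnd ℂ) (Φ j) * ∑ k, stdAddChar (j * k) * 𝓕 Φ k := by
          simp_rw [h1, Finset.mul_sum]
          rw [Finset.sum_comm]
          refine Finset.sum_congr rfl fun j _ => Finset.sum_congr rfl fun k _ => ?_
          ring
      _ = ∑ j, (starRingEnd ℂ) (Φ j) * (N * Φ j) := by
          refine Finset.sum_congr rfl fun j _ => ?_
          have h := congrFun (dft_dft Φ) (-j)
          rw [dft_apply, neg_neg, smul_eq_mul] at h
          rw [← h]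
          congr 1
          refine Finset.sum_congr rfl fun k _ => ?_
          rw [smul_eq_mul, mul_neg, neg_neg, mul_comm k j]
      _ = _ := by
          rw [Finset.mul_sum]
          refine Finset.sum_congr rfl fun j _ => ?_
          rw [← Complex.mul_conj']
          ring
  exact_mod_cast h2

theorem sum_range_mul_pow_mul (w : ℂ) (n : ℕ) :
    (∑ j ∈ Finset.range n, (j : ℂ) * w ^ j) * (w - 1) =
      n * w ^ n - w * ∑ j ∈ Finset.range n, w ^ j := by
  induction n with
  | zero => simp
  | succ n ih =>
    rw [Finset.sum_range_succ, Finset.sum_range_succ, add_mul, ih]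
    push_cast
    ring

theorem sum_zmod_eq_sum_range (f : ℕ → ℂ) : ∑ j : ZMod N, f j.val = ∑ j ∈ Finset.range N, f j := by
  refine Finset.sum_bij (fun j _ => j.val) (fun j _ => Finset.mem_range.mpr j.val_lt)
    (fun a _ b _ h => val_injective N h) (fun b hb => ⟨b, Finset.mem_univ _, ?_⟩) (fun _ _ => rfl)
  exact val_cast_of_lt (Finset.mem_range.mp hb)

theorem norm_dft_val {a : ZMod N} (ha : a ≠ 0) :
    ‖𝓕 (fun j : ZMod N => (j.val : ℂ)) a‖ = N / ‖1 - (stdAddChar a : ℂ)‖ := by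
  set w : ℂ := stdAddChar (-a) with hw
  have hw1 : w ≠ 1 := stdAddChar_ne_one (neg_ne_zero.mpr ha)
  have hwN : w ^ N = 1 := by rw [hw, ← stdAddChar_mul_natCast]; simp
  have h0 : ∑ j ∈ Finset.range N, w ^ j = 0 := by
    rw [geom_sum_eq hw1, hwN]; simp
  have h1 : 𝓕 (fun j : ZMod N => (j.val : ℂ)) a = ∑ j ∈ Finset.range N, (j : ℂ) * w ^ j := by
    rw [dft_apply, ← sum_zmod_eq_sum_range]
    refine Finset.sum_congr rfl fun j _ => ?_
    rw [smul_eq_mul, mul_comm, hw, ← stdAddChar_mul_natCast]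
    congr 2
    rw [natCast_zmod_val]; ring
  have h2 := sum_range_mul_pow_mul w N
  rw [h0, hwN, mul_one, mul_zero, sub_zero, ← h1] at h2
  have h3 : ‖w - 1‖ = ‖1 - (stdAddChar a : ℂ)‖ := by
    have : w = (starRingEnd ℂ) (stdAddChar a) := by rw [hw, AddChar.map_neg_eq_conj]
    rw [this, norm_sub_rev, ← Complex.norm_conj, map_sub, map_one, Complex.conj_conj]
  have h4 : 0 < ‖w - 1‖ := norm_pos_iff.mpr (sub_ne_zero.mpr hw1)
  rw [← h3, eq_div_iff h4.ne', ← norm_mul, h2, Complex.norm_natCast]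

theorem sum_inv_norm_one_sub_sq_le :
    ∑ a ∈ Finset.univ.erase (0 : ZMod N), 1 / ‖1 - (stdAddChar a : ℂ)‖ ^ 2 ≤ (N : ℝ) ^ 2 / 12 := by
  have hN : (0 : ℝ) < N := by exact_mod_cast Nat.pos_of_ne_zero (NeZero.ne N)
  have h := sum_norm_dft_sq (fun j : ZMod N => (j.val : ℂ))
  rw [← Finset.add_sum_erase _ _ (Finset.mem_univ (0 : ZMod N))] at h
  have h1 : ∑ a ∈ Finset.univ.erase (0 : ZMod N), ‖𝓕 (fun j : ZMod N => (j.val : ℂ)) a‖ ^ 2 =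
      N ^ 2 * ∑ a ∈ Finset.univ.erase (0 : ZMod N), 1 / ‖1 - (stdAddChar a : ℂ)‖ ^ 2 := by
    rw [Finset.mul_sum]
    refine Finset.sum_congr rfl fun a ha => ?_
    rw [norm_dft_val (Finset.ne_of_mem_erase ha)]
    ring
  have e1 : ∀ n : ℕ, ∑ j ∈ Finset.range n, (j : ℂ) = n * (n - 1) / 2 := fun n => by
    induction n with
    | zero => simp
    | succ n ih => rw [Finset.sum_range_succ, ih]; push_cast; ring
  have e2 : ∀ n : ℕ, ∑ j ∈ Finset.range n, (j : ℂ) ^ 2 = n * (n - 1) * (2 * n - 1) / 6 := fun n => by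
    induction n with
    | zero => simp
    | succ n ih => rw [Finset.sum_range_succ, ih]; push_cast; ring
  have h2 : ‖𝓕 (fun j : ZMod N => (j.val : ℂ)) 0‖ = N * (N - 1) / 2 := by
    rw [dft_apply_zero, sum_zmod_eq_sum_range (fun j => (j : ℂ)), e1]
    have : ((N : ℂ) * (N - 1) / 2) = ((N * (N - 1) / 2 : ℝ) : ℂ) := by push_cast; ring
    rw [this, Complex.norm_real, Real.norm_of_nonneg]
    have : (1 : ℝ) ≤ N := by exact_mod_cast NeZero.one_le
    have : (0 : ℝ) ≤ N - 1 := by linarith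
    positivity
  have h3 : ∑ j : ZMod N, ‖((j.val : ℕ) : ℂ)‖ ^ 2 = N * (N - 1) * (2 * N - 1) / 6 := by
    have : ((∑ j : ZMod N, ‖((j.val : ℕ) : ℂ)‖ ^ 2 : ℝ) : ℂ) =
        ((N * (N - 1) * (2 * N - 1) / 6 : ℝ) : ℂ) := by
      push_cast
      rw [← e2, ← sum_zmod_eq_sum_range (fun j => (j : ℂ) ^ 2)]
      refine Finset.sum_congr rfl fun j _ => ?_
      rw [Complex.norm_natCast]
      push_cast
      rfl
    exact_mod_cast this
  rw [h1, h2, h3] at h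
  rw [← mul_le_mul_iff_right₀ (show (0 : ℝ) < N ^ 2 by positivity)]
  nlinarith

theorem exists_fourier_coeff {χ : DirichletCharacter ℂ N} (hN : 1 < N) (hχ : χ.IsPrimitive)
    (hχ2 : χ ^ 2 = 1) : ∃ c : ZMod N → ℂ, c 0 = 0 ∧ (∀ a, ‖c a‖ ≤ 1 / √N) ∧
      ∀ n : ℕ, χ n = ∑ a, c a * (stdAddChar a : ℂ) ^ n := by
  have hN0 : (0 : ℝ) < N := by exact_mod_cast Nat.pos_of_ne_zero (NeZero.ne N)
  have hinv : χ⁻¹ = χ := inv_eq_of_mul_eq_one_left (by rw [← sq, hχ2])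
  set τ := gaussSum χ (stdAddChar (N := N)) with hτ
  have hF : ∀ k, 𝓕 χ k = χ (-1) * τ * χ k := fun k => by
    rw [hχ.fourierTransform_eq_inv_mul_gaussSum, hinv, neg_eq_neg_one_mul, map_mul, hτ]
    ring
  have hneg : χ (-1) * χ (-1) = 1 := by rw [← map_mul]; simp
  have hτ2 : ‖τ‖ ^ 2 = N := by
    have h1 := congrFun (dft_dft (χ : ZMod N → ℂ)) (-1)
    have h2 : 𝓕 (𝓕 χ) = fun k => χ (-1) * τ * 𝓕 χ k := by
      rw [← dft_const_mul]; congr 1; funext k; exact hF k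
    rw [h2] at h1
    simp only [hF, neg_neg, map_one, smul_eq_mul, mul_one] at h1
    have h3 : τ ^ 2 * χ (-1) = N := by
      rw [← h1]; linear_combination (-(τ ^ 2 * χ (-1))) * hneg
    have h4 : ‖χ (-1)‖ = 1 := by
      have := congrArg norm hneg
      rw [norm_mul, norm_one] at this
      nlinarith [norm_nonneg (χ (-1))]
    have h5 := congrArg norm h3
    rwa [norm_mul, h4, norm_pow, mul_one, Complex.norm_natCast] at h5
  have hτn : ‖τ‖ = √N := by rw [← hτ2, Real.sqrt_sq (norm_nonneg _)]
  refine ⟨fun a => (N : ℂ)⁻¹ * 𝓕 χ a, ?_, fun a => ?_, fun n => ?_⟩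
  · have : ¬ IsUnit (0 : ZMod N) := by
      have : Fact (1 < N) := ⟨hN⟩
      simp
    simp only [hF, χ.map_nonunit this, mul_zero]
  · show ‖(N : ℂ)⁻¹ * 𝓕 χ a‖ ≤ _
    rw [hF, norm_mul, norm_mul, norm_mul, norm_inv, Complex.norm_natCast, hτn]
    have h1 := χ.norm_le_one a
    have h2 := χ.norm_le_one (-1)
    calc _ ≤ (N : ℝ)⁻¹ * (1 * √N * 1) := by gcongr
      _ = _ := by
        rw [one_mul, mul_one, eq_div_iff (by positivity), mul_assoc, Real.mul_self_sqrt hN0.le,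
          inv_mul_cancel₀ hN0.ne']
  · have h1 : χ n = 𝓕⁻ (𝓕 (χ : ZMod N → ℂ)) n := by rw [LinearEquiv.symm_apply_apply]
    rw [h1, invDFT_apply, smul_eq_mul, Finset.mul_sum]
    refine Finset.sum_congr rfl fun a _ => ?_
    rw [smul_eq_mul, stdAddChar_mul_natCast]
    ring

end FiniteFourier

section LambertKernel

open Set Filter Topology

section LambertSums

open ArithmeticFunction ArithmeticFunction.zeta

theorem HasSum.of_forall_eq {ι E : Type*} [AddCommMonoid E] [TopologicalSpace E] {f g : ι → E} {a : E}
    (hg : HasSum g a) (h : ∀ i, f i = g i) : HasSum f a := by rwa [funext h]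

/-- The function `n ↦ n v exp (-n v)`. -/
noncomputable def expTerm (v : ℝ) (n : ℕ) : ℝ := n * v * Real.exp (-(n * v))

theorem expTerm_nonneg {v : ℝ} (hv : 0 ≤ v) (n : ℕ) : 0 ≤ expTerm v n := by
  unfold expTerm; positivity

theorem mul_expTerm_le {v : ℝ} (hv : 0 < v) {k m : ℕ} (hk : k ≠ 0) (hm : m ≠ 0) :
    (k : ℝ) * m * expTerm v (k * m) ≤
      8 / v * Real.exp (v / 2) * (Real.exp (-(v / 2)) ^ k * Real.exp (-(v / 2)) ^ m) := by
  have hk1 : (1 : ℝ) ≤ k := by exact_mod_cast Nat.one_le_iff_ne_zero.mpr hk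
  have hm1 : (1 : ℝ) ≤ m := by exact_mod_cast Nat.one_le_iff_ne_zero.mpr hm
  set x := (k : ℝ) * m * v with hx
  have hx0 : 0 ≤ x := by positivity
  have h1 : x ^ 2 ≤ 8 * Real.exp (x / 2) := by
    have := Real.quadratic_le_exp_of_nonneg (show 0 ≤ x / 2 by positivity)
    nlinarith
  have h2 : Real.exp (-x) = Real.exp (-(x / 2)) * Real.exp (-(x / 2)) := by
    rw [← Real.exp_add]; ring_nf
  have h3 : Real.exp (x / 2) * Real.exp (-(x / 2)) = 1 := by rw [← Real.exp_add]; simp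
  have h4 : Real.exp (-(x / 2)) ≤
      Real.exp (v / 2) * (Real.exp (-(v / 2)) ^ k * Real.exp (-(v / 2)) ^ m) := by
    rw [← Real.exp_nat_mul, ← Real.exp_nat_mul, ← Real.exp_add, ← Real.exp_add]
    refine Real.exp_le_exp.mpr ?_
    have : 0 ≤ ((k : ℝ) - 1) * (m - 1) * v :=
      mul_nonneg (mul_nonneg (by linarith) (by linarith)) hv.le
    rw [hx]; nlinarith
  have h5 : (k : ℝ) * m * expTerm v (k * m) = x ^ 2 * Real.exp (-x) / v := by
    unfold expTerm
    push_cast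
    rw [← hx, hx]
    field_simp
  rw [h5, h2]
  calc x ^ 2 * (Real.exp (-(x / 2)) * Real.exp (-(x / 2))) / v
      ≤ 8 * Real.exp (x / 2) * (Real.exp (-(x / 2)) * Real.exp (-(x / 2))) / v := by gcongr
    _ = 8 / v * Real.exp (-(x / 2)) := by linear_combination 8 / v * Real.exp (-(x / 2)) * h3
    _ ≤ _ := by rw [mul_assoc]; gcongr

theorem summable_mul_expTerm {A B : ArithmeticFunction ℝ} (hA : ∀ n, |A n| ≤ n)
    (hB : ∀ n, |B n| ≤ n) {v : ℝ} (hv : 0 < v) :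
    Summable fun p : ℕ × ℕ => A p.1 * B p.2 * expTerm v (p.1 * p.2) := by
  have hr : Real.exp (-(v / 2)) < 1 := by rw [Real.exp_lt_one_iff]; linarith
  have hg := summable_geometric_of_lt_one (Real.exp_pos (-(v / 2))).le hr
  have hs := (hg.mul_of_nonneg hg (fun n => by positivity) (fun n => by positivity)).mul_left
    (8 / v * Real.exp (v / 2))
  refine hs.of_norm_bounded fun p => ?_
  by_cases hk : p.1 = 0
  · rw [hk]; simp; positivity
  by_cases hm : p.2 = 0
  · rw [hm]; simp; positivity
  refine le_trans ?_ (mul_expTerm_le hv hk hm)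
  rw [Real.norm_eq_abs, abs_mul, abs_mul, abs_of_nonneg (expTerm_nonneg hv.le _)]
  have := expTerm_nonneg hv.le (p.1 * p.2)
  gcongr
  · exact hA _
  · exact hB _

theorem hasSum_arithmetic_mul {A B : ArithmeticFunction ℝ} {F : ℕ → ℝ} {T : ℝ}
    (h : HasSum (fun p : ℕ × ℕ => A p.1 * B p.2 * F (p.1 * p.2)) T) :
    HasSum (fun n => (A * B) n * F n) T := by
  have h1 := h.tsum_fiberwise (fun p : ℕ × ℕ => p.1 * p.2)
  refine h1.of_forall_eq fun n => ?_
  rcases eq_or_ne n 0 with rfl | hn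
  · rw [ArithmeticFunction.map_zero, zero_mul, eq_comm]
    refine (tsum_congr fun p => ?_).trans tsum_zero
    have : p.1.1 * p.1.2 = 0 := p.2
    rcases mul_eq_zero.mp this with h | h <;> simp [h]
  · have e : (fun p : ℕ × ℕ => p.1 * p.2) ⁻¹' {n} = ↑n.divisorsAntidiagonal := by
      ext p; simp [hn]
    rw [e, Finset.tsum_subtype' n.divisorsAntidiagonal
      (fun p : ℕ × ℕ => A p.1 * B p.2 * F (p.1 * p.2)), mul_apply, Finset.sum_mul]
    refine Finset.sum_congr rfl fun p hp => ?_
    rw [(Nat.mem_divisorsAntidiagonal.mp hp).1]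

variable {N : ℕ} [NeZero N]

/-- The real arithmetic function attached to a Dirichlet character. -/
noncomputable def charArith (χ : DirichletCharacter ℂ N) : ArithmeticFunction ℝ :=
  ⟨fun n => if n = 0 then 0 else (χ n).re, by simp⟩

theorem charArith_apply (χ : DirichletCharacter ℂ N) {n : ℕ} (hn : n ≠ 0) :
    charArith χ n = (χ n).re := by simp [charArith, hn]

theorem ofReal_charArith {χ : DirichletCharacter ℂ N} (hχ2 : χ ^ 2 = 1) {n : ℕ} (hn : n ≠ 0) :
    (charArith χ n : ℂ) = χ n := by
  obtain ⟨r, hr, -⟩ := exists_real_of_sq_eq_one hχ2 n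
  rw [charArith_apply χ hn, hr, Complex.ofReal_re]

theorem abs_charArith_le (χ : DirichletCharacter ℂ N) (n : ℕ) : |charArith χ n| ≤ 1 := by
  rcases eq_or_ne n 0 with rfl | hn
  · simp
  · rw [charArith_apply χ hn]
    exact (Complex.abs_re_le_norm _).trans (χ.norm_le_one _)

theorem abs_le_natCast_of_abs_le_one {A : ArithmeticFunction ℝ} (h : ∀ n, |A n| ≤ 1) (n : ℕ) :
    |A n| ≤ n := by
  rcases eq_or_ne n 0 with rfl | hn
  · simp
  · exact (h n).trans (by exact_mod_cast Nat.one_le_iff_ne_zero.mpr hn)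

theorem abs_zeta_le (n : ℕ) : |(ζ : ArithmeticFunction ℝ) n| ≤ 1 := by
  rcases eq_or_ne n 0 with rfl | hn
  · simp
  · simp [hn]

theorem isMultiplicative_charArith {χ : DirichletCharacter ℂ N} (hχ2 : χ ^ 2 = 1) :
    (charArith χ).IsMultiplicative := by
  rw [IsMultiplicative.iff_ne_zero]
  refine ⟨by simp [charArith], fun {m n} hm hn _ => ?_⟩
  have : ((charArith χ (m * n) : ℝ) : ℂ) = ((charArith χ m * charArith χ n : ℝ) : ℂ) := by
    rw [Complex.ofReal_mul, ofReal_charArith hχ2 hm, ofReal_charArith hχ2 hn,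
      ofReal_charArith hχ2 (mul_ne_zero hm hn), Nat.cast_mul, map_mul]
  exact_mod_cast this

/-- The series `∑ (1 * χ)(n) n v exp (-n v)`. -/
noncomputable def lambertSum (χ : DirichletCharacter ℂ N) (v : ℝ) : ℝ :=
  ∑' p : ℕ × ℕ, (ζ : ArithmeticFunction ℝ) p.1 * charArith χ p.2 * expTerm v (p.1 * p.2)

theorem hasSum_lambertSum (χ : DirichletCharacter ℂ N) {v : ℝ} (hv : 0 < v) :
    HasSum (fun p : ℕ × ℕ => (ζ : ArithmeticFunction ℝ) p.1 * charArith χ p.2 *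
      expTerm v (p.1 * p.2)) (lambertSum χ v) :=
  (summable_mul_expTerm (abs_le_natCast_of_abs_le_one abs_zeta_le)
    (abs_le_natCast_of_abs_le_one (abs_charArith_le χ)) hv).hasSum

end LambertSums

section KernelExpansion

open ZMod ArithmeticFunction ArithmeticFunction.zeta

theorem hasSum_rootKernel {z : ℂ} (hz : ‖z‖ = 1) {t : ℝ} (ht : 0 < t) :
    HasSum (fun n : ℕ => z ^ n * (expTerm t n : ℂ)) (rootKernel z t) := by
  have h : ‖z * Complex.exp (-t)‖ < 1 := by
    rw [norm_mul, hz, one_mul, ← Complex.ofReal_neg, Complex.norm_exp_ofReal, Real.exp_lt_one_iff]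
    linarith
  refine ((hasSum_coe_mul_geometric_of_norm_lt_one h).mul_left (t : ℂ)).of_forall_eq fun n => ?_
  unfold expTerm
  push_cast
  rw [mul_pow, ← Complex.exp_nat_mul, mul_neg]
  ring

theorem continuous_rootKernel {z : ℂ} (hz : ‖z‖ = 1) (hz1 : z ≠ 1) : Continuous (rootKernel z) :=
  continuous_iff_continuousAt.mpr fun t => (hasDerivAt_rootKernel hz hz1 t).continuousAt

theorem norm_rootKernel_le {z : ℂ} (hz : ‖z‖ = 1) {t : ℝ} (ht : 1 ≤ t) :
    ‖rootKernel z t‖ ≤ 8 * Real.exp (-(1 / 2) * t) := by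
  have h0 : Real.exp (-t) ≤ 1 / 2 := by
    rw [Real.exp_neg, inv_le_comm₀ (Real.exp_pos _) (by norm_num)]
    have := Real.add_one_le_exp t
    linarith
  have h1 : ‖z * Complex.exp (-t)‖ = Real.exp (-t) := by
    rw [norm_mul, hz, one_mul, ← Complex.ofReal_neg, Complex.norm_exp_ofReal]
  have h2 : 1 / 2 ≤ ‖1 - z * Complex.exp (-t)‖ := by
    have := norm_sub_norm_le 1 (z * Complex.exp (-t))
    rw [norm_one, h1] at this
    linarith
  have h3 : t ≤ 2 * Real.exp (1 / 2 * t) := by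
    have := Real.add_one_le_exp (1 / 2 * t)
    linarith
  have h4 : Real.exp (1 / 2 * t) * Real.exp (-t) = Real.exp (-(1 / 2) * t) := by
    rw [← Real.exp_add]; ring_nf
  unfold rootKernel
  rw [norm_mul, norm_div, h1, norm_pow, Complex.norm_real, Real.norm_of_nonneg (by linarith)]
  calc t * (Real.exp (-t) / ‖1 - z * Complex.exp (-t)‖ ^ 2)
      ≤ 2 * Real.exp (1 / 2 * t) * (Real.exp (-t) / (1 / 2) ^ 2) := by gcongr
    _ = _ := by rw [← h4]; ring

theorem integrableOn_rootKernel {z : ℂ} (hz : ‖z‖ = 1) (hz1 : z ≠ 1) :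
    MeasureTheory.IntegrableOn (rootKernel z) (Ioi 0) := by
  have hc := continuous_rootKernel hz hz1
  have h : MeasureTheory.IntegrableOn (fun t => ‖rootKernel z t‖) (Ioi 0) := by
    refine integrable_of_isBigO_exp_neg (b := 1 / 2) (by norm_num) hc.norm.continuousOn ?_
    refine Asymptotics.IsBigO.of_bound 8 ?_
    filter_upwards [eventually_ge_atTop 1] with t ht
    rw [norm_norm, Real.norm_of_nonneg (Real.exp_pos _).le]
    exact norm_rootKernel_le hz ht
  exact (MeasureTheory.integrable_norm_iff hc.aestronglyMeasurable).mp h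

variable {N : ℕ} [NeZero N]

theorem exists_lambertSum_bound {χ : DirichletCharacter ℂ N} (hN : 1 < N) (hχ : χ.IsPrimitive)
    (hχ2 : χ ^ 2 = 1) : ∃ l : ℝ, ∀ v : ℝ, 0 < v →
      |lambertSum χ v - l / v| ≤ 11 / 96 * (N * √N) * v := by
  obtain ⟨c, hc0, hc, hcχ⟩ := exists_fourier_coeff hN hχ hχ2
  have hN0 : (0 : ℝ) < N := by exact_mod_cast Nat.pos_of_ne_zero (NeZero.ne N)
  set I := Finset.univ.erase (0 : ZMod N) with hI
  have hz : ∀ a : ZMod N, ‖(stdAddChar a : ℂ)‖ = 1 := norm_stdAddChar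
  have hz1 : ∀ a ∈ I, (stdAddChar a : ℂ) ≠ 1 := fun a ha =>
    stdAddChar_ne_one (Finset.ne_of_mem_erase ha)
  have hcI : ∀ n : ℕ, χ n = ∑ a ∈ I, c a * (stdAddChar a : ℂ) ^ n := fun n => by
    rw [hcχ, ← Finset.add_sum_erase _ _ (Finset.mem_univ (0 : ZMod N)), hc0, zero_mul, zero_add]
  set M : ℝ → ℂ := fun t => ∑ a ∈ I, c a * rootKernel (stdAddChar a) t with hM
  have hMsum : ∀ t : ℝ, 0 < t → HasSum (fun n : ℕ => ((charArith χ n * expTerm t n : ℝ) : ℂ))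
      (M t) := fun t ht => by
    have := hasSum_sum (s := I) fun a _ => (hasSum_rootKernel (hz a) ht).mul_left (c a)
    refine this.of_forall_eq fun n => ?_
    rcases eq_or_ne n 0 with rfl | hn
    · simp [expTerm]
    · rw [Complex.ofReal_mul, ofReal_charArith hχ2 hn, hcI, Finset.sum_mul]
      exact Finset.sum_congr rfl fun a _ => mul_assoc _ _ _
  have hS : ∀ v : ℝ, 0 < v → HasSum (fun k : ℕ => M ((k + 1) * v)) (lambertSum χ v : ℂ) := by
    intro v hv
    have h1 := Complex.hasSum_ofReal.mpr (hasSum_lambertSum χ hv)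
    have h2 : ∀ k : ℕ, HasSum (fun m : ℕ => (((ζ : ArithmeticFunction ℝ) k * charArith χ m *
        expTerm v (k * m) : ℝ) : ℂ)) (if k = 0 then 0 else M (k * v)) := by
      intro k
      split_ifs with hk
      · refine hasSum_zero.of_forall_eq fun m => ?_
        simp [hk]
      · refine (hMsum (k * v) (by positivity)).of_forall_eq fun m => ?_
        simp only [natCoe_apply, zeta_apply, hk, if_false, Nat.cast_one, one_mul, expTerm]
        push_cast
        ring_nf
    have h3 := h1.prod_fiberwise h2
    rw [← hasSum_nat_add_iff' 1] at h3
    simpa using h3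
  have key : ∀ v : ℝ, 0 < v → ‖(v : ℂ) * lambertSum χ v - ∫ t in Ioi (0 : ℝ), M t‖ ≤
      v ^ 2 / 8 * (11 / 12 * (N * √N)) := by
    intro v hv
    refine norm_tsum_sub_integral_le
      (F' := fun t => ∑ a ∈ I, c a * ((stdAddChar a : ℂ) * Complex.exp (-t) /
        (1 - (stdAddChar a : ℂ) * Complex.exp (-t)) ^ 2 + t * -((stdAddChar a : ℂ) *
          Complex.exp (-t) * (1 + (stdAddChar a : ℂ) * Complex.exp (-t)) /
            (1 - (stdAddChar a : ℂ) * Complex.exp (-t)) ^ 3)))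
      (F'' := fun t => ∑ a ∈ I, c a * rootKernelDeriv2 (stdAddChar a) t)
      (fun t => ?_) (fun t => ?_) ?_ ?_ hv (fun X hX => ?_) ?_ (hS v hv)
    · exact HasDerivAt.fun_sum fun a ha => (hasDerivAt_rootKernel (hz a) (hz1 a ha) t).const_mul _
    · exact HasDerivAt.fun_sum fun a ha =>
        (hasDerivAt_rootKernel_deriv (hz a) (hz1 a ha) t).const_mul _
    · exact continuous_finsetSum _ fun a ha =>
        continuous_const.mul (continuous_rootKernelDeriv2 (hz a) (hz1 a ha))
    · simp [hM, rootKernel]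
    · have hcont : ∀ a ∈ I, Continuous fun t => ‖rootKernelDeriv2 (stdAddChar a) t‖ := fun a ha =>
        (continuous_rootKernelDeriv2 (hz a) (hz1 a ha)).norm
      have hii : ∀ a ∈ I, IntervalIntegrable (fun t => 1 / √N * ‖rootKernelDeriv2 (stdAddChar a) t‖)
          MeasureTheory.volume 0 X := fun a ha =>
        (continuous_const.mul (hcont a ha)).intervalIntegrable _ _
      calc ∫ t in (0 : ℝ)..X, ‖∑ a ∈ I, c a * rootKernelDeriv2 (stdAddChar a) t‖
          ≤ ∫ t in (0 : ℝ)..X, ∑ a ∈ I, 1 / √N * ‖rootKernelDeriv2 (stdAddChar a) t‖ := by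
            refine intervalIntegral.integral_mono_on hX
              (Continuous.intervalIntegrable (Continuous.norm (continuous_finsetSum _ fun a ha =>
                continuous_const.mul (continuous_rootKernelDeriv2 (hz a) (hz1 a ha)))) _ _)
              (Continuous.intervalIntegrable (continuous_finsetSum _ fun a ha =>
                continuous_const.mul (hcont a ha)) _ _) fun t _ => ?_
            refine (norm_sum_le _ _).trans (Finset.sum_le_sum fun a _ => ?_)
            rw [norm_mul]
            exact mul_le_mul_of_nonneg_right (hc a) (norm_nonneg _)
        _ = ∑ a ∈ I, 1 / √N * ∫ t in (0 : ℝ)..X, ‖rootKernelDeriv2 (stdAddChar a) t‖ := by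
            rw [intervalIntegral.integral_finsetSum hii]
            simp only [intervalIntegral.integral_const_mul]
        _ ≤ ∑ a ∈ I, 1 / √N * (11 / ‖1 - (stdAddChar a : ℂ)‖ ^ 2) := by
            refine Finset.sum_le_sum fun a ha => mul_le_mul_of_nonneg_left ?_ (by positivity)
            exact integral_norm_rootKernelDeriv2_le (hz a) (hz1 a ha) hX
        _ = 11 / √N * ∑ a ∈ I, 1 / ‖1 - (stdAddChar a : ℂ)‖ ^ 2 := by
            rw [Finset.mul_sum]
            exact Finset.sum_congr rfl fun a _ => by ring
        _ ≤ 11 / √N * ((N : ℝ) ^ 2 / 12) :=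
            mul_le_mul_of_nonneg_left sum_inv_norm_one_sub_sq_le (by positivity)
        _ = 11 / 12 * (N * √N) := by
            have h1 : 0 < √(N : ℝ) := Real.sqrt_pos.mpr hN0
            have h2 := Real.mul_self_sqrt hN0.le
            rw [div_mul_eq_mul_div, div_eq_iff h1.ne']
            linear_combination (-(11 / 12) * (N : ℝ)) * h2
    · exact MeasureTheory.integrable_finsetSum _ fun a ha =>
        (integrableOn_rootKernel (hz a) (hz1 a ha)).const_mul _
  refine ⟨(∫ t in Ioi (0 : ℝ), M t).re, fun v hv => ?_⟩
  have h1 := (Complex.abs_re_le_norm _).trans (key v hv)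
  rw [Complex.sub_re, ← Complex.ofReal_mul, Complex.ofReal_re] at h1
  have h2 : lambertSum χ v - (∫ t in Ioi (0 : ℝ), M t).re / v =
      (v * lambertSum χ v - (∫ t in Ioi (0 : ℝ), M t).re) / v := by field_simp
  rw [h2, abs_div, abs_of_pos hv, div_le_iff₀ hv]
  refine h1.trans (le_of_eq ?_)
  ring

end KernelExpansion

end LambertKernel

section SquareDecomposition

open Set Filter Topology

open ArithmeticFunction ArithmeticFunction.zeta

/-- The indicator of nonzero squares. -/
noncomputable def squareInd : ArithmeticFunction ℝ :=
  ⟨fun n => if n ≠ 0 ∧ IsSquare n then 1 else 0, by simp⟩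

/-- The indicator of squarefree numbers. -/
noncomputable def squarefreeInd : ArithmeticFunction ℝ :=
  ⟨fun n => if Squarefree n then 1 else 0, by simp⟩

theorem isSquare_mul_iff_of_coprime {m n : ℕ} (h : m.Coprime n) :
    IsSquare (m * n) ↔ IsSquare m ∧ IsSquare n := by
  refine ⟨fun ⟨r, hr⟩ => ⟨?_, ?_⟩, fun ⟨h1, h2⟩ => h1.mul h2⟩
  · obtain ⟨d, hd⟩ := exists_associated_pow_of_mul_eq_pow (by rw [gcd_eq_nat_gcd, h.gcd_eq_one]; exact isUnit_one) (hr.trans (sq r).symm)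
    exact ⟨d, by rw [← sq]; exact (associated_iff_eq.mp hd).symm⟩
  · obtain ⟨d, hd⟩ := exists_associated_pow_of_mul_eq_pow (a := n) (b := m) (c := r) (k := 2)
      (by rw [gcd_eq_nat_gcd, h.symm.gcd_eq_one]; exact isUnit_one) (by rw [mul_comm, hr, sq])
    exact ⟨d, by rw [← sq]; exact (associated_iff_eq.mp hd).symm⟩

theorem isMultiplicative_squareInd : squareInd.IsMultiplicative := by
  rw [IsMultiplicative.iff_ne_zero]
  refine ⟨by simp [squareInd], fun {m n} hm hn h => ?_⟩
  simp only [squareInd, coe_mk, isSquare_mul_iff_of_coprime h]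
  by_cases h1 : IsSquare m <;> by_cases h2 : IsSquare n <;> simp [hm, hn, h1, h2]

theorem isMultiplicative_squarefreeInd : squarefreeInd.IsMultiplicative := by
  rw [IsMultiplicative.iff_ne_zero]
  refine ⟨by simp [squarefreeInd], fun {m n} hm hn h => ?_⟩
  simp only [squarefreeInd, coe_mk, Nat.squarefree_mul h]
  by_cases h1 : Squarefree m <;> by_cases h2 : Squarefree n <;> simp [h1, h2]

theorem mul_squarefreeInd_prime_pow (A : ArithmeticFunction ℝ) {p : ℕ} (hp : p.Prime) (k : ℕ) :
    (A * squarefreeInd) (p ^ (k + 1)) = A (p ^ (k + 1)) + A (p ^ k) := by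
  rw [mul_apply, Nat.sum_divisorsAntidiagonal (fun a b => A a * squarefreeInd b),
    Nat.sum_divisors_prime_pow hp, Finset.sum_range_succ, Finset.sum_range_succ]
  have h1 : ∀ i ∈ Finset.range k, A (p ^ i) * squarefreeInd (p ^ (k + 1) / p ^ i) = 0 := by
    intro i hi
    have hik : i < k := Finset.mem_range.mp hi
    rw [Nat.pow_div (by omega) hp.pos]
    have : ¬ Squarefree (p ^ (k + 1 - i)) := by
      rw [Nat.squarefree_pow_iff hp.ne_one (by omega)]
      omega
    simp [squarefreeInd, this]
  rw [Finset.sum_eq_zero h1, Nat.pow_div (by omega) hp.pos, Nat.pow_div (by omega) hp.pos]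
  have h2 : k + 1 - k = 1 := by omega
  have h3 : Squarefree p := hp.squarefree
  simp [squarefreeInd, h2, h3, add_comm]

theorem squareInd_mul_squarefreeInd : squareInd * squarefreeInd = (ζ : ArithmeticFunction ℝ) := by
  rw [IsMultiplicative.eq_iff_eq_on_prime_powers _
    (isMultiplicative_squareInd.mul isMultiplicative_squarefreeInd) _
    (isMultiplicative_zeta.natCast)]
  intro p i hp
  rcases i with _ | k
  · simp [(isMultiplicative_squareInd.mul isMultiplicative_squarefreeInd).map_one]
  · rw [mul_squarefreeInd_prime_pow _ hp]
    have hsq : ∀ j, squareInd (p ^ j) = if Even j then 1 else 0 := by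
      intro j
      have h1 : IsSquare (p ^ j) ↔ Even j := by
        refine ⟨fun ⟨r, hr⟩ => ?_, fun h => h.isSquare_pow _⟩
        have hr0 : r ≠ 0 := by
          rintro rfl
          exact pow_ne_zero j hp.ne_zero (by simpa using hr)
        have := congrArg (fun n => n.factorization p) hr
        simp only [hp.factorization_pow, Finsupp.single_eq_same,
          Nat.factorization_mul hr0 hr0, Finsupp.add_apply] at this
        exact ⟨_, this⟩
      simp [squareInd, h1, hp.ne_zero]
    have h0 : p ^ (k + 1) ≠ 0 := pow_ne_zero _ hp.ne_zero
    rw [hsq, hsq, natCoe_apply, zeta_apply_ne h0]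
    by_cases h : Even k <;> simp [Nat.even_add_one, h]

variable {N : ℕ} [NeZero N]

/-- The nonnegative function `χ * |μ|` for a quadratic character `χ`. -/
noncomputable def charSquarefree (χ : DirichletCharacter ℂ N) : ArithmeticFunction ℝ :=
  charArith χ * squarefreeInd

theorem squareInd_mul_charSquarefree (χ : DirichletCharacter ℂ N) :
    squareInd * charSquarefree χ = (ζ : ArithmeticFunction ℝ) * charArith χ := by
  rw [charSquarefree, mul_comm (charArith χ), ← mul_assoc, squareInd_mul_squarefreeInd]

theorem isMultiplicative_charSquarefree {χ : DirichletCharacter ℂ N} (hχ2 : χ ^ 2 = 1) :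
    (charSquarefree χ).IsMultiplicative :=
  (isMultiplicative_charArith hχ2).mul isMultiplicative_squarefreeInd

theorem charArith_pow {χ : DirichletCharacter ℂ N} (hχ2 : χ ^ 2 = 1) {n : ℕ} (hn : n ≠ 0) (k : ℕ) :
    charArith χ (n ^ k) = charArith χ n ^ k := by
  have : ((charArith χ (n ^ k) : ℝ) : ℂ) = ((charArith χ n ^ k : ℝ) : ℂ) := by
    rw [Complex.ofReal_pow, ofReal_charArith hχ2 hn, ofReal_charArith hχ2 (pow_ne_zero k hn),
      Nat.cast_pow, map_pow]
  exact_mod_cast this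

theorem charArith_eq {χ : DirichletCharacter ℂ N} (hχ2 : χ ^ 2 = 1) {n : ℕ} (hn : n ≠ 0) :
    charArith χ n = 0 ∨ charArith χ n = 1 ∨ charArith χ n = -1 := by
  have h : ((charArith χ n ^ 3 : ℝ) : ℂ) = (charArith χ n : ℝ) := by
    rw [Complex.ofReal_pow, ofReal_charArith hχ2 hn]
    by_cases hu : IsUnit (n : ZMod N)
    · have : (χ ^ 2) (n : ZMod N) = 1 := by rw [hχ2, MulChar.one_apply hu]
      rw [MulChar.pow_apply' _ two_ne_zero] at this
      rw [pow_succ, this, one_mul]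
    · rw [χ.map_nonunit hu]; simp
  have h3 : charArith χ n ^ 3 = charArith χ n := by exact_mod_cast h
  have h4 : charArith χ n * ((charArith χ n - 1) * (charArith χ n + 1)) = 0 := by
    linear_combination h3
  rcases mul_eq_zero.mp h4 with h | h
  · exact Or.inl h
  · rcases mul_eq_zero.mp h with h | h
    · exact Or.inr (Or.inl (by linarith))
    · exact Or.inr (Or.inr (by linarith))

theorem charSquarefree_nonneg {χ : DirichletCharacter ℂ N} (hχ2 : χ ^ 2 = 1) (n : ℕ) :
    0 ≤ charSquarefree χ n := by
  rcases eq_or_ne n 0 with rfl | hn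
  · simp
  have hm := isMultiplicative_charSquarefree hχ2
  rw [hm.multiplicative_factorization _ hn]
  refine Finset.prod_nonneg fun p hp => ?_
  have hpp := Nat.prime_of_mem_primeFactors hp
  show 0 ≤ charSquarefree χ (p ^ n.factorization p)
  rcases n.factorization p with _ | k
  · simp [hm.map_one]
  · rw [charSquarefree, mul_squarefreeInd_prime_pow _ hpp, charArith_pow hχ2 hpp.ne_zero,
      charArith_pow hχ2 hpp.ne_zero]
    rcases charArith_eq hχ2 hpp.ne_zero with h | h | h <;> rw [h]
    · positivity
    · norm_num
    · rw [pow_succ]; ring_nf; rfl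

theorem abs_mul_apply_le {A B : ArithmeticFunction ℝ} (hA : ∀ n, |A n| ≤ 1) (hB : ∀ n, |B n| ≤ 1)
    (n : ℕ) : |(A * B) n| ≤ n := by
  rw [mul_apply]
  refine (Finset.abs_sum_le_sum_abs _ _).trans ?_
  calc ∑ p ∈ n.divisorsAntidiagonal, |A p.1 * B p.2| ≤ ∑ p ∈ n.divisorsAntidiagonal, (1 : ℝ) := by
        refine Finset.sum_le_sum fun p _ => ?_
        rw [abs_mul]
        exact mul_le_one₀ (hA _) (abs_nonneg _) (hB _)
    _ = (n.divisors.card : ℝ) := by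
        rw [Finset.sum_const, nsmul_eq_mul, mul_one, ← Nat.map_div_right_divisors, Finset.card_map]
    _ ≤ n := by exact_mod_cast Nat.card_divisors_le_self n

theorem abs_squareInd_le (n : ℕ) : |squareInd n| ≤ 1 := by
  simp only [squareInd, coe_mk]; split_ifs <;> simp

theorem abs_squarefreeInd_le (n : ℕ) : |squarefreeInd n| ≤ 1 := by
  simp only [squarefreeInd, coe_mk]; split_ifs <;> simp

/-- The series `∑ k² z exp (-k² z)`. -/
noncomputable def squareTheta (z : ℝ) : ℝ := ∑' k : ℕ, expTerm z (k ^ 2)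

theorem summable_expTerm {z : ℝ} (hz : 0 < z) : Summable (expTerm z) := by
  have h := (hasSum_rootKernel (z := 1) norm_one hz).summable
  simp only [one_pow, one_mul] at h
  exact Complex.summable_ofReal.mp h

theorem hasSum_squareTheta {z : ℝ} (hz : 0 < z) :
    HasSum (fun k : ℕ => expTerm z (k ^ 2)) (squareTheta z) :=
  ((summable_expTerm hz).comp_injective (Nat.pow_left_injective two_ne_zero)).hasSum

theorem squareTheta_nonneg {z : ℝ} (hz : 0 ≤ z) : 0 ≤ squareTheta z :=
  tsum_nonneg fun _ => expTerm_nonneg hz _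

theorem hasSum_lambertSum_nat (χ : DirichletCharacter ℂ N) {v : ℝ} (hv : 0 < v) :
    HasSum (fun n => ((ζ : ArithmeticFunction ℝ) * charArith χ) n * expTerm v n)
      (lambertSum χ v) :=
  hasSum_arithmetic_mul (hasSum_lambertSum χ hv)

theorem expTerm_mul_nat (v : ℝ) (a m : ℕ) : expTerm v (a * m) = expTerm (m * v) a := by
  unfold expTerm; push_cast; ring_nf

theorem hasSum_lambertSum_squares (χ : DirichletCharacter ℂ N) {v : ℝ} (hv : 0 < v) :
    HasSum (fun m : ℕ => charSquarefree χ m * squareTheta (m * v)) (lambertSum χ v) := by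
  have hs := (summable_mul_expTerm (abs_le_natCast_of_abs_le_one abs_squareInd_le)
    (abs_mul_apply_le (abs_charArith_le χ) abs_squarefreeInd_le) hv).hasSum
  have h1 := hasSum_arithmetic_mul hs
  have h2 := hasSum_lambertSum_nat χ hv
  rw [← squareInd_mul_charSquarefree] at h2
  rw [h1.unique h2] at hs
  rw [← (Equiv.prodComm ℕ ℕ).hasSum_iff] at hs
  refine hs.prod_fiberwise fun m => ?_
  change HasSum (fun a => squareInd a * charSquarefree χ m * expTerm v (a * m)) _
  rcases eq_or_ne m 0 with rfl | hm
  · simp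
  have hmv : 0 < (m : ℝ) * v := by positivity
  have h3 := (hasSum_squareTheta hmv).mul_left (charSquarefree χ m)
  rw [← (Nat.pow_left_injective two_ne_zero).hasSum_iff (f := fun a =>
    squareInd a * charSquarefree χ m * expTerm v (a * m))]
  · refine h3.of_forall_eq fun k => ?_
    simp only [Function.comp_apply]
    rcases eq_or_ne k 0 with rfl | hk
    · simp [expTerm]
    · rw [expTerm_mul_nat]
      have : squareInd (k ^ 2) = 1 := by simp [squareInd, hk, IsSquare.sq]
      rw [this, one_mul]
  · intro a ha
    have : squareInd a = 0 := by
      simp only [squareInd, coe_mk]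
      rw [if_neg]
      rintro ⟨-, r, hr⟩
      exact ha ⟨r, by simp [hr, sq]⟩
    rw [this, zero_mul, zero_mul]

end SquareDecomposition

section GaussMoment

open Set Filter Topology MeasureTheory

theorem hasDerivAt_exp_neg_sq (t : ℝ) :
    HasDerivAt (fun t : ℝ => Real.exp (-t ^ 2)) (-(2 * t) * Real.exp (-t ^ 2)) t := by
  refine ((hasDerivAt_pow 2 t).neg.exp).congr_deriv ?_
  simp; ring

theorem hasDerivAt_sq_mul_exp_neg_sq (t : ℝ) :
    HasDerivAt (fun t : ℝ => t ^ 2 * Real.exp (-t ^ 2))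
      ((2 * t - 2 * t ^ 3) * Real.exp (-t ^ 2)) t := by
  refine ((hasDerivAt_pow 2 t).mul (hasDerivAt_exp_neg_sq t)).congr_deriv ?_
  simp; ring

theorem hasDerivAt_sq_mul_exp_neg_sq_deriv (t : ℝ) :
    HasDerivAt (fun t : ℝ => (2 * t - 2 * t ^ 3) * Real.exp (-t ^ 2))
      ((2 - 10 * t ^ 2 + 4 * t ^ 4) * Real.exp (-t ^ 2)) t := by
  refine ((((hasDerivAt_id t).const_mul 2).sub ((hasDerivAt_pow 3 t).const_mul 2)).mul
    (hasDerivAt_exp_neg_sq t)).congr_deriv ?_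
  simp; ring

theorem integral_sq_mul_exp_neg_sq :
    ∫ t in Ioi (0 : ℝ), t ^ 2 * Real.exp (-t ^ 2) = √Real.pi / 4 := by
  have h := integral_rpow_mul_exp_neg_rpow (p := 2) (q := 2) (by norm_num) (by norm_num)
  have h1 : Real.Gamma ((2 + 1) / 2) = √Real.pi / 2 := by
    rw [show ((2 : ℝ) + 1) / 2 = 1 / 2 + 1 by norm_num, Real.Gamma_add_one (by norm_num),
      Real.Gamma_one_half_eq]
    ring
  rw [h1] at h
  norm_cast at h
  rw [h]; ring

theorem abs_deriv2_sq_mul_exp_le (t : ℝ) :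
    |(2 - 10 * t ^ 2 + 4 * t ^ 4) * Real.exp (-t ^ 2)| ≤ 28 * (1 + t ^ 2)⁻¹ := by
  have h1 : |2 - 10 * t ^ 2 + 4 * t ^ 4| ≤ 2 + 10 * t ^ 2 + 4 * t ^ 4 := by
    rw [abs_le]; constructor <;> nlinarith [sq_nonneg t, sq_nonneg (t ^ 2)]
  have h2 := Real.sum_le_exp_of_nonneg (sq_nonneg t) 4
  simp [Finset.sum_range_succ, Nat.factorial] at h2
  rw [abs_mul, abs_of_pos (Real.exp_pos _), ← div_eq_mul_inv, le_div_iff₀ (by positivity),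
    Real.exp_neg, ← div_eq_mul_inv, div_mul_eq_mul_div, div_le_iff₀ (Real.exp_pos _)]
  calc |2 - 10 * t ^ 2 + 4 * t ^ 4| * (1 + t ^ 2)
      ≤ (2 + 10 * t ^ 2 + 4 * t ^ 4) * (1 + t ^ 2) := by gcongr
    _ ≤ 28 * (1 + t ^ 2 + (t ^ 2) ^ 2 / 2 + (t ^ 2) ^ 3 / 6) := by
        nlinarith [sq_nonneg t, sq_nonneg (t ^ 3)]
    _ ≤ _ := by gcongr

theorem squareTheta_lower {z : ℝ} (hz : 0 < z) : 0.443 - 5.5 * z ≤ √z * squareTheta z := by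
  have hh : 0 < √z := Real.sqrt_pos.mpr hz
  have hzz : √z ^ 2 = z := Real.sq_sqrt hz.le
  have hsum : HasSum (fun k : ℕ =>
      (((((k : ℝ) + 1) * √z) ^ 2 * Real.exp (-(((k : ℝ) + 1) * √z) ^ 2) : ℝ) : ℂ))
      (squareTheta z : ℂ) := by
    have h := hasSum_squareTheta hz
    rw [← hasSum_nat_add_iff' 1] at h
    simp only [Finset.sum_range_one] at h
    have h0 : expTerm z (0 ^ 2) = 0 := by simp [expTerm]
    rw [h0, sub_zero] at h
    refine (Complex.hasSum_ofReal.mpr h).of_forall_eq fun k => ?_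
    congr 1
    unfold expTerm
    push_cast
    rw [mul_pow, hzz]
  have hexp : Continuous fun t : ℝ => Real.exp (-t ^ 2) := by fun_prop
  have hinteg : IntegrableOn (fun t : ℝ => t ^ 2 * Real.exp (-t ^ 2)) (Ioi 0) := by
    by_contra h
    have h1 := integral_undef h
    rw [integral_sq_mul_exp_neg_sq] at h1
    have := Real.sqrt_pos.mpr Real.pi_pos
    linarith
  have key := norm_tsum_sub_integral_le
    (F := fun t : ℝ => ((t ^ 2 * Real.exp (-t ^ 2) : ℝ) : ℂ))
    (F' := fun t : ℝ => (((2 * t - 2 * t ^ 3) * Real.exp (-t ^ 2) : ℝ) : ℂ))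
    (F'' := fun t : ℝ => (((2 - 10 * t ^ 2 + 4 * t ^ 4) * Real.exp (-t ^ 2) : ℝ) : ℂ))
    (fun t => (hasDerivAt_sq_mul_exp_neg_sq t).ofReal_comp)
    (fun t => (hasDerivAt_sq_mul_exp_neg_sq_deriv t).ofReal_comp)
    (by fun_prop) (by simp) hh (B := 44) (fun X hX => ?_) hinteg.ofReal hsum
  · rw [integral_complex_ofReal, integral_sq_mul_exp_neg_sq, ← Complex.ofReal_mul,
      ← Complex.ofReal_sub, Complex.norm_real, Real.norm_eq_abs, hzz] at key
    have h1 := (abs_le.mp key).1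
    have h2 : 1.7724 ≤ √Real.pi := by
      refine Real.le_sqrt_of_sq_le ?_
      have := Real.pi_gt_d6
      norm_num at this ⊢; linarith
    norm_num at *; linarith
  · calc ∫ t in (0 : ℝ)..X, ‖(((2 - 10 * t ^ 2 + 4 * t ^ 4) * Real.exp (-t ^ 2) : ℝ) : ℂ)‖
        ≤ ∫ t in (0 : ℝ)..X, 28 * (1 + t ^ 2)⁻¹ := by
          refine intervalIntegral.integral_mono_on hX
            (Continuous.intervalIntegrable (by fun_prop) _ _)
            (Continuous.intervalIntegrable (continuous_const.mul
              (Continuous.inv₀ (by fun_prop) fun t => by positivity)) _ _) fun t _ => ?_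
          rw [Complex.norm_real, Real.norm_eq_abs]
          exact abs_deriv2_sq_mul_exp_le t
      _ = 28 * Real.arctan X := by
          rw [intervalIntegral.integral_const_mul, integral_inv_one_add_sq]; simp
      _ ≤ 44 := by
          have := Real.arctan_lt_pi_div_two X
          have := Real.pi_lt_d4
          norm_num at *; linarith

theorem mul_squareTheta_lower {v z : ℝ} (hv : 0 < v) (hv1 : v ≤ 1 / 10 ^ 5) (hvz : v ≤ z)
    (hz1 : z ≤ 1) : 0.4429 * √v ≤ z * squareTheta z := by
  have hz : 0 < z := hv.trans_le hvz
  have hhv : 0 < √v := Real.sqrt_pos.mpr hv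
  have hvv : √v ^ 2 = v := Real.sq_sqrt hv.le
  have hzz : √z ^ 2 = z := Real.sq_sqrt hz.le
  have hvz' : √v ≤ √z := Real.sqrt_le_sqrt hvz
  have hv' : √v ≤ 0.0032 := by
    rw [Real.sqrt_le_left (by norm_num)]; norm_num at *; linarith
  rcases le_total z 0.07 with h | h
  · have h1 := squareTheta_lower hz
    have h2 : √z * (0.443 - 5.5 * √z ^ 2) ≤ z * squareTheta z := by
      calc √z * (0.443 - 5.5 * √z ^ 2) ≤ √z * (√z * squareTheta z) := by
            rw [hzz]; gcongr
        _ = √z ^ 2 * squareTheta z := by ring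
        _ = _ := by rw [hzz]
    refine le_trans ?_ h2
    have h3 : √z ≤ 0.2646 := by
      rw [Real.sqrt_le_left (by norm_num)]; norm_num at *; linarith
    generalize √z = b at *
    generalize √v = a at *
    have h4 : b ^ 2 + b * a + a ^ 2 ≤ 0.0709 := by nlinarith
    have h5 : 0 ≤ (b - a) * (0.443 - 5.5 * (b ^ 2 + b * a + a ^ 2)) :=
      mul_nonneg (by linarith) (by norm_num at *; linarith)
    have h6 : a ^ 2 ≤ 0.0032 ^ 2 := by gcongr
    nlinarith
  · have h1 : expTerm z (1 ^ 2) ≤ squareTheta z :=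
      (hasSum_squareTheta hz).summable.le_tsum 1 fun j _ => expTerm_nonneg hz.le _
    have h2 : z * 0.36 ≤ squareTheta z := by
      refine le_trans ?_ h1
      have : Real.exp (-1) ≤ Real.exp (-z) := Real.exp_le_exp.mpr (by linarith)
      have h3 := Real.exp_neg_one_gt_d9
      simp only [expTerm, one_pow, Nat.cast_one, one_mul]
      gcongr
      norm_num at h3 ⊢; linarith
    have h3 : z * (z * 0.36) ≤ z * squareTheta z := by gcongr
    norm_num at *
    nlinarith

/-- The integral of `expTerm v n` over `v` from `z` to infinity. -/
noncomputable def expTail (z : ℝ) (n : ℕ) : ℝ := (1 + n * z) * Real.exp (-(n * z)) / n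

theorem expTail_nonneg {z : ℝ} (hz : 0 ≤ z) (n : ℕ) : 0 ≤ expTail z n := by
  unfold expTail; positivity

theorem expTail_le (z : ℝ) (n : ℕ) : expTail z n ≤ 1 / n := by
  unfold expTail
  have h := Real.add_one_le_exp (n * z)
  gcongr
  rw [Real.exp_neg, ← div_eq_mul_inv, div_le_one (Real.exp_pos _)]
  linarith

theorem expTail_le_of_one_le {z : ℝ} (hz : 1 ≤ z) (n : ℕ) : expTail z n ≤ 2 * z * expTerm z n := by
  rcases eq_or_ne n 0 with rfl | hn
  · simp [expTail, expTerm]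
  have hn1 : (1 : ℝ) ≤ n := by exact_mod_cast Nat.one_le_iff_ne_zero.mpr hn
  unfold expTail expTerm
  rw [div_le_iff₀ (by linarith)]
  have : (1 + n * z) ≤ 2 * z * (n * z) * n := by
    have h1 : 1 ≤ n * z := one_le_mul_of_one_le_of_one_le hn1 hz
    nlinarith [mul_nonneg (show (0 : ℝ) ≤ n * z by positivity) (show (0 : ℝ) ≤ n * z - 1 by linarith)]
  calc _ ≤ 2 * z * (n * z) * n * Real.exp (-(n * z)) := by gcongr
    _ = _ := by ring

theorem summable_one_div_sq : Summable fun k : ℕ => 1 / (((k ^ 2 : ℕ) : ℝ)) := by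
  simp

theorem summable_expTail_sq {z : ℝ} (hz : 0 ≤ z) : Summable fun k : ℕ => expTail z (k ^ 2) :=
  summable_one_div_sq.of_nonneg_of_le (fun _ => expTail_nonneg hz _) (fun _ => expTail_le z _)

theorem tsum_expTail_sq_le {v z : ℝ} (hv : 0 < v) (hv1 : v ≤ 1 / 10 ^ 5) (hvz : v ≤ z) :
    ∑' k : ℕ, expTail z (k ^ 2) ≤ 1.645 / (0.4429 * √v) * (z * squareTheta z) := by
  have hz : 0 < z := hv.trans_le hvz
  have hhv : 0 < √v := Real.sqrt_pos.mpr hv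
  rcases le_total z 1 with h | h
  · have h1 : ∑' k : ℕ, expTail z (k ^ 2) ≤ 1.645 := by
      calc ∑' k : ℕ, expTail z (k ^ 2) ≤ ∑' k : ℕ, 1 / (((k ^ 2 : ℕ) : ℝ)) :=
            (summable_expTail_sq hz.le).tsum_le_tsum (fun _ => expTail_le z _)
              summable_one_div_sq
        _ = Real.pi ^ 2 / 6 := by
            rw [← hasSum_zeta_two.tsum_eq]; simp
        _ ≤ 1.645 := by
            have h1 := Real.pi_lt_d6
            have h2 := Real.pi_gt_three
            norm_num at *; nlinarith
    refine h1.trans ?_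
    rw [div_mul_eq_mul_div, le_div_iff₀ (by positivity)]
    have := mul_squareTheta_lower hv hv1 hvz h
    gcongr
  · have hv' : √v ≤ 0.0032 := by
      rw [Real.sqrt_le_left (by norm_num)]; norm_num at *; linarith
    calc ∑' k : ℕ, expTail z (k ^ 2) ≤ ∑' k : ℕ, 2 * z * expTerm z (k ^ 2) :=
          (summable_expTail_sq hz.le).tsum_le_tsum (fun _ => expTail_le_of_one_le h _)
            ((hasSum_squareTheta hz).summable.mul_left _)
      _ = 2 * (z * squareTheta z) := by rw [tsum_mul_left, mul_assoc]; rfl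
      _ ≤ _ := by
          have := squareTheta_nonneg hz.le
          gcongr
          rw [le_div_iff₀ (by positivity)]
          norm_num at *; linarith

end GaussMoment

section LambertIntegral

open Set Filter Topology MeasureTheory

open ArithmeticFunction ArithmeticFunction.zeta

theorem hasDerivAt_expTerm_antideriv {n : ℕ} (hn : n ≠ 0) (v : ℝ) :
    HasDerivAt (fun v => -expTail v n) (expTerm v n) v := by
  have hn0 : (n : ℝ) ≠ 0 := by exact_mod_cast hn
  have h1 : HasDerivAt (fun v : ℝ => (n : ℝ) * v) n v := by
    simpa using (hasDerivAt_id v).const_mul (n : ℝ)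
  refine ((((h1.const_add 1).mul h1.neg.exp).div_const (n : ℝ)).neg).congr_deriv ?_
  unfold expTerm
  field_simp
  simp only [Pi.neg_apply]
  ring

theorem tendsto_expTail {n : ℕ} (hn : n ≠ 0) : Tendsto (fun v => -expTail v n) atTop (𝓝 0) := by
  have hn0 : (0 : ℝ) < n := by exact_mod_cast Nat.pos_of_ne_zero hn
  have h1 : Tendsto (fun v : ℝ => (n : ℝ) * v) atTop atTop := tendsto_id.const_mul_atTop hn0
  have h2 := (Real.tendsto_pow_mul_exp_neg_atTop_nhds_zero 0).comp h1
  have h3 := (Real.tendsto_pow_mul_exp_neg_atTop_nhds_zero 1).comp h1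
  have h4 := ((h2.add h3).div_const (n : ℝ)).neg
  simp only [add_zero, zero_div, neg_zero] at h4
  refine h4.congr fun v => ?_
  simp only [Function.comp_apply, expTail]
  ring

theorem integrableOn_expTerm {v₀ : ℝ} (hv₀ : 0 ≤ v₀) (n : ℕ) :
    IntegrableOn (fun v => expTerm v n) (Ioi v₀) := by
  rcases eq_or_ne n 0 with rfl | hn
  · simp [expTerm]
  · exact integrableOn_Ioi_deriv_of_nonneg' (fun v _ => hasDerivAt_expTerm_antideriv hn v)
      (fun v hv => expTerm_nonneg (hv₀.trans (le_of_lt hv)) n) (tendsto_expTail hn)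

theorem integral_expTerm {v₀ : ℝ} (hv₀ : 0 ≤ v₀) (n : ℕ) :
    ∫ v in Ioi v₀, expTerm v n = expTail v₀ n := by
  rcases eq_or_ne n 0 with rfl | hn
  · simp [expTerm, expTail]
  · rw [integral_Ioi_of_hasDerivAt_of_nonneg' (fun v _ => hasDerivAt_expTerm_antideriv hn v)
      (fun v hv => expTerm_nonneg (hv₀.trans (le_of_lt hv)) n) (tendsto_expTail hn)]
    ring

theorem expTail_mul_nat (v : ℝ) (a m : ℕ) : expTail v (a * m) = expTail (m * v) a / m := by
  unfold expTail; push_cast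
  rw [show (a : ℝ) * m * v = a * (m * v) by ring, ← div_div]

variable {N : ℕ} [NeZero N]

theorem abs_term_le (χ : DirichletCharacter ℂ N) {δ v : ℝ} (hδ : 0 < δ) (hv : δ ≤ v) (n : ℕ) :
    |((ζ : ArithmeticFunction ℝ) * charArith χ) n * expTerm v n| ≤
      8 / δ * Real.exp (δ / 2) * Real.exp (-(δ / 2)) ^ n * Real.exp (-(1 / 2) * v) := by
  rcases eq_or_ne n 0 with rfl | hn
  · simp; positivity
  have hv0 : 0 < v := hδ.trans_le hv
  have h1 := abs_mul_apply_le abs_zeta_le (abs_charArith_le χ) n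
  have hn1 : (1 : ℝ) ≤ n := by exact_mod_cast Nat.one_le_iff_ne_zero.mpr hn
  set x := (n : ℝ) * v with hx
  have hx0 : 0 < x := by positivity
  have h2 : x ^ 2 ≤ 8 * Real.exp (x / 2) := by
    have := Real.quadratic_le_exp_of_nonneg (show 0 ≤ x / 2 by positivity)
    nlinarith
  have h3 : Real.exp (x / 2) * Real.exp (-x) = Real.exp (-(x / 2)) := by
    rw [← Real.exp_add]; ring_nf
  have h4 : Real.exp (-(x / 2)) ≤
      Real.exp (δ / 2) * Real.exp (-(δ / 2)) ^ n * Real.exp (-(1 / 2) * v) := by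
    rw [← Real.exp_nat_mul, ← Real.exp_add, ← Real.exp_add]
    refine Real.exp_le_exp.mpr ?_
    have : 0 ≤ ((n : ℝ) - 1) * (v - δ) := mul_nonneg (by linarith) (by linarith)
    rw [hx]; nlinarith
  rw [abs_mul, abs_of_nonneg (expTerm_nonneg hv0.le n)]
  calc |((ζ : ArithmeticFunction ℝ) * charArith χ) n| * expTerm v n
      ≤ n * expTerm v n := mul_le_mul_of_nonneg_right h1 (expTerm_nonneg hv0.le n)
    _ = x ^ 2 * Real.exp (-x) / v := by
        unfold expTerm; rw [← hx, hx]; field_simp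
    _ ≤ 8 * Real.exp (x / 2) * Real.exp (-x) / δ := by gcongr
    _ = 8 / δ * Real.exp (-(x / 2)) := by rw [mul_assoc, h3]; ring
    _ ≤ 8 / δ * (Real.exp (δ / 2) * Real.exp (-(δ / 2)) ^ n * Real.exp (-(1 / 2) * v)) := by gcongr
    _ = _ := by ring

theorem exp_neg_half_lt_one {δ : ℝ} (hδ : 0 < δ) : Real.exp (-(δ / 2)) < 1 := by
  rw [Real.exp_lt_one_iff]; linarith

theorem exists_abs_lambertSum_le (χ : DirichletCharacter ℂ N) {δ : ℝ} (hδ : 0 < δ) :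
    ∃ C : ℝ, ∀ v, δ ≤ v → |lambertSum χ v| ≤ C * Real.exp (-(1 / 2) * v) := by
  have hg := (summable_geometric_of_lt_one (Real.exp_pos _).le
    (exp_neg_half_lt_one hδ)).mul_left (8 / δ * Real.exp (δ / 2))
  refine ⟨∑' n : ℕ, 8 / δ * Real.exp (δ / 2) * Real.exp (-(δ / 2)) ^ n, fun v hv => ?_⟩
  have h := hasSum_lambertSum_nat χ (hδ.trans_le hv)
  rw [← h.tsum_eq]
  exact tsum_of_norm_bounded (E := ℝ) (hg.hasSum.mul_right (Real.exp (-(1 / 2) * v)))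
    (fun n => abs_term_le χ hδ hv n)

theorem continuousOn_lambertSum (χ : DirichletCharacter ℂ N) :
    ContinuousOn (lambertSum χ) (Ioi 0) := by
  intro v (hv : 0 < v)
  have hδ : 0 < v / 2 := by linarith
  have hg := (summable_geometric_of_lt_one (Real.exp_pos _).le
    (exp_neg_half_lt_one hδ)).mul_left (8 / (v / 2) * Real.exp (v / 2 / 2))
  have hc : ContinuousOn (fun v => ∑' n, ((ζ : ArithmeticFunction ℝ) * charArith χ) n * expTerm v n)
      (Ici (v / 2)) := by
    refine continuousOn_tsum (fun n => ?_) hg fun n w hw => ?_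
    · unfold expTerm; fun_prop
    · refine (abs_term_le χ hδ hw n).trans (mul_le_of_le_one_right (by positivity) ?_)
      rw [Real.exp_le_one_iff]
      have : v / 2 ≤ w := hw
      linarith
  have hc2 : ContinuousOn (lambertSum χ) (Ici (v / 2)) :=
    hc.congr fun w hw => (hasSum_lambertSum_nat χ (hδ.trans_le hw)).tsum_eq.symm
  exact (hc2.continuousAt (Ici_mem_nhds (by linarith))).continuousWithinAt

theorem integrableOn_lambertSum (χ : DirichletCharacter ℂ N) {v₀ : ℝ} (hv₀ : 0 < v₀) :
    IntegrableOn (lambertSum χ) (Ioi v₀) := by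
  obtain ⟨C, hC⟩ := exists_abs_lambertSum_le χ hv₀
  refine integrable_of_isBigO_exp_neg (b := 1 / 2) (by norm_num)
    ((continuousOn_lambertSum χ).mono fun v hv => hv₀.trans_le hv) ?_
  refine Asymptotics.IsBigO.of_bound C ?_
  filter_upwards [eventually_ge_atTop v₀] with v hv
  rw [Real.norm_eq_abs, Real.norm_of_nonneg (Real.exp_pos _).le]
  exact hC v hv

theorem lambertSum_nonneg {χ : DirichletCharacter ℂ N} (hχ2 : χ ^ 2 = 1) {v : ℝ} (hv : 0 < v) :
    0 ≤ lambertSum χ v := by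
  rw [← (hasSum_lambertSum_squares χ hv).tsum_eq]
  exact tsum_nonneg fun m => mul_nonneg (charSquarefree_nonneg hχ2 m)
    (squareTheta_nonneg (by positivity))

theorem lambertSum_lower {χ : DirichletCharacter ℂ N} (hχ2 : χ ^ 2 = 1) {v : ℝ} (hv : 0 < v)
    (hv1 : v ≤ 1 / 10 ^ 5) : 0.4429 * √v ≤ v * lambertSum χ v := by
  refine (mul_squareTheta_lower hv hv1 le_rfl (by norm_num at *; linarith)).trans ?_
  gcongr
  have h := hasSum_lambertSum_squares χ hv
  rw [← h.tsum_eq]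
  have h1 := h.summable.le_tsum 1 fun m _ => mul_nonneg (charSquarefree_nonneg hχ2 m)
    (squareTheta_nonneg (by positivity))
  rwa [(isMultiplicative_charSquarefree hχ2).map_one, Nat.cast_one, one_mul, one_mul] at h1

theorem integral_lambertSum_le {χ : DirichletCharacter ℂ N} (hχ2 : χ ^ 2 = 1) {v₀ : ℝ}
    (hv₀ : 0 < v₀) (hv1 : v₀ ≤ 1 / 10 ^ 5) :
    ∫ v in Ioi v₀, lambertSum χ v ≤ 1.645 / (0.4429 * √v₀) * (v₀ * lambertSum χ v₀) := by
  set K := 1.645 / (0.4429 * √v₀) with hK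
  set G : ℕ × ℕ → ℝ → ℝ := fun p v => charSquarefree χ p.1 * expTerm v (p.2 ^ 2 * p.1) with hG
  have hg := charSquarefree_nonneg hχ2
  have hG0 : ∀ p, ∀ v ∈ Ioi v₀, 0 ≤ G p v := fun p v hv =>
    mul_nonneg (hg _) (expTerm_nonneg (hv₀.trans hv).le _)
  have hGi : ∀ p, IntegrableOn (G p) (Ioi v₀) := fun p =>
    (integrableOn_expTerm hv₀.le _).const_mul _
  have hGint : ∀ p, ∫ v in Ioi v₀, G p v = charSquarefree χ p.1 * expTail v₀ (p.2 ^ 2 * p.1) :=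
    fun p => by rw [integral_const_mul, integral_expTerm hv₀.le]
  have hGn : ∀ p, ∫ v in Ioi v₀, ‖G p v‖ = ∫ v in Ioi v₀, G p v := fun p =>
    setIntegral_congr_fun measurableSet_Ioi fun v hv => Real.norm_of_nonneg (hG0 p v hv)
  have hin : ∀ m : ℕ, HasSum (fun k : ℕ => charSquarefree χ m * expTail v₀ (k ^ 2 * m))
      (charSquarefree χ m / m * ∑' k : ℕ, expTail (m * v₀) (k ^ 2)) := fun m => by
    refine ((summable_expTail_sq (z := m * v₀) (by positivity)).hasSum.mul_left
      (charSquarefree χ m / m)).of_forall_eq fun k => ?_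
    rw [expTail_mul_nat]; ring
  have hle : ∀ m : ℕ, charSquarefree χ m / m * ∑' k : ℕ, expTail (m * v₀) (k ^ 2) ≤
      K * v₀ * (charSquarefree χ m * squareTheta (m * v₀)) := fun m => by
    rcases eq_or_ne m 0 with rfl | hm
    · simp
    have hm1 : (1 : ℝ) ≤ m := by exact_mod_cast Nat.one_le_iff_ne_zero.mpr hm
    have hm0 : (0 : ℝ) < m := by linarith
    have h1 := tsum_expTail_sq_le hv₀ hv1 (z := m * v₀) (le_mul_of_one_le_left hv₀.le hm1)
    calc _ ≤ charSquarefree χ m / m * (K * (m * v₀ * squareTheta (m * v₀))) :=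
          mul_le_mul_of_nonneg_left h1 (div_nonneg (hg m) hm0.le)
      _ = _ := by field_simp
  have hlam := (hasSum_lambertSum_squares χ hv₀).mul_left (K * v₀)
  have hout : Summable fun m : ℕ => charSquarefree χ m / m * ∑' k : ℕ, expTail (m * v₀) (k ^ 2) :=
    hlam.summable.of_nonneg_of_le (fun m => mul_nonneg (div_nonneg (hg m) (Nat.cast_nonneg m))
      (tsum_nonneg fun k => expTail_nonneg (by positivity) _)) hle
  have hsum : Summable fun p : ℕ × ℕ => charSquarefree χ p.1 * expTail v₀ (p.2 ^ 2 * p.1) := by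
    rw [summable_prod_of_nonneg (fun p => mul_nonneg (hg _) (expTail_nonneg hv₀.le _))]
    refine ⟨fun m => (hin m).summable, ?_⟩
    refine hout.congr fun m => ?_
    exact (hin m).tsum_eq.symm
  have hI := hasSum_integral_of_summable_integral_norm (μ := volume.restrict (Ioi v₀)) hGi
    (by simpa only [hGn, hGint] using hsum)
  have hval : ∀ v ∈ Ioi v₀, ∑' p, G p v = lambertSum χ v := fun v hv => by
    have hv0 : 0 < v := hv₀.trans hv
    have h1 : ∀ m : ℕ, HasSum (fun k : ℕ => G (m, k) v)
        (charSquarefree χ m * squareTheta (m * v)) := fun m => by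
      rcases eq_or_ne m 0 with rfl | hm
      · simp [hG]
      refine ((hasSum_squareTheta (z := m * v) (by positivity)).mul_left _).of_forall_eq fun k => ?_
      simp only [hG, expTerm_mul_nat]
    have h2 : Summable fun p => G p v := by
      rw [summable_prod_of_nonneg (fun p => hG0 p v hv)]
      refine ⟨fun m => (h1 m).summable, ?_⟩
      refine (hasSum_lambertSum_squares χ hv0).summable.congr fun m => ?_
      exact (h1 m).tsum_eq.symm
    exact (h2.hasSum.prod_fiberwise h1).unique (hasSum_lambertSum_squares χ hv0)
  rw [setIntegral_congr_fun measurableSet_Ioi hval] at hI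
  simp only [hGint] at hI
  have h3 := hI.prod_fiberwise hin
  calc _ ≤ K * v₀ * lambertSum χ v₀ := hasSum_le hle h3 hlam
    _ = _ := by ring

end LambertIntegral

section LambertMellin

open Set Filter Topology MeasureTheory

open ArithmeticFunction ArithmeticFunction.zeta DirichletCharacter

variable {N : ℕ} [NeZero N]

theorem ofReal_zeta_mul_charArith {χ : DirichletCharacter ℂ N} (hχ2 : χ ^ 2 = 1) (n : ℕ) :
    ((((ζ : ArithmeticFunction ℝ) * charArith χ) n : ℝ) : ℂ) = χ.zetaMul n := by
  rw [DirichletCharacter.zetaMul, coe_zeta_mul_apply, coe_zeta_mul_apply, Complex.ofReal_sum]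
  refine Finset.sum_congr rfl fun d hd => ?_
  have hd0 : d ≠ 0 := (Nat.pos_of_mem_divisors hd).ne'
  rw [ofReal_charArith hχ2 hd0]
  simp [toArithmeticFunction, hd0]

theorem LSeries_zetaMul (χ : DirichletCharacter ℂ N) {s : ℂ} (hs : 1 < s.re) :
    LSeries χ.zetaMul s = riemannZeta s * LFunction χ s := by
  rw [DirichletCharacter.zetaMul, ← coe_mul, LSeries_convolution']
  · rw [χ.LFunction_eq_LSeries hs]
    congr 1
    · simp_rw [← LSeries_zeta_eq_riemannZeta hs, ← natCoe_apply]
    · exact (LSeries_congr χ.apply_eq_toArithmeticFunction_apply s).symm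
  · exact LSeriesSummable_zeta_iff.mpr hs
  · exact (LSeriesSummable_congr _ fun h ↦ (χ.apply_eq_toArithmeticFunction_apply h).symm).mpr <|
      ZMod.LSeriesSummable_of_one_lt_re χ hs

theorem mellin_lambertSum {χ : DirichletCharacter ℂ N} (hχ2 : χ ^ 2 = 1) {s : ℂ} (hs : 1 < s.re) :
    mellin (fun v => (lambertSum χ v : ℂ)) s =
      Complex.Gamma (s + 1) * (riemannZeta s * LFunction χ s) := by
  have h1 : mellin (fun v => (lambertSum χ v : ℂ)) s =
      mellin (fun v => (lambertSum χ v / v : ℂ)) (s + 1) := by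
    rw [← mellin_cpow_smul]
    refine setIntegral_congr_fun measurableSet_Ioi fun v (hv : 0 < v) => ?_
    have hv0 : (v : ℂ) ≠ 0 := by exact_mod_cast hv.ne'
    simp only [smul_eq_mul, Complex.cpow_one]
    field_simp
  have hre : (s + 1).re = s.re + 1 := by simp
  have h2 := hasSum_mellin (a := fun n : ℕ => χ.zetaMul n * n) (p := fun n : ℕ => (n : ℝ))
    (F := fun v => (lambertSum χ v / v : ℂ)) (s := s + 1) (fun n => ?_) (by rw [hre]; linarith)
    (fun v hv => ?_) ?_
  · rw [h1, ← LSeries_zetaMul χ hs, ← h2.tsum_eq, LSeries, ← tsum_mul_left]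
    refine tsum_congr fun n => ?_
    rcases eq_or_ne n 0 with rfl | hn
    · simp
    · have hn0 : (n : ℂ) ≠ 0 := by exact_mod_cast hn
      rw [LSeries.term_of_ne_zero hn, Complex.ofReal_natCast, Complex.cpow_add _ _ hn0,
        Complex.cpow_one]
      field_simp
  · rcases eq_or_ne n 0 with rfl | hn
    · left; simp
    · right; positivity
  · have hv0 : (0 : ℝ) < v := hv
    have hvc : (v : ℂ) ≠ 0 := by exact_mod_cast hv0.ne'
    refine ((Complex.hasSum_ofReal.mpr (hasSum_lambertSum_nat χ hv0)).div_const
      (v : ℂ)).of_forall_eq fun n => ?_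
    rw [Complex.ofReal_mul, ofReal_zeta_mul_charArith hχ2, expTerm]
    push_cast
    field_simp
  · have h3 := (LSeriesSummable_zetaMul χ hs).norm
    refine h3.congr fun n => ?_
    rw [LSeries.norm_term_eq]
    split_ifs with hn
    · simp [hn]
    · have hn0 : (0 : ℝ) < n := by exact_mod_cast Nat.pos_of_ne_zero hn
      rw [hre, norm_mul, Complex.norm_natCast, Real.rpow_add hn0, Real.rpow_one]
      field_simp

theorem hasMellin_inv_Ioc {v₀ : ℝ} (hv₀ : 0 < v₀) {s : ℂ} (hs : 1 < s.re) :
    HasMellin ((Ioc 0 v₀).indicator fun v : ℝ => (1 / v : ℂ)) s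
      ((v₀ : ℂ) ^ (s - 1) / (s - 1)) := by
  have hi : 0 < v₀⁻¹ := by positivity
  have hvc : (v₀ : ℂ) ≠ 0 := by exact_mod_cast hv₀.ne'
  obtain ⟨h1, h2⟩ := hasMellin_cpow_Ioc (-1) (s := s) (by simp; linarith)
  have e : (Ioc 0 v₀).indicator (fun v : ℝ => (1 / v : ℂ)) = fun v : ℝ =>
      (v₀ : ℂ)⁻¹ • (Ioc 0 1).indicator (fun t : ℝ => (t : ℂ) ^ (-1 : ℂ)) (v₀⁻¹ * v) := by
    funext v
    have hmem : v₀⁻¹ * v ∈ Ioc (0 : ℝ) 1 ↔ v ∈ Ioc 0 v₀ := by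
      rw [mem_Ioc, mem_Ioc, mul_pos_iff_of_pos_left hi, inv_mul_le_iff₀ hv₀, mul_one]
    by_cases hv : v ∈ Ioc 0 v₀
    · rw [indicator_of_mem hv, indicator_of_mem (hmem.mpr hv), Complex.cpow_neg_one, smul_eq_mul]
      have : (v : ℂ) ≠ 0 := by exact_mod_cast hv.1.ne'
      push_cast
      field_simp
    · rw [indicator_of_notMem hv, indicator_of_notMem (fun h => hv (hmem.mp h)), smul_zero]
  rw [e]
  have h3 := hasMellin_const_smul ((MellinConvergent.comp_mul_left hi).mpr h1) (v₀ : ℂ)⁻¹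
  rw [mellin_comp_mul_left _ _ hi, h2] at h3
  have e2 : (v₀ : ℂ) ^ (s - 1) / (s - 1) =
      (v₀ : ℂ)⁻¹ • ((v₀⁻¹ : ℝ) : ℂ) ^ (-s) • (1 / (s + -1)) := by
    rw [Complex.ofReal_inv, Complex.inv_cpow _ _ (by
        rw [Complex.arg_ofReal_of_nonneg hv₀.le]; exact Real.pi_pos.ne),
      ← Complex.cpow_neg, neg_neg, Complex.cpow_sub _ _ hvc, Complex.cpow_one, smul_eq_mul,
      smul_eq_mul]
    ring
  rw [e2]
  exact h3

/-- The series `lambertSum χ` with its polar part `l / v` removed for `v ≤ v₀`. -/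
noncomputable def lambertReg (χ : DirichletCharacter ℂ N) (l v₀ v : ℝ) : ℂ :=
  lambertSum χ v - l * (Ioc 0 v₀).indicator (fun v : ℝ => (1 / v : ℂ)) v

theorem locallyIntegrableOn_lambertReg (χ : DirichletCharacter ℂ N) (l v₀ : ℝ) :
    LocallyIntegrableOn (lambertReg χ l v₀) (Ioi 0) := by
  rw [locallyIntegrableOn_iff isOpen_Ioi.isLocallyClosed]
  intro k hk hkc
  refine Integrable.sub ?_ (Integrable.const_mul ?_ _)
  · exact ContinuousOn.integrableOn_compact hkc (Complex.continuous_ofReal.comp_continuousOn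
      ((continuousOn_lambertSum χ).mono hk))
  · refine IntegrableOn.indicator ?_ measurableSet_Ioc
    refine ContinuousOn.integrableOn_compact hkc ?_
    refine continuousOn_const.div Complex.continuous_ofReal.continuousOn fun v hv => ?_
    have : (0 : ℝ) < v := hk hv
    exact_mod_cast this.ne'

theorem lambertReg_of_lt (χ : DirichletCharacter ℂ N) (l : ℝ) {v₀ v : ℝ} (hv : v₀ < v) :
    lambertReg χ l v₀ v = lambertSum χ v := by
  rw [lambertReg, indicator_of_notMem (fun h => absurd h.2 (not_le.mpr hv)), mul_zero, sub_zero]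

theorem lambertReg_of_le (χ : DirichletCharacter ℂ N) (l : ℝ) {v₀ v : ℝ} (h0 : 0 < v)
    (hv : v ≤ v₀) : lambertReg χ l v₀ v = ((lambertSum χ v - l / v : ℝ) : ℂ) := by
  rw [lambertReg, indicator_of_mem (show v ∈ Ioc 0 v₀ from ⟨h0, hv⟩)]
  push_cast; ring

theorem isBigO_lambertReg_atTop (χ : DirichletCharacter ℂ N) (l : ℝ) {v₀ : ℝ} (hv₀ : 0 < v₀) :
    lambertReg χ l v₀ =O[atTop] fun v => Real.exp (-(1 / 2) * v) := by
  obtain ⟨C, hC⟩ := exists_abs_lambertSum_le χ hv₀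
  refine Asymptotics.IsBigO.of_bound C ?_
  filter_upwards [eventually_gt_atTop v₀] with v hv
  rw [lambertReg_of_lt χ l hv, Complex.norm_real, Real.norm_eq_abs,
    Real.norm_of_nonneg (Real.exp_pos _).le]
  exact hC v hv.le

theorem isBigO_lambertReg_zero {χ : DirichletCharacter ℂ N} {l C : ℝ}
    (hl : ∀ v : ℝ, 0 < v → |lambertSum χ v - l / v| ≤ C * v) {v₀ : ℝ} (hv₀ : 0 < v₀) :
    lambertReg χ l v₀ =O[𝓝[>] 0] fun v => v ^ (-(-1 : ℝ)) := by
  refine Asymptotics.IsBigO.of_bound C ?_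
  filter_upwards [Ioc_mem_nhdsGT hv₀] with v hv
  rw [lambertReg_of_le χ l hv.1 hv.2, Complex.norm_real, Real.norm_eq_abs, neg_neg, Real.rpow_one,
    Real.norm_of_nonneg hv.1.le]
  exact hl v hv.1

theorem mellin_lambertReg_eq {χ : DirichletCharacter ℂ N} (hχ1 : χ ≠ 1) (hχ2 : χ ^ 2 = 1) {l C : ℝ}
    (hl : ∀ v : ℝ, 0 < v → |lambertSum χ v - l / v| ≤ C * v) {v₀ : ℝ} (hv₀ : 0 < v₀) {s : ℂ}
    (hs : 0 < s.re) :
    (s - 1) * mellin (lambertReg χ l v₀) s + l * (v₀ : ℂ) ^ (s - 1) =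
      Complex.Gamma (s + 1) * (charF (1 : DirichletCharacter ℂ 1) s * LFunction χ s) := by
  have hvc : (v₀ : ℂ) ≠ 0 := by exact_mod_cast hv₀.ne'
  have hconv : ∀ s : ℂ, 0 < s.re → MellinConvergent (lambertReg χ l v₀) s := fun s hs =>
    mellinConvergent_of_isBigO_rpow_exp (by norm_num) (locallyIntegrableOn_lambertReg χ l v₀)
      (isBigO_lambertReg_atTop χ l hv₀) (isBigO_lambertReg_zero hl hv₀) (by linarith)
  have hdiff : ∀ s : ℂ, 0 < s.re → DifferentiableAt ℂ (mellin (lambertReg χ l v₀)) s := fun s hs =>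
    mellin_differentiableAt_of_isBigO_rpow_exp (by norm_num)
      (locallyIntegrableOn_lambertReg χ l v₀)
      (isBigO_lambertReg_atTop χ l hv₀) (isBigO_lambertReg_zero hl hv₀) (by linarith)
  have hU : IsOpen {s : ℂ | 0 < s.re} := isOpen_lt continuous_const Complex.continuous_re
  have hUc : IsPreconnected {s : ℂ | 0 < s.re} := (convex_halfSpace_re_gt 0).isPreconnected
  have hA1 : AnalyticOnNhd ℂ (fun s => (s - 1) * mellin (lambertReg χ l v₀) s +
      l * (v₀ : ℂ) ^ (s - 1)) {s : ℂ | 0 < s.re} := by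
    refine DifferentiableOn.analyticOnNhd (fun s hs => ?_) hU
    refine DifferentiableAt.differentiableWithinAt ?_
    refine ((differentiableAt_id.sub_const 1).mul (hdiff s hs)).add
      (DifferentiableAt.const_mul ?_ _)
    exact (differentiableAt_id.sub_const 1).const_cpow (Or.inl hvc)
  have hA2 : AnalyticOnNhd ℂ (fun s => Complex.Gamma (s + 1) *
      (charF (1 : DirichletCharacter ℂ 1) s * LFunction χ s)) {s : ℂ | 0 < s.re} := by
    refine DifferentiableOn.analyticOnNhd (fun s hs => ?_) hU
    refine DifferentiableAt.differentiableWithinAt ?_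
    refine DifferentiableAt.mul ?_ ((differentiable_charF _ s).mul (differentiable_LFunction hχ1 s))
    refine DifferentiableAt.comp (g := Complex.Gamma) s (Complex.differentiableAt_Gamma _ fun m h => ?_)
      (differentiableAt_id.add_const 1)
    have h1 := congrArg Complex.re h
    have h2 : 0 < s.re := hs
    have h3 : (0 : ℝ) ≤ m := Nat.cast_nonneg m
    simp at h1
    linarith
  refine hA1.eqOn_of_preconnected_of_eventuallyEq hA2 hUc (z₀ := 2) (by simp) ?_ hs
  have hV : {s : ℂ | 1 < s.re} ∈ 𝓝 (2 : ℂ) :=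
    (isOpen_lt continuous_const Complex.continuous_re).mem_nhds (by simp)
  filter_upwards [hV] with s hs1
  have hs1' : 1 < s.re := hs1
  have hs' : s ≠ 1 := fun h => by rw [h, Complex.one_re] at hs1'; exact lt_irrefl _ hs1'
  have hD := hasMellin_inv_Ioc hv₀ hs1'
  have hD2 := hasMellin_const_smul hD.1 (l : ℂ)
  have hsum := hasMellin_add (hconv s (by linarith)) hD2.1
  have e : (fun v => (lambertSum χ v : ℂ)) = fun v => lambertReg χ l v₀ v +
      (l : ℂ) • (Ioc 0 v₀).indicator (fun v : ℝ => (1 / v : ℂ)) v := by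
    funext v; rw [lambertReg, smul_eq_mul]; ring
  have h1 := mellin_lambertSum hχ2 hs1'
  rw [e, hsum.2, hD2.2, hD.2, smul_eq_mul] at h1
  rw [charF_one_apply hs', LFunction_modOne_eq]
  have hs1z : s - 1 ≠ 0 := sub_ne_zero.mpr hs'
  have h2 : (s - 1) * (l * ((v₀ : ℂ) ^ (s - 1) / (s - 1))) = l * (v₀ : ℂ) ^ (s - 1) := by
    field_simp
  linear_combination (s - 1) * h1 - h2

end LambertMellin

section SiegelZero

open Set Filter Topology MeasureTheory

open DirichletCharacter

theorem norm_mellin_lambertReg_le {N : ℕ} [NeZero N] {χ : DirichletCharacter ℂ N}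
    (hχ2 : χ ^ 2 = 1) {l C : ℝ} (hC : 0 ≤ C)
    (hl : ∀ v : ℝ, 0 < v → |lambertSum χ v - l / v| ≤ C * v) {v₀ : ℝ} (hv₀ : 0 < v₀) {β : ℝ}
    (hβ : 0 < β) (hβ1 : β < 1) :
    ‖mellin (lambertReg χ l v₀) β‖ ≤
      v₀ ^ (β - 1) * (C * v₀ ^ 2 + ∫ v in Ioi v₀, lambertSum χ v) := by
  have hconv : MellinConvergent (lambertReg χ l v₀) β :=
    mellinConvergent_of_isBigO_rpow_exp (by norm_num) (locallyIntegrableOn_lambertReg χ l v₀)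
      (isBigO_lambertReg_atTop χ l hv₀) (isBigO_lambertReg_zero hl hv₀)
      (by rw [Complex.ofReal_re]; linarith)
  have hinteg : IntegrableOn (fun t : ℝ => ‖(t : ℂ) ^ ((β : ℂ) - 1) • lambertReg χ l v₀ t‖) (Ioi 0) :=
    hconv.norm
  have hnorm : ∀ t ∈ Ioi (0 : ℝ), ‖(t : ℂ) ^ ((β : ℂ) - 1) • lambertReg χ l v₀ t‖ =
      t ^ (β - 1) * ‖lambertReg χ l v₀ t‖ := fun t ht => by
    rw [norm_smul, Complex.norm_cpow_eq_rpow_re_of_pos ht]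
    simp
  refine (norm_integral_le_integral_norm _).trans ?_
  rw [← Ioc_union_Ioi_eq_Ioi hv₀.le] at hinteg ⊢
  rw [setIntegral_union (Ioc_disjoint_Ioi le_rfl) measurableSet_Ioi
    (hinteg.mono_set subset_union_left) (hinteg.mono_set subset_union_right), mul_add]
  refine add_le_add ?_ ?_
  · have h1 : ∀ t ∈ Ioc 0 v₀, ‖(t : ℂ) ^ ((β : ℂ) - 1) • lambertReg χ l v₀ t‖ ≤ C * v₀ ^ β := by
      intro t ht
      rw [hnorm t ht.1, lambertReg_of_le χ l ht.1 ht.2, Complex.norm_real, Real.norm_eq_abs]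
      calc t ^ (β - 1) * |lambertSum χ t - l / t| ≤ t ^ (β - 1) * (C * t) := by
            gcongr
            · exact Real.rpow_nonneg ht.1.le _
            · exact hl t ht.1
        _ = C * t ^ β := by
            rw [Real.rpow_sub_one ht.1.ne']
            field_simp [ht.1.ne']
        _ ≤ C * v₀ ^ β := by
            gcongr
            · exact ht.1.le
            · exact ht.2
    refine (setIntegral_mono_on (hinteg.mono_set subset_union_left)
      (integrableOn_const (by simp))
      measurableSet_Ioc h1).trans_eq ?_
    rw [setIntegral_const, Real.volume_real_Ioc_of_le hv₀.le, Real.rpow_sub_one hv₀.ne', smul_eq_mul]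
    field_simp
    ring
  · rw [← integral_const_mul]
    refine setIntegral_mono_on (hinteg.mono_set subset_union_right)
      ((integrableOn_lambertSum χ hv₀).const_mul _) measurableSet_Ioi fun t ht => ?_
    have ht0 : 0 < t := hv₀.trans ht
    rw [hnorm t ht0, lambertReg_of_lt χ l ht, Complex.norm_real, Real.norm_eq_abs,
      abs_of_nonneg (lambertSum_nonneg hχ2 ht0)]
    exact mul_le_mul_of_nonneg_right
      (Real.rpow_le_rpow_of_nonpos hv₀ (le_of_lt ht) (by linarith)) (lambertSum_nonneg hχ2 ht0)

theorem one_sub_zero_ge_of_isPrimitive {N : ℕ} [NeZero N] (hN : 1 < N)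
    {χ : DirichletCharacter ℂ N} (hχ : χ.IsPrimitive) (hχ2 : χ ^ 2 = 1) {x : ℝ} (hNx : N ≤ x)
    (hx : 10 ^ 5 ≤ x) {β : ℝ} (hβ : 0 < β) (hβ1 : β < 1) (h0 : LFunction χ β = 0) :
    0.199 / √x ≤ 1 - β := by
  have hχ1 : χ ≠ 1 := by
    rintro rfl
    rw [isPrimitive_def, conductor_one] at hχ
    omega
  obtain ⟨l, hl⟩ := exists_lambertSum_bound hN hχ hχ2
  have hx0 : 0 < x := by linarith
  obtain ⟨v, hv⟩ : ∃ v, v = 1 / x := ⟨_, rfl⟩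
  have hv0 : 0 < v := by rw [hv]; positivity
  have hv1 : v ≤ 1 / 10 ^ 5 := by rw [hv]; gcongr
  obtain ⟨h, hh⟩ : ∃ h, h = √v := ⟨_, rfl⟩
  have hh0 : 0 < h := by rw [hh]; positivity
  have hhx : 0.199 / √x = 0.199 * h := by
    rw [hh, hv, Real.sqrt_div zero_le_one, Real.sqrt_one]; ring
  have hh1 : h ≤ 1 / 300 := by
    rw [hh]
    refine Real.sqrt_le_iff.2 ⟨by norm_num, hv1.trans (by norm_num)⟩
  obtain ⟨C, hC⟩ : ∃ C : ℝ, C = 11 / 96 * (N * √N) := ⟨_, rfl⟩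
  rw [← hC] at hl
  have hC0 : 0 ≤ C := by rw [hC]; positivity
  have hD : C * v ^ 2 ≤ 11 / 96 * h := by
    have hhv : h ^ 2 = v := by rw [hh, Real.sq_sqrt hv0.le]
    have hxh : √x = 1 / h := by
      rw [hh, hv, Real.sqrt_div zero_le_one, Real.sqrt_one]; field_simp
    have : C ≤ 11 / 96 * (x * √x) := by rw [hC]; gcongr
    have hxv : x = 1 / v := by rw [hv]; field_simp
    calc C * v ^ 2 ≤ 11 / 96 * (x * √x) * v ^ 2 := by gcongr
      _ = 11 / 96 * h := by
        rw [hxh, hxv, ← hhv]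
        field_simp
  have hmel := norm_mellin_lambertReg_le hχ2 hC0 hl hv0 hβ hβ1
  have hinteg := integral_lambertSum_le hχ2 hv0 hv1
  have hlow := lambertSum_lower hχ2 hv0 hv1
  rw [← hh] at hinteg hlow
  have heq := mellin_lambertReg_eq hχ1 hχ2 hl hv0 (s := β) (by simpa using hβ)
  rw [h0, mul_zero, mul_zero] at heq
  obtain ⟨X, hX⟩ : ∃ X, X = v * lambertSum χ v := ⟨_, rfl⟩
  rw [← hX] at hinteg hlow
  have hlX : X - C * v ^ 2 ≤ l := by
    have h1 := (abs_le.1 (hl v hv0)).2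
    have h2 : v * (lambertSum χ v - l / v) ≤ v * (C * v) := by gcongr
    rw [mul_sub, ← hX, mul_div_cancel₀ _ hv0.ne'] at h2
    linarith
  have hvp : 0 < v ^ (β - 1) := Real.rpow_pos_of_pos hv0 _
  have hlle : l * v ^ (β - 1) ≤
      (1 - β) * (v ^ (β - 1) * (C * v ^ 2 + 1.645 / (0.4429 * h) * X)) := by
    have h1 : (l : ℂ) * (v : ℂ) ^ ((β : ℂ) - 1) =
        ((1 - β : ℝ) : ℂ) * mellin (lambertReg χ l v) β := by
      push_cast
      linear_combination heq
    have h2 := congrArg norm h1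
    rw [norm_mul, norm_mul, Complex.norm_cpow_eq_rpow_re_of_pos hv0, Complex.norm_real,
      Complex.norm_real, Real.norm_eq_abs, Real.norm_eq_abs, abs_of_pos (by linarith : 0 < 1 - β)]
      at h2
    have h3 : ((β : ℂ) - 1).re = β - 1 := by simp
    rw [h3] at h2
    calc l * v ^ (β - 1) ≤ |l| * v ^ (β - 1) := by gcongr; exact le_abs_self l
      _ ≤ _ := by
        rw [h2]
        have : 0 ≤ 1 - β := by linarith
        gcongr
        exact hmel.trans (by gcongr)
  have hfin : X - C * v ^ 2 ≤ (1 - β) * (C * v ^ 2 + 1.645 / (0.4429 * h) * X) := by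
    refine hlX.trans (le_of_mul_le_mul_right ?_ hvp)
    linarith
  rw [hhx]
  by_contra! hcon
  have hX0 : 0 < X := lt_of_lt_of_le (by positivity) hlow
  have hpos : 0 ≤ C * v ^ 2 := by positivity
  have h4 : (1 - β) * (C * v ^ 2 + 1.645 / (0.4429 * h) * X) ≤
      0.199 * h * (C * v ^ 2 + 1.645 / (0.4429 * h) * X) := by gcongr
  have h5 : 0.199 * h * (C * v ^ 2 + 1.645 / (0.4429 * h) * X) =
      0.199 * h * (C * v ^ 2) + 0.199 * 1.645 / 0.4429 * X := by
    field_simp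
  have h6 : 0.199 * h * (C * v ^ 2) ≤ 0.199 * (1 / 300) * (C * v ^ 2) := by gcongr
  norm_num at hlow h4 h5 h6
  nlinarith

theorem zero_le_of_sq_eq_one {q : ℕ} [NeZero q] (hq : 10 ^ 5 ≤ q) {χ : DirichletCharacter ℂ q}
    (hχ1 : χ ≠ 1) (hχ2 : χ ^ 2 = 1) {β : ℝ} (h0 : charF χ β = 0) : β ≤ 1 - 0.199 / √q := by
  have hqr : (10 ^ 5 : ℝ) ≤ q := by exact_mod_cast hq
  have hβ1 : β < 1 := by
    by_contra! hcon
    exact charF_ne_zero_of_one_le_re χ (by simpa using hcon) h0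
  have hsq : 0.199 / √(q : ℝ) ≤ 0.199 := by
    refine div_le_self (by norm_num) (Real.one_le_sqrt.2 (by linarith))
  rcases le_or_gt β 0 with hβ | hβ
  · linarith
  rw [charF_of_ne χ hχ1] at h0
  have hM0 : χ.conductor ≠ 0 := fun h => NeZero.ne q (conductor_eq_zero_iff_level_eq_zero.1 h)
  have : NeZero χ.conductor := ⟨hM0⟩
  set ψ := χ.primitiveCharacter with hψ
  have hlift : changeLevel χ.conductor_dvd_level ψ = χ := changeLevel_primitiveCharacter χ
  have hψ1 : ψ ≠ 1 := by
    intro h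
    rw [h, changeLevel_one] at hlift
    exact hχ1 hlift.symm
  have hψ2 : ψ ^ 2 = 1 := by
    apply changeLevel_injective χ.conductor_dvd_level
    rw [map_pow, hlift, hχ2, changeLevel_one]
  have hM1 : 1 < χ.conductor := by
    have : χ.conductor ≠ 1 := fun h => hχ1 (eq_one_iff_conductor_eq_one.2 h)
    omega
  have hL : LFunction ψ β = 0 := by
    rw [← hlift, LFunction_changeLevel _ _ (Or.inl hψ1)] at h0
    rcases mul_eq_zero.1 h0 with h | h
    · exact h
    · exfalso
      obtain ⟨p, hp, hp0⟩ := Finset.prod_eq_zero_iff.1 h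
      have hpp := (Nat.prime_of_mem_primeFactors hp)
      have h1 : ‖ψ p * (p : ℂ) ^ (-(β : ℂ))‖ < 1 := by
        rw [norm_mul, Complex.norm_natCast_cpow_of_pos hpp.pos]
        have : (p : ℝ) ^ (-(β : ℂ)).re < 1 :=
          Real.rpow_lt_one_of_one_lt_of_neg (by exact_mod_cast hpp.one_lt) (by simpa using hβ)
        have h2 : 0 ≤ (p : ℝ) ^ (-(β : ℂ)).re := by positivity
        have := ψ.norm_le_one p
        nlinarith
      rw [← sub_eq_zero.1 hp0, norm_one] at h1
      exact lt_irrefl _ h1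
  have := one_sub_zero_ge_of_isPrimitive hM1 (primitiveCharacter_isPrimitive χ) hψ2
    (x := q) (by exact_mod_cast Nat.le_of_dvd (by omega) χ.conductor_dvd_level) hqr hβ hβ1 hL
  linarith

end SiegelZero

section LargeModulus

section TotientLower

theorem cube_le_mul_totient_pow {n : ℕ} (hn : n ≠ 0) :
    (n : ℝ) ^ 3 ≤ (if 2 ∣ n then 8 else 1) * (if 3 ∣ n then 27 / 16 else 1) *
      (n.totient : ℝ) ^ 4 := by
  induction n using Nat.recOnPosPrimePosCoprime with
  | zero => exact absurd rfl hn
  | one => norm_num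
  | prime_pow p k hp hk =>
    obtain ⟨m, rfl⟩ : ∃ m, k = m + 1 := ⟨k - 1, by omega⟩
    have hp1 : (1 : ℝ) ≤ p := by exact_mod_cast hp.one_lt.le
    have hdvd : ∀ r : ℕ, r.Prime → ((r ∣ p ^ (m + 1)) ↔ r = p) := fun r hr =>
      ⟨fun h => (Nat.prime_dvd_prime_iff_eq hr hp).1 (hr.dvd_of_dvd_pow h),
        fun h => h ▸ dvd_pow_self r (by omega)⟩
    have key : (p : ℝ) ^ 3 ≤ (if 2 = p then 8 else 1) * (if 3 = p then 27 / 16 else 1) *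
        ((p : ℝ) - 1) ^ 4 := by
      rcases Nat.lt_or_ge p 5 with h | h
      · have := hp.two_le
        interval_cases p <;> norm_num
      · rw [if_neg (by omega), if_neg (by omega), one_mul, one_mul]
        have h5 : (5 : ℝ) ≤ p := by exact_mod_cast h
        have h6 : 4 / 5 * (p : ℝ) ≤ p - 1 := by linarith
        calc (p : ℝ) ^ 3 ≤ (4 / 5 * (p : ℝ)) ^ 4 := by
              rw [mul_pow]
              nlinarith [pow_pos (by linarith : (0 : ℝ) < p) 3]
          _ ≤ _ := by gcongr
    simp only [hdvd 2 Nat.prime_two, hdvd 3 Nat.prime_three]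
    rw [Nat.totient_prime_pow_succ hp]
    push_cast [hp.one_lt.le]
    calc ((p : ℝ) ^ (m + 1)) ^ 3 = (p : ℝ) ^ (m * 3) * p ^ 3 := by ring
      _ ≤ (p : ℝ) ^ (m * 4) * ((if 2 = p then 8 else 1) * (if 3 = p then 27 / 16 else 1) *
        ((p : ℝ) - 1) ^ 4) := by
          gcongr
          norm_num
      _ = _ := by ring
  | coprime a b ha hb hab iha ihb =>
    have hmul : ∀ (r : ℕ) (c : ℝ), r.Prime → ((if r ∣ a * b then c else 1) =
        (if r ∣ a then c else 1) * (if r ∣ b then c else 1)) := fun r c hr => by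
      by_cases h1 : r ∣ a
      · have h2 : ¬ r ∣ b := fun h => hr.one_lt.ne' (Nat.eq_one_of_dvd_coprimes hab h1 h)
        simp [h1, h2, dvd_mul_of_dvd_left]
      · by_cases h2 : r ∣ b <;> simp [h1, h2, hr.dvd_mul]
    rw [hmul 2 _ Nat.prime_two, hmul 3 _ Nat.prime_three, Nat.totient_mul hab]
    push_cast
    rw [mul_pow]
    refine (mul_le_mul (iha (by omega)) (ihb (by omega)) (by positivity) (by positivity)).trans_eq ?_
    ring

theorem cube_le_totient_pow (n : ℕ) : (n : ℝ) ^ 3 ≤ 13.5 * (n.totient : ℝ) ^ 4 := by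
  rcases eq_or_ne n 0 with rfl | hn
  · simp
  refine (cube_le_mul_totient_pow hn).trans ?_
  gcongr
  split_ifs <;> norm_num

end TotientLower

section ClassPsiLarge

variable {q : ℕ}

set_option exponentiation.threshold 300 in
theorem log_ge_of_lt (hq : 10 ^ 5 < q) : 11.5126 ≤ Real.log q := by
  have hqr : ((10 : ℝ) ^ 5) ≤ q := by exact_mod_cast hq.le
  have h1 : 289 * Real.log 2 ≤ 87 * Real.log 10 := by
    have := Real.log_le_log (by positivity) (by norm_num : (2 : ℝ) ^ 289 ≤ 10 ^ 87)
    rwa [Real.log_pow, Real.log_pow] at this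
  have h2 := Real.log_le_log (by positivity) hqr
  rw [Real.log_pow] at h2
  have h3 := Real.log_two_gt_d9
  norm_num at h1 h2 h3 ⊢
  linarith

theorem le_totient_of_lt (hq : 10 ^ 5 < q) :
    2930 ≤ (q.totient : ℝ) ∧ 9 * √(q : ℝ) ≤ q.totient := by
  have hqr : ((10 : ℝ) ^ 5) ≤ q := by exact_mod_cast hq.le
  have h := cube_le_totient_pow q
  have hs : √(q : ℝ) ^ 4 = (q : ℝ) ^ 2 := by
    rw [show √(q : ℝ) ^ 4 = (√(q : ℝ) ^ 2) ^ 2 by ring, Real.sq_sqrt (by positivity)]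
  constructor
  · refine le_of_pow_le_pow_left₀ (n := 4) (by norm_num) (by positivity) ?_
    have : ((10 : ℝ) ^ 5) ^ 3 ≤ (q : ℝ) ^ 3 := by gcongr
    norm_num at this h ⊢
    linarith
  · refine le_of_pow_le_pow_left₀ (n := 4) (by norm_num) (by positivity) ?_
    rw [mul_pow, hs]
    have : (10 : ℝ) ^ 5 * (q : ℝ) ^ 2 ≤ (q : ℝ) ^ 3 := by
      rw [pow_succ (q : ℝ) 2, mul_comm]
      gcongr
    norm_num at this h ⊢
    nlinarith

theorem abs_classPsi_sub_le_of_large [NeZero q] (hq : 10 ^ 5 < q) {a : ZMod q} (ha : IsUnit a)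
    {y : ℝ} (hy : 0.0297 * √q * Real.log q ^ 3 ≤ y) :
    |classPsi a (Real.exp y) - Real.exp y / q.totient| ≤ 0.91 / 160 * Real.exp y / y := by
  have hqr : ((10 : ℝ) ^ 5) ≤ q := by exact_mod_cast hq.le
  have hL := log_ge_of_lt hq
  obtain ⟨hφ, hφs⟩ := le_totient_of_lt hq
  obtain ⟨s, hs⟩ : ∃ s, s = √(q : ℝ) := ⟨_, rfl⟩
  rw [← hs] at hy hφs
  have hs2 : s ^ 2 = q := by rw [hs, Real.sq_sqrt (by positivity)]
  have hs1 : 316.2 ≤ s := by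
    rw [hs]
    exact Real.le_sqrt_of_sq_le (le_trans (by norm_num) hqr)
  have hL3 : 1525.87 ≤ Real.log q ^ 3 := by
    refine le_trans (by norm_num) (pow_le_pow_left₀ (by norm_num) hL 3)
  have hys : 45.318 * s ≤ y := by
    refine le_trans ?_ hy
    have := mul_le_mul_of_nonneg_left hL3 (by positivity : 0 ≤ 0.0297 * s)
    norm_num at this ⊢
    nlinarith
  have hy1 : 14325 ≤ y := by norm_num at hs1 hys ⊢; linarith
  have hy0 : 0 < y := by linarith
  have hs0 : 0 < s := by linarith
  have hφ0 : (0 : ℝ) < q.totient := by linarith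
  have hle : (q.totient : ℝ) ≤ q := by exact_mod_cast Nat.totient_le q
  refine abs_classPsi_sub_le ha hy1 hφ ?_ (b := 1 - 0.199 / s) ?_ ?_
    (fun χ β h1 h2 h0 => hs ▸ zero_le_of_sq_eq_one hq.le h1 h2 h0) ?_
  · have : (45.318 * s) ^ 2 ≤ y ^ 2 := by gcongr
    rw [mul_pow, hs2] at this
    norm_num at this ⊢
    nlinarith
  · rw [sub_pos, div_lt_one hs0]; linarith
  · have : 0 ≤ 0.199 / s := by positivity
    linarith
  · obtain ⟨w, hw⟩ : ∃ w, w = 0.199 / s * y := ⟨_, rfl⟩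
    have hw9 : 9 ≤ w := by
      rw [hw, div_mul_eq_mul_div, le_div_iff₀ hs0]
      norm_num at hys ⊢
      nlinarith
    have hb : 0.999 ≤ 1 - 0.199 / s := by
      have : 0.199 / s ≤ 0.199 / 316.2 := by gcongr
      norm_num at this ⊢
      linarith
    rw [show (1 - (1 - 0.199 / s)) * y = w by rw [hw]; ring]
    have hyφ : y / q.totient ≤ 0.5584 * w := by
      rw [div_le_iff₀ hφ0, hw]
      have : 0.5584 * (0.199 / s * y) * (9 * s) ≤ 0.5584 * (0.199 / s * y) * q.totient := by
        gcongr
      refine le_trans ?_ this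
      have : 0.5584 * (0.199 / s * y) * (9 * s) = 0.5584 * 0.199 * 9 * y := by
        field_simp
      rw [this]
      norm_num
      linarith
    have he : 860 * w ≤ Real.exp w := by
      have h1 : (7743 : ℝ) ≤ Real.exp 9 := by
        have h2 := pow_le_pow_left₀ (by norm_num) Real.exp_one_gt_d9.le 9
        rw [← Real.exp_nat_mul] at h2
        norm_num at h2
        linarith
      have h2 := Real.add_one_le_exp (w - 9)
      rw [show w = 9 + (w - 9) by ring, Real.exp_add]
      nlinarith [Real.exp_pos 9]
    have hb0 : 0 < 1 - 0.199 / s := by linarith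
    rw [div_le_iff₀ hb0, div_mul_eq_mul_div, le_div_iff₀ hy0, Real.exp_neg, inv_mul_eq_div,
      div_mul_eq_mul_div, div_le_iff₀ (Real.exp_pos w)]
    have h1 : (1 / (q.totient : ℝ) + 1 / (320 * y)) * y = y / q.totient + 1 / 320 := by
      field_simp
    rw [h1]
    have h2 : 0.25 / 160 * 0.999 * (860 * w) ≤
        0.25 / 160 * (1 - 0.199 / s) * Real.exp w := by gcongr
    norm_num at h2 hyφ ⊢
    linarith

end ClassPsiLarge

end LargeModulus

section ClassTheta

open Set Filter Topology MeasureTheory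

variable {q : ℕ}

/-- The weight `log p` on the primes `p ≡ a (mod q)`. -/
noncomputable def classLog (a : ZMod q) (n : ℕ) : ℝ :=
  if n.Prime ∧ a = n then Real.log n else 0

/-- `θ(x;q,a)`, the sum of `log p` over the primes `p ≤ x` with `p ≡ a (mod q)`. -/
noncomputable def classTheta (a : ZMod q) (x : ℝ) : ℝ := ∑ n ∈ Finset.Icc 0 ⌊x⌋₊, classLog a n

theorem classLog_nonneg (a : ZMod q) (n : ℕ) : 0 ≤ classLog a n := by
  rw [classLog]
  split_ifs
  · exact Real.log_natCast_nonneg n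
  · exact le_rfl

theorem classTheta_eq_sum_Ioc (a : ZMod q) (x : ℝ) :
    classTheta a x = ∑ n ∈ Finset.Ioc 0 ⌊x⌋₊, classLog a n := by
  rw [classTheta, Finset.Icc_eq_cons_Ioc (Nat.zero_le _), Finset.sum_cons]
  simp [classLog, Nat.not_prime_zero]

theorem classTheta_nonneg (a : ZMod q) (x : ℝ) : 0 ≤ classTheta a x :=
  Finset.sum_nonneg fun n _ => classLog_nonneg a n

theorem classTheta_le (a : ZMod q) {x : ℝ} (hx : 0 ≤ x) : classTheta a x ≤ 1.4 * x := by
  have h1 : classTheta a x ≤ Chebyshev.theta x := by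
    rw [classTheta_eq_sum_Ioc, Chebyshev.theta, Finset.sum_filter]
    refine Finset.sum_le_sum fun n _ => ?_
    rw [classLog]
    split_ifs with h1 h2 h2
    · exact le_rfl
    · exact absurd h1.1 h2
    · exact Real.log_natCast_nonneg n
    · exact le_rfl
  have h2 := Chebyshev.theta_le_log4_mul_x hx
  have h3 : Real.log 4 ≤ 1.4 := by
    rw [show (4 : ℝ) = 2 ^ 2 by norm_num, Real.log_pow]
    have := Real.log_two_lt_d9
    norm_num at this ⊢
    linarith
  calc _ ≤ _ := h1.trans h2
    _ ≤ _ := by gcongr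

theorem abs_classPsi_sub_classTheta_le [NeZero q] (a : ZMod q) {x : ℝ} (hx : 1 ≤ x) :
    |classPsi a x - classTheta a x| ≤ 2 * √x * Real.log x := by
  have hsub : classPsi a x - classTheta a x = ∑ n ∈ Finset.Ioc 0 ⌊x⌋₊,
      ((if a = n then ArithmeticFunction.vonMangoldt n else 0) - classLog a n) := by
    rw [classTheta_eq_sum_Ioc, classPsi, Finset.sum_sub_distrib]
  have hterm : ∀ n : ℕ, 0 ≤ (if a = n then ArithmeticFunction.vonMangoldt n else 0) - classLog a n ∧
      (if a = n then ArithmeticFunction.vonMangoldt n else 0) - classLog a n ≤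
        ArithmeticFunction.vonMangoldt n - if n.Prime then Real.log n else 0 := by
    intro n
    have h0 : 0 ≤ ArithmeticFunction.vonMangoldt n := ArithmeticFunction.vonMangoldt_nonneg
    rw [classLog]
    by_cases hp : n.Prime
    · have := ArithmeticFunction.vonMangoldt_apply_prime hp
      by_cases ha : a = n <;> simp [hp, ha, this]
    · by_cases ha : a = n <;> simp [hp, ha, h0]
  rw [abs_of_nonneg (hsub ▸ Finset.sum_nonneg fun n _ => (hterm n).1)]
  refine le_trans ?_ (Chebyshev.psi_sub_theta_le hx)
  rw [hsub, Chebyshev.psi, Chebyshev.theta, Finset.sum_filter, ← Finset.sum_sub_distrib]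
  exact Finset.sum_le_sum fun n _ => (hterm n).2

theorem hasDerivAt_inv_log {t : ℝ} (ht : 2 ≤ t) :
    HasDerivAt (fun t => (Real.log t)⁻¹) (-(t * Real.log t ^ 2)⁻¹) t := by
  have h1 : 0 < Real.log t := Real.log_pos (by linarith)
  refine ((Real.hasDerivAt_log (by linarith)).inv h1.ne').congr_deriv ?_
  field_simp

theorem continuousOn_inv_mul_log_sq (x : ℝ) :
    ContinuousOn (fun t : ℝ => (t * Real.log t ^ 2)⁻¹) (Icc 2 x) := by
  intro t ht
  have h1 : 0 < Real.log t := Real.log_pos (by linarith [ht.1])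
  have h2 : t ≠ 0 := by linarith [ht.1]
  have h3 : t * Real.log t ^ 2 ≠ 0 := by positivity
  exact ContinuousAt.continuousWithinAt (by fun_prop (disch := assumption))

theorem integrableOn_classTheta (a : ZMod q) (x : ℝ) :
    IntegrableOn (fun t => (t * Real.log t ^ 2)⁻¹ * classTheta a t) (Icc 2 x) :=
  integrableOn_mul_sum_Icc _ (by norm_num) (continuousOn_inv_mul_log_sq x).integrableOn_Icc

theorem primesPi_eq {a : ℤ} {x : ℝ} (hx : 2 ≤ x) :
    (primesPi x q a : ℝ) = classTheta (a : ZMod q) x / Real.log x +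
      ∫ t in 2..x, (t * Real.log t ^ 2)⁻¹ * classTheta (a : ZMod q) t := by
  have hsum : (primesPi x q a : ℝ) =
      ∑ n ∈ Finset.Icc 0 ⌊x⌋₊, (Real.log n)⁻¹ * classLog (a : ZMod q) n := by
    rw [primesPi, Finset.card_filter, Finset.Icc_eq_cons_Ioc (Nat.zero_le _), Finset.sum_cons,
      show Finset.Icc 1 ⌊x⌋₊ = Finset.Ioc 0 ⌊x⌋₊ from rfl]
    push_cast
    rw [show classLog (a : ZMod q) 0 = 0 by simp [classLog, Nat.not_prime_zero], mul_zero, zero_add]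
    refine Finset.sum_congr rfl fun n _ => ?_
    rw [classLog]
    by_cases hp : n.Prime
    · have : Real.log n ≠ 0 := (Real.log_pos (by exact_mod_cast hp.one_lt)).ne'
      by_cases ha : (n : ZMod q) = a
      · simp [hp, ha, this]
      · simp [hp, ha, Ne.symm ha]
    · simp [hp]
  have hder : ∀ t ∈ Icc 2 x, deriv (fun t => (Real.log t)⁻¹) t = -(t * Real.log t ^ 2)⁻¹ :=
    fun t ht => (hasDerivAt_inv_log ht.1).deriv
  rw [hsum, sum_mul_eq_sub_integral_mul₁ (f := fun t => (Real.log t)⁻¹) _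
    (by simp [classLog, Nat.not_prime_zero]) (by simp [classLog, Nat.not_prime_one]) x
    (fun t ht => (hasDerivAt_inv_log ht.1).differentiableAt)
    ((continuousOn_inv_mul_log_sq x).neg.integrableOn_Icc.congr_fun
      (fun t ht => (hder t ht).symm) measurableSet_Icc),
    intervalIntegral.integral_of_le hx, setIntegral_congr_fun (g := fun t =>
      -((t * Real.log t ^ 2)⁻¹ * classTheta (a : ZMod q) t)) measurableSet_Ioc, integral_neg,
    sub_neg_eq_add, ← classTheta, inv_mul_eq_div]
  intro t ht
  simp only [hder t (Ioc_subset_Icc_self ht), classTheta]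
  ring

theorem Li_eq {x : ℝ} (hx : 2 ≤ x) :
    Li x = x / Real.log x - 2 / Real.log 2 + ∫ t in 2..x, (t * Real.log t ^ 2)⁻¹ * t := by
  have hmem : ∀ t ∈ uIcc 2 x, 2 ≤ t := fun t ht => (uIcc_of_le hx ▸ ht).1
  have h1 := intervalIntegral.integral_mul_deriv_eq_deriv_mul (a := 2) (b := x)
    (u := fun t => (Real.log t)⁻¹) (u' := fun t => -(t * Real.log t ^ 2)⁻¹) (v := fun t => t)
    (v' := fun _ => 1) (fun t ht => hasDerivAt_inv_log (hmem t ht))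
    (fun t _ => hasDerivAt_id t)
    (ContinuousOn.intervalIntegrable (uIcc_of_le hx ▸ (continuousOn_inv_mul_log_sq x).neg))
    (by simp)
  simp only [mul_one, neg_mul, intervalIntegral.integral_neg, sub_neg_eq_add] at h1
  rw [Li]
  simp only [one_div]
  rw [h1]
  ring

end ClassTheta

section PrimeCount

open Set Filter Topology MeasureTheory

theorem abs_classTheta_sub_le {q : ℕ} [NeZero q] (hq : 10 ^ 5 < q) {a : ZMod q} (ha : IsUnit a)
    {u : ℝ} (hu1 : 14000 ≤ u) (hu : 0.0297 * √q * Real.log q ^ 3 ≤ u) :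
    |classTheta a (Real.exp u) - Real.exp u / q.totient| ≤ 0.92 / 160 * Real.exp u / u := by
  have h1 := abs_classPsi_sub_le_of_large hq ha hu
  have h2 := abs_classPsi_sub_classTheta_le a (Real.one_le_exp (by linarith : 0 ≤ u))
  have hu0 : 0 < u := by linarith
  have h3 : 2 * √(Real.exp u) * Real.log (Real.exp u) ≤ 0.01 / 160 * Real.exp u / u := by
    have hs : √(Real.exp u) = Real.exp (u / 2) := by
      rw [Real.sqrt_eq_iff_mul_self_eq (Real.exp_pos _).le (Real.exp_pos _).le, ← Real.exp_add]
      congr 1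
      ring
    have he : Real.exp u = Real.exp (u / 2) * Real.exp (u / 2) := by
      rw [← Real.exp_add]
      congr 1
      ring
    have hp := Real.pow_div_factorial_le_exp (u / 2) (by positivity) 4
    have hb : 32000 * u ^ 2 ≤ Real.exp (u / 2) := by
      refine le_trans ?_ hp
      norm_num [Nat.factorial]
      nlinarith [sq_nonneg u, mul_le_mul hu1 hu1 (by norm_num) hu0.le]
    rw [hs, Real.log_exp, he, le_div_iff₀ hu0]
    have := mul_le_mul_of_nonneg_left hb (Real.exp_pos (u / 2)).le
    norm_num at this ⊢
    linarith
  rw [abs_sub_comm] at h2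
  calc _ ≤ |classTheta a (Real.exp u) - classPsi a (Real.exp u)| +
        |classPsi a (Real.exp u) - Real.exp u / q.totient| := abs_sub_le _ _ _
    _ ≤ 0.01 / 160 * Real.exp u / u + 0.91 / 160 * Real.exp u / u := add_le_add (h2.trans h3) h1
    _ = _ := by ring

theorem pi_large_q_bound (q : ℕ) (hq : 10 ^ 5 < q) (a : ℤ) (ha : Int.gcd a q = 1)
    (x : ℝ) (hx : Real.exp (0.03 * Real.sqrt q * Real.log q ^ 3) ≤ x) :
    |(primesPi x q a : ℝ) - Li x / (Nat.totient q : ℝ)| ≤ (1 / 160) * x / Real.log x ^ 2 := by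
  have : NeZero q := ⟨by omega⟩
  have hau : IsUnit (a : ZMod q) := by
    rw [ZMod.coe_int_isUnit_iff_isCoprime, isCoprime_comm]
    exact Int.isCoprime_iff_gcd_eq_one.2 ha
  have hφ := (le_totient_of_lt hq).1
  obtain ⟨φ, hφd⟩ : ∃ φ : ℝ, φ = q.totient := ⟨_, rfl⟩
  have hφ0 : 0 < φ := by linarith
  have hx0 : 0 < x := (Real.exp_pos _).trans_le hx
  obtain ⟨y, hy⟩ : ∃ y, y = Real.log x := ⟨_, rfl⟩
  have hxy : x = Real.exp y := by rw [hy, Real.exp_log hx0]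
  have hyl : 0.03 * √q * Real.log q ^ 3 ≤ y := by
    rw [hy]
    exact (Real.le_log_iff_exp_le hx0).2 hx
  have hu : 0.0297 * √q * Real.log q ^ 3 ≤ 0.99 * y := by
    have := mul_le_mul_of_nonneg_left hyl (by norm_num : (0 : ℝ) ≤ 0.99)
    norm_num at this ⊢
    linarith
  have hu1 : 14300 ≤ 0.99 * y := by
    refine le_trans ?_ hu
    have hqr : ((10 : ℝ) ^ 5) ≤ q := by exact_mod_cast hq.le
    have hs1 : 316.2 ≤ √(q : ℝ) := Real.le_sqrt_of_sq_le (le_trans (by norm_num) hqr)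
    have hL3 : 1525.87 ≤ Real.log q ^ 3 :=
      le_trans (by norm_num) (pow_le_pow_left₀ (by norm_num) (log_ge_of_lt hq) 3)
    calc (14300 : ℝ) ≤ 0.0297 * 316.2 * 1525.87 := by norm_num
      _ ≤ _ := by gcongr
  have hy1 : 14300 ≤ y := by norm_num at hu1 ⊢; linarith
  have hy0 : 0 < y := by linarith
  set E : ℝ → ℝ := fun t => classTheta (a : ZMod q) t - t / φ with hE
  have hElarge : ∀ u, 0.99 * y ≤ u → |E (Real.exp u)| ≤ 0.92 / 160 * Real.exp u / u := fun u h => by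
    simp only [hE, hφd]
    exact abs_classTheta_sub_le hq hau (by linarith) (hu.trans h)
  have hEsmall : ∀ t, 0 ≤ t → |E t| ≤ 1.4 * t := fun t ht => by
    have h1 := classTheta_nonneg (a : ZMod q) t
    have h2 := classTheta_le (a : ZMod q) ht
    have h3 : 0 ≤ t / φ := by positivity
    have h4 : t / φ ≤ t := div_le_self ht (by linarith)
    rw [abs_le]
    norm_num at h2 ⊢
    constructor <;> simp only [hE] <;> linarith
  obtain ⟨T, hT⟩ : ∃ T, T = Real.exp (0.99 * y) := ⟨_, rfl⟩
  have hT2 : 2 ≤ T := by rw [hT]; linarith [Real.add_one_le_exp (0.99 * y)]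
  have hTx : T ≤ x := by
    rw [hT, hxy]
    exact Real.exp_le_exp.2 (by linarith)
  have hx2 : 2 ≤ x := hT2.trans hTx
  have hinteg : IntegrableOn (fun t => (t * Real.log t ^ 2)⁻¹ * E t) (Icc 2 x) := by
    have h1 := (continuousOn_inv_mul_log_sq x).mul (continuousOn_id.div_const φ)
    refine ((integrableOn_classTheta (a : ZMod q) x).sub h1.integrableOn_Icc).congr_fun
      (fun t _ => ?_) measurableSet_Icc
    simp only [hE, id, Pi.sub_apply, Pi.mul_apply]
    ring
  have hdiff : (primesPi x q a : ℝ) - Li x / (Nat.totient q : ℝ) =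
      E x / y + 2 / (φ * Real.log 2) + ((∫ t in 2..T, (t * Real.log t ^ 2)⁻¹ * E t) +
        ∫ t in T..x, (t * Real.log t ^ 2)⁻¹ * E t) := by
    have hii : ∀ c d, 2 ≤ c → c ≤ d → d ≤ x →
        IntervalIntegrable (fun t => (t * Real.log t ^ 2)⁻¹ * E t) volume c d := fun c d h1 h2 h3 =>
      (intervalIntegrable_iff_integrableOn_Icc_of_le h2).2 (hinteg.mono_set (Icc_subset_Icc h1 h3))
    rw [intervalIntegral.integral_add_adjacent_intervals (hii _ _ le_rfl hT2 hTx)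
      (hii _ _ hT2 hTx le_rfl), primesPi_eq hx2, Li_eq hx2, ← hφd, ← hy]
    have hc : ContinuousOn (fun t : ℝ => (t * Real.log t ^ 2)⁻¹ * t / φ) (Icc 2 x) :=
      ((continuousOn_inv_mul_log_sq x).mul continuousOn_id).div_const φ
    have hsub : ∫ t in 2..x, (t * Real.log t ^ 2)⁻¹ * E t =
        (∫ t in 2..x, (t * Real.log t ^ 2)⁻¹ * classTheta (a : ZMod q) t) -
          (∫ t in 2..x, (t * Real.log t ^ 2)⁻¹ * t) / φ := by
      rw [← intervalIntegral.integral_div, ← intervalIntegral.integral_sub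
        ((intervalIntegrable_iff_integrableOn_Icc_of_le hx2).2 (integrableOn_classTheta _ x))
        ((intervalIntegrable_iff_integrableOn_Icc_of_le hx2).2 hc.integrableOn_Icc)]
      refine intervalIntegral.integral_congr fun t _ => ?_
      simp only [hE]
      ring
    rw [hsub]
    have hl2 : Real.log 2 ≠ 0 := (Real.log_pos one_lt_two).ne'
    simp only [hE]
    field_simp
    ring
  have hl2 : 0.693 ≤ Real.log 2 := by
    have := Real.log_two_gt_d9
    norm_num at this ⊢
    linarith
  have hI1 : |∫ t in 2..T, (t * Real.log t ^ 2)⁻¹ * E t| ≤ 3 * T := by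
    rw [← Real.norm_eq_abs]
    refine (intervalIntegral.norm_integral_le_of_norm_le_const (C := 3) fun t ht => ?_).trans ?_
    · rw [uIoc_of_le hT2] at ht
      have ht0 : 0 < t := by linarith [ht.1]
      have hl : 0.693 ≤ Real.log t := hl2.trans (Real.log_le_log (by norm_num) ht.1.le)
      have hl' : (0.693 : ℝ) ^ 2 ≤ Real.log t ^ 2 := by gcongr
      rw [norm_mul, norm_inv, Real.norm_of_nonneg (by positivity : 0 ≤ t * Real.log t ^ 2),
        inv_mul_le_iff₀ (mul_pos ht0 (by positivity))]
      refine (hEsmall t ht0.le).trans ?_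
      have := mul_le_mul_of_nonneg_left hl' ht0.le
      norm_num at this ⊢
      nlinarith
    · rw [abs_of_nonneg (by linarith)]
      linarith
  have hI2 : |∫ t in T..x, (t * Real.log t ^ 2)⁻¹ * E t| ≤ 0.92 / 160 / (0.99 * y) ^ 3 * x := by
    rw [← Real.norm_eq_abs]
    refine (intervalIntegral.norm_integral_le_of_norm_le_const
      (C := 0.92 / 160 / (0.99 * y) ^ 3) fun t ht => ?_).trans ?_
    · rw [uIoc_of_le hTx] at ht
      have ht0 : 0 < t := by linarith [ht.1]
      have hl : 0.99 * y ≤ Real.log t := by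
        rw [hT] at ht
        exact (Real.le_log_iff_exp_le ht0).2 ht.1.le
      have hl0 : 0 < Real.log t := by linarith
      have h1 := hElarge _ hl
      rw [Real.exp_log ht0] at h1
      rw [norm_mul, norm_inv, Real.norm_of_nonneg (by positivity : 0 ≤ t * Real.log t ^ 2),
        inv_mul_le_iff₀ (mul_pos ht0 (by positivity))]
      refine h1.trans ?_
      calc 0.92 / 160 * t / Real.log t = t * Real.log t ^ 2 * (0.92 / 160 / Real.log t ^ 3) := by
            field_simp
        _ ≤ _ := by gcongr
    · rw [abs_of_nonneg (by linarith)]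
      gcongr
      linarith
  have hEx : |E x / y| ≤ 0.92 / 160 * x / y ^ 2 := by
    have h1 := hElarge y (by linarith)
    rw [← hxy] at h1
    rw [abs_div, abs_of_pos hy0, div_le_iff₀ hy0]
    refine h1.trans_eq ?_
    field_simp
  have hc : |2 / (φ * Real.log 2)| ≤ 1 := by
    rw [abs_of_nonneg (by positivity), div_le_one (by positivity)]
    nlinarith
  have hTle : 4 * T ≤ 0.07 / 160 * x / y ^ 2 := by
    have hp := Real.pow_div_factorial_le_exp (0.01 * y) (by positivity) 8
    have hxT : x = T * Real.exp (0.01 * y) := by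
      rw [hT, hxy, ← Real.exp_add]
      congr 1
      ring
    have h6 : (14300 : ℝ) ^ 6 ≤ y ^ 6 := by gcongr
    have hb : 9200 * y ^ 2 ≤ Real.exp (0.01 * y) := by
      refine le_trans ?_ hp
      have := mul_le_mul_of_nonneg_right h6 (sq_nonneg y)
      rw [mul_pow]
      norm_num [Nat.factorial] at this ⊢
      nlinarith
    rw [le_div_iff₀ (by positivity), hxT]
    have := mul_le_mul_of_nonneg_left hb (by linarith : 0 ≤ T)
    norm_num at this ⊢
    linarith
  have hI2' : 0.92 / 160 / (0.99 * y) ^ 3 * x ≤ 0.01 / 160 * x / y ^ 2 := by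
    rw [mul_pow, div_mul_eq_mul_div, div_le_div_iff₀ (by positivity) (by positivity)]
    have h1 : 0 ≤ x * y ^ 2 * (y - 14300) := by
      have : 0 ≤ y - 14300 := by linarith
      positivity
    have h2 : 0 ≤ x * y ^ 2 := by positivity
    norm_num
    nlinarith
  rw [hdiff, ← hy]
  refine (abs_add_three _ _ _).trans ?_
  have h5 := abs_add_le (∫ t in 2..T, (t * Real.log t ^ 2)⁻¹ * E t)
    (∫ t in T..x, (t * Real.log t ^ 2)⁻¹ * E t)
  have h6 : (1 / 160) * x / y ^ 2 =
      0.92 / 160 * x / y ^ 2 + 0.07 / 160 * x / y ^ 2 + 0.01 / 160 * x / y ^ 2 := by ring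
  rw [h6]
  linarith

end PrimeCount
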